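/- For every nonnegative integer s and every δ ∈ {0,1}, there exists an integer j with s+3 ≤ j ≤ 3s+5 and j ≡ δ (mod 2) such that the 2-adic Hurwitz zeta value ζ₂(j,1/4) is irrational, i.e. does not lie in the image of ℚ in ℚ₂. (In particular, for each such j the limit defining ζ₂(j,1/4) exists in ℚ₂.) -/

import Mathlib

open Filter Finset

/-- `zeta2Quarter j z` says that `z` is the 2-adic Hurwitz zeta value `ζ₂(j, 1/4)`,
i.e. `(j-1) * 4^(j-1) * z` is the 2-adic limit of the Volkenborn sums
`2^{-M} ∑_{k=0}^{2^M-1} (k+1/4)^{1-j}`. -/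
def zeta2Quarter (j : ℕ) (z : ℚ_[2]) : Prop :=
  Filter.Tendsto
    (fun M : ℕ => (2 ^ M : ℚ_[2])⁻¹ *
      ∑ k ∈ Finset.range (2 ^ M), ((((k : ℚ) + 1/4) ^ ((1 : ℤ) - (j : ℤ)) : ℚ) : ℚ_[2]))
    Filter.atTop (nhds (((j : ℚ_[2]) - 1) * 4 ^ (j - 1) * z))

/-- Volkenborn integrability. -/
def HasV (f : ℤ → ℚ_[2]) (I : ℚ_[2]) : Prop :=
  Tendsto (fun M : ℕ => (2 ^ M : ℚ_[2])⁻¹ * ∑ k ∈ range (2 ^ M), f (k : ℤ)) atTop (nhds I)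

def Lip {A : Type*} [CommRing A] (φ : ℤ → A) : Prop := ∀ t h : ℤ, (h : A) ∣ φ (t + h) - φ t

lemma Lip.mul {A : Type*} [CommRing A] {φ ψ : ℤ → A} (h1 : Lip φ) (h2 : Lip ψ) :
    Lip (fun t => φ t * ψ t) := by
  intro t h
  obtain ⟨a, ha⟩ := h1 t h
  obtain ⟨b, hb⟩ := h2 t h
  refine ⟨a * ψ (t + h) + φ t * b, ?_⟩
  linear_combination ψ (t + h) * ha + φ t * hb

lemma Lip.const {A : Type*} [CommRing A] (c : A) : Lip (fun _ => c) := by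
  intro t h; simp

lemma Lip.pow {A : Type*} [CommRing A] {φ : ℤ → A} (h1 : Lip φ) (n : ℕ) :
    Lip (fun t => φ t ^ n) := by
  induction n with
  | zero => simpa using Lip.const (1 : A)
  | succ n ih => simpa [pow_succ] using ih.mul h1

lemma Lip.prod {A ι : Type*} [CommRing A] (s : Finset ι) {φ : ι → ℤ → A}
    (h1 : ∀ i ∈ s, Lip (φ i)) : Lip (fun t => ∏ i ∈ s, φ i t) := by
  classical
  induction s using Finset.induction_on with
  | empty => simpa using Lip.const (1 : A)
  | insert a s ha ih =>
    have := (h1 a (by simp)).mul (ih (fun i hi => h1 i (by simp [hi])))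
    simpa [Finset.prod_insert ha] using this

/-- inverse of a Lipschitz function -/
lemma Lip.inv {A : Type*} [CommRing A] {φ ψ : ℤ → A} (h1 : Lip φ) (h : ∀ t, φ t * ψ t = 1) :
    Lip ψ := by
  intro t k
  obtain ⟨a, ha⟩ := h1 t k
  refine ⟨- a * ψ t * ψ (t + k), ?_⟩
  linear_combination (-ψ t * ψ (t + k)) * ha + ψ t * h (t + k) - ψ (t + k) * h t

lemma Lip.lin {A : Type*} [CommRing A] (a b : A) : Lip (fun t => a + b * (t : A)) := by
  intro t h
  refine ⟨b, ?_⟩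
  push_cast; ring

lemma Lip.sum_dvd {A : Type*} [CommRing A] {φ : ℤ → A} (h1 : Lip φ) (M : ℕ) :
    (2 ^ M : A) ∣ 2 * ∑ k ∈ range (2 ^ M), φ (k : ℤ) := by
  induction M with
  | zero => simp
  | succ M ih =>
    have e : ∑ k ∈ range (2 ^ (M + 1)), φ (k : ℤ)
        = 2 * ∑ k ∈ range (2 ^ M), φ (k : ℤ)
          + ∑ k ∈ range (2 ^ M), (φ ((k : ℤ) + (2 ^ M : ℤ)) - φ k) := by
      rw [pow_succ, mul_two, Finset.sum_range_add, Finset.sum_sub_distrib]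
      have : ∀ x ∈ range (2 ^ M), φ (((2 ^ M + x : ℕ)) : ℤ) = φ ((x : ℤ) + (2 ^ M : ℤ)) := by
        intro x _; congr 1; push_cast; ring
      rw [Finset.sum_congr rfl this]; ring
    have d : (2 ^ M : A) ∣ ∑ k ∈ range (2 ^ M), (φ ((k : ℤ) + (2 ^ M : ℤ)) - φ k) := by
      apply Finset.dvd_sum
      intro k _
      simpa using h1 k (2 ^ M)
    rw [e, mul_add, pow_succ, mul_comm]
    exact dvd_add (mul_dvd_mul_left _ ih) (mul_dvd_mul_left _ d)

lemma coe_two' : ((2 : ℤ_[2]) : ℚ_[2]) = 2 := by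
  exact_mod_cast PadicInt.coe_natCast (p := 2) 2

lemma coe_four' : ((4 : ℤ_[2]) : ℚ_[2]) = 4 := by
  exact_mod_cast PadicInt.coe_natCast (p := 2) 4

/-- second order class in `ℤ_[2]` -/
def Tay (φ φ1 : ℤ → ℤ_[2]) : Prop :=
  Lip φ1 ∧ ∀ t h : ℤ, ((h : ℤ_[2]) ^ 2) ∣ φ (t + h) - φ t - h * φ1 t

lemma norm_sum_lip {φ : ℤ → ℤ_[2]} (h : Lip φ) (M : ℕ) :
    ‖∑ k ∈ range (2 ^ M), φ (k : ℤ)‖ ≤ 2 * (2 ^ M : ℝ)⁻¹ := by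
  obtain ⟨c, hc⟩ := h.sum_dvd M
  have h2 : ‖(2 : ℤ_[2])‖ = (2 : ℝ)⁻¹ := by simpa using PadicInt.norm_p (p := 2)
  have := congrArg norm hc
  rw [norm_mul, norm_mul, norm_pow, h2] at this
  have hc1 := PadicInt.norm_le_one c
  have hp : (0 : ℝ) < (2⁻¹) ^ M := by positivity
  rw [← inv_pow]
  nlinarith

lemma tendsto_two_pow : Tendsto (fun M : ℕ => ‖(2 ^ M : ℤ_[2])‖) atTop (nhds 0) := by
  have h2 : ‖(2 : ℤ_[2])‖ = (2 : ℝ)⁻¹ := by simpa using PadicInt.norm_p (p := 2)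
  simp only [norm_pow, h2]
  exact tendsto_pow_atTop_nhds_zero_of_lt_one (by norm_num) (by norm_num)

lemma norm_two_pow (M : ℕ) : ‖(2 ^ M : ℤ_[2])‖ = ((2 : ℝ)⁻¹) ^ M := by
  have h2 : ‖(2 : ℤ_[2])‖ = (2 : ℝ)⁻¹ := by simpa using PadicInt.norm_p (p := 2)
  rw [norm_pow, h2]

lemma norm_two_pow' (M : ℕ) : ‖(2 ^ M : ℚ_[2])‖ = ((2 : ℝ)⁻¹) ^ M := by
  have h2 : ‖(2 : ℚ_[2])‖ = (2 : ℝ)⁻¹ := by simpa using Padic.norm_p (p := 2)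
  rw [norm_pow, h2]

/-- key difference estimate -/
lemma Tay.diff {φ φ1 : ℤ → ℤ_[2]} (h : Tay φ φ1) (M : ℕ) (s : ℤ) (hs : s = 1 ∨ s = -1) :
    ‖(2 ^ M : ℚ_[2])⁻¹ * ∑ k ∈ range (2 ^ M),
      ((φ (k + s * 2 ^ M) - φ (k : ℤ) : ℤ_[2]) : ℚ_[2])‖ ≤ 2 * (2⁻¹ : ℝ) ^ M := by
  have hc : ∃ c : ℤ_[2], ∑ k ∈ range (2 ^ M), (φ (k + s * 2 ^ M) - φ (k : ℤ))
      = 2 ^ M * (s * ∑ k ∈ range (2 ^ M), φ1 (k : ℤ) + 2 ^ M * c) := by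
    choose c hc using fun k : ℕ => h.2 k (s * 2 ^ M)
    refine ⟨∑ k ∈ range (2 ^ M), c k, ?_⟩
    rw [Finset.mul_sum, Finset.mul_sum, ← Finset.sum_add_distrib, Finset.mul_sum]
    apply Finset.sum_congr rfl
    intro k _
    have := hc k
    have hs2 : (s : ℤ_[2]) ^ 2 = 1 := by rcases hs with rfl | rfl <;> simp
    push_cast at this
    rw [mul_pow, hs2] at this
    linear_combination this
  obtain ⟨c, hc⟩ := hc
  rw [← PadicInt.coe_sum, hc]
  push_cast [coe_two']
  rw [← mul_assoc, inv_mul_cancel₀ (pow_ne_zero _ two_ne_zero), one_mul]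
  have e : (s : ℚ_[2]) * ((∑ k ∈ range (2 ^ M), φ1 (k : ℤ) : ℤ_[2]) : ℚ_[2]) + 2 ^ M * (c : ℚ_[2])
    = ((s * ∑ k ∈ range (2 ^ M), φ1 (k : ℤ) + 2 ^ M * c : ℤ_[2]) : ℚ_[2]) := by
    push_cast [coe_two']; rfl
  refine le_trans (le_of_eq (congrArg norm e)) ?_
  rw [← PadicInt.norm_def]
  refine (PadicInt.nonarchimedean _ _).trans (max_le ?_ ?_)
  · rw [norm_mul]
    have := norm_sum_lip h.1 M
    have h1 := PadicInt.norm_le_one (s : ℤ_[2])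
    rw [← inv_pow] at this
    nlinarith [norm_nonneg (∑ k ∈ range (2 ^ M), φ1 (k : ℤ))]
  · rw [norm_mul, norm_two_pow]
    have h1 := PadicInt.norm_le_one c
    have hp : (0 : ℝ) < (2⁻¹) ^ M := by positivity
    nlinarith

lemma Tay.exists_HasV {φ φ1 : ℤ → ℤ_[2]} (h : Tay φ φ1) : ∃ I, HasV (fun t => (φ t : ℚ_[2])) I := by
  apply cauchySeq_tendsto_of_complete
  apply cauchySeq_of_le_geometric (r := 2⁻¹) (C := 4) (by norm_num)
  intro M
  rw [dist_comm, dist_eq_norm]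
  have e : ((2 ^ (M + 1) : ℚ_[2])⁻¹ * ∑ k ∈ range (2 ^ (M + 1)), (φ (k : ℤ) : ℚ_[2]))
     - ((2 ^ M : ℚ_[2])⁻¹ * ∑ k ∈ range (2 ^ M), (φ (k : ℤ) : ℚ_[2]))
     = 2⁻¹ * ((2 ^ M : ℚ_[2])⁻¹ * ∑ k ∈ range (2 ^ M),
      ((φ (k + 1 * 2 ^ M) - φ (k : ℤ) : ℤ_[2]) : ℚ_[2])) := by
    rw [show 2 ^ (M + 1) = 2 ^ M + 2 ^ M by ring, Finset.sum_range_add]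
    have : ∀ x ∈ range (2 ^ M), ((φ (((2 ^ M + x : ℕ)) : ℤ) : ℤ_[2]) : ℚ_[2])
        = φ ((x : ℤ) + 1 * (2 ^ M : ℤ)) := by
      intro x _; congr 2; push_cast; ring
    rw [Finset.sum_congr rfl this]
    push_cast
    rw [Finset.sum_sub_distrib, pow_succ]
    field_simp
    ring
  rw [e, norm_mul]
  have := h.diff M 1 (Or.inl rfl)
  have h2 : ‖(2⁻¹ : ℚ_[2])‖ = 2 := by
    have h2 : ‖(2 : ℚ_[2])‖ = (2 : ℝ)⁻¹ := by simpa using Padic.norm_p (p := 2)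
    rw [norm_inv, h2]; norm_num
  rw [h2]
  linarith

lemma HasV.reflect {φ φ1 : ℤ → ℤ_[2]} (h : Tay φ φ1) {I : ℚ_[2]}
    (hI : HasV (fun t => (φ t : ℚ_[2])) I) : HasV (fun t => (φ (-1 - t) : ℚ_[2])) I := by
  have hz : Tendsto (fun M : ℕ => (2 ^ M : ℚ_[2])⁻¹ * ∑ k ∈ range (2 ^ M),
      ((φ (k + (-1) * 2 ^ M) - φ (k : ℤ) : ℤ_[2]) : ℚ_[2])) atTop (nhds 0) := by
    apply squeeze_zero_norm (fun M => h.diff M (-1) (Or.inr rfl))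
    have := tendsto_pow_atTop_nhds_zero_of_lt_one (r := (2⁻¹ : ℝ)) (by norm_num) (by norm_num)
    simpa using this.const_mul 2
  have := hI.add hz
  rw [add_zero] at this
  refine this.congr ?_
  intro M
  rw [← mul_add, ← Finset.sum_add_distrib]
  congr 1
  rw [← Finset.sum_range_reflect (fun k : ℕ => ((φ (-1 - (k : ℤ)) : ℤ_[2]) : ℚ_[2]))]
  apply Finset.sum_congr rfl
  intro k hk
  have hk := Finset.mem_range.1 hk
  have : (-1 - ((2 ^ M - 1 - k : ℕ) : ℤ)) = k + (-1) * 2 ^ M := by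
    rw [Nat.sub_sub, Nat.cast_sub (by omega)]; push_cast; ring
  rw [this]; push_cast; ring

lemma HasV.shift {φ φ1 : ℤ → ℤ_[2]} (h : Tay φ φ1) {I : ℚ_[2]} (u : ℤ)
    (hI : HasV (fun t => (φ (t + u) : ℚ_[2])) I) :
    HasV (fun t => (φ (t + (u + 1)) : ℚ_[2])) (I + φ1 u) := by
  have hz : Tendsto (fun M : ℕ => (2 ^ M : ℚ_[2])⁻¹ *
      ((φ (u + 2 ^ M) - φ u : ℤ_[2]) : ℚ_[2])) atTop (nhds (φ1 u)) := by
    rw [← tendsto_sub_nhds_zero_iff]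
    apply squeeze_zero_norm (a := fun M => (2⁻¹ : ℝ) ^ M)
    · intro M
      obtain ⟨c, hc⟩ := h.2 u (2 ^ M)
      have : φ (u + 2 ^ M) - φ u = 2 ^ M * (φ1 u + 2 ^ M * c) := by
        push_cast at hc
        linear_combination hc
      rw [this]; push_cast [coe_two']
      rw [← mul_assoc, inv_mul_cancel₀ (pow_ne_zero _ two_ne_zero), one_mul, add_sub_cancel_left, norm_mul,
        norm_two_pow']
      have h1 : ‖(c : ℚ_[2])‖ ≤ 1 := PadicInt.norm_le_one c
      have hp : (0 : ℝ) < (2⁻¹) ^ M := by positivity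
      nlinarith
    · exact tendsto_pow_atTop_nhds_zero_of_lt_one (r := (2⁻¹ : ℝ)) (by norm_num) (by norm_num)
  refine (hI.add hz).congr ?_
  intro M
  rw [← mul_add]
  congr 1
  have := Finset.sum_range_succ' (fun k : ℕ => ((φ ((k : ℤ) + u) : ℤ_[2]) : ℚ_[2])) (2 ^ M)
  rw [Finset.sum_range_succ] at this
  push_cast at this ⊢
  have e : ∀ x : ℕ, φ ((x : ℤ) + (u + 1)) = φ ((x : ℤ) + 1 + u) := fun x => by congr 1; ring
  simp only [e]
  rw [zero_add, add_comm ((2 : ℤ) ^ M) u] at this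
  linear_combination this

lemma HasV.add {f g : ℤ → ℚ_[2]} {a b : ℚ_[2]} (h1 : HasV f a) (h2 : HasV g b) :
    HasV (fun t => f t + g t) (a + b) := by
  refine (Tendsto.add h1 h2).congr ?_
  intro M
  rw [← mul_add, ← Finset.sum_add_distrib]

lemma HasV.const_mul {f : ℤ → ℚ_[2]} {a : ℚ_[2]} (c : ℚ_[2]) (h1 : HasV f a) :
    HasV (fun t => c * f t) (c * a) := by
  refine (Tendsto.const_mul c h1).congr ?_
  intro M
  rw [← Finset.mul_sum]; ring

lemma HasV.sum {ι : Type*} (s : Finset ι) {f : ι → ℤ → ℚ_[2]} {a : ι → ℚ_[2]}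
    (h : ∀ i ∈ s, HasV (f i) (a i)) : HasV (fun t => ∑ i ∈ s, f i t) (∑ i ∈ s, a i) := by
  classical
  induction s using Finset.induction_on with
  | empty => simp [HasV]
  | insert x s hx ih =>
    simp only [Finset.sum_insert hx]
    exact (h x (by simp)).add (ih (fun i hi => h i (by simp [hi])))

/-- the inverse of `1+4t` in `ℤ_[2]` -/
lemma exists_vinv : ∃ v : ℤ → ℤ_[2], ∀ t : ℤ, (1 + 4 * (t : ℤ_[2])) * v t = 1 := by
  have : ∀ t : ℤ, IsUnit (1 + 4 * (t : ℤ_[2])) := by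
    intro t
    rw [PadicInt.isUnit_iff]
    have h : (1 + 4 * (t : ℤ_[2])) = ((1 + 4 * t : ℤ) : ℤ_[2]) := by push_cast; ring
    rw [h]
    have := PadicInt.norm_int_lt_one_iff_dvd (p := 2) (1 + 4 * t)
    have h1 := PadicInt.norm_le_one ((1 + 4 * t : ℤ) : ℤ_[2])
    by_contra hne
    have := this.1 (lt_of_le_of_ne h1 hne)
    omega
  choose v hv using fun t => (this t).exists_right_inv
  exact ⟨v, hv⟩

noncomputable def vinv : ℤ → ℤ_[2] := exists_vinv.choose
lemma vinv_spec (t : ℤ) : (1 + 4 * (t : ℤ_[2])) * vinv t = 1 := exists_vinv.choose_spec t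

lemma vinv_lip : Lip vinv := (Lip.lin (1 : ℤ_[2]) 4).inv vinv_spec

lemma vinv_tay (k : ℕ) : Tay (fun t => vinv t ^ k) (fun t => -4 * k * vinv t ^ (k + 1)) := by
  refine ⟨(Lip.const _).mul (vinv_lip.pow _), ?_⟩
  intro t h
  have hx := vinv_spec t
  have hy := vinv_spec (t + h)
  push_cast at hy
  set x := vinv t
  set y := vinv (t + h)
  have e : y = x - 4 * h * x ^ 2 + h ^ 2 * (16 * x ^ 2 * y) := by
    have e1 : y = x - 4 * h * x * y := by linear_combination x * hy - y * hx
    linear_combination e1 - 4 * h * x * e1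
  induction k with
  | zero => simp
  | succ k ih =>
    obtain ⟨c, hc⟩ := ih
    refine ⟨c * y - 4 * k * x ^ (k + 1) * (- 4 * x ^ 2 + h * (16 * x ^ 2 * y)) + x ^ k * (16 * x ^ 2 * y), ?_⟩
    push_cast at hc ⊢
    linear_combination y * hc + (x ^ k - 4 * h * k * x ^ (k+1)) * e

lemma vinv_coe (t : ℤ) : (vinv t : ℚ_[2]) = (1 + 4 * (t : ℚ_[2]))⁻¹ := by
  have := congrArg (fun z : ℤ_[2] => (z : ℚ_[2])) (vinv_spec t)
  push_cast at this
  exact (inv_eq_of_mul_eq_one_right this).symm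

/-- `J k = ∫ (1+4t)^{-k}` -/
lemma exists_J (k : ℕ) : ∃ I, HasV (fun t => ((1 + 4 * (t : ℚ_[2]))⁻¹) ^ k) I := by
  obtain ⟨I, hI⟩ := (vinv_tay k).exists_HasV
  refine ⟨I, ?_⟩
  simpa [vinv_coe] using hI

noncomputable def Jv (k : ℕ) : ℚ_[2] := (exists_J k).choose
lemma Jv_spec (k : ℕ) : HasV (fun t => ((1 + 4 * (t : ℚ_[2]))⁻¹) ^ k) (Jv k) := (exists_J k).choose_spec

lemma HasV.shift_nat (k : ℕ) (u : ℕ) :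
    HasV (fun t => ((1 + 4 * ((t + u : ℤ) : ℚ_[2]))⁻¹) ^ k)
      (Jv k + ∑ v ∈ range u, (-4 * k) * ((1 + 4 * (v : ℚ_[2]))⁻¹) ^ (k + 1)) := by
  induction u with
  | zero => simpa using Jv_spec k
  | succ u ih =>
    have := HasV.shift (vinv_tay k) (u : ℤ) (I := _) (by simpa [vinv_coe] using ih)
    rw [Finset.sum_range_succ, ← add_assoc]
    simpa [vinv_coe, coe_four'] using this

lemma HasV.shift_neg (k : ℕ) (u : ℕ) :
    HasV (fun t => ((1 + 4 * ((t - u : ℤ) : ℚ_[2]))⁻¹) ^ k)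
      (Jv k + ∑ v ∈ range u, (4 * k) * ((1 - 4 * ((v : ℚ_[2]) + 1))⁻¹) ^ (k + 1)) := by
  induction u with
  | zero => simpa using Jv_spec k
  | succ u ih =>
    obtain ⟨I, hI⟩ : ∃ I, HasV (fun t => ((1 + 4 * ((t - (u + 1 : ℕ) : ℤ) : ℚ_[2]))⁻¹) ^ k) I := by
      have ht := vinv_tay k
      have h2 : Tay (fun t => vinv (t - (u+1:ℕ)) ^ k) (fun t => -4 * k * vinv (t - (u+1:ℕ)) ^ (k + 1)) := by
        refine ⟨fun t h => ?_, fun t h => ?_⟩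
        · have := ht.1 (t - (u+1:ℕ)) h
          rwa [sub_add_eq_add_sub] at this
        · have := ht.2 (t - (u+1:ℕ)) h
          rwa [sub_add_eq_add_sub] at this
      obtain ⟨I, hI⟩ := h2.exists_HasV
      exact ⟨I, by simpa [vinv_coe] using hI⟩
    have := HasV.shift (vinv_tay k) (-(u + 1 : ℕ) : ℤ) (I := I) (by simpa [vinv_coe, sub_eq_add_neg] using hI)
    have h3 : HasV (fun t => ((1 + 4 * ((t - u : ℤ) : ℚ_[2]))⁻¹) ^ k)
       (I + (-4 * k * vinv (-(u + 1 : ℕ) : ℤ) ^ (k + 1) : ℤ_[2])) := by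
      simpa [vinv_coe, sub_eq_add_neg] using this
    have h4 := tendsto_nhds_unique ih h3
    have h5 : I = (Jv k + ∑ v ∈ range (u + 1), (4 * k) * ((1 - 4 * ((v : ℚ_[2]) + 1))⁻¹) ^ (k + 1)) := by
      rw [Finset.sum_range_succ, ← add_assoc, h4]
      push_cast [vinv_coe, coe_four']
      have : (1 + 4 * -((u : ℚ_[2]) + 1)) = (1 - 4 * ((u : ℚ_[2]) + 1)) := by ring
      rw [this]; ring
    rw [← h5]; exact hI

lemma zeta2Quarter_J (k : ℕ) (hk : 1 ≤ k) : zeta2Quarter (k + 1) (Jv k / k) := by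
  have h := (Jv_spec k).const_mul (4 ^ k)
  unfold zeta2Quarter
  unfold HasV at h
  have hk0 : (k : ℚ_[2]) ≠ 0 := by exact_mod_cast (by omega : k ≠ 0)
  have e1 : (((k + 1 : ℕ) : ℚ_[2]) - 1) * 4 ^ (k + 1 - 1) * (Jv k / k) = 4 ^ k * Jv k := by
    rw [Nat.add_sub_cancel]; push_cast; field_simp; ring
  rw [e1]
  refine h.congr fun M => ?_
  congr 1
  apply Finset.sum_congr rfl
  intro t _
  have : (1 : ℤ) - ((k + 1 : ℕ) : ℤ) = -(k : ℤ) := by push_cast; ring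
  rw [this, zpow_neg, zpow_natCast]
  push_cast
  rw [← inv_pow, ← mul_pow]
  congr 1
  have h1 : (1 + 4 * (t : ℚ_[2])) ≠ 0 := by exact_mod_cast (by omega : 1 + 4 * t ≠ 0)
  have h2 : ((t : ℚ_[2]) + 1 / 4) = (1 + 4 * t) / 4 := by field_simp; ring
  rw [h2, inv_div]; field_simp

/-- shift contribution -/
def Gq (k : ℕ) (u : ℤ) : ℚ :=
  if 0 ≤ u then ∑ v ∈ range u.toNat, (-4 * k : ℚ) * ((1 + 4 * (v : ℚ))⁻¹) ^ (k + 1)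
  else ∑ v ∈ range (-u).toNat, (4 * k : ℚ) * ((1 - 4 * ((v : ℚ) + 1))⁻¹) ^ (k + 1)

lemma HasV.shift_int (k : ℕ) (u : ℤ) :
    HasV (fun t => ((1 + 4 * ((t + u : ℤ) : ℚ_[2]))⁻¹) ^ k) (Jv k + (Gq k u : ℚ)) := by
  unfold Gq
  split_ifs with h
  · have := HasV.shift_nat k u.toNat
    rw [Int.toNat_of_nonneg h] at this
    push_cast at this ⊢
    exact this
  · have := HasV.shift_neg k (-u).toNat
    rw [Int.toNat_of_nonneg (by omega)] at this
    push_cast at this ⊢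
    simpa using this

def eps (e : ℤ) : ℚ := if 4 ∣ e then 1 else -1

def Hq (k : ℕ) (e : ℤ) : ℚ := if 4 ∣ e then Gq k (-(e / 4)) else (-1) ^ k * Gq k ((e + 2) / 4)

lemma HasV.pole (k : ℕ) (e : ℤ) (he : 2 ∣ e) :
    HasV (fun t => ((1 + 4 * (t : ℚ_[2]) - e)⁻¹) ^ k) ((eps e : ℚ) ^ k * Jv k + (Hq k e : ℚ)) := by
  unfold eps Hq
  split_ifs with h
  · obtain ⟨u, rfl⟩ := h
    have h4 : (4 * u / 4) = u := by omega
    rw [h4]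
    have := HasV.shift_int k (-u)
    convert this using 2
    · push_cast; ring_nf
    · simp
  · obtain ⟨u, hu⟩ : ∃ u, e = 4 * u + 2 := ⟨(e - 2) / 4, by omega⟩
    have h4 : (e + 2) / 4 = u + 1 := by omega
    rw [h4]
    have h1 := HasV.shift_int k (u + 1)
    have ht := vinv_tay k
    have h2 : Tay (fun t => vinv (t + (u + 1)) ^ k)
        (fun t => -4 * k * vinv (t + (u + 1)) ^ (k + 1)) := by
      refine ⟨fun t h => ?_, fun t h => ?_⟩
      · have := ht.1 (t + (u+1)) h
        rwa [add_right_comm] at this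
      · have := ht.2 (t + (u+1)) h
        rwa [add_right_comm] at this
    have h3 := HasV.reflect h2 (I := (Jv k + (Gq k (u + 1) : ℚ))) (by simpa [vinv_coe] using h1)
    have h5 := h3.const_mul ((-1) ^ k)
    convert h5 using 1
    · funext t
      push_cast
      rw [vinv_coe, ← mul_pow]
      congr 1
      push_cast
      rw [hu, ← inv_neg_one, ← mul_inv]
      congr 1; push_cast; ring
    · push_cast; ring

lemma Gq_norm {p : ℕ} [Fact p.Prime] (k a : ℕ) (u : ℤ) (C : ℤ)
    (hC : C ≤ p ^ (a + 1)) (h1 : 4 * u - 3 < C) (h2 : -4 * u - 1 < C) :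
    ‖((Gq k u : ℚ) : ℚ_[p])‖ ≤ ((p : ℝ) ^ a) ^ (k + 1) := by
  have hp : (1 : ℝ) ≤ (p : ℝ) ^ a := one_le_pow₀ (by exact_mod_cast (Fact.out : p.Prime).one_le)
  have hR : (0 : ℝ) ≤ ((p : ℝ) ^ a) ^ (k + 1) := by positivity
  have key : ∀ m : ℤ, m ≠ 0 → |m| < C → ‖((m : ℚ_[p]))⁻¹‖ ≤ (p : ℝ) ^ a := by
    intro m hm hmC
    rw [norm_inv]
    by_contra hcon
    push Not at hcon
    have hlt : ‖(m : ℚ_[p])‖ < ((p : ℝ) ^ a)⁻¹ := by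
      have hm0 : (0 : ℝ) < ‖(m : ℚ_[p])‖ := norm_pos_iff.2 (by exact_mod_cast hm)
      exact (lt_inv_comm₀ (by linarith) hm0).1 hcon
    have hd : ((p ^ (a + 1) : ℕ) : ℤ) ∣ m := by
      have h := (Padic.norm_int_le_pow_iff_dvd (p := p) m (a + 1)).1 ?_
      · exact_mod_cast h
      · have h3 := (Padic.norm_le_pow_iff_norm_lt_pow_add_one (m : ℚ_[p]) (-((a + 1 : ℕ) : ℤ))).2 ?_
        · exact h3
        · have : (-((a + 1 : ℕ) : ℤ) + 1) = -(a : ℤ) := by push_cast; ring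
          rw [this, zpow_neg, zpow_natCast]; exact hlt
    have := Int.le_of_dvd (abs_pos.2 hm) ((dvd_abs _ _).2 hd)
    push_cast at this
    omega
  have sumb : ∀ (s : Finset ℕ) (f : ℕ → ℚ_[p]), (∀ i ∈ s, ‖f i‖ ≤ ((p : ℝ) ^ a) ^ (k + 1)) →
      ‖∑ i ∈ s, f i‖ ≤ ((p : ℝ) ^ a) ^ (k + 1) := fun s f hf =>
    IsUltrametricDist.norm_sum_le_of_forall_le_of_nonneg hR hf
  have termb : ∀ (c m : ℤ), m ≠ 0 → |m| < C →
      ‖(c : ℚ_[p]) * ((m : ℚ_[p])⁻¹) ^ (k + 1)‖ ≤ ((p : ℝ) ^ a) ^ (k + 1) := by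
    intro c m hm hmC
    rw [norm_mul, norm_pow]
    calc _ ≤ 1 * ((p : ℝ) ^ a) ^ (k + 1) := by
          apply mul_le_mul (Padic.norm_int_le_one c) _ (by positivity) zero_le_one
          exact pow_le_pow_left₀ (norm_nonneg _) (key m hm hmC) _
      _ = _ := one_mul _
  unfold Gq
  split_ifs with h
  · push_cast
    apply sumb
    intro v hv
    have hv := Finset.mem_range.1 hv
    have := termb (-4 * k) (1 + 4 * v) (by omega) (by rw [abs_of_nonneg (by omega)]; omega)
    push_cast at this
    exact this
  · push_cast
    apply sumb
    intro v hv
    have hv := Finset.mem_range.1 hv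
    have := termb (4 * k) (1 - 4 * (v + 1)) (by omega) (by rw [abs_of_neg (by omega)]; omega)
    push_cast at this
    exact this

lemma Hq_norm {p : ℕ} [Fact p.Prime] (k a : ℕ) (e : ℤ) (he : 2 ∣ e) (he2 : |e| ≤ p ^ (a + 1)) :
    ‖((Hq k e : ℚ) : ℚ_[p])‖ ≤ ((p : ℝ) ^ a) ^ (k + 1) := by
  have hpos : (1 : ℤ) ≤ (p : ℤ) ^ (a + 1) := by
    exact_mod_cast Nat.one_le_pow _ _ (Fact.out : p.Prime).pos
  rcases abs_le.1 he2 with ⟨h1, h2⟩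
  unfold Hq
  split_ifs with h
  · apply Gq_norm k a _ (p ^ (a + 1)) le_rfl <;> omega
  · push_cast
    rw [norm_mul, norm_pow, norm_neg, norm_one, one_pow, one_mul]
    apply Gq_norm k a _ (p ^ (a + 1)) le_rfl <;> omega

lemma Gq_abs (k : ℕ) (u : ℤ) : |Gq k u| ≤ 4 * k * |u| := by
  have termb : ∀ (m : ℤ), m ≠ 0 → |((m : ℚ)⁻¹) ^ (k + 1)| ≤ 1 := by
    intro m hm
    rw [abs_pow, abs_inv]
    apply pow_le_one₀ (by positivity)
    apply inv_le_one_of_one_le₀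
    exact_mod_cast Int.one_le_abs hm
  unfold Gq
  split_ifs with h
  · refine (Finset.abs_sum_le_sum_abs _ _).trans ?_
    have : ∀ v ∈ range u.toNat, |(-4 * k : ℚ) * ((1 + 4 * (v : ℚ))⁻¹) ^ (k + 1)| ≤ 4 * k := by
      intro v _
      have := termb (1 + 4 * v) (by omega)
      push_cast at this
      rw [abs_mul, abs_mul, abs_neg]
      simp only [Nat.abs_cast, Nat.abs_ofNat]
      have hk : (0 : ℚ) ≤ 4 * k := by positivity
      nlinarith
    refine (Finset.sum_le_card_nsmul _ _ _ this).trans ?_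
    rw [card_range, nsmul_eq_mul, abs_of_nonneg h]
    have : ((u.toNat : ℕ) : ℚ) = ((u : ℤ) : ℚ) := by exact_mod_cast Int.toNat_of_nonneg h
    rw [this]; linarith
  · refine (Finset.abs_sum_le_sum_abs _ _).trans ?_
    have : ∀ v ∈ range (-u).toNat, |(4 * k : ℚ) * ((1 - 4 * ((v : ℚ) + 1))⁻¹) ^ (k + 1)| ≤ 4 * k := by
      intro v _
      have := termb (1 - 4 * (v + 1)) (by omega)
      push_cast at this
      rw [abs_mul, abs_mul]
      simp only [Nat.abs_cast, Nat.abs_ofNat]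
      have hk : (0 : ℚ) ≤ 4 * k := by positivity
      nlinarith
    refine (Finset.sum_le_card_nsmul _ _ _ this).trans ?_
    rw [card_range, nsmul_eq_mul, abs_of_neg (by omega)]
    have : (((-u).toNat : ℕ) : ℚ) = ((-u : ℤ) : ℚ) := by exact_mod_cast Int.toNat_of_nonneg (by omega)
    rw [this]; push_cast; linarith

lemma Hq_abs (k : ℕ) (e : ℤ) : |Hq k e| ≤ 4 * k * (|e| + 1) := by
  have h0 : ∀ u : ℤ, |u| ≤ |e| + 1 → |Gq k u| ≤ 4 * k * (|e| + 1) := by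
    intro u hu
    refine (Gq_abs k u).trans ?_
    have : (|(u : ℤ)| : ℚ) ≤ |(e : ℚ)| + 1 := by exact_mod_cast hu
    push_cast
    gcongr
  unfold Hq
  split_ifs with h
  · apply h0; rw [abs_le]; constructor <;> rcases abs_cases e with ⟨h, _⟩ | ⟨h, _⟩ <;> omega
  · rw [abs_mul, abs_pow, abs_neg, abs_one, one_pow, one_mul]
    apply h0; rw [abs_le]; constructor <;> rcases abs_cases e with ⟨h, _⟩ | ⟨h, _⟩ <;> omega

noncomputable def lin (c : ℚ) : PowerSeries ℚ := PowerSeries.C c + PowerSeries.X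

lemma lin_mul_inv {c : ℚ} (h : c ≠ 0) : lin c * (lin c)⁻¹ = 1 := by
  apply PowerSeries.mul_inv_cancel
  simpa [lin] using h

noncomputable def Bser (I : Finset ℤ) (n d : ℤ → ℕ) (e : ℤ) : PowerSeries ℚ :=
  (∏ x ∈ I, (lin ((e : ℚ) - x)) ^ n x) * ∏ x ∈ I.erase e, ((lin ((e : ℚ) - x))⁻¹) ^ d x

noncomputable def acoef (I : Finset ℤ) (n d : ℤ → ℕ) (e : ℤ) (i : ℕ) : ℚ :=
  PowerSeries.coeff (d e - i) (Bser I n d e)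

open Polynomial in
noncomputable def Dpart (I : Finset ℤ) (d : ℤ → ℕ) (e : ℤ) (i : ℕ) : ℚ[X] :=
  (X - C (e : ℚ)) ^ (d e - i) * ∏ x ∈ I.erase e, (X - C (x : ℚ)) ^ d x

open Polynomial in
lemma partial_fractions_poly (I : Finset ℤ) (n d : ℤ → ℕ) (hdeg : ∑ x ∈ I, n x < ∑ x ∈ I, d x) :
    ∏ x ∈ I, (X - C (x : ℚ)) ^ n x
      = ∑ e ∈ I, ∑ i ∈ Finset.Icc 1 (d e), C (acoef I n d e i) * Dpart I d e i := by
  have hdegprod : ∀ (J : Finset ℤ) (f : ℤ → ℕ),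
      (∏ x ∈ J, (X - C (x : ℚ)) ^ f x).degree = ((∑ x ∈ J, f x : ℕ) : WithBot ℕ) := by
    intro J f
    rw [degree_prod]
    push_cast
    apply Finset.sum_congr rfl
    intro x _
    rw [degree_pow, degree_X_sub_C]; simp
  rw [← sub_eq_zero]
  set S := ∑ e ∈ I, ∑ i ∈ Finset.Icc 1 (d e), C (acoef I n d e i) * Dpart I d e i with hS
  have hSdeg : S.degree < ((∑ x ∈ I, d x : ℕ) : WithBot ℕ) := by
    rw [hS]
    refine (degree_sum_le _ _).trans_lt ?_
    rw [Finset.sup_lt_iff (WithBot.bot_lt_coe _)]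
    intro e he
    refine (degree_sum_le _ _).trans_lt ?_
    rw [Finset.sup_lt_iff (WithBot.bot_lt_coe _)]
    intro i hi
    obtain ⟨hi1, hi2⟩ := Finset.mem_Icc.1 hi
    refine (show _ ≤ (Dpart I d e i).degree by rw [← smul_eq_C_mul]; exact degree_smul_le _ _).trans_lt ?_
    unfold Dpart
    rw [degree_mul, hdegprod, degree_pow, degree_X_sub_C]
    rw [← Finset.add_sum_erase I d he]
    simp only [nsmul_eq_mul, mul_one]
    exact_mod_cast (by omega : d e - i + ∑ x ∈ I.erase e, d x < d e + ∑ x ∈ I.erase e, d x)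
  have hdvd : (∏ x ∈ I, (X - C (x : ℚ)) ^ d x) ∣ (∏ x ∈ I, (X - C (x : ℚ)) ^ n x) - S := by
    apply Finset.prod_dvd_of_coprime
    · intro x _ y _ hxy
      apply IsCoprime.pow
      apply isCoprime_X_sub_C_of_isUnit_sub
      rw [isUnit_iff_ne_zero, sub_ne_zero]
      exact_mod_cast hxy
    · intro e he
      rw [hS, ← Finset.add_sum_erase I _ he, ← sub_sub]
      apply dvd_sub
      · rw [X_sub_C_pow_dvd_iff, X_pow_dvd_iff]
        -- move to power series
        set Q := ((∏ x ∈ I, (X - C (x : ℚ)) ^ n x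
          - ∑ i ∈ Finset.Icc 1 (d e), C (acoef I n d e i) * Dpart I d e i).comp (X + C (e : ℚ))) with hQ
        have hps : (PowerSeries.X : PowerSeries ℚ) ^ d e ∣ (Q : PowerSeries ℚ) := by
          have hlin : ∀ x : ℤ, (((X + C (e : ℚ) - C (x : ℚ) : ℚ[X])) : PowerSeries ℚ) = lin ((e : ℚ) - x) := by
            intro x; rw [Polynomial.coe_sub, Polynomial.coe_add, Polynomial.coe_X, Polynomial.coe_C, Polynomial.coe_C, lin, map_sub]; ring
          have hcp : ∀ (J : Finset ℤ) (f : ℤ → ℕ),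
              (((∏ x ∈ J, (X - C (x : ℚ)) ^ f x).comp (X + C (e : ℚ)) : ℚ[X]) : PowerSeries ℚ)
               = ∏ x ∈ J, lin ((e : ℚ) - x) ^ f x := by
            intro J f
            rw [Polynomial.prod_comp]
            rw [← Polynomial.coeToPowerSeries.ringHom_apply, map_prod]
            apply Finset.prod_congr rfl
            intro x _
            rw [Polynomial.pow_comp, map_pow, Polynomial.coeToPowerSeries.ringHom_apply]
            rw [← hlin]; simp
          set E := ∏ x ∈ I.erase e, lin ((e : ℚ) - x) ^ d x with hE
          have hB : (∏ x ∈ I, lin ((e : ℚ) - x) ^ n x) = Bser I n d e * E := by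
            unfold Bser
            rw [mul_assoc, hE, ← Finset.prod_mul_distrib]
            rw [Finset.prod_eq_one (s := I.erase e), mul_one]
            intro x hx
            rw [← mul_pow, mul_comm, lin_mul_inv, one_pow]
            rw [sub_ne_zero]; exact_mod_cast (Finset.ne_of_mem_erase hx).symm
          have hD : ∀ i, (((Dpart I d e i).comp (X + C (e : ℚ)) : ℚ[X]) : PowerSeries ℚ)
              = PowerSeries.X ^ (d e - i) * E := by
            intro i
            unfold Dpart
            rw [Polynomial.mul_comp, Polynomial.coe_mul, hcp]
            congr 1
            simp
          have hQe : (Q : PowerSeries ℚ) = E * (Bser I n d e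
             - ∑ i ∈ Finset.Icc 1 (d e), PowerSeries.C (acoef I n d e i) * PowerSeries.X ^ (d e - i)) := by
            rw [hQ, Polynomial.sub_comp, Polynomial.coe_sub, hcp, hB, Polynomial.sum_comp]
            rw [← Polynomial.coeToPowerSeries.ringHom_apply (φ := ∑ i ∈ _, _), map_sum]
            have : ∀ i ∈ Finset.Icc 1 (d e), Polynomial.coeToPowerSeries.ringHom
               ((C (acoef I n d e i) * Dpart I d e i).comp (X + C (e : ℚ)))
               = E * (PowerSeries.C (acoef I n d e i) * PowerSeries.X ^ (d e - i)) := by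
              intro i _
              rw [Polynomial.mul_comp, map_mul, Polynomial.coeToPowerSeries.ringHom_apply,
                Polynomial.coeToPowerSeries.ringHom_apply, hD]
              simp; ring
            rw [Finset.sum_congr rfl this, ← Finset.mul_sum]; ring
          rw [hQe]
          apply Dvd.dvd.mul_left
          rw [PowerSeries.X_pow_dvd_iff]
          intro m hm
          rw [map_sub, map_sum, Finset.sum_eq_single (d e - m)]
          · rw [PowerSeries.coeff_C_mul, PowerSeries.coeff_X_pow]
            have : d e - (d e - m) = m := by omega
            simp [acoef, this]
          · intro i hi hne
            obtain ⟨hi1, hi2⟩ := Finset.mem_Icc.1 hi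
            rw [PowerSeries.coeff_C_mul, PowerSeries.coeff_X_pow, if_neg (by omega), mul_zero]
          · intro h; exfalso; apply h; rw [Finset.mem_Icc]; omega
        intro m hm
        have := PowerSeries.X_pow_dvd_iff.1 hps m hm
        rwa [Polynomial.coeff_coe] at this
      · apply Finset.dvd_sum
        intro e' he'
        apply Finset.dvd_sum
        intro i _
        apply Dvd.dvd.mul_left
        unfold Dpart
        apply Dvd.dvd.mul_left
        apply Finset.dvd_prod_of_mem (fun x : ℤ => (X - C (x : ℚ)) ^ d x)
        rw [Finset.mem_erase]
        exact ⟨(Finset.ne_of_mem_erase he').symm, he⟩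
  apply Polynomial.eq_zero_of_dvd_of_degree_lt hdvd
  rw [hdegprod]
  refine (degree_sub_le _ _).trans_lt (max_lt ?_ hSdeg)
  rw [hdegprod]
  exact_mod_cast hdeg

lemma partial_fractions {A : Type*} [CommRing A] [Algebra ℚ A] (I : Finset ℤ) (n d : ℤ → ℕ)
    (hdeg : ∑ x ∈ I, n x < ∑ x ∈ I, d x) (y : A) (u : ℤ → A)
    (hu : ∀ x ∈ I, d x ≠ 0 → (y - (x : A)) * u x = 1) :
    (∏ x ∈ I, (y - (x : A)) ^ n x) * ∏ x ∈ I, u x ^ d x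
      = ∑ e ∈ I, ∑ i ∈ Finset.Icc 1 (d e), algebraMap ℚ A (acoef I n d e i) * u e ^ i := by
  have h := congrArg (Polynomial.aeval y) (partial_fractions_poly I n d hdeg)
  have hc : ∀ (x : ℤ), Polynomial.aeval y (Polynomial.C (x : ℚ)) = (x : A) := by
    intro x; rw [Polynomial.aeval_C]; simp
  have hpow : ∀ x ∈ I, ∀ k, (d x ≠ 0 ∨ k = 0) → (y - (x : A)) ^ k * u x ^ k = 1 := by
    intro x hx k hk
    rcases hk with hk | hk
    · rw [← mul_pow, hu x hx hk, one_pow]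
    · simp [hk]
  simp only [map_prod, map_sum, map_pow, map_sub, Polynomial.aeval_X, hc, map_mul, Polynomial.aeval_C,
    Dpart] at h
  rw [h, Finset.sum_mul]
  apply Finset.sum_congr rfl
  intro e he
  rw [Finset.sum_mul]
  apply Finset.sum_congr rfl
  intro i hi
  obtain ⟨hi1, hi2⟩ := Finset.mem_Icc.1 hi
  rw [← Finset.mul_prod_erase I (fun x => u x ^ d x) he]
  have h1 : (∏ x ∈ I.erase e, (y - (x : A)) ^ d x) * ∏ x ∈ I.erase e, u x ^ d x = 1 := by
    rw [← Finset.prod_mul_distrib]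
    apply Finset.prod_eq_one
    intro x hx
    apply hpow x (Finset.mem_of_mem_erase hx)
    tauto
  have h2 := hpow e he (d e - i) (by omega)
  have h3 : u e ^ d e = u e ^ (d e - i) * u e ^ i := by rw [← pow_add]; congr 1; omega
  rw [h3]
  linear_combination (algebraMap ℚ A (acoef I n d e i)) * u e ^ i * (h2 + (y - (e:A)) ^ (d e - i) * u e ^ (d e - i) * h1)

lemma linK_inv {K : Type*} [Field K] {c : K} (h : c ≠ 0) :
    (PowerSeries.C c + PowerSeries.X : PowerSeries K)⁻¹
      = PowerSeries.C c⁻¹ * PowerSeries.rescale (-c⁻¹) (PowerSeries.mk 1) := by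
  symm
  rw [PowerSeries.eq_inv_iff_mul_eq_one (by simpa using h)]
  have h1 := congrArg (PowerSeries.rescale (-c⁻¹)) (PowerSeries.mk_one_mul_one_sub_eq_one K)
  rw [map_mul, map_sub, map_one, PowerSeries.rescale_X] at h1
  have h2 : (PowerSeries.C c⁻¹ : PowerSeries K) * PowerSeries.C c = 1 := by
    rw [← map_mul, inv_mul_cancel₀ h, map_one]
  rw [map_neg] at h1
  linear_combination h1 + PowerSeries.rescale (-c⁻¹) (PowerSeries.mk 1) * h2

lemma coeff_linK_inv_pow {K : Type*} [Field K] {c : K} (h : c ≠ 0) (i r : ℕ) (hi : 1 ≤ i) :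
    PowerSeries.coeff r (((PowerSeries.C c + PowerSeries.X : PowerSeries K)⁻¹) ^ i)
      = (-1) ^ r * ((i + r - 1).choose r : K) * (c⁻¹) ^ (i + r) := by
  obtain ⟨j, rfl⟩ := Nat.exists_eq_add_of_le' hi
  rw [linK_inv h, mul_pow, ← map_pow, PowerSeries.coeff_C_mul, ← map_pow,
    PowerSeries.mk_one_pow_eq_mk_choose_add, PowerSeries.coeff_rescale, PowerSeries.coeff_mk]
  have : (j + 1 + r - 1).choose r = (j + r).choose j := by
    rw [show j + 1 + r - 1 = j + r by omega]
    exact (Nat.choose_symm_add).symm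
  rw [this]
  ring

/-- symmetry of coefficients -/
lemma acoef_neg (I : Finset ℤ) (n d : ℤ → ℕ) (hI : ∀ x, x ∈ I ↔ -x ∈ I)
    (hn : ∀ x, n (-x) = n x) (hd : ∀ x, d (-x) = d x) (e : ℤ) (he : e ∈ I) (i : ℕ) (hi : i ≤ d e) :
    acoef I n d (-e) i = (-1) ^ (∑ x ∈ I, n x + ∑ x ∈ I, d x + i) * acoef I n d e i := by
  have hlin : ∀ c : ℚ, PowerSeries.rescale (-1 : ℚ) (lin c) = - lin (-c) := by
    intro c
    unfold lin
    have hC : PowerSeries.rescale (-1 : ℚ) (PowerSeries.C c) = PowerSeries.C c := by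
      ext k
      rw [PowerSeries.coeff_rescale, PowerSeries.coeff_C]
      split_ifs with hk
      · simp [hk]
      · simp
    rw [map_add, PowerSeries.rescale_X, hC]
    simp [add_comm]
  have hlininv : ∀ c : ℚ, c ≠ 0 → PowerSeries.rescale (-1 : ℚ) (lin c)⁻¹ = - (lin (-c))⁻¹ := by
    intro c hc
    have h1 := congrArg (PowerSeries.rescale (-1 : ℚ)) (lin_mul_inv hc)
    rw [map_mul, map_one, hlin] at h1
    have h2 := lin_mul_inv (neg_ne_zero.2 hc)
    linear_combination (-(lin (-c))⁻¹) * h1 - PowerSeries.rescale (-1 : ℚ) (lin c)⁻¹ * h2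
  have hB : PowerSeries.rescale (-1 : ℚ) (Bser I n d (-e))
      = (-1) ^ (∑ x ∈ I, n x + ∑ x ∈ I.erase e, d x) * Bser I n d e := by
    unfold Bser
    rw [map_mul, map_prod, map_prod]
    have e1 : ∏ x ∈ I, PowerSeries.rescale (-1 : ℚ) (lin (((-e : ℤ) : ℚ) - x) ^ n x)
        = (-1) ^ (∑ x ∈ I, n x) * ∏ x ∈ I, lin ((e : ℚ) - x) ^ n x := by
      rw [← Finset.prod_pow_eq_pow_sum, ← Finset.prod_mul_distrib]
      apply Finset.prod_nbij' (fun x => -x) (fun x => -x)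
      · intro x hx; exact (hI x).1 hx
      · intro x hx; exact (hI x).1 hx
      · intro x _; simp
      · intro x _; simp
      · intro x _
        rw [map_pow, hlin, hn, ← mul_pow]
        congr 1; push_cast
        rw [neg_one_mul]; congr 2; ring
    have e2 : ∏ x ∈ I.erase (-e), PowerSeries.rescale (-1 : ℚ) ((lin (((-e : ℤ) : ℚ) - x))⁻¹ ^ d x)
        = (-1) ^ (∑ x ∈ I.erase e, d x) * ∏ x ∈ I.erase e, (lin ((e : ℚ) - x))⁻¹ ^ d x := by
      rw [← Finset.prod_pow_eq_pow_sum, ← Finset.prod_mul_distrib]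
      apply Finset.prod_nbij' (fun x => -x) (fun x => -x)
      · intro x hx
        rw [Finset.mem_erase] at hx ⊢
        exact ⟨fun h => hx.1 (by rw [← h]; simp), (hI x).1 hx.2⟩
      · intro x hx
        rw [Finset.mem_erase] at hx ⊢
        exact ⟨fun h => hx.1 (by simpa using h), (hI x).1 hx.2⟩
      · intro x _; simp
      · intro x _; simp
      · intro x hx
        have hne := Finset.ne_of_mem_erase hx
        rw [map_pow, hlininv, hd, ← mul_pow]
        · congr 1; push_cast
          rw [neg_one_mul]; congr 3; ring
        · rw [sub_ne_zero]; exact_mod_cast hne.symm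
    rw [e1, e2, pow_add]; ring
  have h := congrArg (PowerSeries.coeff (d e - i)) hB
  rw [PowerSeries.coeff_rescale] at h
  have h3 : ((-1 : PowerSeries ℚ)) ^ (∑ x ∈ I, n x + ∑ x ∈ I.erase e, d x)
      = PowerSeries.C ((-1 : ℚ) ^ (∑ x ∈ I, n x + ∑ x ∈ I.erase e, d x)) := by simp
  rw [h3, PowerSeries.coeff_C_mul] at h
  unfold acoef
  rw [hd]
  have h4 : (-1 : ℚ) ^ (d e - i) * (-1) ^ (d e - i) = 1 := by
    rw [← mul_pow]; simp
  have h5 : (-1 : ℚ) ^ (d e - i) * (-1 : ℚ) ^ (∑ x ∈ I, n x + ∑ x ∈ I.erase e, d x)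
     = (-1) ^ (∑ x ∈ I, n x + ∑ x ∈ I, d x + i) := by
    rw [← Finset.add_sum_erase I d he, ← pow_add]
    have : ∑ x ∈ I, n x + (d e + ∑ x ∈ I.erase e, d x) + i
       = (d e - i + (∑ x ∈ I, n x + ∑ x ∈ I.erase e, d x)) + 2 * i := by omega
    rw [this, pow_add _ _ (2 * i), pow_mul]; simp
  rw [← h5]
  linear_combination (-1) ^ (d e - i) * h - PowerSeries.coeff (d e - i) (Bser I n d (-e)) * h4

/-- residue sum -/
lemma residue_sum (I : Finset ℤ) (n d : ℤ → ℕ) (hdeg : ∑ x ∈ I, n x + 2 ≤ ∑ x ∈ I, d x) :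
    ∑ e ∈ I, (if 1 ≤ d e then acoef I n d e 1 else 0) = 0 := by
  have h := congrArg (fun P => Polynomial.coeff P (∑ x ∈ I, d x - 1))
    (partial_fractions_poly I n d (by omega))
  have hnd : ∀ (J : Finset ℤ) (f : ℤ → ℕ),
      (∏ x ∈ J, (Polynomial.X - Polynomial.C (x : ℚ)) ^ f x).natDegree = (∑ x ∈ J, f x) := by
    intro J f
    rw [Polynomial.natDegree_prod_of_monic]
    · apply Finset.sum_congr rfl
      intro x _
      rw [Polynomial.natDegree_pow, Polynomial.natDegree_X_sub_C, mul_one]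
    · intro x _; exact (Polynomial.monic_X_sub_C _).pow _
  have hmon : ∀ e i, (Dpart I d e i).Monic := by
    intro e i
    exact ((Polynomial.monic_X_sub_C _).pow _).mul
      (Polynomial.monic_prod_of_monic _ _ fun x _ => (Polynomial.monic_X_sub_C _).pow _)
  have hDd : ∀ e ∈ I, ∀ i, i ≤ d e → (Dpart I d e i).natDegree = ∑ x ∈ I, d x - i := by
    intro e he i hi
    unfold Dpart
    rw [Polynomial.Monic.natDegree_mul ((Polynomial.monic_X_sub_C _).pow _)
      (Polynomial.monic_prod_of_monic _ _ fun x _ => (Polynomial.monic_X_sub_C _).pow _), hnd,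
      ← Finset.add_sum_erase I d he, Polynomial.natDegree_pow, Polynomial.natDegree_X_sub_C]
    omega
  rw [Polynomial.coeff_eq_zero_of_natDegree_lt (by rw [hnd]; omega), Polynomial.finsetSum_coeff] at h
  refine Eq.trans ?_ h.symm
  apply Finset.sum_congr rfl
  intro e he
  rw [Polynomial.finsetSum_coeff]
  split_ifs with hde
  · rw [Finset.sum_eq_single 1]
    · rw [Polynomial.coeff_C_mul, ← hDd e he 1 hde, (hmon e 1).coeff_natDegree, mul_one]
    · intro i hi hne
      obtain ⟨hi1, hi2⟩ := Finset.mem_Icc.1 hi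
      have hle : d e ≤ ∑ x ∈ I, d x := Finset.single_le_sum (fun _ _ => Nat.zero_le _) he
      rw [Polynomial.coeff_C_mul, Polynomial.coeff_eq_zero_of_natDegree_lt, mul_zero]
      rw [hDd e he i hi2]; omega
    · intro h; exfalso; apply h; rw [Finset.mem_Icc]; omega
  · rw [Finset.Icc_eq_empty (by omega)]; simp

noncomputable def Rser (I : Finset ℤ) (n d : ℤ → ℕ) (y : ℚ_[2]) : PowerSeries ℚ_[2] :=
  (∏ x ∈ I, (PowerSeries.C (y - x) + PowerSeries.X) ^ n x) *
    ∏ x ∈ I, ((PowerSeries.C (y - x) + PowerSeries.X)⁻¹) ^ d x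

noncomputable def cI (r i : ℕ) : ℚ := (-1) ^ r * ((i + r - 1).choose r : ℚ)

lemma S_formula (I : Finset ℤ) (n d : ℤ → ℕ) (hdeg : ∑ x ∈ I, n x < ∑ x ∈ I, d x)
    (hd : ∀ x, d x ≠ 0 → 2 ∣ x) (r : ℕ) :
    HasV (fun t => PowerSeries.coeff r (Rser I n d (1 + 4 * (t : ℚ_[2]))))
      (∑ e ∈ I, ∑ i ∈ Finset.Icc 1 (d e), ((acoef I n d e i * cI r i : ℚ) : ℚ_[2]) *
        ((eps e : ℚ) ^ (i + r) * Jv (i + r) + (Hq (i + r) e : ℚ))) := by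
  have hne : ∀ (t : ℤ) (x : ℤ), d x ≠ 0 → (1 + 4 * (t : ℚ_[2]) - x) ≠ 0 := by
    intro t x hx
    have := hd x hx
    exact_mod_cast (by omega : 1 + 4 * t - x ≠ 0)
  have key : ∀ t : ℤ, PowerSeries.coeff r (Rser I n d (1 + 4 * (t : ℚ_[2])))
     = ∑ e ∈ I, ∑ i ∈ Finset.Icc 1 (d e), ((acoef I n d e i * cI r i : ℚ) : ℚ_[2]) *
        ((1 + 4 * (t : ℚ_[2]) - e)⁻¹) ^ (i + r) := by
    intro t
    have h := partial_fractions (A := PowerSeries ℚ_[2]) I n d hdeg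
      (PowerSeries.C (1 + 4 * (t : ℚ_[2])) + PowerSeries.X)
      (fun x => (PowerSeries.C (1 + 4 * (t : ℚ_[2]) - x) + PowerSeries.X)⁻¹) (by
        intro x _ hx
        have : (PowerSeries.C (1 + 4 * (t : ℚ_[2])) + PowerSeries.X - (x : PowerSeries ℚ_[2]))
          = PowerSeries.C (1 + 4 * (t : ℚ_[2]) - x) + PowerSeries.X := by
          rw [map_sub, map_intCast]; ring
        rw [this]
        apply PowerSeries.mul_inv_cancel
        simpa using hne t x hx)
    have h2 : Rser I n d (1 + 4 * (t : ℚ_[2])) = ∑ e ∈ I, ∑ i ∈ Finset.Icc 1 (d e),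
        algebraMap ℚ (PowerSeries ℚ_[2]) (acoef I n d e i) *
          ((PowerSeries.C (1 + 4 * (t : ℚ_[2]) - e) + PowerSeries.X)⁻¹) ^ i := by
      rw [← h]
      unfold Rser
      congr 1
      apply Finset.prod_congr rfl
      intro x _
      congr 1
      rw [map_sub, map_intCast]; ring
    rw [h2, map_sum]
    apply Finset.sum_congr rfl
    intro e _
    rw [map_sum]
    apply Finset.sum_congr rfl
    intro i hi
    obtain ⟨hi1, hi2⟩ := Finset.mem_Icc.1 hi
    have h3 : algebraMap ℚ (PowerSeries ℚ_[2]) (acoef I n d e i)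
       = PowerSeries.C ((acoef I n d e i : ℚ) : ℚ_[2]) := by
      rw [PowerSeries.algebraMap_apply]; simp
    rw [h3, PowerSeries.coeff_C_mul, coeff_linK_inv_pow (hne t e (by omega)) i r hi1]
    unfold cI
    push_cast; ring
  simp only [key]
  apply HasV.sum
  intro e _
  apply HasV.sum
  intro i hi
  obtain ⟨hi1, hi2⟩ := Finset.mem_Icc.1 hi
  apply HasV.const_mul
  exact HasV.pole (i + r) e (hd e (by omega))

lemma sum_range_mul' {A : Type*} [AddCommMonoid A] (f : ℕ → A) (a b : ℕ) :
    ∑ t ∈ range (a * b), f t = ∑ t0 ∈ range a, ∑ t' ∈ range b, f (t0 + a * t') := by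
  rw [Finset.sum_comm]
  induction b with
  | zero => simp
  | succ b ih =>
    rw [mul_add, mul_one, Finset.sum_range_add, ih, Finset.sum_range_succ]
    congr 1
    apply Finset.sum_congr rfl
    intro x _; congr 1; ring

lemma local_series (I : Finset ℤ) (n d : ℤ → ℕ) (hd : ∀ x, d x ≠ 0 → 2 ∣ x) (m : ℕ) (t0 : ℤ)
    (g : ℤ → ℕ) (hg1 : ∀ x, g x ≤ m + 2) (hg2 : ∀ x, (2 : ℤ) ^ g x ∣ 1 + 4 * t0 - x) :
    ∃ Φ : ℤ → PowerSeries ℤ_[2], Lip Φ ∧ ∀ t' : ℤ,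
      PowerSeries.rescale ((2 : ℚ_[2]) ^ (m + 2)) (Rser I n d (1 + 4 * ((t0 + 2 ^ m * t' : ℤ) : ℚ_[2])))
        = PowerSeries.C ((2 : ℚ_[2]) ^ (∑ x ∈ I, n x * g x)) *
          PowerSeries.map PadicInt.Coe.ringHom (Φ t') := by
  choose α hα using hg2
  set ρ := PowerSeries.map (PadicInt.Coe.ringHom (p := 2)) with hρ
  -- numerators
  let N : ℤ → ℤ → PowerSeries ℤ_[2] := fun x t' =>
    (PowerSeries.C (α x : ℤ_[2]) + PowerSeries.C (2 ^ (m + 2 - g x)) * PowerSeries.X)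
      + PowerSeries.C (2 ^ (m + 2 - g x)) * (t' : PowerSeries ℤ_[2])
  let P : ℤ → ℤ → PowerSeries ℤ_[2] := fun x t' =>
    (PowerSeries.C ((1 + 4 * t0 - x : ℤ) : ℤ_[2]) + PowerSeries.C (2 ^ (m + 2)) * PowerSeries.X)
      + PowerSeries.C (2 ^ (m + 2)) * (t' : PowerSeries ℤ_[2])
  have hPunit : ∀ x, d x ≠ 0 → ∀ t', IsUnit (P x t') := by
    intro x hx t'
    rw [PowerSeries.isUnit_iff_constantCoeff]
    have h2 := hd x hx
    have : PowerSeries.constantCoeff (P x t') = ((1 + 4 * t0 - x + 2 ^ (m + 2) * t' : ℤ) : ℤ_[2]) := by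
      simp only [P]
      rw [← map_intCast (PowerSeries.C : ℤ_[2] →+* _) t']
      simp only [map_add, map_mul, PowerSeries.constantCoeff_C, PowerSeries.constantCoeff_X]
      push_cast; ring
    rw [this, PadicInt.isUnit_iff]
    have h3 := PadicInt.norm_int_lt_one_iff_dvd (p := 2) (1 + 4 * t0 - x + 2 ^ (m + 2) * t')
    have h1 := PadicInt.norm_le_one (p := 2) ((1 + 4 * t0 - x + 2 ^ (m + 2) * t' : ℤ) : ℤ_[2])
    by_contra hne
    have h5 := h3.1 (lt_of_le_of_ne h1 hne)
    have h4 : (2 : ℤ) ^ (m + 2) * t' = 2 * (2 ^ (m + 1) * t') := by ring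
    rw [h4] at h5
    push_cast at h5
    omega
  have hPinv : ∀ x t', ∃ w : PowerSeries ℤ_[2], d x ≠ 0 → P x t' * w = 1 := by
    intro x t'
    by_cases hx : d x ≠ 0
    · obtain ⟨w, hw⟩ := (hPunit x hx t').exists_right_inv
      exact ⟨w, fun _ => hw⟩
    · exact ⟨0, fun h => absurd h hx⟩
  choose W hW using hPinv
  refine ⟨fun t' => (∏ x ∈ I, N x t' ^ n x) * ∏ x ∈ I, W x t' ^ d x, ?_, ?_⟩
  · apply Lip.mul
    · apply Lip.prod
      intro x _
      exact (Lip.lin _ _).pow _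
    · apply Lip.prod
      intro x _
      by_cases hx : d x ≠ 0
      · exact ((Lip.lin _ _).inv (fun t => hW x t hx)).pow _
      · push Not at hx
        simp only [hx, pow_zero]
        exact Lip.const _
  · intro t'
    have hres : ∀ x : ℤ, PowerSeries.rescale ((2 : ℚ_[2]) ^ (m + 2))
        (PowerSeries.C (1 + 4 * ((t0 + 2 ^ m * t' : ℤ) : ℚ_[2]) - x) + PowerSeries.X) = ρ (P x t') := by
      intro x
      have hC : ∀ c s : ℚ_[2], PowerSeries.rescale s (PowerSeries.C c) = PowerSeries.C c := by
        intro c s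
        ext k
        rw [PowerSeries.coeff_rescale, PowerSeries.coeff_C]
        split_ifs with hk
        · simp [hk]
        · simp
      simp only [P]
      rw [map_add, hC, PowerSeries.rescale_X, hρ]
      rw [← map_intCast (PowerSeries.C : ℤ_[2] →+* _) t']
      simp only [map_add, map_mul, PowerSeries.map_C, PowerSeries.map_X, map_intCast, map_pow, map_ofNat]
      push_cast
      simp only [map_add, map_mul, map_sub, map_pow, map_ofNat, map_intCast, map_one]
      ring
    have hN : ∀ x : ℤ, ρ (P x t') = PowerSeries.C ((2 : ℚ_[2]) ^ g x) * ρ (N x t') := by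
      intro x
      have : P x t' = PowerSeries.C (2 ^ g x) * N x t' := by
        simp only [P, N]
        rw [hα x]
        have h1 : (2 : ℤ_[2]) ^ (m + 2) = 2 ^ g x * 2 ^ (m + 2 - g x) := by
          rw [← pow_add]; congr 1; have := hg1 x; omega
        rw [h1]
        push_cast
        simp only [map_mul]
        ring
      rw [this, map_mul, hρ, PowerSeries.map_C, map_pow, map_ofNat]
    have hWi : ∀ x, d x ≠ 0 → (ρ (P x t'))⁻¹ = ρ (W x t') := by
      intro x hx
      have h1 := congrArg ρ (hW x t' hx)
      rw [map_mul, map_one] at h1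
      rw [PowerSeries.inv_eq_iff_mul_eq_one]
      · rw [mul_comm]; exact h1
      · intro h0
        have := congrArg PowerSeries.constantCoeff h1
        rw [map_mul, h0] at this
        simp at this
    have hresinv : ∀ x : ℤ, d x ≠ 0 → PowerSeries.rescale ((2 : ℚ_[2]) ^ (m + 2))
        (PowerSeries.C (1 + 4 * ((t0 + 2 ^ m * t' : ℤ) : ℚ_[2]) - x) + PowerSeries.X)⁻¹ = ρ (W x t') := by
      intro x hx
      have hne : (1 + 4 * ((t0 + 2 ^ m * t' : ℤ) : ℚ_[2]) - x) ≠ 0 := by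
        have := hd x hx
        have h : (1 + 4 * (t0 + 2 ^ m * t') - x : ℤ) ≠ 0 := by omega
        exact_mod_cast h
      have h1 := PowerSeries.mul_inv_cancel
        (PowerSeries.C (1 + 4 * ((t0 + 2 ^ m * t' : ℤ) : ℚ_[2]) - x) + PowerSeries.X) (by simpa using hne)
      have h2 := congrArg (PowerSeries.rescale ((2 : ℚ_[2]) ^ (m + 2))) h1
      rw [map_mul, map_one, hres] at h2
      have h3 := congrArg ρ (hW x t' hx)
      rw [map_mul, map_one] at h3
      linear_combination ρ (W x t') * h2 - PowerSeries.rescale ((2 : ℚ_[2]) ^ (m + 2))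
        (PowerSeries.C (1 + 4 * ((t0 + 2 ^ m * t' : ℤ) : ℚ_[2]) - x) + PowerSeries.X)⁻¹ * h3
    unfold Rser
    rw [map_mul, map_prod, map_prod, map_mul, map_prod, map_prod, ← mul_assoc]
    congr 1
    · rw [← Finset.prod_pow_eq_pow_sum, map_prod, ← Finset.prod_mul_distrib]
      apply Finset.prod_congr rfl
      intro x _
      rw [map_pow, hres, hN, mul_pow, map_pow ρ, ← map_pow PowerSeries.C, ← pow_mul, mul_comm (g x)]
    · apply Finset.prod_congr rfl
      intro x _
      by_cases hx : d x ≠ 0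
      · rw [map_pow, hresinv x hx, map_pow]
      · push Not at hx
        simp [hx]

lemma S_bound (I : Finset ℤ) (n d : ℤ → ℕ) (hd : ∀ x, d x ≠ 0 → 2 ∣ x) (m r G : ℕ)
    (g : ℤ → ℤ → ℕ) (hg1 : ∀ t x, g t x ≤ m + 2) (hg2 : ∀ t x, (2 : ℤ) ^ g t x ∣ 1 + 4 * t - x)
    (hG : ∀ t, G ≤ ∑ x ∈ I, n x * g t x) {S : ℚ_[2]}
    (hS : HasV (fun t => PowerSeries.coeff r (Rser I n d (1 + 4 * (t : ℚ_[2])))) S) :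
    ‖S‖ ≤ 2 ^ (m + 1 + (m + 2) * r) * (2⁻¹ : ℝ) ^ G := by
  refine le_of_tendsto hS.norm ?_
  filter_upwards [Filter.eventually_ge_atTop m] with M hM
  obtain ⟨M', rfl⟩ := Nat.exists_eq_add_of_le hM
  choose Φ hΦ1 hΦ2 using fun t0 : ℤ => local_series I n d hd m t0 (g t0) (hg1 t0) (hg2 t0)
  rw [show (2:ℕ)^(m+M') = 2^m*2^M' from pow_add 2 m M', sum_range_mul', pow_add 2 m M']
  have hin : ∀ t0 ∈ range (2 ^ m), ‖∑ t' ∈ range (2 ^ M'), PowerSeries.coeff r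
      (Rser I n d (1 + 4 * (((t0 + 2 ^ m * t' : ℕ) : ℤ) : ℚ_[2])))‖
      ≤ 2 ^ ((m + 2) * r) * (2⁻¹ : ℝ) ^ G * (2 * (2⁻¹ : ℝ) ^ M') := by
    intro t0 _
    have h1 : ∀ t' : ℕ, PowerSeries.coeff r (Rser I n d (1 + 4 * (((t0 + 2 ^ m * t' : ℕ) : ℤ) : ℚ_[2])))
       = ((2 : ℚ_[2]) ^ ((m + 2) * r))⁻¹ * ((2 : ℚ_[2]) ^ (∑ x ∈ I, n x * g t0 x) *
         ((PowerSeries.coeff r (Φ t0 t') : ℤ_[2]) : ℚ_[2])) := by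
      intro t'
      have h := congrArg (PowerSeries.coeff r) (hΦ2 t0 t')
      rw [PowerSeries.coeff_rescale, PowerSeries.coeff_C_mul, PowerSeries.coeff_map, ← pow_mul] at h
      have e : (((t0 + 2 ^ m * t' : ℕ) : ℤ) : ℚ_[2]) = (((t0 : ℤ) + 2 ^ m * (t' : ℤ) : ℤ) : ℚ_[2]) := by
        push_cast; rfl
      rw [e]
      have e2 : (PadicInt.Coe.ringHom (PowerSeries.coeff r (Φ t0 t')) : ℚ_[2])
        = ((PowerSeries.coeff r (Φ t0 t') : ℤ_[2]) : ℚ_[2]) := rfl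
      rw [e2] at h
      rw [← h, ← mul_assoc, inv_mul_cancel₀ (pow_ne_zero _ two_ne_zero), one_mul]
    rw [Finset.sum_congr rfl (fun t' _ => h1 t'), ← Finset.mul_sum, ← Finset.mul_sum,
      ← PadicInt.coe_sum, ← map_sum]
    have h3 : ‖PowerSeries.coeff r (∑ t' ∈ range (2 ^ M'), Φ t0 (t' : ℤ))‖ ≤ 2 * (2⁻¹ : ℝ) ^ M' := by
      obtain ⟨c, hc⟩ := (hΦ1 t0).sum_dvd M'
      have hc2 := congrArg (PowerSeries.coeff r) hc
      have e1 : (2 : PowerSeries ℤ_[2]) = PowerSeries.C (2 : ℤ_[2]) := (map_ofNat _ 2).symm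
      rw [e1, ← map_pow, PowerSeries.coeff_C_mul, PowerSeries.coeff_C_mul] at hc2
      have h2 : ‖(2 : ℤ_[2])‖ = (2 : ℝ)⁻¹ := by simpa using PadicInt.norm_p (p := 2)
      have := congrArg norm hc2
      rw [norm_mul, norm_mul, norm_pow, h2] at this
      have hc1 := PadicInt.norm_le_one (PowerSeries.coeff r c)
      have hp : (0 : ℝ) < (2⁻¹) ^ M' := by positivity
      nlinarith
    rw [norm_mul, norm_mul, norm_inv, norm_two_pow', norm_two_pow', ← PadicInt.norm_def, ← mul_assoc]
    have h5 : ((2⁻¹ : ℝ) ^ ((m + 2) * r))⁻¹ = 2 ^ ((m + 2) * r) := by rw [inv_pow, inv_inv]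
    rw [h5]
    have h6 : (2⁻¹ : ℝ) ^ (∑ x ∈ I, n x * g t0 x) ≤ (2⁻¹ : ℝ) ^ G :=
      pow_le_pow_of_le_one (by norm_num) (by norm_num) (hG t0)
    gcongr
  rw [norm_mul, norm_inv, norm_mul, norm_two_pow', norm_two_pow']
  have hs := IsUltrametricDist.norm_sum_le_of_forall_le_of_nonneg
    (by positivity : (0:ℝ) ≤ 2 ^ ((m + 2) * r) * (2⁻¹ : ℝ) ^ G * (2 * (2⁻¹ : ℝ) ^ M')) hin
  refine (mul_le_mul_of_nonneg_left hs (by positivity)).trans (le_of_eq ?_)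
  rw [pow_add 2 (m+1), pow_add 2 m 1]
  simp only [inv_pow]
  field_simp

/-- number of `j < M` with `2^(j+1) ∣ y` -/
def gg (M : ℕ) (y : ℤ) : ℕ := ∑ j ∈ range M, if (2 : ℤ) ^ (j + 1) ∣ y then 1 else 0

lemma gg_le (M : ℕ) (y : ℤ) : gg M y ≤ M := by
  unfold gg
  calc _ ≤ ∑ j ∈ range M, 1 := Finset.sum_le_sum (fun j _ => by split_ifs <;> simp)
    _ = M := by simp

lemma gg_dvd (M : ℕ) (y : ℤ) : (2 : ℤ) ^ gg M y ∣ y := by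
  induction M with
  | zero => simp [gg]
  | succ M ih =>
    have h : gg (M + 1) y = gg M y + if (2 : ℤ) ^ (M + 1) ∣ y then 1 else 0 := by
      unfold gg; rw [Finset.sum_range_succ]
    by_cases hd : (2 : ℤ) ^ (M + 1) ∣ y
    · exact (pow_dvd_pow 2 (gg_le (M + 1) y)).trans hd
    · rw [h, if_neg hd]; simpa using ih

def nf (w ℓ : Fin 3 → ℕ) (x : ℤ) : ℕ :=
  if 2 ∣ x then 0 else ∑ k, if |x| ≤ (ℓ k : ℤ) then w k else 0

def df (w ℓ : Fin 3 → ℕ) (x : ℤ) : ℕ :=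
  if 2 ∣ x then ∑ k, if |x| ≤ (ℓ k : ℤ) then w k else 0 else 0

lemma count_mod (ℓ : ℕ) (L : ℕ) (hℓ : ℓ ≤ L) (r : ℤ) (hr : 0 < r) (c : ℤ) :
    ((2 * ℓ + 1 : ℚ)) / r - 1 ≤ #{x ∈ Icc (-(L : ℤ)) (L : ℤ) | |x| ≤ (ℓ : ℤ) ∧ r ∣ c - x} := by
  have h : ({x ∈ Icc (-(L : ℤ)) (L : ℤ) | |x| ≤ (ℓ : ℤ) ∧ r ∣ c - x} : Finset ℤ) =
      {x ∈ Ioc (-(ℓ : ℤ) - 1) (ℓ : ℤ) | x ≡ c [ZMOD r]} := by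
    ext x
    simp only [mem_filter, mem_Icc, mem_Ioc, abs_le, Int.modEq_iff_dvd]
    constructor
    · rintro ⟨h1, h2, h3⟩; exact ⟨by omega, h3⟩
    · rintro ⟨h1, h3⟩; exact ⟨by omega, by omega, h3⟩
  rw [h]
  have := Int.Ioc_filter_modEq_card (-(ℓ : ℤ) - 1) ℓ hr c
  have h2 : ((⌊((ℓ : ℤ) - c : ℚ) / r⌋ - ⌊((-(ℓ : ℤ) - 1 : ℤ) - c : ℚ) / r⌋ : ℤ) : ℚ) ≤
     #{x ∈ Ioc (-(ℓ : ℤ) - 1) (ℓ : ℤ) | x ≡ c [ZMOD r]} := by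
    have h3 : (⌊((ℓ : ℤ) - c : ℚ) / r⌋ - ⌊((-(ℓ : ℤ) - 1 : ℤ) - c : ℚ) / r⌋ : ℤ) ≤
     (#{x ∈ Ioc (-(ℓ : ℤ) - 1) (ℓ : ℤ) | x ≡ c [ZMOD r]} : ℤ) := by
      rw [this]; exact le_max_left _ _
    exact_mod_cast h3
  refine le_trans ?_ h2
  push_cast
  have h4 := Int.lt_floor_add_one (((ℓ : ℚ) - c) / r)
  have h5 := Int.floor_le ((-(ℓ : ℚ) - 1 - c) / r)
  have h6 : (2 * ℓ + 1 : ℚ) / r = ((ℓ : ℚ) - c) / r - (-(ℓ : ℚ) - 1 - c) / r := by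
    rw [← sub_div]; congr 1; ring
  rw [h6]
  linarith

lemma count_gg (ℓ L : ℕ) (hℓ : ℓ ≤ L) (M : ℕ) (hM : 2 * L + 1 ≤ 2 ^ M) (c : ℤ) :
    2 * ℓ - M ≤ ∑ x ∈ Icc (-(L : ℤ)) (L : ℤ), if |x| ≤ (ℓ : ℤ) then gg M (c - x) else 0 := by
  have h1 : ∑ x ∈ Icc (-(L : ℤ)) (L : ℤ), (if |x| ≤ (ℓ : ℤ) then gg M (c - x) else 0) =
     ∑ j ∈ range M, #{x ∈ Icc (-(L : ℤ)) (L : ℤ) | |x| ≤ (ℓ : ℤ) ∧ (2 : ℤ) ^ (j + 1) ∣ c - x} := by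
    simp_rw [Finset.card_filter, gg]
    rw [Finset.sum_comm]
    apply Finset.sum_congr rfl
    intro x _
    by_cases h : |x| ≤ ℓ <;> simp [h]
  rw [h1, Nat.sub_le_iff_le_add]
  have h2 : ∀ K, ∑ j ∈ range K, (((2 * ℓ + 1 : ℚ)) / ((2 : ℤ) ^ (j + 1) : ℤ) - 1) =
      (2 * ℓ + 1) * (1 - (1 / 2 ^ K)) - K := by
    intro K
    induction K with
    | zero => simp
    | succ K ih =>
      rw [Finset.sum_range_succ, ih]; push_cast; field_simp; ring
  have h3 : (∑ j ∈ range M, (((2 * ℓ + 1 : ℚ)) / ((2 : ℤ) ^ (j + 1) : ℤ) - 1)) ≤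
     ∑ j ∈ range M, (#{x ∈ Icc (-(L : ℤ)) (L : ℤ) | |x| ≤ (ℓ : ℤ) ∧ (2 : ℤ) ^ (j + 1) ∣ c - x} : ℚ) :=
    Finset.sum_le_sum (fun j _ => count_mod ℓ L hℓ _ (by positivity) c)
  rw [h2] at h3
  have h4 : (2 * ℓ + 1 : ℚ) * (1 / 2 ^ M) ≤ 1 := by
    rw [mul_one_div, div_le_one (by positivity)]
    have : (2 * ℓ + 1 : ℕ) ≤ 2 ^ M := by omega
    exact_mod_cast this
  have h5 : (2 * ℓ : ℚ) ≤ (∑ j ∈ range M, (#{x ∈ Icc (-(L : ℤ)) (L : ℤ) | |x| ≤ (ℓ : ℤ) ∧ (2 : ℤ) ^ (j + 1) ∣ c - x} : ℚ)) + M := by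
    linarith
  exact_mod_cast h5

lemma G_bound (w ℓ : Fin 3 → ℕ) (L : ℕ) (hℓ : ∀ k, ℓ k ≤ L) (M : ℕ) (hM0 : 1 ≤ M) (hM : 2 * L + 1 ≤ 2 ^ M)
    (n : ℤ → ℕ) (hn : ∀ x, nf w ℓ x ≤ n x) (t : ℤ) :
    ∑ k, w k * (2 * ℓ k - M) ≤ ∑ x ∈ Icc (-(L : ℤ)) (L : ℤ), n x * gg M (1 + 4 * t - x) := by
  have h1 : ∀ x : ℤ, (∑ k, w k * if |x| ≤ (ℓ k : ℤ) then gg M (1 + 4 * t - x) else 0) ≤ n x * gg M (1 + 4 * t - x) := by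
    intro x
    refine le_trans ?_ (Nat.mul_le_mul_right _ (hn x))
    unfold nf
    by_cases hx : 2 ∣ x
    · have : gg M (1 + 4 * t - x) = 0 := by
        unfold gg
        apply Finset.sum_eq_zero
        intro j _
        rw [if_neg]
        intro hd
        have : (2 : ℤ) ∣ 1 + 4 * t - x := (dvd_pow_self 2 (by omega)).trans hd
        omega
      simp [this]
    · rw [if_neg hx, Finset.sum_mul]
      apply Finset.sum_le_sum
      intro k _
      split_ifs <;> simp
  calc _ ≤ ∑ k, w k * ∑ x ∈ Icc (-(L : ℤ)) (L : ℤ), (if |x| ≤ (ℓ k : ℤ) then gg M (1 + 4 * t - x) else 0) :=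
        Finset.sum_le_sum (fun k _ => Nat.mul_le_mul_left _ (count_gg (ℓ k) L (hℓ k) M hM _))
    _ = ∑ x ∈ Icc (-(L : ℤ)) (L : ℤ), ∑ k, w k * (if |x| ≤ (ℓ k : ℤ) then gg M (1 + 4 * t - x) else 0) := by
        rw [Finset.sum_comm]; simp_rw [Finset.mul_sum]
    _ ≤ _ := Finset.sum_le_sum (fun x _ => h1 x)

def BdR (B : PowerSeries ℚ) (K : ℚ) (T : ℕ) : Prop := ∀ n, |PowerSeries.coeff n B| ≤ K * (T : ℚ) ^ n

lemma BdR.nonneg {B : PowerSeries ℚ} {K : ℚ} {T : ℕ} (h : BdR B K T) : 0 ≤ K := by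
  have := h 0
  have h2 := abs_nonneg (PowerSeries.coeff 0 B)
  simp only [pow_zero, mul_one] at this
  linarith

lemma coeff_mul_lin (B : PowerSeries ℚ) (c : ℚ) (n : ℕ) :
    PowerSeries.coeff n (B * lin c) = c * PowerSeries.coeff n B +
      if n = 0 then 0 else PowerSeries.coeff (n - 1) B := by
  unfold lin
  rw [mul_add, map_add, mul_comm B (PowerSeries.C c), PowerSeries.coeff_C_mul]
  congr 1
  cases n with
  | zero => simp
  | succ n => simp [PowerSeries.coeff_succ_mul_X]

lemma pow_aux1 (T n : ℕ) : (T : ℚ) ^ (n + 1) + (T : ℚ) ^ n ≤ (T + 1 : ℚ) ^ (n + 1) := by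
  have h : (T : ℚ) ^ n ≤ (T + 1 : ℚ) ^ n := by gcongr; linarith
  have hT : (0 : ℚ) ≤ T := by positivity
  rw [pow_succ, pow_succ]
  nlinarith [pow_nonneg hT n]

lemma pow_aux2 (T n : ℕ) : (T : ℚ) ^ (n + 1) + (T + 1 : ℚ) ^ n ≤ (T + 1 : ℚ) ^ (n + 1) := by
  have h : (T : ℚ) ^ n ≤ (T + 1 : ℚ) ^ n := by gcongr; linarith
  have hT : (0 : ℚ) ≤ T := by positivity
  rw [pow_succ, pow_succ]
  nlinarith [pow_nonneg hT n]

lemma BdR.mul_lin {B : PowerSeries ℚ} {K : ℚ} {T : ℕ} (h : BdR B K T) {c : ℚ} (hc : 1 ≤ |c|) :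
    BdR (B * lin c) (K * |c|) (T + 1) := by
  intro n
  rw [coeff_mul_lin]
  have hK := h.nonneg
  cases n with
  | zero =>
    have := h 0
    simp only [if_true, add_zero, pow_zero, mul_one, abs_mul] at *
    rw [mul_comm]; gcongr
  | succ n =>
    have h1 := h (n + 1)
    have h2 := h n
    simp only [Nat.succ_ne_zero, if_false, Nat.add_sub_cancel, Nat.cast_add, Nat.cast_one]
    refine (abs_add_le _ _).trans ?_
    rw [abs_mul]
    have h3 := pow_aux1 T n
    calc |c| * |PowerSeries.coeff (n + 1) B| + |PowerSeries.coeff n B|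
        ≤ |c| * (K * T ^ (n + 1)) + |c| * (K * T ^ n) := by
          gcongr
          refine h2.trans ?_
          exact le_mul_of_one_le_left (by positivity) hc
      _ = K * |c| * ((T : ℚ) ^ (n + 1) + (T : ℚ) ^ n) := by ring
      _ ≤ _ := by gcongr

lemma BdR.mul_lin_inv {B : PowerSeries ℚ} {K : ℚ} {T : ℕ} (h : BdR B K T) {c : ℚ} (hc : 1 ≤ |c|) :
    BdR (B * (lin c)⁻¹) (K * |c|⁻¹) (T + 1) := by
  have hK := h.nonneg
  have hc0 : c ≠ 0 := by rintro rfl; simp at hc; linarith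
  have hcp : 0 < |c| := abs_pos.2 hc0
  have hB : B * (lin c)⁻¹ * lin c = B := by
    rw [mul_assoc, mul_comm (lin c)⁻¹, lin_mul_inv hc0, mul_one]
  set B' := B * (lin c)⁻¹ with hB'
  have hrec : ∀ n, c * PowerSeries.coeff n B' + (if n = 0 then 0 else PowerSeries.coeff (n - 1) B') =
      PowerSeries.coeff n B := by
    intro n; rw [← coeff_mul_lin, hB]
  intro n
  induction n with
  | zero =>
    have h0 := hrec 0
    have h1 := h 0
    simp only [if_true, add_zero, pow_zero, mul_one] at *
    rw [← h0, abs_mul] at h1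
    rw [← div_eq_mul_inv, le_div_iff₀ hcp]; linarith
  | succ n ih =>
    have h0 := hrec (n + 1)
    have h1 := h (n + 1)
    simp only [Nat.succ_ne_zero, if_false, Nat.add_sub_cancel] at h0
    have h2 : |c| * |PowerSeries.coeff (n + 1) B'| ≤ |PowerSeries.coeff (n + 1) B| + |PowerSeries.coeff n B'| := by
      rw [← abs_mul, eq_sub_of_add_eq h0]
      exact abs_sub _ _
    have h3 := pow_aux2 T n
    push_cast at ih ⊢
    have h4 : K * |c|⁻¹ * (T + 1 : ℚ) ^ n ≤ K * (T + 1 : ℚ) ^ n := by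
      gcongr
      exact mul_le_of_le_one_right hK (inv_le_one_of_one_le₀ hc)
    have h5 : |c| * |PowerSeries.coeff (n + 1) B'| ≤ K * (T + 1 : ℚ) ^ (n + 1) := by
      refine h2.trans ((add_le_add h1 (ih.trans h4)).trans ?_)
      rw [← mul_add]; gcongr
    calc |PowerSeries.coeff (n + 1) B'| ≤ (K * (T + 1 : ℚ) ^ (n + 1)) / |c| := by
          rw [le_div_iff₀ hcp]; linarith
      _ = _ := by rw [div_eq_mul_inv]; ring

lemma BdR.mul_pow_lin {B : PowerSeries ℚ} {K : ℚ} {T : ℕ} (h : BdR B K T) {c : ℚ} (hc : 1 ≤ |c|) (m : ℕ) :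
    BdR (B * lin c ^ m) (K * |c| ^ m) (T + m) := by
  induction m with
  | zero => simpa using h
  | succ m ih =>
    have := ih.mul_lin hc
    rw [pow_succ, pow_succ, ← mul_assoc, ← mul_assoc, ← add_assoc]; exact this

lemma BdR.mul_pow_lin_inv {B : PowerSeries ℚ} {K : ℚ} {T : ℕ} (h : BdR B K T) {c : ℚ} (hc : 1 ≤ |c|) (m : ℕ) :
    BdR (B * (lin c)⁻¹ ^ m) (K * (|c|⁻¹) ^ m) (T + m) := by
  induction m with
  | zero => simpa using h
  | succ m ih =>
    have := ih.mul_lin_inv hc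
    rw [pow_succ, pow_succ, ← mul_assoc, ← mul_assoc, ← add_assoc]; exact this

lemma BdR.prod_lin (s : Finset ℤ) (c : ℤ → ℚ) (m : ℤ → ℕ) (hc : ∀ x ∈ s, m x ≠ 0 → 1 ≤ |c x|)
    {B : PowerSeries ℚ} {K : ℚ} {T : ℕ} (h : BdR B K T) :
    BdR (B * ∏ x ∈ s, lin (c x) ^ m x) (K * ∏ x ∈ s, |c x| ^ m x) (T + ∑ x ∈ s, m x) := by
  induction s using Finset.induction_on with
  | empty => simpa using h
  | insert a s ha ih =>
    have ih' := ih (fun x hx => hc x (mem_insert_of_mem hx))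
    rw [prod_insert ha, prod_insert ha, sum_insert ha]
    by_cases hm : m a = 0
    · simpa [hm] using ih'
    · have := ih'.mul_pow_lin (hc a (mem_insert_self _ _) hm) (m a)
      convert this using 1 <;> ring

lemma BdR.prod_lin_inv (s : Finset ℤ) (c : ℤ → ℚ) (m : ℤ → ℕ) (hc : ∀ x ∈ s, m x ≠ 0 → 1 ≤ |c x|)
    {B : PowerSeries ℚ} {K : ℚ} {T : ℕ} (h : BdR B K T) :
    BdR (B * ∏ x ∈ s, (lin (c x))⁻¹ ^ m x) (K * ∏ x ∈ s, (|c x|⁻¹) ^ m x) (T + ∑ x ∈ s, m x) := by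
  induction s using Finset.induction_on with
  | empty => simpa using h
  | insert a s ha ih =>
    have ih' := ih (fun x hx => hc x (mem_insert_of_mem hx))
    rw [prod_insert ha, prod_insert ha, sum_insert ha]
    by_cases hm : m a = 0
    · simpa [hm] using ih'
    · have := ih'.mul_pow_lin_inv (hc a (mem_insert_self _ _) hm) (m a)
      convert this using 1 <;> ring

lemma Bser_BdR (I : Finset ℤ) (n d : ℤ → ℕ) (e : ℤ) (hne : n e = 0) :
    BdR (Bser I n d e) ((∏ x ∈ I, |((e - x : ℤ) : ℚ)| ^ n x) * ∏ x ∈ I.erase e, (|((e - x : ℤ) : ℚ)|⁻¹) ^ d x)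
      (∑ x ∈ I, n x + ∑ x ∈ I, d x) := by
  have h1 : BdR 1 1 0 := by
    intro k
    rw [PowerSeries.coeff_one]
    by_cases hk : k = 0 <;> simp [hk]
  have habs : ∀ x : ℤ, x ≠ e → (1 : ℚ) ≤ |((e - x : ℤ) : ℚ)| := by
    intro x hx
    have : 1 ≤ |e - x| := Int.one_le_abs (by omega)
    exact_mod_cast this
  have h2 := (h1.prod_lin I (fun x => ((e - x : ℤ) : ℚ)) n
    (fun x _ hx => habs x (by rintro rfl; exact hx hne))).prod_lin_inv (I.erase e)
    (fun x => ((e - x : ℤ) : ℚ)) d (fun x hx _ => habs x (Finset.ne_of_mem_erase hx))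
  rw [one_mul, one_mul, zero_add] at h2
  intro k
  have h3 := h2 k
  have h4 : Bser I n d e = (∏ x ∈ I, lin ((e - x : ℤ) : ℚ) ^ n x) * ∏ x ∈ I.erase e, (lin ((e - x : ℤ) : ℚ))⁻¹ ^ d x := by
    unfold Bser; push_cast; rfl
  rw [h4]
  refine h3.trans ?_
  have := h2.nonneg
  gcongr
  exact Finset.erase_subset _ _

lemma interlace (w ℓ : Fin 3 → ℕ) (L : ℕ) (hℓ : ∀ k, ℓ k ≤ L) (hev : ∀ k, 2 ∣ ℓ k) (e : ℤ) (he : 2 ∣ e) :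
    ∏ x ∈ Icc (-(L : ℤ)) (L : ℤ), |((e - x : ℤ) : ℚ)| ^ nf w ℓ x ≤
      ∏ x ∈ (Icc (-(L : ℤ)) (L : ℤ)).erase e, |((e - x : ℤ) : ℚ)| ^ df w ℓ x := by
  set I := Icc (-(L : ℤ)) (L : ℤ)
  let φ : ℤ → ℤ := fun x => if e < x then x + 1 else x - 1
  have habs : ∀ x : ℤ, x ≠ e → (1 : ℚ) ≤ |((e - x : ℤ) : ℚ)| := by
    intro x hx
    have : 1 ≤ |e - x| := Int.one_le_abs (by omega)
    exact_mod_cast this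
  have hnd : ∀ x, nf w ℓ x ≤ df w ℓ (φ x) := by
    intro x
    unfold nf df
    by_cases hx : 2 ∣ x
    · simp [hx]
    · have h2 : 2 ∣ φ x := by simp only [φ]; split_ifs <;> omega
      rw [if_neg hx, if_pos h2]
      apply Finset.sum_le_sum
      intro k _
      have := hev k
      by_cases h3 : |x| ≤ (ℓ k : ℤ)
      · have h4 : |φ x| ≤ (ℓ k : ℤ) := by
          rw [abs_le] at *
          simp only [φ]; split_ifs <;> omega
        rw [if_pos h3, if_pos h4]
      · rw [if_neg h3]; exact Nat.zero_le _
  set Z := I.filter (fun x => nf w ℓ x ≠ 0) with hZ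
  have hodd : ∀ x, nf w ℓ x ≠ 0 → ¬ 2 ∣ x := by
    intro x hx h2; apply hx; simp [nf, h2]
  have hinj : Set.InjOn φ Z := by
    intro x hx y hy hxy
    have h1 := hodd x (mem_filter.1 hx).2
    have h2 := hodd y (mem_filter.1 hy).2
    simp only [φ] at hxy
    split_ifs at hxy <;> omega
  have hsub : Z.image φ ⊆ I.erase e := by
    intro y hy
    obtain ⟨x, hx, rfl⟩ := mem_image.1 hy
    have h1 := hodd x (mem_filter.1 hx).2
    have h3 : df w ℓ (φ x) ≠ 0 := by have := hnd x; have := (mem_filter.1 hx).2; omega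
    rw [mem_erase]
    constructor
    · simp only [φ]; split_ifs <;> omega
    · unfold df at h3
      split_ifs at h3
      · obtain ⟨k, _, hk⟩ := Finset.exists_ne_zero_of_sum_ne_zero h3
        have h5 : |φ x| ≤ (ℓ k : ℤ) := by by_contra h; rw [if_neg h] at hk; exact hk rfl
        have := hℓ k
        rw [abs_le] at h5
        simp only [I, mem_Icc]; omega
      · exact absurd rfl h3
  calc ∏ x ∈ I, |((e - x : ℤ) : ℚ)| ^ nf w ℓ x = ∏ x ∈ Z, |((e - x : ℤ) : ℚ)| ^ nf w ℓ x := by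
        rw [hZ, Finset.prod_filter]
        apply Finset.prod_congr rfl
        intro x _
        by_cases h : nf w ℓ x = 0 <;> simp [h]
    _ ≤ ∏ x ∈ Z, |((e - φ x : ℤ) : ℚ)| ^ df w ℓ (φ x) := by
        apply Finset.prod_le_prod
        · intro x _; positivity
        · intro x hx
          have h1 := hodd x (mem_filter.1 hx).2
          have h2 : |e - x| ≤ |e - φ x| := by
            simp only [φ]
            split_ifs
            · rw [abs_of_neg (by omega), abs_of_neg (by omega)]; omega
            · rw [abs_of_nonneg (by omega), abs_of_nonneg (by omega)]; omega
          have h3 : |((e - x : ℤ) : ℚ)| ≤ |((e - φ x : ℤ) : ℚ)| := by exact_mod_cast h2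
          calc _ ≤ |((e - φ x : ℤ) : ℚ)| ^ nf w ℓ x := by gcongr
            _ ≤ _ := by
              apply pow_le_pow_right₀ _ (hnd x)
              exact (habs x (by rintro rfl; exact h1 he)).trans h3
    _ = ∏ y ∈ Z.image φ, |((e - y : ℤ) : ℚ)| ^ df w ℓ y := by
        rw [Finset.prod_image hinj]
    _ ≤ _ := by
        apply Finset.prod_le_prod_of_subset_of_one_le hsub
        · intro x _; positivity
        · intro x hx _
          exact one_le_pow₀ (habs x (Finset.ne_of_mem_erase hx))

lemma acoef_abs (w ℓ : Fin 3 → ℕ) (L : ℕ) (hL : 1 ≤ L) (hℓ : ∀ k, ℓ k ≤ L) (hev : ∀ k, 2 ∣ ℓ k)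
    (n d ν μ : ℤ → ℕ) (κ : ℕ) (hn : ∀ x, n x ≤ nf w ℓ x + ν x) (hd : ∀ x, df w ℓ x ≤ d x + μ x)
    (hκ : ∑ x ∈ Icc (-(L : ℤ)) (L : ℤ), ν x + ∑ x ∈ Icc (-(L : ℤ)) (L : ℤ), μ x ≤ κ)
    (e : ℤ) (heI : e ∈ Icc (-(L : ℤ)) (L : ℤ)) (he : 2 ∣ e) (hne : n e = 0) (i : ℕ) :
    |acoef (Icc (-(L : ℤ)) (L : ℤ)) n d e i| ≤ (2 * L : ℚ) ^ κ *
      ((∑ x ∈ Icc (-(L : ℤ)) (L : ℤ), n x + ∑ x ∈ Icc (-(L : ℤ)) (L : ℤ), d x : ℕ) : ℚ) ^ (d e - i) := by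
  set I := Icc (-(L : ℤ)) (L : ℤ) with hI
  have habs : ∀ x : ℤ, x ≠ e → (1 : ℚ) ≤ |((e - x : ℤ) : ℚ)| := by
    intro x hx
    have : 1 ≤ |e - x| := Int.one_le_abs (by omega)
    exact_mod_cast this
  have hup : ∀ x ∈ I, |((e - x : ℤ) : ℚ)| ≤ 2 * L := by
    intro x hx
    have : |e - x| ≤ 2 * L := by
      rw [hI, mem_Icc] at *
      rw [abs_le]; omega
    exact_mod_cast this
  refine (Bser_BdR I n d e hne (d e - i)).trans ?_
  gcongr
  have h2L : (1 : ℚ) ≤ 2 * L := by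
    have : (1 : ℚ) ≤ L := by exact_mod_cast hL
    linarith
  -- numerator
  have h1 : ∏ x ∈ I, |((e - x : ℤ) : ℚ)| ^ n x ≤
      (∏ x ∈ I, |((e - x : ℤ) : ℚ)| ^ nf w ℓ x) * (2 * L : ℚ) ^ (∑ x ∈ I, ν x) := by
    rw [← Finset.prod_pow_eq_pow_sum, ← Finset.prod_mul_distrib]
    apply Finset.prod_le_prod
    · intro x _; positivity
    · intro x hx
      by_cases hxe : x = e
      · subst hxe
        rw [hne]
        have : nf w ℓ x = 0 := by simp [nf, he]
        rw [this]
        simp only [pow_zero, one_mul]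
        exact one_le_pow₀ h2L
      · calc _ ≤ |((e - x : ℤ) : ℚ)| ^ (nf w ℓ x + ν x) := pow_le_pow_right₀ (habs x hxe) (hn x)
          _ = |((e - x : ℤ) : ℚ)| ^ (nf w ℓ x) * |((e - x : ℤ) : ℚ)| ^ (ν x) := pow_add _ _ _
          _ ≤ _ := by have := hup x hx; gcongr
  have h2 : ∏ x ∈ I.erase e, |((e - x : ℤ) : ℚ)| ^ df w ℓ x ≤
      (∏ x ∈ I.erase e, |((e - x : ℤ) : ℚ)| ^ d x) * (2 * L : ℚ) ^ (∑ x ∈ I, μ x) := by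
    have h3 : (2 * L : ℚ) ^ (∑ x ∈ I.erase e, μ x) ≤ (2 * L : ℚ) ^ (∑ x ∈ I, μ x) := by
      apply pow_le_pow_right₀ h2L
      exact Finset.sum_le_sum_of_subset (Finset.erase_subset _ _)
    refine le_trans ?_ (mul_le_mul_of_nonneg_left h3 (by positivity))
    rw [← Finset.prod_pow_eq_pow_sum, ← Finset.prod_mul_distrib]
    apply Finset.prod_le_prod
    · intro x _; positivity
    · intro x hx
      have hxe := Finset.ne_of_mem_erase hx
      calc _ ≤ |((e - x : ℤ) : ℚ)| ^ (d x + μ x) := pow_le_pow_right₀ (habs x hxe) (hd x)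
          _ = |((e - x : ℤ) : ℚ)| ^ (d x) * |((e - x : ℤ) : ℚ)| ^ (μ x) := pow_add _ _ _
          _ ≤ _ := by have := hup x (Finset.mem_of_mem_erase hx); gcongr
  have h3 := interlace w ℓ L hℓ hev e he
  have h4 : 0 < ∏ x ∈ I.erase e, |((e - x : ℤ) : ℚ)| ^ d x := by
    apply Finset.prod_pos
    intro x hx
    have := habs x (Finset.ne_of_mem_erase hx)
    positivity
  simp_rw [inv_pow, Finset.prod_inv_distrib]
  rw [← div_eq_mul_inv, div_le_iff₀ h4]
  calc _ ≤ _ := h1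
    _ ≤ ((∏ x ∈ I.erase e, |((e - x : ℤ) : ℚ)| ^ d x) * (2 * L : ℚ) ^ (∑ x ∈ I, μ x)) * (2 * L : ℚ) ^ (∑ x ∈ I, ν x) := by
        have := h3.trans h2
        gcongr
    _ = (2 * L : ℚ) ^ (∑ x ∈ I, ν x + ∑ x ∈ I, μ x) * ∏ x ∈ I.erase e, |((e - x : ℤ) : ℚ)| ^ d x := by
        rw [pow_add]; ring
    _ ≤ _ := by
        gcongr

section padic
variable {p : ℕ} [Fact p.Prime]

def BdP (p : ℕ) [Fact p.Prime] (B : PowerSeries ℚ) (K ρ : ℝ) : Prop :=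
  ∀ n, ‖((PowerSeries.coeff n B : ℚ) : ℚ_[p])‖ ≤ K * ρ ^ n

lemma BdP.nonneg {B : PowerSeries ℚ} {K ρ : ℝ} (h : BdP p B K ρ) : 0 ≤ K := by
  have := h 0
  have h2 := norm_nonneg (((PowerSeries.coeff 0 B : ℚ) : ℚ_[p]))
  simp only [pow_zero, mul_one] at this
  linarith

lemma BdP.mul_lin {B : PowerSeries ℚ} {K ρ : ℝ} (h : BdP p B K ρ) (hρ : 0 ≤ ρ) {c : ℚ} {γ : ℝ}
    (hc : ‖(c : ℚ_[p])‖ ≤ γ) (hγ : 1 ≤ γ * ρ) : BdP p (B * lin c) (K * γ) ρ := by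
  intro n
  have hK := h.nonneg
  have hγ0 : 0 ≤ γ := (norm_nonneg _).trans hc
  rw [coeff_mul_lin]
  cases n with
  | zero =>
    have := h 0
    simp only [if_true, add_zero, pow_zero, mul_one] at *
    push_cast
    rw [norm_mul, mul_comm K]; gcongr
  | succ n =>
    have h1 := h (n + 1)
    have h2 := h n
    simp only [Nat.succ_ne_zero, if_false, Nat.add_sub_cancel]
    push_cast
    refine (Padic.nonarchimedean _ _).trans (max_le ?_ ?_)
    · rw [norm_mul]
      calc _ ≤ γ * (K * ρ ^ (n + 1)) := by gcongr
        _ = _ := by ring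
    · calc _ ≤ K * ρ ^ n := h2
        _ ≤ (K * ρ ^ n) * (γ * ρ) := le_mul_of_one_le_right (by positivity) hγ
        _ = _ := by ring

lemma BdP.mul_lin_inv {B : PowerSeries ℚ} {K ρ : ℝ} (h : BdP p B K ρ) (hρ : 0 ≤ ρ) {c : ℚ} (hc0 : c ≠ 0)
    (hγ : 1 ≤ ‖(c : ℚ_[p])‖ * ρ) : BdP p (B * (lin c)⁻¹) (K * ‖(c : ℚ_[p])‖⁻¹) ρ := by
  have hK := h.nonneg
  have hcp : 0 < ‖(c : ℚ_[p])‖ := norm_pos_iff.2 (by exact_mod_cast hc0)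
  have hB : B * (lin c)⁻¹ * lin c = B := by
    rw [mul_assoc, mul_comm (lin c)⁻¹, lin_mul_inv hc0, mul_one]
  set B' := B * (lin c)⁻¹ with hB'
  have hrec : ∀ n, c * PowerSeries.coeff n B' + (if n = 0 then 0 else PowerSeries.coeff (n - 1) B') =
      PowerSeries.coeff n B := by
    intro n; rw [← coeff_mul_lin, hB]
  intro n
  induction n with
  | zero =>
    have h0 := hrec 0
    have h1 := h 0
    simp only [if_true, add_zero, pow_zero, mul_one] at *
    rw [← h0] at h1
    push_cast at h1
    rw [norm_mul] at h1
    rw [← div_eq_mul_inv, le_div_iff₀ hcp]; linarith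
  | succ n ih =>
    have h0 := hrec (n + 1)
    have h1 := h (n + 1)
    simp only [Nat.succ_ne_zero, if_false, Nat.add_sub_cancel] at h0
    have h2 : ‖(c : ℚ_[p])‖ * ‖((PowerSeries.coeff (n + 1) B' : ℚ) : ℚ_[p])‖ ≤ K * ρ ^ (n + 1) := by
      rw [← norm_mul]
      have : (c : ℚ_[p]) * ((PowerSeries.coeff (n + 1) B' : ℚ) : ℚ_[p]) =
        ((PowerSeries.coeff (n + 1) B : ℚ) : ℚ_[p]) + (-((PowerSeries.coeff n B' : ℚ) : ℚ_[p])) := by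
        rw [← h0]; push_cast; ring
      rw [this]
      refine (Padic.nonarchimedean _ _).trans (max_le h1 ?_)
      rw [norm_neg]
      refine ih.trans ?_
      have h5 : ‖(c : ℚ_[p])‖⁻¹ ≤ ρ := by
        rw [inv_le_iff_one_le_mul₀' hcp]; exact hγ
      calc K * ‖(c : ℚ_[p])‖⁻¹ * ρ ^ n ≤ K * ρ * ρ ^ n := by gcongr
        _ = _ := by ring
    calc _ ≤ (K * ρ ^ (n + 1)) / ‖(c : ℚ_[p])‖ := by
          rw [le_div_iff₀ hcp]; linarith
      _ = _ := by rw [div_eq_mul_inv]; ring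

lemma BdP.prod_lin (s : Finset ℤ) (c : ℤ → ℚ) (m : ℤ → ℕ) (γ : ℤ → ℝ)
    {B : PowerSeries ℚ} {K ρ : ℝ} (h : BdP p B K ρ) (hρ : 0 ≤ ρ)
    (hc : ∀ x ∈ s, m x ≠ 0 → ‖(c x : ℚ_[p])‖ ≤ γ x ∧ 1 ≤ γ x * ρ) :
    BdP p (B * ∏ x ∈ s, lin (c x) ^ m x) (K * ∏ x ∈ s, γ x ^ m x) ρ := by
  induction s using Finset.induction_on with
  | empty => simpa using h
  | insert a s ha ih =>
    have ih' := ih (fun x hx => hc x (mem_insert_of_mem hx))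
    rw [prod_insert ha, prod_insert ha]
    by_cases hm : m a = 0
    · simpa [hm] using ih'
    · obtain ⟨h1, h2⟩ := hc a (mem_insert_self _ _) hm
      have key : ∀ k : ℕ, BdP p ((B * ∏ x ∈ s, lin (c x) ^ m x) * lin (c a) ^ k)
          ((K * ∏ x ∈ s, γ x ^ m x) * γ a ^ k) ρ := by
        intro k
        induction k with
        | zero => simpa using ih'
        | succ k ihk =>
          rw [pow_succ, pow_succ, ← mul_assoc, ← mul_assoc]
          exact ihk.mul_lin hρ h1 h2
      have := key (m a)
      convert this using 1 <;> ring

lemma BdP.prod_lin_inv (s : Finset ℤ) (c : ℤ → ℚ) (m : ℤ → ℕ)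
    {B : PowerSeries ℚ} {K ρ : ℝ} (h : BdP p B K ρ) (hρ : 0 ≤ ρ)
    (hc : ∀ x ∈ s, m x ≠ 0 → c x ≠ 0 ∧ 1 ≤ ‖(c x : ℚ_[p])‖ * ρ) :
    BdP p (B * ∏ x ∈ s, (lin (c x))⁻¹ ^ m x) (K * ∏ x ∈ s, (‖(c x : ℚ_[p])‖⁻¹) ^ m x) ρ := by
  induction s using Finset.induction_on with
  | empty => simpa using h
  | insert a s ha ih =>
    have ih' := ih (fun x hx => hc x (mem_insert_of_mem hx))
    rw [prod_insert ha, prod_insert ha]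
    by_cases hm : m a = 0
    · simpa [hm] using ih'
    · obtain ⟨h1, h2⟩ := hc a (mem_insert_self _ _) hm
      have key : ∀ k : ℕ, BdP p ((B * ∏ x ∈ s, (lin (c x))⁻¹ ^ m x) * (lin (c a))⁻¹ ^ k)
          ((K * ∏ x ∈ s, (‖(c x : ℚ_[p])‖⁻¹) ^ m x) * (‖(c a : ℚ_[p])‖⁻¹) ^ k) ρ := by
        intro k
        induction k with
        | zero => simpa using ih'
        | succ k ihk =>
          rw [pow_succ, pow_succ, ← mul_assoc, ← mul_assoc]
          exact ihk.mul_lin_inv hρ h1 h2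
      have := key (m a)
      convert this using 1 <;> ring

lemma BdP_one (ρ : ℝ) (hρ : 0 ≤ ρ) : BdP p 1 1 ρ := by
  intro k
  rw [PowerSeries.coeff_one]
  by_cases hk : k = 0
  · simp [hk]
  · simp only [if_neg hk, Rat.cast_zero, norm_zero]; positivity

lemma Bser_cast (I : Finset ℤ) (n d : ℤ → ℕ) (e : ℤ) :
  Bser I n d e = (1 * ∏ x ∈ I, lin ((e - x : ℤ) : ℚ) ^ n x) * ∏ x ∈ I.erase e, (lin ((e - x : ℤ) : ℚ))⁻¹ ^ d x := by
    unfold Bser; push_cast; rw [one_mul]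

/-- truncated valuation -/
def vv (p a : ℕ) (z : ℤ) : ℕ := ∑ j ∈ range a, if (p : ℤ) ^ (j + 1) ∣ z then 1 else 0

lemma vv_le (p a : ℕ) (z : ℤ) : vv p a z ≤ a := by
  unfold vv
  calc _ ≤ ∑ j ∈ range a, 1 := Finset.sum_le_sum (fun j _ => by split_ifs <;> simp)
    _ = a := by simp

lemma norm_int_vv (a : ℕ) (z : ℤ) (hz : z ≠ 0) (hz2 : |z| < (p : ℤ) ^ (a + 1)) :
    ‖(z : ℚ_[p])‖ = ((p : ℝ)⁻¹) ^ (vv p a z) := by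
  have hp := (Fact.out : p.Prime)
  set v := padicValInt p z with hv
  have h1 : ‖(z : ℚ_[p])‖ = ((p : ℝ)⁻¹) ^ v := by
    have h := Padic.eq_padicNorm (p := p) (z : ℚ)
    rw [padicNorm.eq_zpow_of_nonzero (by exact_mod_cast hz), padicValRat.of_int] at h
    push_cast at h
    rw [h, inv_pow, ← zpow_natCast, ← zpow_neg]
  have hva : v ≤ a := by
    by_contra hlt
    push Not at hlt
    have : (p : ℤ) ^ (a + 1) ∣ z := (padicValInt_dvd_iff (a + 1) z).2 (Or.inr hlt)
    have := Int.le_of_dvd (abs_pos.2 hz) ((dvd_abs _ _).2 this)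
    omega
  have h2 : vv p a z = v := by
    unfold vv
    rw [← Finset.card_filter]
    have : (range a).filter (fun j => (p : ℤ) ^ (j + 1) ∣ z) = range v := by
      ext j
      simp only [mem_filter, mem_range]
      rw [padicValInt_dvd_iff]
      constructor
      · rintro ⟨_, h | h⟩
        · exact absurd h hz
        · exact h
      · intro h; exact ⟨by omega, Or.inr h⟩
    rw [this, card_range]
  rw [h1, h2]

def Psi (I : Finset ℤ) (n d : ℤ → ℕ) (e P : ℤ) : ℤ :=
  ∑ x ∈ I, if P ∣ e - x then (d x : ℤ) - n x else 0

lemma K_eq (I : Finset ℤ) (n d : ℤ → ℕ) (e : ℤ) (heI : e ∈ I) (hne : n e = 0) (a : ℕ)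
    (hI : ∀ x ∈ I, |e - x| < (p : ℤ) ^ (a + 1)) :
    (∏ x ∈ I, ‖(((e - x : ℤ) : ℚ) : ℚ_[p])‖ ^ n x) * ∏ x ∈ I.erase e, (‖(((e - x : ℤ) : ℚ) : ℚ_[p])‖⁻¹) ^ d x =
     (p : ℝ) ^ ((∑ j ∈ range a, Psi I n d e ((p : ℤ) ^ (j + 1))) - a * d e) := by
  have hp0 : (p : ℝ) ≠ 0 := by exact_mod_cast (Fact.out : p.Prime).ne_zero
  have hn : ∀ x ∈ I.erase e, ‖(((e - x : ℤ) : ℚ) : ℚ_[p])‖ = (p : ℝ) ^ (-(vv p a (e - x) : ℤ)) := by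
    intro x hx
    have h := norm_int_vv (p := p) a (e - x) (by have := Finset.ne_of_mem_erase hx; omega)
      (hI x (Finset.mem_of_mem_erase hx))
    rw [zpow_neg, zpow_natCast, ← inv_pow, ← h]
    push_cast; rfl
  rw [← Finset.mul_prod_erase I _ heI, hne, pow_zero, one_mul, ← Finset.prod_mul_distrib]
  have h1 : ∀ x ∈ I.erase e, ‖(((e - x : ℤ) : ℚ) : ℚ_[p])‖ ^ n x * (‖(((e - x : ℤ) : ℚ) : ℚ_[p])‖⁻¹) ^ d x =
      (p : ℝ) ^ ((vv p a (e - x) : ℤ) * ((d x : ℤ) - n x)) := by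
    intro x hx
    rw [hn x hx, ← zpow_neg, neg_neg, ← zpow_natCast, ← zpow_natCast, ← zpow_mul, ← zpow_mul, ← zpow_add₀ hp0]
    congr 1; ring
  rw [Finset.prod_congr rfl h1]
  have h2 : ∀ (s : Finset ℤ) (f : ℤ → ℤ), ∏ x ∈ s, (p : ℝ) ^ (f x) = (p : ℝ) ^ (∑ x ∈ s, f x) := by
    intro s f
    induction s using Finset.induction_on with
    | empty => simp
    | insert b s hb ih => rw [prod_insert hb, sum_insert hb, zpow_add₀ hp0, ih]
  rw [h2]
  congr 1
  unfold Psi vv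
  rw [Finset.sum_comm, ← Finset.add_sum_erase I _ heI]
  simp only [sub_self, dvd_zero, if_true, hne, sum_const, card_range]
  push_cast
  simp_rw [Finset.sum_mul]
  simp

lemma Bser_norm0 (I : Finset ℤ) (n d : ℤ → ℕ) (e : ℤ) (heI : e ∈ I) (hne : n e = 0) (a : ℕ)
    (hI : ∀ x ∈ I, |e - x| < (p : ℤ) ^ (a + 1)) :
    ‖((PowerSeries.coeff 0 (Bser I n d e) : ℚ) : ℚ_[p])‖ =
     (p : ℝ) ^ ((∑ j ∈ range a, Psi I n d e ((p : ℤ) ^ (j + 1))) - a * d e) := by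
  rw [← K_eq I n d e heI hne a hI, Bser_cast]
  simp only [PowerSeries.coeff_zero_eq_constantCoeff, map_mul, map_prod, map_pow, one_mul, lin,
    PowerSeries.constantCoeff_inv, map_add, PowerSeries.constantCoeff_C, PowerSeries.constantCoeff_X, add_zero]
  rw [Rat.cast_mul, norm_mul, Rat.cast_prod, Rat.cast_prod, norm_prod, norm_prod]
  simp

lemma acoef_norm (I : Finset ℤ) (n d : ℤ → ℕ) (e : ℤ) (heI : e ∈ I) (hne : n e = 0) (a : ℕ)
    (hI : ∀ x ∈ I, |e - x| < (p : ℤ) ^ (a + 1)) (i : ℕ) (hi : i ≤ d e) :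
    ‖((acoef I n d e i : ℚ) : ℚ_[p])‖ ≤
     (p : ℝ) ^ ((∑ j ∈ range a, Psi I n d e ((p : ℤ) ^ (j + 1))) - a * i) := by
  have hp0 : (p : ℝ) ≠ 0 := by exact_mod_cast (Fact.out : p.Prime).ne_zero
  have hp1 : (1 : ℝ) ≤ p := by exact_mod_cast (Fact.out : p.Prime).one_lt.le
  have hρ : (0 : ℝ) ≤ (p : ℝ) ^ a := by positivity
  have hc : ∀ x ∈ I, x ≠ e → (1 : ℝ) ≤ ‖(((e - x : ℤ) : ℚ) : ℚ_[p])‖ * (p : ℝ) ^ a := by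
    intro x hx hxe
    have h := norm_int_vv (p := p) a (e - x) (by omega) (hI x hx)
    rw [Rat.cast_intCast, h, inv_pow, inv_mul_eq_div, le_div_iff₀ (by positivity), one_mul]
    exact pow_le_pow_right₀ hp1 (vv_le _ _ _)
  have h2 := ((BdP_one (p := p) _ hρ).prod_lin I (fun x => ((e - x : ℤ) : ℚ)) n
    (fun x => ‖(((e - x : ℤ) : ℚ) : ℚ_[p])‖) hρ
    (fun x hxI hx => ⟨le_rfl, hc x hxI (by rintro rfl; exact hx hne)⟩)).prod_lin_inv (I.erase e)
    (fun x => ((e - x : ℤ) : ℚ)) d hρ (fun x hx _ => ⟨by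
      have := Finset.ne_of_mem_erase hx
      have h3 : e - x ≠ 0 := by omega
      exact_mod_cast h3, hc x (Finset.mem_of_mem_erase hx) (Finset.ne_of_mem_erase hx)⟩)
  rw [← Bser_cast, one_mul, K_eq I n d e heI hne a hI] at h2
  refine (h2 (d e - i)).trans (le_of_eq ?_)
  rw [← pow_mul, ← zpow_natCast, ← zpow_add₀ hp0]
  congr 1
  push_cast [Nat.cast_sub hi]
  ring

lemma acoef_norm_one (I : Finset ℤ) (n d : ℤ → ℕ) (e : ℤ)
    (hI : ∀ x ∈ I, x ≠ e → d x ≠ 0 → ¬ (p : ℤ) ∣ e - x) (i : ℕ) :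
    ‖((acoef I n d e i : ℚ) : ℚ_[p])‖ ≤ 1 := by
  have h1 : ∀ x ∈ I.erase e, d x ≠ 0 → ‖(((e - x : ℤ) : ℚ) : ℚ_[p])‖ = 1 := by
    intro x hx hd
    have h := hI x (Finset.mem_of_mem_erase hx) (Finset.ne_of_mem_erase hx) hd
    rw [← Padic.norm_intCast_lt_one_iff] at h
    push Not at h
    rw [Rat.cast_intCast]
    exact le_antisymm (Padic.norm_int_le_one _) h
  have h2 := ((BdP_one (p := p) 1 zero_le_one).prod_lin I (fun x => ((e - x : ℤ) : ℚ)) n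
    (fun x => 1) zero_le_one
    (fun x hxI hx => ⟨by rw [Rat.cast_intCast]; exact Padic.norm_int_le_one _, by norm_num⟩)).prod_lin_inv (I.erase e)
    (fun x => ((e - x : ℤ) : ℚ)) d zero_le_one (fun x hx hd => ⟨by
      have := Finset.ne_of_mem_erase hx
      have h3 : e - x ≠ 0 := by omega
      exact_mod_cast h3, by rw [h1 x hx hd]; norm_num⟩)
  rw [← Bser_cast] at h2
  refine (h2 (d e - i)).trans (le_of_eq ?_)
  have : ∏ x ∈ I.erase e, (‖(((e - x : ℤ) : ℚ) : ℚ_[p])‖⁻¹) ^ d x = 1 := by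
    apply Finset.prod_eq_one
    intro x hx
    by_cases hd : d x = 0
    · rw [hd, pow_zero]
    · rw [h1 x hx hd]; simp
  simp only [this]
  simp

end padic

def chi (n : ℤ) : ℤ := if 2 ∣ n then 1 else -1

lemma chi_le (n : ℤ) : chi n ≤ 1 := by unfold chi; split_ifs <;> norm_num

lemma sum_chi (A : ℤ) (m : ℕ) : 2 * ∑ j ∈ Icc (-A) (-A - 1 + m), chi j = chi A + chi (-A - 1 + m) := by
  induction m with
  | zero =>
    rw [Finset.Icc_eq_empty (by push_cast; omega)]
    simp only [sum_empty, chi]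
    push_cast
    split_ifs <;> omega
  | succ m ih =>
    have : Icc (-A) (-A - 1 + ((m + 1 : ℕ) : ℤ)) = insert (-A - 1 + ((m + 1 : ℕ) : ℤ)) (Icc (-A) (-A - 1 + m)) := by
      ext j; simp only [mem_Icc, mem_insert]; push_cast; omega
    rw [this, sum_insert (by simp), mul_add, ih]
    simp only [chi]
    push_cast
    split_ifs <;> omega

lemma alt_sum (ℓ L : ℕ) (hℓ : ℓ ≤ L) (P e : ℤ) (hP : 0 < P) (hP2 : ¬ 2 ∣ P) (he : 2 ∣ e) :
    2 * ∑ x ∈ Icc (-(L : ℤ)) (L : ℤ), (if P ∣ e - x then if |x| ≤ (ℓ : ℤ) then chi x else 0 else 0) =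
      chi ((ℓ + e) / P) + chi ((ℓ - e) / P) := by
  set A := ((ℓ : ℤ) + e) / P with hA
  set B := ((ℓ : ℤ) - e) / P with hB
  have hA1 : P * A ≤ ℓ + e := Int.mul_ediv_self_le hP.ne'
  have hA2 : (ℓ : ℤ) + e < P * A + P := by
    have := Int.lt_ediv_add_one_mul_self ((ℓ : ℤ) + e) hP
    rw [← hA] at this; linarith
  have hB1 : P * B ≤ ℓ - e := Int.mul_ediv_self_le hP.ne'
  have hB2 : (ℓ : ℤ) - e < P * B + P := by
    have := Int.lt_ediv_add_one_mul_self ((ℓ : ℤ) - e) hP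
    rw [← hB] at this; linarith
  have hAB : -A ≤ B + 1 := by
    by_contra h
    have : A + B + 2 ≤ 0 := by omega
    nlinarith
  obtain ⟨m, hm⟩ : ∃ m : ℕ, B = -A - 1 + m := ⟨(B + A + 1).toNat, by omega⟩
  have h1 := sum_chi A m
  rw [← hm] at h1
  rw [← h1]
  congr 1
  rw [← Finset.sum_filter, ← Finset.sum_filter]
  symm
  apply Finset.sum_bij (fun j _ => e + j * P)
  · intro j hj
    rw [mem_Icc] at hj
    have h3 : -(ℓ : ℤ) ≤ e + j * P := by nlinarith
    have h4 : e + j * P ≤ ℓ := by nlinarith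
    simp only [mem_filter, mem_Icc, abs_le]
    refine ⟨⟨⟨by omega, by omega⟩, ⟨-j, by ring⟩⟩, by omega, by omega⟩
  · intro a _ b _ hab
    have : a * P = b * P := by linarith
    exact mul_right_cancel₀ hP.ne' this
  · intro x hx
    simp only [mem_filter, mem_Icc, abs_le] at hx
    obtain ⟨⟨_, j, hj⟩, h3, h4⟩ := hx
    refine ⟨-j, ?_, by linarith⟩
    rw [mem_Icc]
    constructor
    · by_contra hlt
      have : A + 1 ≤ j := by omega
      nlinarith
    · by_contra hlt
      have : j + B + 1 ≤ 0 := by omega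
      nlinarith
  · intro j _
    unfold chi
    have : (2 ∣ e + j * P) ↔ 2 ∣ j := by
      have h7 : 2 ∣ j * P ↔ 2 ∣ j := Int.prime_two.dvd_mul.trans (or_iff_left hP2)
      rw [← h7]
      generalize j * P = y
      omega
    simp only [this]

lemma Psi_le (w ℓ : Fin 3 → ℕ) (L : ℕ) (hℓ : ∀ k, ℓ k ≤ L) (n d : ℤ → ℕ) (hn : ∀ x, nf w ℓ x ≤ n x)
    (hd : ∀ x, d x ≤ df w ℓ x) (P e : ℤ) (hP : 0 < P) (hP2 : ¬ 2 ∣ P) (he : 2 ∣ e) :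
    2 * Psi (Icc (-(L : ℤ)) (L : ℤ)) n d e P ≤
      ∑ k, (w k : ℤ) * (chi ((ℓ k + e) / P) + chi ((ℓ k - e) / P)) := by
  simp_rw [fun k => (alt_sum (ℓ k) L (hℓ k) P e hP hP2 he).symm]
  have h1 : ∀ k, (w k : ℤ) * (2 * ∑ x ∈ Icc (-(L : ℤ)) (L : ℤ), (if P ∣ e - x then if |x| ≤ (ℓ k : ℤ) then chi x else 0 else 0))
     = 2 * ∑ x ∈ Icc (-(L : ℤ)) (L : ℤ), (if P ∣ e - x then if |x| ≤ (ℓ k : ℤ) then w k * chi x else 0 else 0) := by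
    intro k
    rw [mul_left_comm, Finset.mul_sum]
    congr 1
    apply Finset.sum_congr rfl
    intro x _
    split_ifs <;> simp
  simp_rw [h1]
  rw [← Finset.mul_sum, Finset.sum_comm]
  unfold Psi
  refine mul_le_mul_of_nonneg_left (Finset.sum_le_sum ?_) (by norm_num)
  intro x _
  by_cases hx : P ∣ e - x
  · simp only [hx, if_true]
    have h3 := hn x
    have h4 := hd x
    by_cases h2 : 2 ∣ x
    · have h5 : (∑ k, if |x| ≤ (ℓ k : ℤ) then (w k : ℤ) * chi x else 0) = (df w ℓ x : ℤ) := by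
        unfold df chi
        simp [h2]
      rw [h5]; omega
    · have h5 : (∑ k, if |x| ≤ (ℓ k : ℤ) then (w k : ℤ) * chi x else 0) = -(nf w ℓ x : ℤ) := by
        unfold nf chi
        simp only [h2, if_false]
        push_cast
        rw [← Finset.sum_neg_distrib]
        apply Finset.sum_congr rfl
        intro k _
        split_ifs <;> simp
      have h6 : df w ℓ x = 0 := by simp [df, h2]
      rw [h5]; omega
  · simp [hx]

lemma norm_inv_int_le_one {p : ℕ} [Fact p.Prime] (m : ℤ) (h : ¬ (p : ℤ) ∣ m) : ‖((m : ℚ_[p]))⁻¹‖ ≤ 1 := by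
  rw [norm_inv]
  have : ‖(m : ℚ_[p])‖ = 1 := by
    have h1 := Padic.norm_int_le_one (p := p) m
    have h2 := (Padic.norm_intCast_lt_one_iff (p := p) (k := m)).not.2 h
    exact le_antisymm h1 (not_lt.1 h2)
  rw [this]; norm_num

lemma Gq_int {p : ℕ} [Fact p.Prime] (k : ℕ) (u : ℤ)
    (h1 : ∀ v : ℤ, 0 ≤ v → v < u → ¬ (p : ℤ) ∣ 1 + 4 * v)
    (h2 : ∀ v : ℤ, 0 ≤ v → v < -u → ¬ (p : ℤ) ∣ 1 - 4 * (v + 1)) :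
    ‖((Gq k u : ℚ) : ℚ_[p])‖ ≤ 1 := by
  have hk : ‖(k : ℚ_[p])‖ ≤ 1 := by exact_mod_cast Padic.norm_int_le_one (p := p) (k : ℤ)
  have h4 : ‖(4 : ℚ_[p])‖ ≤ 1 := by exact_mod_cast Padic.norm_int_le_one (p := p) (4 : ℤ)
  unfold Gq
  split_ifs with h
  · push_cast
    apply IsUltrametricDist.norm_sum_le_of_forall_le_of_nonneg zero_le_one
    intro v hv
    rw [mem_range] at hv
    have h3 := norm_inv_int_le_one (p := p) _ (h1 v (by omega) (by omega))
    push_cast at h3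
    rw [norm_mul, norm_mul, norm_neg, norm_pow]
    exact mul_le_one₀ (mul_le_one₀ h4 (norm_nonneg _) hk) (by positivity) (pow_le_one₀ (norm_nonneg _) h3)
  · push_cast
    apply IsUltrametricDist.norm_sum_le_of_forall_le_of_nonneg zero_le_one
    intro v hv
    rw [mem_range] at hv
    have h3 := norm_inv_int_le_one (p := p) _ (h2 v (by omega) (by omega))
    push_cast at h3
    rw [norm_mul, norm_mul, norm_pow]
    exact mul_le_one₀ (mul_le_one₀ h4 (norm_nonneg _) hk) (by positivity) (pow_le_one₀ (norm_nonneg _) h3)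

lemma Hq_int {p : ℕ} [Fact p.Prime] (k : ℕ) (e : ℤ) (he : 2 ∣ e)
    (h : ∀ z : ℤ, z % 4 = 1 → (0 < z ∧ z < e ∨ e < z ∧ z < 0) → ¬ (p : ℤ) ∣ e - z) :
    ‖((Hq k e : ℚ) : ℚ_[p])‖ ≤ 1 := by
  unfold Hq
  split_ifs with h4
  · apply Gq_int
    · intro v hv hv2 hd
      apply h (e + (1 + 4 * v)) (by omega) (by omega)
      have : e - (e + (1 + 4 * v)) = -(1 + 4 * v) := by ring
      rw [this]; exact (dvd_neg).2 hd
    · intro v hv hv2 hd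
      apply h (e + (1 - 4 * (v + 1))) (by omega) (by omega)
      have : e - (e + (1 - 4 * (v + 1))) = -(1 - 4 * (v + 1)) := by ring
      rw [this]; exact (dvd_neg).2 hd
  · push_cast
    rw [norm_mul, norm_pow, norm_neg, norm_one, one_pow, one_mul]
    apply Gq_int
    · intro v hv hv2 hd
      apply h (e - (1 + 4 * v)) (by omega) (by omega)
      have : e - (e - (1 + 4 * v)) = (1 + 4 * v) := by ring
      rw [this]; exact hd
    · intro v hv hv2 hd
      apply h (e - (1 - 4 * (v + 1))) (by omega) (by omega)
      have : e - (e - (1 - 4 * (v + 1))) = (1 - 4 * (v + 1)) := by ring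
      rw [this]; exact hd

/-- rational value of S when the J are rational. -/
noncomputable def Sq (I : Finset ℤ) (n d : ℤ → ℕ) (r : ℕ) (Jq : ℕ → ℚ) : ℚ :=
  ∑ e ∈ I, ∑ i ∈ Icc 1 (d e), acoef I n d e i * cI r i * (eps e ^ (i + r) * Jq (i + r) + Hq (i + r) e)

lemma norm_cI {p : ℕ} [Fact p.Prime] (r i : ℕ) : ‖((cI r i : ℚ) : ℚ_[p])‖ ≤ 1 := by
  have : (cI r i : ℚ) = (((-1) ^ r * ((i + r - 1).choose r : ℤ) : ℤ) : ℚ) := by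
    unfold cI; push_cast; ring
  rw [this, Rat.cast_intCast]
  exact Padic.norm_int_le_one _

lemma norm_eps_pow {p : ℕ} [Fact p.Prime] (e : ℤ) (k : ℕ) : ‖((eps e ^ k : ℚ) : ℚ_[p])‖ = 1 := by
  unfold eps
  split_ifs <;> simp

lemma Sq_norm_le {p : ℕ} [Fact p.Prime] (I : Finset ℤ) (n d : ℤ → ℕ) (r : ℕ) (Jq : ℕ → ℚ) (Q : ℕ)
    (hQ : ∀ k, ‖((Q * Jq k : ℚ) : ℚ_[p])‖ ≤ 1) (B : ℝ) (hB : 0 ≤ B)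
    (h : ∀ e ∈ I, ∀ i ∈ Icc 1 (d e), ‖(acoef I n d e i : ℚ_[p])‖ ≤ B ∧
      ‖(acoef I n d e i : ℚ_[p])‖ * ‖(Hq (i + r) e : ℚ_[p])‖ ≤ B) :
    ‖((Q * Sq I n d r Jq : ℚ) : ℚ_[p])‖ ≤ B := by
  unfold Sq
  rw [mul_sum]
  push_cast
  apply IsUltrametricDist.norm_sum_le_of_forall_le_of_nonneg hB
  intro e he
  rw [mul_sum]
  apply IsUltrametricDist.norm_sum_le_of_forall_le_of_nonneg hB
  intro i hi
  obtain ⟨h1, h2⟩ := h e he i hi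
  have h3 := norm_cI (p := p) r i
  have h4 := norm_eps_pow (p := p) e (i + r)
  have h5 := hQ (i + r)
  have hQ1 : ‖(Q : ℚ_[p])‖ ≤ 1 := by exact_mod_cast Padic.norm_int_le_one (p := p) (Q : ℤ)
  push_cast at h4 h5
  have e1 : (Q : ℚ_[p]) * ((acoef I n d e i : ℚ_[p]) * (cI r i : ℚ_[p]) *
      ((eps e : ℚ_[p]) ^ (i + r) * (Jq (i + r) : ℚ_[p]) + (Hq (i + r) e : ℚ_[p]))) =
      (cI r i : ℚ_[p]) * ((acoef I n d e i : ℚ_[p]) * ((eps e : ℚ_[p]) ^ (i + r) * (Q * (Jq (i + r) : ℚ_[p])))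
       + Q * ((acoef I n d e i : ℚ_[p]) * (Hq (i + r) e : ℚ_[p]))) := by ring
  rw [e1, norm_mul]
  refine (mul_le_of_le_one_left (norm_nonneg _) h3).trans ?_
  refine (IsUltrametricDist.norm_add_le_max _ _).trans (max_le ?_ ?_)
  · rw [norm_mul, norm_mul, h4, one_mul]
    exact (mul_le_of_le_one_right (norm_nonneg _) h5).trans h1
  · rw [norm_mul, norm_mul]
    exact (mul_le_of_le_one_left (by positivity) hQ1).trans h2

/-- cost condition for a pole at a prime with one level. -/
def CC (p : ℕ) [Fact p.Prime] (I : Finset ℤ) (n d : ℤ → ℕ) (r c : ℕ) (e : ℤ) : Prop :=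
  Psi I n d e p + r + 1 ≤ c ∨ ((∀ k, ‖(Hq k e : ℚ_[p])‖ ≤ 1) ∧
    (Psi I n d e p - 1 ≤ c ∨ ∀ x ∈ I, x ≠ e → d x ≠ 0 → ¬ (p : ℤ) ∣ e - x))

lemma abs_sub_lt' {L : ℕ} {e x : ℤ} {Y : ℤ} (he : e ∈ Icc (-(L : ℤ)) L) (hx : x ∈ Icc (-(L : ℤ)) L)
    (h : 2 * (L : ℤ) < Y) : |e - x| < Y := by
  rw [mem_Icc] at he hx
  rw [abs_lt]; omega

lemma Sq_integral (L : ℕ) (n d : ℤ → ℕ) (hd : ∀ x, d x ≠ 0 → 2 ∣ x) (hn : ∀ x, n x ≠ 0 → ¬ 2 ∣ x)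
    (r : ℕ) (Jq : ℕ → ℚ) (Q Δ E : ℕ) (c : ℕ → ℕ)
    (hPsi : ∀ P e : ℤ, 0 < P → ¬ 2 ∣ P → 2 ∣ e → Psi (Icc (-(L : ℤ)) L) n d e P ≤ E)
    (hsmall : ∀ p a : ℕ, p.Prime → p ^ 2 ≤ 2 * L → p ^ a ≤ 2 * L → p ^ (a * (E + r + 1)) ∣ Δ)
    (hmid : ∀ p : ℕ, [Fact p.Prime] → p ≠ 2 → p ≤ 2 * L → 2 * L < p ^ 2 → ∀ e ∈ Icc (-(L : ℤ)) L, 2 ∣ e → d e ≠ 0 →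
      CC p (Icc (-(L : ℤ)) L) n d r (c p) e)
    (hmid2 : ∀ p : ℕ, p.Prime → p ≠ 2 → p ≤ 2 * L → 2 * L < p ^ 2 → p ^ (c p) ∣ Δ)
    (p : ℕ) [hp : Fact p.Prime] (hp2 : p ≠ 2) (hQ : ∀ k, ‖((Q * Jq k : ℚ) : ℚ_[p])‖ ≤ 1) :
    ‖((Δ * (Q * Sq (Icc (-(L : ℤ)) L) n d r Jq) : ℚ) : ℚ_[p])‖ ≤ 1 := by
  have hp1 : (1 : ℝ) ≤ p := by exact_mod_cast hp.out.one_le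
  have hp0 : (0 : ℝ) < p := by linarith
  have hΔ : ‖(Δ : ℚ_[p])‖ ≤ 1 := by exact_mod_cast Padic.norm_int_le_one (p := p) (Δ : ℤ)
  have hev : ∀ e, ∀ i ∈ Icc 1 (d e), 2 ∣ e ∧ n e = 0 ∧ d e ≠ 0 ∧ 1 ≤ i ∧ i ≤ d e := by
    intro e i hi
    rw [mem_Icc] at hi
    have h1 : d e ≠ 0 := by omega
    have h2 := hd e h1
    refine ⟨h2, ?_, h1, hi⟩
    by_contra h3
    exact hn e h3 h2
  -- reduction
  have red : ∀ C : ℕ, p ^ C ∣ Δ → (∀ e ∈ Icc (-(L : ℤ)) L, ∀ i ∈ Icc 1 (d e),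
      ‖(acoef (Icc (-(L : ℤ)) L) n d e i : ℚ_[p])‖ ≤ (p : ℝ) ^ C ∧
      ‖(acoef (Icc (-(L : ℤ)) L) n d e i : ℚ_[p])‖ * ‖(Hq (i + r) e : ℚ_[p])‖ ≤ (p : ℝ) ^ C) →
      ‖((Δ * (Q * Sq (Icc (-(L : ℤ)) L) n d r Jq) : ℚ) : ℚ_[p])‖ ≤ 1 := by
    intro C hC h
    have h1 := Sq_norm_le (p := p) _ n d r Jq Q hQ ((p : ℝ) ^ C) (by positivity) h
    have h2 : ‖(Δ : ℚ_[p])‖ ≤ ((p : ℝ) ^ C)⁻¹ := by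
      have := (Padic.norm_int_le_pow_iff_dvd (p := p) (Δ : ℤ) C).2 (by exact_mod_cast hC)
      rw [zpow_neg, zpow_natCast] at this
      exact_mod_cast this
    rw [Rat.cast_mul, norm_mul, Rat.cast_natCast]
    calc _ ≤ ((p : ℝ) ^ C)⁻¹ * (p : ℝ) ^ C := mul_le_mul h2 h1 (norm_nonneg _) (by positivity)
      _ = 1 := inv_mul_cancel₀ (by positivity)
  rcases lt_or_ge (2 * L) p with hL | hL
  · -- large
    apply red 0 (by simp)
    intro e he i hi
    obtain ⟨h1, h2, h3, h4, h5⟩ := hev e i hi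
    have ha := acoef_norm (p := p) (Icc (-(L : ℤ)) L) n d e he h2 0 (fun x hx => abs_sub_lt' he hx (by simp only [zero_add, pow_one]; omega)) i h5
    have hb := Hq_norm (p := p) (i + r) 0 e h1 (by rw [mem_Icc] at he; rw [abs_le]; simp only [zero_add, pow_one]; omega)
    simp only [range_zero, sum_empty, Nat.cast_zero, zero_mul, sub_zero, zpow_zero, pow_zero, one_pow] at ha hb ⊢
    exact ⟨ha, mul_le_one₀ ha (norm_nonneg _) hb⟩
  rcases lt_or_ge (2 * L) (p ^ 2) with hL2 | hL2
  · apply red (c p) (hmid2 p hp.out hp2 hL hL2)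
    intro e he i hi
    obtain ⟨h1, h2, h3, h4, h5⟩ := hev e i hi
    have hlt : ∀ x ∈ Icc (-(L : ℤ)) L, |e - x| < (p : ℤ) ^ (1 + 1) :=
      fun x hx => abs_sub_lt' he hx (by exact_mod_cast hL2)
    have ha := acoef_norm (p := p) (Icc (-(L : ℤ)) L) n d e he h2 1 hlt i h5
    simp only [range_one, sum_singleton, zero_add, pow_one, Nat.cast_one, one_mul] at ha
    rcases hmid p hp2 hL hL2 e he h1 h3 with hc | ⟨hH, hc⟩
    · have hb := Hq_norm (p := p) (i + r) 1 e h1 (by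
        rw [mem_Icc] at he; rw [abs_le]
        have : (2 * L : ℤ) < (p : ℤ) ^ 2 := by exact_mod_cast hL2
        constructor <;> simp only [Nat.reduceAdd] <;> linarith)
      rw [pow_one] at hb
      constructor
      · refine ha.trans ?_
        rw [← zpow_natCast]
        exact zpow_le_zpow_right₀ hp1 (by omega)
      · calc _ ≤ (p : ℝ) ^ (Psi (Icc (-(L : ℤ)) L) n d e p - (i : ℤ)) * (p : ℝ) ^ (i + r + 1) :=
              mul_le_mul ha hb (norm_nonneg _) (by positivity)
          _ = (p : ℝ) ^ (Psi (Icc (-(L : ℤ)) L) n d e p + r + 1) := by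
              rw [← zpow_natCast, ← zpow_add₀ hp0.ne']
              congr 1; push_cast; ring
          _ ≤ _ := by
              rw [← zpow_natCast]
              exact zpow_le_zpow_right₀ hp1 (by omega)
    · have h6 : ‖(acoef (Icc (-(L : ℤ)) L) n d e i : ℚ_[p])‖ ≤ (p : ℝ) ^ (c p) := by
        rcases hc with hc | hc
        · refine ha.trans ?_
          rw [← zpow_natCast]
          exact zpow_le_zpow_right₀ hp1 (by omega)
        · exact (acoef_norm_one _ n d e hc i).trans (one_le_pow₀ hp1)
      exact ⟨h6, (mul_le_of_le_one_right (norm_nonneg _) (hH _)).trans h6⟩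
  · obtain ⟨a, ha1, ha2⟩ : ∃ a, p ^ a ≤ 2 * L ∧ 2 * L < p ^ (a + 1) := by
      have hL0 : 2 * L ≠ 0 := by have := hp.out.pos; omega
      exact ⟨Nat.log p (2 * L), Nat.pow_log_le_self p hL0, Nat.lt_pow_succ_log_self hp.out.one_lt _⟩
    apply red (a * (E + r + 1)) (hsmall p a hp.out hL2 ha1)
    intro e he i hi
    obtain ⟨h1, h2, h3, h4, h5⟩ := hev e i hi
    have hlt : ∀ x ∈ Icc (-(L : ℤ)) L, |e - x| < (p : ℤ) ^ (a + 1) :=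
      fun x hx => abs_sub_lt' he hx (by exact_mod_cast ha2)
    have ha := acoef_norm (p := p) (Icc (-(L : ℤ)) L) n d e he h2 a hlt i h5
    have hodd : ∀ j : ℕ, ¬ (2 : ℤ) ∣ (p : ℤ) ^ j := by
      intro j hj
      have h7 : 2 ∣ p ^ j := by exact_mod_cast hj
      exact hp2 ((Nat.prime_dvd_prime_iff_eq Nat.prime_two hp.out).1 (Nat.prime_two.dvd_of_dvd_pow h7)).symm
    have hs : (∑ j ∈ range a, Psi (Icc (-(L : ℤ)) L) n d e ((p : ℤ) ^ (j + 1))) ≤ a * E := by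
      calc _ ≤ ∑ j ∈ range a, (E : ℤ) := Finset.sum_le_sum (fun j _ => hPsi _ e (by have := hp.out.pos; positivity) (hodd _) h1)
        _ = _ := by simp
    have hb := Hq_norm (p := p) (i + r) a e h1 (by
        rw [mem_Icc] at he; rw [abs_le]
        have : (2 * L : ℤ) < (p : ℤ) ^ (a + 1) := by exact_mod_cast ha2
        constructor <;> linarith)
    have hai : (0 : ℤ) ≤ a * i := by positivity
    have har : (0 : ℤ) ≤ a * (r + 1) := by positivity
    constructor
    · refine ha.trans ?_
      rw [← zpow_natCast]
      refine zpow_le_zpow_right₀ hp1 ?_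
      push_cast; nlinarith
    · calc _ ≤ (p : ℝ) ^ ((∑ j ∈ range a, Psi (Icc (-(L : ℤ)) L) n d e ((p : ℤ) ^ (j + 1))) - a * (i : ℤ)) * ((p : ℝ) ^ a) ^ (i + r + 1) :=
              mul_le_mul ha hb (norm_nonneg _) (by positivity)
          _ = (p : ℝ) ^ ((∑ j ∈ range a, Psi (Icc (-(L : ℤ)) L) n d e ((p : ℤ) ^ (j + 1))) + a * (r + 1)) := by
              rw [← pow_mul, ← zpow_natCast, ← zpow_add₀ hp0.ne']
              congr 1; push_cast; ring
          _ ≤ _ := by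
              rw [← zpow_natCast]
              refine zpow_le_zpow_right₀ hp1 ?_
              push_cast; nlinarith

def mult5 (n : ℕ) : ℕ := (1806 * n).choose (903 * n) * (903 * n).choose (602 * n) * (301 * n).choose (258 * n) *
  (43 * n).choose (42 * n)

lemma mult5_mul (n : ℕ) : mult5 n * ((903 * n).factorial * (602 * n).factorial * (258 * n).factorial *
    (42 * n).factorial * n.factorial) = (1806 * n).factorial := by
  have h1 := Nat.choose_mul_factorial_mul_factorial (n := 1806 * n) (k := 903 * n) (by omega)
  have h2 := Nat.choose_mul_factorial_mul_factorial (n := 903 * n) (k := 602 * n) (by omega)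
  have h3 := Nat.choose_mul_factorial_mul_factorial (n := 301 * n) (k := 258 * n) (by omega)
  have h4 := Nat.choose_mul_factorial_mul_factorial (n := 43 * n) (k := 42 * n) (by omega)
  have e1 : 1806 * n - 903 * n = 903 * n := by omega
  have e2 : 903 * n - 602 * n = 301 * n := by omega
  have e3 : 301 * n - 258 * n = 43 * n := by omega
  have e4 : 43 * n - 42 * n = n := by omega
  rw [e1] at h1; rw [e2] at h2; rw [e3] at h3; rw [e4] at h4
  unfold mult5
  calc _ = (1806 * n).choose (903 * n) * (903 * n).factorial * ((903 * n).choose (602 * n) * (602 * n).factorial *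
        ((301 * n).choose (258 * n) * (258 * n).factorial * ((43 * n).choose (42 * n) * (42 * n).factorial * n.factorial))) := by ring
    _ = _ := by rw [h4, h3, h2, h1]

lemma choose_pow_le (a b n : ℕ) (h : b ≤ a) :
    (a * n).choose (b * n) * (b ^ b * (a - b) ^ (a - b)) ^ n ≤ (a ^ a) ^ n := by
  have h1 : (b + (a - b)) ^ (a * n) = (a ^ a) ^ n := by
    rw [Nat.add_sub_cancel' h, pow_mul]
  rw [← h1, add_pow]
  have h2 : b * n ∈ range (a * n + 1) := by
    rw [mem_range]; exact Nat.lt_succ_of_le (Nat.mul_le_mul_right n h)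
  refine le_trans (le_of_eq ?_) (Finset.single_le_sum (f := fun m => b ^ m * (a - b) ^ (a * n - m) * ((a * n).choose m : ℕ)) (fun _ _ => Nat.zero_le _) h2)
  rw [← Nat.sub_mul, mul_pow, ← pow_mul, ← pow_mul]
  ring

lemma mult5_le_aux (c1 c2 c3 c4 A B C D E F G n : ℕ) (h1 : c1 * (A * A) ^ n ≤ G ^ n) (h2 : c2 * (B * E) ^ n ≤ A ^ n)
    (h3 : c3 * (C * F) ^ n ≤ E ^ n) (h4 : c4 * (D * 1) ^ n ≤ F ^ n) :
    c1 * c2 * c3 * c4 * (A * B * C * D) ^ n ≤ G ^ n := by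
  rw [mul_one] at h4
  simp only [mul_pow] at *
  calc c1 * c2 * c3 * c4 * (A ^ n * B ^ n * C ^ n * D ^ n)
      = c1 * A ^ n * (c2 * (B ^ n * (c3 * (C ^ n * (c4 * D ^ n))))) := by ring
    _ ≤ c1 * A ^ n * (c2 * (B ^ n * (c3 * (C ^ n * F ^ n)))) := by gcongr
    _ ≤ c1 * A ^ n * (c2 * (B ^ n * E ^ n)) := by gcongr
    _ ≤ c1 * A ^ n * A ^ n := by gcongr
    _ = c1 * (A ^ n * A ^ n) := by ring
    _ ≤ _ := h1

lemma choose_pow_le' (a b c n : ℕ) (h : a = b + c) :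
    (a * n).choose (b * n) * (b ^ b * c ^ c) ^ n ≤ (a ^ a) ^ n := by
  have := choose_pow_le a b n (by omega)
  rwa [show a - b = c by omega] at this

lemma mult5_le_gen' (a b c d e f g n : ℕ) (h1 : a = b + b) (h2 : b = c + d) (h3 : d = e + f) (h4 : f = g + 1) :
    (a * n).choose (b * n) * (b * n).choose (c * n) * (d * n).choose (e * n) * (f * n).choose (g * n) *
      (b ^ b * c ^ c * e ^ e * g ^ g) ^ n ≤ (a ^ a) ^ n := by
  have q4 := choose_pow_le' f g 1 n h4
  rw [one_pow] at q4
  exact mult5_le_aux _ _ _ _ _ _ _ _ _ _ _ n (choose_pow_le' a b b n h1) (choose_pow_le' b c d n h2)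
    (choose_pow_le' d e f n h3) q4

lemma mult5_le (n : ℕ) : mult5 n * (903 ^ 903 * 602 ^ 602 * 258 ^ 258 * 42 ^ 42) ^ n ≤ (1806 ^ 1806) ^ n :=
  mult5_le_gen' 1806 903 602 301 258 43 42 n rfl rfl rfl rfl

lemma prime_dvd_mult5 (n p : ℕ) (hp : p.Prime) (h1 : n < p) (h2 : p ≤ 1806 * n) : p ∣ mult5 n := by
  have : Fact p.Prime := ⟨hp⟩
  by_contra hcon
  have hm : mult5 n ≠ 0 := by rintro h; rw [h] at hcon; exact hcon (dvd_zero _)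
  have h3 := congrArg (padicValNat p) (mult5_mul n)
  have hf : ∀ m : ℕ, m.factorial ≠ 0 := Nat.factorial_ne_zero
  rw [padicValNat.mul hm (by simp [hf]), padicValNat.mul (by simp [hf]) (hf _), padicValNat.mul (by simp [hf]) (hf _),
    padicValNat.mul (by simp [hf]) (hf _), padicValNat.mul (hf _) (hf _), padicValNat.eq_zero_of_not_dvd hcon, zero_add] at h3
  set b := Nat.log p (1806 * n) + 1
  have hlog : ∀ m, m ≤ 1806 * n → Nat.log p m < b := fun m hm => Nat.lt_succ_of_le (Nat.log_mono_right hm)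
  rw [padicValNat_factorial (hlog _ (by omega)), padicValNat_factorial (hlog _ (by omega)),
    padicValNat_factorial (hlog _ (by omega)), padicValNat_factorial (hlog _ (by omega)),
    padicValNat_factorial (hlog _ (by omega)), padicValNat_factorial (hlog _ le_rfl)] at h3
  rw [← sum_add_distrib, ← sum_add_distrib, ← sum_add_distrib, ← sum_add_distrib] at h3
  have key : ∀ P : ℕ, 0 < P → 903 * n / P + 602 * n / P + 258 * n / P + 42 * n / P + n / P ≤ 1806 * n / P := by
    intro P hP
    rw [Nat.le_div_iff_mul_le hP]
    have := Nat.div_mul_le_self (903 * n) P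
    have := Nat.div_mul_le_self (602 * n) P
    have := Nat.div_mul_le_self (258 * n) P
    have := Nat.div_mul_le_self (42 * n) P
    have := Nat.div_mul_le_self n P
    linarith
  have hb : 1 ∈ Ico 1 b := by
    rw [mem_Ico]
    refine ⟨le_rfl, ?_⟩
    have : 0 < Nat.log p (1806 * n) := Nat.log_pos hp.one_lt h2
    omega
  have hlt : 903 * n / p ^ 1 + 602 * n / p ^ 1 + 258 * n / p ^ 1 + 42 * n / p ^ 1 + n / p ^ 1 < 1806 * n / p ^ 1 := by
    rw [pow_one, Nat.div_eq_of_lt h1]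
    have hpos := hp.pos
    set k := 1806 * n / p with hk
    have hk1 : 1 ≤ k := (Nat.one_le_div_iff hpos).2 h2
    have q1 : 903 * n / p = k / 2 := by rw [hk, Nat.div_div_eq_div_mul, mul_comm p, ← Nat.div_div_eq_div_mul]; congr 1; omega
    have q2 : 602 * n / p = k / 3 := by rw [hk, Nat.div_div_eq_div_mul, mul_comm p, ← Nat.div_div_eq_div_mul]; congr 1; omega
    have q3 : 258 * n / p = k / 7 := by rw [hk, Nat.div_div_eq_div_mul, mul_comm p, ← Nat.div_div_eq_div_mul]; congr 1; omega
    have q4 : 42 * n / p = k / 43 := by rw [hk, Nat.div_div_eq_div_mul, mul_comm p, ← Nat.div_div_eq_div_mul]; congr 1; omega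
    rw [q1, q2, q3, q4]
    omega
  have := Finset.sum_lt_sum (fun i (_ : i ∈ Ico 1 b) => key (p ^ i) (pow_pos hp.pos i)) ⟨1, hb, hlt⟩
  omega

lemma primorial_mult5 (n : ℕ) : primorial (1806 * n) ≤ primorial n * mult5 n := by
  have hm : 0 < mult5 n := by
    have := mult5_mul n
    rcases Nat.eq_zero_or_pos (mult5 n) with h | h
    · rw [h, zero_mul] at this
      exact absurd this.symm (Nat.factorial_ne_zero _)
    · exact h
  have h1 : (∏ p ∈ (Ico (n + 1) (1806 * n + 1)).filter Nat.Prime, p) ∣ mult5 n := by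
    apply Finset.prod_primes_dvd
    · intro p hp
      exact (mem_filter.1 hp).2.prime
    · intro p hp
      rw [mem_filter, mem_Ico] at hp
      exact prime_dvd_mult5 n p hp.2 (by omega) (by omega)
  have h2 : primorial (1806 * n) = primorial n * ∏ p ∈ (Ico (n + 1) (1806 * n + 1)).filter Nat.Prime, p := by
    unfold primorial
    rw [← Finset.prod_union]
    · congr 1
      ext p
      simp only [mem_filter, mem_range, mem_union, mem_Ico]
      constructor
      · rintro ⟨a, b⟩
        by_cases h : p < n + 1
        · exact Or.inl ⟨h, b⟩
        · exact Or.inr ⟨⟨by omega, a⟩, b⟩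
      · rintro (⟨a, b⟩ | ⟨a, b⟩)
        · exact ⟨by omega, b⟩
        · exact ⟨by omega, b⟩
    · rw [Finset.disjoint_left]
      intro p hp hp2
      simp only [mem_filter, mem_range, mem_Ico] at hp hp2
      omega
  rw [h2]
  exact Nat.mul_le_mul_left _ (Nat.le_of_dvd hm h1)

lemma primorial_mono' {a b : ℕ} (h : a ≤ b) : primorial a ≤ primorial b := by
  unfold primorial
  apply Finset.prod_le_prod_of_subset_of_one_le'
  · apply Finset.filter_subset_filter
    exact Finset.range_subset_range.2 (by omega)
  · intro p hp _
    exact (mem_filter.1 hp).2.one_le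

lemma primorial_step_gen (Dn Nn : ℕ) (hDp : 0 < Dn) (hm0 : ∀ n, mult5 n * Dn ^ n ≤ Nn ^ n)
    (B B' : ℝ) (hB : 1 ≤ B) (hB' : 1 ≤ B')
    (hBB : B * Nn ≤ B' ^ 1806 * Dn)
    (C : ℝ) (hC : 0 ≤ C) (h : ∀ n, (primorial n : ℝ) ≤ C * B ^ n) :
    ∀ N, (primorial N : ℝ) ≤ (C * B' ^ 1806) * B' ^ N := by
  intro N
  set n := N / 1806 + 1 with hn
  have h1 : N ≤ 1806 * n := by omega
  have h2 : 1806 * n ≤ 1806 + N := by omega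
  have hm := hm0 n
  have hmr : (mult5 n : ℝ) * (Dn : ℝ) ^ n ≤ (Nn : ℝ) ^ n := by exact_mod_cast hm
  have h3 : (primorial N : ℝ) ≤ primorial n * mult5 n := by
    exact_mod_cast (primorial_mono' h1).trans (primorial_mult5 n)
  have hNn : (0 : ℝ) ≤ Nn := by positivity
  have hDpos : (0 : ℝ) < Dn := by exact_mod_cast hDp
  have h4 : (mult5 n : ℝ) * B ^ n ≤ (B' ^ 1806) ^ n := by
    have h5 : (mult5 n : ℝ) * B ^ n * Dn ^ n ≤ (B' ^ 1806) ^ n * Dn ^ n := by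
      calc _ = (mult5 n * Dn ^ n) * B ^ n := by ring
        _ ≤ Nn ^ n * B ^ n := by gcongr
        _ = (B * Nn) ^ n := by rw [mul_pow]; ring
        _ ≤ (B' ^ 1806 * Dn) ^ n := by
            apply pow_le_pow_left₀ _ hBB
            positivity
        _ = _ := by rw [mul_pow]
    exact le_of_mul_le_mul_right h5 (by positivity)
  calc (primorial N : ℝ) ≤ primorial n * mult5 n := h3
    _ ≤ (C * B ^ n) * mult5 n := mul_le_mul_of_nonneg_right (h n) (Nat.cast_nonneg _)
    _ = C * (mult5 n * B ^ n) := by rw [mul_assoc, mul_comm (B ^ n)]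
    _ ≤ C * (B' ^ 1806) ^ n := mul_le_mul_of_nonneg_left h4 hC
    _ = C * B' ^ (1806 * n) := by rw [pow_mul]
    _ ≤ C * B' ^ (1806 + N) := mul_le_mul_of_nonneg_left (pow_le_pow_right₀ hB' h2) hC
    _ = _ := by rw [pow_add, mul_assoc]

lemma primorial_step (B B' D : ℕ) (hD : 0 < D) (hB : D ≤ B) (hB' : D ≤ B')
    (hBB : B * 1806 ^ 1806 * D ^ 1806 ≤ B' ^ 1806 * (903 ^ 903 * 602 ^ 602 * 258 ^ 258 * 42 ^ 42) * D)
    (C : ℝ) (hC : 0 ≤ C) (h : ∀ n, (primorial n : ℝ) ≤ C * ((B : ℝ) / D) ^ n) :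
    ∀ N, (primorial N : ℝ) ≤ (C * ((B' : ℝ) / D) ^ 1806) * ((B' : ℝ) / D) ^ N := by
  have hDr : (0 : ℝ) < D := by exact_mod_cast hD
  obtain ⟨Dn, hDn⟩ : ∃ Dn : ℕ, Dn = 903 ^ 903 * 602 ^ 602 * 258 ^ 258 * 42 ^ 42 := ⟨_, rfl⟩
  obtain ⟨Nn, hNn⟩ : ∃ Nn : ℕ, Nn = 1806 ^ 1806 := ⟨_, rfl⟩
  rw [← hDn, ← hNn] at hBB
  have hDp : 0 < Dn := by rw [hDn]; positivity
  have hm : ∀ n, mult5 n * Dn ^ n ≤ Nn ^ n := by intro n; rw [hDn, hNn]; exact mult5_le n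
  clear hDn hNn
  refine primorial_step_gen Dn Nn hDp hm _ _ ?_ ?_ ?_ C hC h
  · rw [le_div_iff₀ hDr]; simpa using (by exact_mod_cast hB : (D : ℝ) ≤ B)
  · rw [le_div_iff₀ hDr]; simpa using (by exact_mod_cast hB' : (D : ℝ) ≤ B')
  · rw [div_pow, div_mul_eq_mul_div, div_mul_eq_mul_div, div_le_div_iff₀ (by positivity) (by positivity)]
    exact_mod_cast hBB

set_option exponentiation.threshold 100000 in
lemma primorial_bound : ∃ C : ℝ, 0 < C ∧ ∀ n, (primorial n : ℝ) ≤ C * (((29536 : ℕ) : ℝ) / (10000 : ℕ)) ^ n := by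
  have h0 : ∀ n, (primorial n : ℝ) ≤ 1 * (((40000 : ℕ) : ℝ) / (10000 : ℕ)) ^ n := by
    intro n; rw [one_mul]
    have : (((40000 : ℕ) : ℝ) / (10000 : ℕ)) = 4 := by norm_num
    rw [this]; exact_mod_cast primorial_le_four_pow n
  have h1 := primorial_step 40000 29542 10000 (by norm_num) (by norm_num) (by norm_num)
    (Nat.le_of_ble_eq_true (by rfl)) 1 zero_le_one h0
  have h2 := primorial_step 29542 29536 10000 (by norm_num) (by norm_num) (by norm_num)
    (Nat.le_of_ble_eq_true (by rfl)) _ (by positivity) h1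
  exact ⟨_, by positivity, h2⟩

lemma prod_formula (x : ℚ) (hx : x ≠ 0)
    (h : ∀ (p : ℕ) [Fact p.Prime], p ≠ 2 → ‖(x : ℚ_[p])‖ ≤ 1) : 1 ≤ (|x| : ℝ) * ‖(x : ℚ_[2])‖ := by
  have hden : ∀ p : ℕ, p.Prime → p ∣ x.den → p = 2 := by
    intro p hp hd
    by_contra h2
    have : Fact p.Prime := ⟨hp⟩
    have h1 := h p h2
    have hq : (x : ℚ_[p]) * (x.den : ℚ_[p]) = (x.num : ℚ_[p]) := by
      have := Rat.mul_den_eq_num x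
      exact_mod_cast congrArg (fun q : ℚ => (q : ℚ_[p])) this
    have hn : ‖(x.num : ℚ_[p])‖ < 1 := by
      rw [← hq, norm_mul]
      have h3 : ‖(x.den : ℚ_[p])‖ < 1 := (Padic.norm_natCast_lt_one_iff).2 hd
      calc _ ≤ 1 * ‖(x.den : ℚ_[p])‖ := by gcongr
        _ < 1 := by rw [one_mul]; exact h3
    have hn2 : (p : ℤ) ∣ x.num := (Padic.norm_intCast_lt_one_iff).1 hn
    have hc := x.reduced
    have h4 : p ∣ x.num.natAbs := Int.natCast_dvd.1 hn2
    exact hp.one_lt.ne' (Nat.dvd_one.1 (hc ▸ Nat.dvd_gcd h4 hd))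
  obtain ⟨k, hk⟩ : ∃ k, x.den = 2 ^ k := ⟨_, Nat.eq_prime_pow_of_unique_prime_dvd x.den_nz (fun {d} hd hdd => hden d hd hdd)⟩
  have hq : (x : ℚ_[2]) * ((2 : ℚ_[2]) ^ k) = (x.num : ℚ_[2]) := by
    have := Rat.mul_den_eq_num x
    rw [hk] at this
    exact_mod_cast congrArg (fun q : ℚ => (q : ℚ_[2])) this
  have hq2 : (|x| : ℝ) * 2 ^ k = |(x.num : ℝ)| := by
    have := congrArg (fun q : ℚ => |(q : ℝ)|) (Rat.mul_den_eq_num x)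
    rw [hk] at this
    push_cast at this
    rw [abs_mul, abs_of_pos (show (0 : ℝ) < 2 ^ k by positivity)] at this
    exact_mod_cast this
  have hnum : x.num ≠ 0 := Rat.num_ne_zero.2 hx
  have h5 : 1 ≤ |(x.num : ℝ)| * ‖(x.num : ℚ_[2])‖ := by
    have h1 : ‖(x.num : ℚ_[2])‖ = ((2 : ℝ)⁻¹) ^ (padicValInt 2 x.num) := by
      rw [Padic.norm_eq_zpow_neg_valuation (by exact_mod_cast hnum), Padic.valuation_intCast]
      simp
    have h2 : ((2 : ℤ)) ^ (padicValInt 2 x.num) ∣ x.num := by exact_mod_cast padicValInt_dvd (p := 2) x.num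
    have h3 : (2 : ℤ) ^ (padicValInt 2 x.num) ≤ |x.num| :=
      Int.le_of_dvd (abs_pos.2 hnum) ((dvd_abs _ _).2 h2)
    have h4 : (2 : ℝ) ^ (padicValInt 2 x.num) ≤ |(x.num : ℝ)| := by exact_mod_cast h3
    rw [h1, inv_pow, ← div_eq_mul_inv, le_div_iff₀ (by positivity), one_mul]
    exact h4
  have h6 := congrArg norm hq
  rw [norm_mul, norm_pow] at h6
  have h7 : ‖(2 : ℚ_[2])‖ = 2⁻¹ := by simpa using Padic.norm_p (p := 2)
  rw [h7] at h6
  calc 1 ≤ _ := h5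
    _ = _ := by rw [← h6, ← hq2, inv_pow]; field_simp

lemma asymp (C θ : ℝ) (K κ c : ℕ) (hC : 0 < C) (hK : 1 ≤ K) (h0 : 0 < θ) (h1 : θ < 1) :
    ∀ᶠ N : ℕ in atTop, C * ((K * N : ℕ) : ℝ) ^ (κ + c * Nat.sqrt (K * N)) * θ ^ N < 1 := by
  have hKr : (0 : ℝ) < K := by exact_mod_cast hK
  set lam := - Real.log θ / K with hlam
  have hl : 0 < lam := by
    rw [hlam]; exact div_pos (neg_pos.2 (Real.log_neg h0 h1)) hKr
  set A := 4 * (κ : ℝ) + 4 * c + |Real.log C| with hA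
  have hT : Tendsto (fun N : ℕ => ((K * N : ℕ) : ℝ) ^ ((1 : ℝ) / 4)) atTop atTop := by
    apply (tendsto_rpow_atTop (by norm_num)).comp
    apply tendsto_natCast_atTop_atTop.comp
    exact tendsto_id.const_mul_atTop' (by omega)
  filter_upwards [hT.eventually_gt_atTop (A / lam), eventually_ge_atTop 1] with N hN hN1
  set x : ℝ := ((K * N : ℕ) : ℝ) with hx
  have hx1 : 1 ≤ x := by rw [hx]; exact_mod_cast Nat.mul_pos hK hN1
  have hx0 : 0 < x := by linarith
  set t := x ^ ((1 : ℝ) / 4) with ht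
  have ht1 : 1 ≤ t := Real.one_le_rpow hx1 (by norm_num)
  have ht4 : t ^ 4 = x := by
    rw [ht, ← Real.rpow_natCast, ← Real.rpow_mul hx0.le]; norm_num
  have hlog : Real.log x ≤ 4 * t := by
    rw [← ht4, Real.log_pow]
    have := Real.log_le_sub_one_of_pos (show 0 < t by linarith)
    push_cast; linarith
  have hs : (Nat.sqrt (K * N) : ℝ) ≤ t ^ 2 := by
    have h : (Nat.sqrt (K * N) * Nat.sqrt (K * N) : ℝ) ≤ x := by rw [hx]; exact_mod_cast Nat.sqrt_le (K * N)
    rw [← ht4] at h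
    exact abs_le_of_sq_le_sq' (by nlinarith) (by positivity) |>.2
  have hlogx : 0 ≤ Real.log x := Real.log_nonneg hx1
  rw [← Real.log_neg_iff (by positivity), Real.log_mul (by positivity) (by positivity), Real.log_mul (by positivity) (by positivity),
    Real.log_pow, Real.log_pow]
  have hth : Real.log θ * N = - lam * t ^ 4 := by
    rw [ht4, hlam, hx]; push_cast; field_simp
  push_cast
  have hb1 : ((κ : ℝ) + c * Nat.sqrt (K * N)) * Real.log x ≤ (κ + c * t ^ 2) * (4 * t) := by gcongr
  have hb2 : ((κ : ℝ) + c * t ^ 2) * (4 * t) + Real.log C ≤ A * t ^ 3 := by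
    rw [hA]
    have h3 : 1 ≤ t ^ 3 := one_le_pow₀ ht1
    have h4 : t ≤ t ^ 3 := le_self_pow₀ ht1 (by norm_num)
    have h5 := le_abs_self (Real.log C)
    have h6 : |Real.log C| ≤ |Real.log C| * t ^ 3 := le_mul_of_one_le_right (abs_nonneg _) h3
    have h7 : (κ : ℝ) * t ≤ κ * t ^ 3 := by gcongr
    nlinarith
  have hb3 : A * t ^ 3 < lam * t ^ 4 := by
    rw [div_lt_iff₀ hl] at hN
    have h3 : 0 < t ^ 3 := by positivity
    nlinarith
  nlinarith

def smallD (Y F : ℕ) : ℕ := ∏ p ∈ Icc 1 (Nat.sqrt Y), p ^ (Nat.log p Y * F)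

lemma smallD_pos (Y F : ℕ) : 0 < smallD Y F := by
  apply Finset.prod_pos
  intro p hp
  rw [mem_Icc] at hp
  exact pow_pos (by omega) _

lemma smallD_le (Y F : ℕ) (hY : Y ≠ 0) : smallD Y F ≤ Y ^ (F * Nat.sqrt Y) := by
  unfold smallD
  calc _ ≤ ∏ p ∈ Icc 1 (Nat.sqrt Y), Y ^ F := by
        apply Finset.prod_le_prod' 
        intro p hp
        rw [pow_mul]
        exact Nat.pow_le_pow_left (Nat.pow_log_le_self p hY) F
    _ = _ := by rw [prod_const, Nat.card_Icc, Nat.add_sub_cancel, ← pow_mul]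

lemma smallD_dvd (Y F p a : ℕ) (hp : p.Prime) (hp2 : p ^ 2 ≤ Y) (ha : p ^ a ≤ Y) : p ^ (a * F) ∣ smallD Y F := by
  have h1 : p ∈ Icc 1 (Nat.sqrt Y) := by
    rw [mem_Icc]; exact ⟨hp.one_le, Nat.le_sqrt'.2 hp2⟩
  refine dvd_trans (pow_dvd_pow p ?_) (Finset.dvd_prod_of_mem (fun p => p ^ (Nat.log p Y * F)) h1)
  exact Nat.mul_le_mul_right _ (Nat.le_log_of_pow_le hp.one_lt ha)

lemma prime_pow_dvd_primorial (p x c : ℕ) (hp : p.Prime) (h : p ≤ x) : p ^ c ∣ primorial x ^ c := by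
  apply pow_dvd_pow_of_dvd
  unfold primorial
  exact Finset.dvd_prod_of_mem (fun p => p) (by rw [mem_filter, mem_range]; exact ⟨by omega, hp⟩)

lemma S_rational (I : Finset ℤ) (n d : ℤ → ℕ) (r : ℕ) (Jq : ℕ → ℚ)
    (hJ : ∀ i, 1 ≤ i → (Jv (i + r) = (Jq (i + r) : ℚ_[2])) ∨
      (Jq (i + r) = 0 ∧ ∑ e ∈ I, (if i ≤ d e then acoef I n d e i * eps e ^ (i + r) else 0) = 0)) :
    (∑ e ∈ I, ∑ i ∈ Finset.Icc 1 (d e), ((acoef I n d e i * cI r i : ℚ) : ℚ_[2]) *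
        ((eps e : ℚ) ^ (i + r) * Jv (i + r) + (Hq (i + r) e : ℚ))) = ((Sq I n d r Jq : ℚ) : ℚ_[2]) := by
  have key : ∀ J : ℕ → ℚ_[2], (∑ e ∈ I, ∑ i ∈ Finset.Icc 1 (d e), ((acoef I n d e i * cI r i : ℚ) : ℚ_[2]) *
        ((eps e : ℚ) ^ (i + r) * J (i + r) + (Hq (i + r) e : ℚ))) =
      (∑ i ∈ Icc 1 (∑ e ∈ I, d e), ((∑ e ∈ I, (if i ≤ d e then acoef I n d e i * eps e ^ (i + r) else 0) : ℚ) : ℚ_[2]) *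
        (cI r i : ℚ_[2]) * J (i + r)) + 
      ∑ e ∈ I, ∑ i ∈ Finset.Icc 1 (d e), ((acoef I n d e i * cI r i : ℚ) : ℚ_[2]) * (Hq (i + r) e : ℚ_[2]) := by
    intro J
    simp_rw [mul_add, sum_add_distrib]
    congr 1
    push_cast
    simp_rw [sum_mul]
    rw [sum_comm]
    apply sum_congr rfl
    intro e he
    have hsub : Icc 1 (d e) ⊆ Icc 1 (∑ e ∈ I, d e) := by
      apply Icc_subset_Icc le_rfl
      exact Finset.single_le_sum (f := d) (fun _ _ => Nat.zero_le _) he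
    rw [← Finset.sum_subset hsub]
    · apply sum_congr rfl
      intro i hi
      rw [mem_Icc] at hi
      rw [if_pos hi.2]
      push_cast; ring
    · intro i hi hi2
      rw [mem_Icc] at hi hi2
      rw [if_neg (by omega)]; simp
  rw [key]
  have h2 : ((Sq I n d r Jq : ℚ) : ℚ_[2]) = (∑ e ∈ I, ∑ i ∈ Finset.Icc 1 (d e), ((acoef I n d e i * cI r i : ℚ) : ℚ_[2]) *
        ((eps e : ℚ) ^ (i + r) * (Jq (i + r) : ℚ_[2]) + (Hq (i + r) e : ℚ))) := by
    unfold Sq; push_cast; rfl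
  rw [h2, key (fun k => (Jq k : ℚ_[2]))]
  congr 1
  apply sum_congr rfl
  intro i hi
  rcases hJ i (mem_Icc.1 hi).1 with h | ⟨_, h⟩
  · rw [h]
  · rw [h]; simp

lemma Sq_abs (L : ℕ) (n d : ℤ → ℕ) (r D : ℕ) (Jq : ℕ → ℚ) (Aa Jm : ℚ) (hJm : 0 ≤ Jm) (hJ : ∀ k, |Jq k| ≤ Jm) (hA : 0 ≤ Aa)
    (hD : ∀ e, d e ≤ D)
    (ha : ∀ e ∈ Icc (-(L : ℤ)) L, ∀ i, 1 ≤ i → i ≤ d e → |acoef (Icc (-(L : ℤ)) L) n d e i| ≤ Aa) :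
    |Sq (Icc (-(L : ℤ)) L) n d r Jq| ≤ (2 * L + 1) * (D * (Aa * 2 ^ (D + r) * (Jm + 4 * (D + r) * (L + 1)))) := by
  unfold Sq
  refine (abs_sum_le_sum_abs _ _).trans ?_
  have h1 : ∀ e ∈ Icc (-(L : ℤ)) L, |∑ i ∈ Icc 1 (d e), acoef (Icc (-(L : ℤ)) L) n d e i * cI r i * (eps e ^ (i + r) * Jq (i + r) + Hq (i + r) e)|
      ≤ D * (Aa * 2 ^ (D + r) * (Jm + 4 * (D + r) * (L + 1))) := by
    intro e he
    refine (abs_sum_le_sum_abs _ _).trans ?_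
    have h2 : ∀ i ∈ Icc 1 (d e), |acoef (Icc (-(L : ℤ)) L) n d e i * cI r i * (eps e ^ (i + r) * Jq (i + r) + Hq (i + r) e)|
        ≤ Aa * 2 ^ (D + r) * (Jm + 4 * (D + r) * (L + 1)) := by
      intro i hi
      rw [mem_Icc] at hi
      have hiD := hi.2.trans (hD e)
      rw [abs_mul, abs_mul]
      have hc : |cI r i| ≤ 2 ^ (D + r) := by
        unfold cI
        rw [abs_mul, abs_pow, abs_neg, abs_one, one_pow, one_mul, Nat.abs_cast]
        have : (i + r - 1).choose r ≤ 2 ^ (D + r) := 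
          (Nat.choose_le_two_pow _ _).trans (Nat.pow_le_pow_right (by norm_num) (by omega))
        exact_mod_cast this
      have he1 : |eps e ^ (i + r)| = 1 := by
        rw [abs_pow]; unfold eps; split_ifs <;> simp
      have hH : |Hq (i + r) e| ≤ 4 * (D + r) * (L + 1) := by
        refine (Hq_abs _ _).trans ?_
        have hee : |(e : ℚ)| ≤ L := by
          rw [mem_Icc] at he
          have : |e| ≤ L := abs_le.2 he
          exact_mod_cast this
        have hir : ((i + r : ℕ) : ℚ) ≤ D + r := by exact_mod_cast (by omega : i + r ≤ D + r)
        push_cast at *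
        gcongr
      have hin : |eps e ^ (i + r) * Jq (i + r) + Hq (i + r) e| ≤ Jm + 4 * (D + r) * (L + 1) := by
        refine (abs_add_le _ _).trans (add_le_add ?_ hH)
        rw [abs_mul, he1, one_mul]; exact hJ _
      have hab := ha e he i hi.1 hi.2
      gcongr
    refine (sum_le_card_nsmul _ _ _ h2).trans ?_
    rw [Nat.card_Icc, Nat.add_sub_cancel, nsmul_eq_mul]
    have : (d e : ℚ) ≤ D := by exact_mod_cast hD e
    gcongr
  refine (sum_le_card_nsmul _ _ _ h1).trans ?_
  rw [Int.card_Icc, nsmul_eq_mul]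
  have : ((L : ℤ) + 1 - -(L : ℤ)).toNat = 2 * L + 1 := by omega
  rw [this]; push_cast; rfl

lemma chi_add (a b : ℤ) : chi (a + b) = chi a * chi b := by
  unfold chi
  split_ifs <;> omega

lemma chi_cases (a : ℤ) : chi a = 1 ∨ chi a = -1 := by
  unfold chi; split_ifs <;> simp

lemma chi_core (N p ρ σ K α γ α' γ' : ℤ) (h1 : 12 * N < 5 * p) (h2 : p ≤ 10 * N) (hpo : p % 2 = 1)
    (hp4 : p ≠ 4 * N - 1) (hp8 : p ≠ 8 * N - 1) (hρ : 0 ≤ ρ) (hρ2 : ρ < p) (hσ : 0 ≤ σ) (hσ2 : σ < p)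
    (hK : ρ + σ + p * K = 12 * N) (a1 : p * α ≤ ρ + 4 * N) (a2 : ρ + 4 * N < p * α + p)
    (b1 : p * α' ≤ σ + 4 * N) (b2 : σ + 4 * N < p * α' + p)
    (c1 : p * γ ≤ ρ + 8 * N - 2) (c2 : ρ + 8 * N - 2 < p * γ + p)
    (d1 : p * γ' ≤ σ + 8 * N - 2) (d2 : σ + 8 * N - 2 < p * γ' + p) :
    |1 + chi α + chi γ + chi K * (1 + chi α' + chi γ')| ≤ 2 := by
  have hp : 0 < p := by omega
  have hN : 0 < N := by omega
  have hK0 : 0 ≤ K := by by_contra h; have : p * K ≤ p * (-1) := by gcongr; omega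
                         omega
  have hK4 : K ≤ 4 := by by_contra h; have : p * 5 ≤ p * K := by gcongr; omega
                         omega
  have ha0 : 0 ≤ α := by by_contra h; have : p * α ≤ p * (-1) := by gcongr; omega
                         omega
  have ha4 : α ≤ 2 := by by_contra h; have : p * 3 ≤ p * α := by gcongr; omega
                         omega
  have hb0 : 0 ≤ α' := by by_contra h; have : p * α' ≤ p * (-1) := by gcongr; omega
                          omega
  have hb4 : α' ≤ 2 := by by_contra h; have : p * 3 ≤ p * α' := by gcongr; omega
                          omega
  have hc0 : 0 ≤ γ := by by_contra h; have : p * γ ≤ p * (-1) := by gcongr; omega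
                         omega
  have hc4 : γ ≤ 4 := by by_contra h; have : p * 5 ≤ p * γ := by gcongr; omega
                         omega
  have hd0 : 0 ≤ γ' := by by_contra h; have : p * γ' ≤ p * (-1) := by gcongr; omega
                          omega
  have hd4 : γ' ≤ 4 := by by_contra h; have : p * 5 ≤ p * γ' := by gcongr; omega
                          omega
  interval_cases K <;> interval_cases α <;> (try omega) <;> interval_cases α' <;> (try omega) <;>
    interval_cases γ <;> (try omega) <;> interval_cases γ' <;> first | omega | decide

lemma chi_main (N p e : ℤ) (h1 : 12 * N < 5 * p) (h2 : p ≤ 10 * N) (hpo : p % 2 = 1)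
    (hp4 : p ≠ 4 * N - 1) (hp8 : p ≠ 8 * N - 1) :
    chi ((6 * N + e) / p) + chi ((6 * N - e) / p) + (chi ((10 * N + e) / p) + chi ((10 * N - e) / p)) +
      (chi ((14 * N - 2 + e) / p) + chi ((14 * N - 2 - e) / p)) ≤ 2 := by
  have hp : 0 < p := by omega
  set A := (6 * N + e) / p with hA
  set B := (6 * N - e) / p with hB
  set ρ := (6 * N + e) % p with hρ
  set σ := (6 * N - e) % p with hσ
  have e1 : p * A + ρ = 6 * N + e := Int.mul_ediv_add_emod _ _
  have e2 : p * B + σ = 6 * N - e := Int.mul_ediv_add_emod _ _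
  have r1 := Int.emod_nonneg (6 * N + e) hp.ne'
  have r2 := Int.emod_lt_of_pos (6 * N + e) hp
  have s1 := Int.emod_nonneg (6 * N - e) hp.ne'
  have s2 := Int.emod_lt_of_pos (6 * N - e) hp
  have f : ∀ y c q r' : ℤ, p * q + r' = c → (c + y) / p = q + (r' + y) / p := by
    intro y c q r' h
    rw [← h, show p * q + r' + y = (r' + y) + p * q by ring, Int.add_mul_ediv_left _ _ hp.ne']; ring
  have g : ∀ y : ℤ, p * (y / p) ≤ y ∧ y < p * (y / p) + p := by
    intro y
    have := Int.mul_ediv_add_emod y p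
    have := Int.emod_nonneg y hp.ne'
    have := Int.emod_lt_of_pos y hp
    omega
  have a2 : (10 * N + e) / p = A + (ρ + 4 * N) / p := by rw [← f _ _ _ _ e1]; congr 1; ring
  have a3 : (14 * N - 2 + e) / p = A + (ρ + (8 * N - 2)) / p := by rw [← f _ _ _ _ e1]; congr 1; ring
  have b2 : (10 * N - e) / p = B + (σ + 4 * N) / p := by rw [← f _ _ _ _ e2]; congr 1; ring
  have b3 : (14 * N - 2 - e) / p = B + (σ + (8 * N - 2)) / p := by rw [← f _ _ _ _ e2]; congr 1; ring
  have hKK : ρ + σ + p * (A + B) = 12 * N := by rw [mul_add]; omega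
  have core := chi_core N p ρ σ (A + B) ((ρ + 4 * N) / p) ((ρ + (8 * N - 2)) / p) ((σ + 4 * N) / p) ((σ + (8 * N - 2)) / p)
    h1 h2 hpo hp4 hp8 r1 r2 s1 s2 hKK (g _).1 (g _).2 (g _).1 (g _).2
    (by have := (g (ρ + (8 * N - 2))).1; omega) (by have := (g (ρ + (8 * N - 2))).2; omega)
    (by have := (g (σ + (8 * N - 2))).1; omega) (by have := (g (σ + (8 * N - 2))).2; omega)
  rw [a2, a3, b2, b3]
  simp only [chi_add] at *
  have hAA : chi A * chi A = 1 := by rcases chi_cases A with h | h <;> rw [h] <;> norm_num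
  have := abs_le.1 core
  rcases chi_cases A with h | h <;> rw [h] at this ⊢ <;> nlinarith

lemma T_psi_comb (m a b s1 s2 s3 P : ℤ) (hm : 0 ≤ m) (ha : 0 ≤ a) (hb : 0 ≤ b)
    (h : 2 * P ≤ m * s1 + (m + a) * s2 + (m + b) * s3) (h2 : s2 ≤ 2) (h3 : s3 ≤ 2) (hs : s1 + s2 + s3 ≤ 2) :
    P ≤ m + a + b := by nlinarith

/-- large primes: values of the floor symbols -/
lemma T_big (N p e : ℤ) (hN : 1 ≤ N) (h1 : 10 * N < p) (he : |e| ≤ 14 * N - 2) (hep : 2 * p ≤ |e| + (14 * N - 2)) :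
    chi ((6 * N + e) / p) + chi ((6 * N - e) / p) = -2 ∧ chi ((10 * N + e) / p) + chi ((10 * N - e) / p) ≤ 0 ∧
    ((12 * N < p ∨ (p = 12 * N - 1 ∧ |e| ≠ 14 * N - 2 ∧ |e| ≠ 10 * N)) → chi ((10 * N + e) / p) + chi ((10 * N - e) / p) = -2) := by
  have hp : 0 < p := by omega
  have c1 : chi 1 = -1 := by decide
  have c2 : chi (-1) = -1 := by decide
  have q1 : ∀ y : ℤ, p ≤ y → y < 2 * p → y / p = 1 := by
    intro y h h'
    rw [Int.ediv_eq_iff_of_pos hp]; constructor <;> omega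
  have q2 : ∀ y : ℤ, -p ≤ y → y < 0 → y / p = -1 := by
    intro y h h'
    rw [Int.ediv_eq_iff_of_pos hp]; constructor <;> omega
  have l1 := chi_le ((10 * N + e) / p)
  have l2 := chi_le ((10 * N - e) / p)
  rcases le_total 0 e with h0 | h0
  · rw [abs_of_nonneg h0] at *
    rw [q1 (6 * N + e) (by omega) (by omega), q2 (6 * N - e) (by omega) (by omega), c1, c2]
    refine ⟨by norm_num, ?_, ?_⟩
    · by_cases h5 : 10 * N < e
      · rw [q2 (10 * N - e) (by omega) (by omega), c2]; omega
      · rw [q1 (10 * N + e) (by omega) (by omega), c1]; omega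
    · intro h6
      rw [q1 (10 * N + e) (by omega) (by omega), q2 (10 * N - e) (by omega) (by omega), c1, c2]; norm_num
  · rw [abs_of_nonpos h0] at *
    rw [q1 (6 * N - e) (by omega) (by omega), q2 (6 * N + e) (by omega) (by omega), c1, c2]
    refine ⟨by norm_num, ?_, ?_⟩
    · by_cases h5 : 10 * N < -e
      · rw [q2 (10 * N + e) (by omega) (by omega), c2]; omega
      · rw [q1 (10 * N - e) (by omega) (by omega), c1]; omega
    · intro h6
      rw [q1 (10 * N - e) (by omega) (by omega), q2 (10 * N + e) (by omega) (by omega), c1, c2]; norm_num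

def ellT (N : ℕ) : Fin 3 → ℕ := ![6 * N, 10 * N, 14 * N - 2]
def wT (m a b : ℕ) : Fin 3 → ℕ := ![m, m + a, m + b]
def nT (m a b N : ℕ) : ℤ → ℕ := nf (wT m a b) (ellT N)
def dT (m a b η N : ℕ) (x : ℤ) : ℕ :=
  if |x| = ((14 * N - 2 : ℕ) : ℤ) then 1 else if x = 0 then df (wT m a b) (ellT N) x - η else df (wT m a b) (ellT N) x

/-- the index interval -/
noncomputable def IT (N : ℕ) : Finset ℤ := Icc (-((14 * N - 2 : ℕ) : ℤ)) ((14 * N - 2 : ℕ) : ℤ)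

lemma ellT_le (N : ℕ) (hN : 1 ≤ N) (k : Fin 3) : ellT N k ≤ 14 * N - 2 := by
  fin_cases k <;> simp [ellT] <;> omega

lemma ellT_even (N : ℕ) (k : Fin 3) : 2 ∣ ellT N k := by
  fin_cases k <;> simp [ellT] <;> omega

lemma df_T (m a b N : ℕ) (x : ℤ) : df (wT m a b) (ellT N) x = if 2 ∣ x then (if |x| ≤ 6 * N then m else 0) +
    (if |x| ≤ 10 * N then m + a else 0) + (if |x| ≤ ((14 * N - 2 : ℕ) : ℤ) then m + b else 0) else 0 := by
  unfold df
  rw [Fin.sum_univ_three]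
  simp only [wT, ellT, Matrix.cons_val_zero, Matrix.cons_val_one, Matrix.cons_val]
  push_cast
  congr

lemma nf_T (m a b N : ℕ) (x : ℤ) : nT m a b N x = if 2 ∣ x then 0 else (if |x| ≤ 6 * N then m else 0) +
    (if |x| ≤ 10 * N then m + a else 0) + (if |x| ≤ ((14 * N - 2 : ℕ) : ℤ) then m + b else 0) := by
  unfold nT nf
  rw [Fin.sum_univ_three]
  simp only [wT, ellT, Matrix.cons_val_zero, Matrix.cons_val_one, Matrix.cons_val]
  push_cast
  congr

lemma df_T_le (m a b N : ℕ) (x : ℤ) : df (wT m a b) (ellT N) x ≤ 3 * m + a + b := by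
  rw [df_T]; split_ifs <;> omega

lemma dT_le (m a b η N : ℕ) (hm : 1 ≤ m) (x : ℤ) : dT m a b η N x ≤ df (wT m a b) (ellT N) x := by
  unfold dT
  split_ifs with h1 h2
  · rw [df_T, if_pos (by have : (2 : ℤ) ∣ |x| := by rw [h1]; omega
                         exact (dvd_abs _ _).1 this), if_pos h1.le]
    omega
  · omega
  · exact le_rfl

lemma dT_le_D (m a b η N : ℕ) (hm : 1 ≤ m) (x : ℤ) : dT m a b η N x ≤ 3 * m + a + b :=
  (dT_le m a b η N hm x).trans (df_T_le m a b N x)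

lemma dT_even (m a b η N : ℕ) (hm : 1 ≤ m) (x : ℤ) (h : dT m a b η N x ≠ 0) : 2 ∣ x := by
  by_contra h2
  have := dT_le m a b η N hm x
  rw [df_T, if_neg h2] at this
  omega

lemma nT_odd (m a b N : ℕ) (x : ℤ) (h : nT m a b N x ≠ 0) : ¬ 2 ∣ x := by
  intro h2; rw [nf_T, if_pos h2] at h; exact h rfl

lemma T_Psi_le (m a b η N : ℕ) (hm : 1 ≤ m) (hN : 1 ≤ N) (P e : ℤ) (hP : 0 < P) (hP2 : ¬ 2 ∣ P) (he : 2 ∣ e) :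
    2 * Psi (IT N) (nT m a b N) (dT m a b η N) e P ≤
      m * (chi ((6 * N + e) / P) + chi ((6 * N - e) / P)) + (m + a) * (chi ((10 * N + e) / P) + chi ((10 * N - e) / P)) +
      (m + b) * (chi ((14 * N - 2 + e) / P) + chi ((14 * N - 2 - e) / P)) := by
  have h := Psi_le (wT m a b) (ellT N) (14 * N - 2) (ellT_le N hN) (nT m a b N) (dT m a b η N) (fun x => le_rfl)
    (dT_le m a b η N hm) P e hP hP2 he
  rw [Fin.sum_univ_three] at h
  have e0 : ((14 * N - 2 : ℕ) : ℤ) = 14 * N - 2 := by omega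
  simp only [wT, ellT, Matrix.cons_val_zero, Matrix.cons_val_one, Matrix.cons_val] at h
  rw [e0] at h
  push_cast at h
  unfold IT
  rw [e0]
  exact h

lemma T_Psi_D (m a b η N : ℕ) (hm : 1 ≤ m) (hN : 1 ≤ N) (P e : ℤ) (hP : 0 < P) (hP2 : ¬ 2 ∣ P) (he : 2 ∣ e) :
    Psi (IT N) (nT m a b N) (dT m a b η N) e P ≤ (3 * m + a + b : ℕ) := by
  have h := T_Psi_le m a b η N hm hN P e hP hP2 he
  have h1 := chi_le ((6 * N + e) / P)
  have h2 := chi_le ((6 * N - e) / P)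
  have h3 := chi_le ((10 * N + e) / P)
  have h4 := chi_le ((10 * N - e) / P)
  have h5 := chi_le ((14 * N - 2 + e) / P)
  have h6 := chi_le ((14 * N - 2 - e) / P)
  have hm0 : (0 : ℤ) ≤ m := by positivity
  have ha0 : (0 : ℤ) ≤ m + a := by positivity
  have hb0 : (0 : ℤ) ≤ m + b := by positivity
  push_cast
  nlinarith

def costT (m a b r N p : ℕ) : ℕ :=
  if 5 * p ≤ 12 * N ∨ p = 4 * N - 1 ∨ p = 8 * N - 1 then r + 1 + (3 * m + a + b)
  else if p ≤ 10 * N then r + 1 + (m + a + b)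
  else if p ≤ 12 * N then r + 1 + b
  else if p ≤ 14 * N then r + 1 + b - (m + a)
  else 0

/-- large primes: alone in class. -/
lemma T_alone (m a b η N : ℕ) (hN : 1 ≤ N) (p : ℕ) [Fact p.Prime] (hp2 : p ≠ 2)
    (e : ℤ) (he : e ∈ IT N) (he2 : 2 ∣ e) (hm : 1 ≤ m) (h : |e| + ((14 * N - 2 : ℕ) : ℤ) < 2 * p) :
    (∀ k, ‖(Hq k e : ℚ_[p])‖ ≤ 1) ∧ ∀ x ∈ IT N, x ≠ e → dT m a b η N x ≠ 0 → ¬ (p : ℤ) ∣ e - x := by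
  have hodd : (p : ℤ) % 2 = 1 := by
    have := (Fact.out : p.Prime).eq_two_or_odd
    omega
  unfold IT at *
  rw [mem_Icc] at he
  have hab : |e| ≤ ((14 * N - 2 : ℕ) : ℤ) := abs_le.2 he
  constructor
  · intro k
    apply Hq_int k e he2
    rintro z _ h2 ⟨q, hq⟩
    have hq0 : |q| < 1 := by
      by_contra h3
      have h4 : (p : ℤ) ≤ |p * q| := by
        rw [abs_mul, abs_of_nonneg (by positivity)]
        exact le_mul_of_one_le_right (by positivity) (by omega)
      rw [← hq] at h4
      rcases abs_cases e with h5 | h5 <;> rcases abs_cases (e - z) with h6 | h6 <;> omega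
    have : q = 0 := by simpa using Int.abs_lt_one_iff.1 hq0
    rw [this] at hq; omega
  · rintro x hx hxe hdx ⟨q, hq⟩
    have hx2 := dT_even m a b η N hm x hdx
    rw [mem_Icc] at hx
    have hq2 : 2 ∣ q := by
      have h1 : (2 : ℤ) ∣ p * q := by rw [← hq]; omega
      rcases Int.prime_two.dvd_or_dvd h1 with h2 | h2
      · omega
      · exact h2
    obtain ⟨q', rfl⟩ := hq2
    have hq0 : |q'| < 1 := by
      by_contra h3
      have h4 : 2 * (p : ℤ) ≤ |p * (2 * q')| := by
        rw [abs_mul, abs_mul, abs_of_nonneg (show (0 : ℤ) ≤ p by positivity), abs_two]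
        nlinarith [show (0 : ℤ) ≤ p by positivity]
      rw [← hq] at h4
      rcases abs_cases e with h5 | h5 <;> rcases abs_cases (e - x) with h6 | h6 <;> omega
    have : q' = 0 := by simpa using Int.abs_lt_one_iff.1 hq0
    rw [this] at hq; omega

lemma T_mid (m a b η r N : ℕ) (hm : 1 ≤ m) (hN : 1 ≤ N) (p : ℕ) [Fact p.Prime] (hp2 : p ≠ 2)
    (e : ℤ) (he : e ∈ IT N) (he2 : 2 ∣ e) :
    CC p (IT N) (nT m a b N) (dT m a b η N) r (costT m a b r N p) e := by
  have hpp := (Fact.out : p.Prime)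
  have hodd : p % 2 = 1 := by
    have := hpp.eq_two_or_odd
    omega
  have hP2 : ¬ (2 : ℤ) ∣ p := by omega
  have hP : (0 : ℤ) < p := by exact_mod_cast hpp.pos
  have hPsi := T_Psi_le m a b η N hm hN p e hP hP2 he2
  have h2 := chi_le ((10 * N + e) / p)
  have h2' := chi_le ((10 * N - e) / p)
  have h3 := chi_le ((14 * N - 2 + e) / p)
  have h3' := chi_le ((14 * N - 2 - e) / p)
  have hm0 : (0 : ℤ) ≤ m := by positivity
  have ha0 : (0 : ℤ) ≤ a := by positivity
  have hb0 : (0 : ℤ) ≤ b := by positivity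
  have e0 : ((14 * N - 2 : ℕ) : ℤ) = 14 * N - 2 := by omega
  by_cases hbig : 10 * N < p
  · by_cases hal : |e| + ((14 * N - 2 : ℕ) : ℤ) < 2 * p
    · obtain ⟨q1, q2⟩ := T_alone m a b η N hN p hp2 e he he2 hm hal
      exact Or.inr ⟨q1, Or.inr q2⟩
    · left
      have heL : |e| ≤ 14 * N - 2 := by
        unfold IT at he
        rw [mem_Icc, e0] at he; exact abs_le.2 he
      obtain ⟨t1, t2, t3⟩ := T_big N p e (by omega) (by omega) heL (by omega)
      unfold costT
      rw [if_neg (by omega), if_neg (by omega)]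
      rw [t1] at hPsi
      split_ifs with c1 c2
      · push_cast
        nlinarith
      · rw [t3 (by omega)] at hPsi
        have : Psi (IT N) (nT m a b N) (dT m a b η N) e p ≤ b - m - a := by nlinarith
        omega
      · omega
  · left
    unfold costT
    split_ifs with c1 c2
    · have := T_Psi_D m a b η N hm hN p e hP hP2 he2
      push_cast at *
      omega
    · have hch := chi_main N p e (by omega) (by omega) (by omega) (by omega) (by omega)
      have := T_psi_comb m a b _ _ _ _ hm0 ha0 hb0 hPsi (by omega) (by omega) (by omega)
      push_cast
      omega
    all_goals omega

/-- the denominator -/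
def DeltaT (m a b r x : ℕ) : ℕ :=
  smallD (2 * (14 * (5 * x) - 2)) (3 * m + a + b + r + 1) * ((4 * (5 * x) - 1) * (8 * (5 * x) - 1)) ^ (r + 1 + (3 * m + a + b)) *
  (primorial (70 * x) ^ (r + 1 + b - (m + a)) * primorial (60 * x) ^ (r + 1 + b - (r + 1 + b - (m + a))) * primorial (50 * x) ^ (m + a) *
    primorial (12 * x) ^ (2 * m))

lemma DeltaT_dvd (m a b r x p : ℕ) (hx : 1 ≤ x) (hp : p.Prime) : p ^ costT m a b r (5 * x) p ∣ DeltaT m a b r x := by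
  unfold DeltaT costT
  set c7 := r + 1 + b - (m + a) with hc7
  have hc : c7 ≤ r + 1 + b := by omega
  have k7 : p ≤ 70 * x → p ^ c7 ∣ primorial (70 * x) ^ c7 := prime_pow_dvd_primorial p _ _ hp
  have k6 : p ≤ 60 * x → p ^ (r + 1 + b - c7) ∣ primorial (60 * x) ^ (r + 1 + b - c7) := prime_pow_dvd_primorial p _ _ hp
  have k5 : p ≤ 50 * x → p ^ (m + a) ∣ primorial (50 * x) ^ (m + a) := prime_pow_dvd_primorial p _ _ hp
  have k1 : p ≤ 12 * x → p ^ (2 * m) ∣ primorial (12 * x) ^ (2 * m) := prime_pow_dvd_primorial p _ _ hp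
  have f6 : p ≤ 60 * x → p ^ (r + 1 + b) ∣ primorial (70 * x) ^ c7 * primorial (60 * x) ^ (r + 1 + b - c7) := by
    intro h
    have := mul_dvd_mul (k7 (by omega)) (k6 h)
    rwa [← pow_add, Nat.add_sub_cancel' hc] at this
  have f5 : p ≤ 50 * x → p ^ (r + 1 + (m + a + b)) ∣ primorial (70 * x) ^ c7 * primorial (60 * x) ^ (r + 1 + b - c7) *
      primorial (50 * x) ^ (m + a) := by
    intro h
    have := mul_dvd_mul (f6 (by omega)) (k5 h)
    rwa [← pow_add, show r + 1 + b + (m + a) = r + 1 + (m + a + b) by ring] at this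
  have f1 : p ≤ 12 * x → p ^ (r + 1 + (3 * m + a + b)) ∣ primorial (70 * x) ^ c7 * primorial (60 * x) ^ (r + 1 + b - c7) *
      primorial (50 * x) ^ (m + a) * primorial (12 * x) ^ (2 * m) := by
    intro h
    have := mul_dvd_mul (f5 (by omega)) (k1 h)
    rwa [← pow_add, show r + 1 + (m + a + b) + 2 * m = r + 1 + (3 * m + a + b) by ring] at this
  split_ifs with h1 h2 h3 h4
  · rcases h1 with h1 | h1 | h1
    · exact Dvd.dvd.mul_left (f1 (by omega)) _
    · apply Dvd.dvd.mul_right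
      apply Dvd.dvd.mul_left
      apply pow_dvd_pow_of_dvd
      rw [h1]; exact Dvd.intro _ rfl
    · apply Dvd.dvd.mul_right
      apply Dvd.dvd.mul_left
      apply pow_dvd_pow_of_dvd
      rw [h1]; exact Dvd.intro_left _ rfl
  · exact Dvd.dvd.mul_left (Dvd.dvd.mul_right (f5 (by omega)) _) _
  · exact Dvd.dvd.mul_left (Dvd.dvd.mul_right (Dvd.dvd.mul_right (f6 (by omega)) _) _) _
  · exact Dvd.dvd.mul_left (Dvd.dvd.mul_right (Dvd.dvd.mul_right (Dvd.dvd.mul_right (k7 (by omega)) _) _) _) _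
  · simp

lemma T_integral (m a b η r x : ℕ) (hm : 1 ≤ m) (hx : 1 ≤ x) (Jq : ℕ → ℚ) (Q : ℕ)
    (p : ℕ) [hp : Fact p.Prime] (hp2 : p ≠ 2) (hQ : ∀ k, ‖((Q * Jq k : ℚ) : ℚ_[p])‖ ≤ 1) :
    ‖((DeltaT m a b r x * (Q * Sq (IT (5 * x)) (nT m a b (5 * x)) (dT m a b η (5 * x)) r Jq) : ℚ) : ℚ_[p])‖ ≤ 1 := by
  apply Sq_integral (14 * (5 * x) - 2) (nT m a b (5 * x)) (dT m a b η (5 * x)) (dT_even m a b η _ hm) (nT_odd m a b _) r Jq Q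
    (DeltaT m a b r x) (3 * m + a + b) (costT m a b r (5 * x)) _ _ _ _ p hp2 hQ
  · intro P e hP hP2 he
    exact T_Psi_D m a b η (5 * x) hm (by omega) P e hP hP2 he
  · intro p a' hp h1 h2
    have := smallD_dvd (2 * (14 * (5 * x) - 2)) (3 * m + a + b + r + 1) p a' hp h1 h2
    unfold DeltaT
    exact Dvd.dvd.mul_right (Dvd.dvd.mul_right this _) _
  · intro p _ hp2 _ _ e he he2 _
    exact T_mid m a b η r (5 * x) hm (by omega) p hp2 e he he2
  · intro p hp _ _ _
    exact DeltaT_dvd m a b r x p hx hp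

lemma Sq_ne_zero {p : ℕ} [Fact p.Prime] (I : Finset ℤ) (n d : ℤ → ℕ) (r : ℕ) (Jq : ℕ → ℚ)
    (hJ : ∀ k, ‖((Jq k : ℚ) : ℚ_[p])‖ ≤ 1) (e₀ : ℤ) (he₀ : e₀ ∈ I) (hd : d e₀ = 1) (V B : ℝ) (hB : 0 ≤ B) (hBV : B < V)
    (hV : ‖(acoef I n d e₀ 1 : ℚ_[p])‖ * ‖(Hq (1 + r) e₀ : ℚ_[p])‖ = V) (hV2 : ‖(acoef I n d e₀ 1 : ℚ_[p])‖ ≤ B)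
    (h : ∀ e ∈ I, e ≠ e₀ → ∀ i ∈ Icc 1 (d e), ‖(acoef I n d e i : ℚ_[p])‖ ≤ B ∧
      ‖(acoef I n d e i : ℚ_[p])‖ * ‖(Hq (i + r) e : ℚ_[p])‖ ≤ B) : Sq I n d r Jq ≠ 0 := by
  intro h0
  unfold Sq at h0
  rw [← Finset.add_sum_erase I _ he₀, hd, Icc_self, sum_singleton] at h0
  have h1 := congrArg (fun q : ℚ => (q : ℚ_[p])) h0
  simp only [Rat.cast_add, Rat.cast_sum, Rat.cast_mul, Rat.cast_pow, Rat.cast_zero] at h1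
  have key : ‖∑ e ∈ I.erase e₀, ∑ i ∈ Icc 1 (d e), (acoef I n d e i : ℚ_[p]) * (cI r i : ℚ_[p]) *
      ((eps e : ℚ_[p]) ^ (i + r) * (Jq (i + r) : ℚ_[p]) + (Hq (i + r) e : ℚ_[p]))‖ ≤ B := by
    apply IsUltrametricDist.norm_sum_le_of_forall_le_of_nonneg hB
    intro e he
    apply IsUltrametricDist.norm_sum_le_of_forall_le_of_nonneg hB
    intro i hi
    obtain ⟨h1, h2⟩ := h e (mem_of_mem_erase he) (ne_of_mem_erase he) i hi
    have h3 := norm_cI (p := p) r i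
    have h4 := norm_eps_pow (p := p) e (i + r)
    push_cast at h4
    have e1 : (acoef I n d e i : ℚ_[p]) * (cI r i : ℚ_[p]) *
      ((eps e : ℚ_[p]) ^ (i + r) * (Jq (i + r) : ℚ_[p]) + (Hq (i + r) e : ℚ_[p])) =
      (cI r i : ℚ_[p]) * ((acoef I n d e i : ℚ_[p]) * ((eps e : ℚ_[p]) ^ (i + r) * (Jq (i + r) : ℚ_[p]))
       + ((acoef I n d e i : ℚ_[p]) * (Hq (i + r) e : ℚ_[p]))) := by ring
    rw [e1, norm_mul]
    refine (mul_le_of_le_one_left (norm_nonneg _) h3).trans ?_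
    refine (IsUltrametricDist.norm_add_le_max _ _).trans (max_le ?_ ?_)
    · rw [norm_mul, norm_mul, h4, one_mul]
      exact (mul_le_of_le_one_right (norm_nonneg _) (hJ _)).trans h1
    · rw [norm_mul]; exact h2
  have hc : ‖(cI r 1 : ℚ_[p])‖ = 1 := by
    unfold cI
    simp
  have h4 := norm_eps_pow (p := p) e₀ (1 + r)
  push_cast at h4
  have e1 : (acoef I n d e₀ 1 : ℚ_[p]) * (Hq (1 + r) e₀ : ℚ_[p]) * (cI r 1 : ℚ_[p]) = 
     -((acoef I n d e₀ 1 : ℚ_[p]) * (cI r 1 : ℚ_[p]) * ((eps e₀ : ℚ_[p]) ^ (1 + r) * (Jq (1 + r) : ℚ_[p]))) + 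
    -(∑ e ∈ I.erase e₀, ∑ i ∈ Icc 1 (d e), (acoef I n d e i : ℚ_[p]) * (cI r i : ℚ_[p]) *
      ((eps e : ℚ_[p]) ^ (i + r) * (Jq (i + r) : ℚ_[p]) + (Hq (i + r) e : ℚ_[p]))) := by
    linear_combination h1
  have h5 := congrArg norm e1
  rw [norm_mul, norm_mul, hc, mul_one, hV] at h5
  have h6 := IsUltrametricDist.norm_add_le_max (-((acoef I n d e₀ 1 : ℚ_[p]) * (cI r 1 : ℚ_[p]) * ((eps e₀ : ℚ_[p]) ^ (1 + r) * (Jq (1 + r) : ℚ_[p]))))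
    (-(∑ e ∈ I.erase e₀, ∑ i ∈ Icc 1 (d e), (acoef I n d e i : ℚ_[p]) * (cI r i : ℚ_[p]) *
      ((eps e : ℚ_[p]) ^ (i + r) * (Jq (i + r) : ℚ_[p]) + (Hq (i + r) e : ℚ_[p]))))
  rw [← h5, norm_neg, norm_neg, norm_mul, norm_mul, hc, mul_one, norm_mul, h4, one_mul] at h6
  have h7 := (mul_le_of_le_one_right (norm_nonneg (acoef I n d e₀ 1 : ℚ_[p])) (hJ (1 + r))).trans hV2
  have := h6.trans (max_le h7 key)
  linarith

lemma T_H0 (N r p : ℕ) [hp : Fact p.Prime] (hN : N % 2 = 1) (hpN : p = 12 * N - 1) (hr : r + 1 < p) :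
    ‖((Hq (1 + r) (14 * N - 2) : ℚ) : ℚ_[p])‖ = (p : ℝ) ^ (r + 2) := by
  unfold Hq Gq
  rw [if_pos (by omega), if_neg (by omega)]
  have hmem : 3 * N - 1 ∈ range ((-(-((14 * (N : ℤ) - 2) / 4))).toNat) := by rw [mem_range]; omega
  rw [← add_sum_erase _ _ hmem]
  have hp1 : (1 : ℝ) < p := by exact_mod_cast hp.out.one_lt
  have hr1 : ‖((1 + r : ℕ) : ℚ_[p])‖ = 1 := by
    have : ¬ (p : ℤ) ∣ ((1 + r : ℕ) : ℤ) := by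
      intro h
      have := Int.le_of_dvd (by positivity) h
      omega
    rw [← Padic.norm_intCast_lt_one_iff] at this
    push Not at this
    exact_mod_cast le_antisymm (Padic.norm_int_le_one _) this
  have h41 : ‖(4 : ℚ_[p])‖ = 1 := by
    have : ¬ (p : ℤ) ∣ 4 := by
      intro h
      have := Int.le_of_dvd (by positivity) h
      omega
    rw [← Padic.norm_intCast_lt_one_iff] at this
    push Not at this
    exact_mod_cast le_antisymm (Padic.norm_int_le_one _) this
  have hmain : (1 - 4 * (((3 * N - 1 : ℕ) : ℚ) + 1)) = -(p : ℚ) := by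
    rw [hpN, Nat.cast_sub (by omega), Nat.cast_sub (by omega)]; push_cast; ring
  push_cast
  have hmain2 : (1 - 4 * (((3 * N - 1 : ℕ) : ℚ_[p]) + 1)) = -(p : ℚ_[p]) := by exact_mod_cast congrArg (fun q : ℚ => (q : ℚ_[p])) hmain
  have hx : ‖4 * (1 + (r : ℚ_[p])) * (1 - 4 * (((3 * N - 1 : ℕ) : ℚ_[p]) + 1))⁻¹ ^ (1 + r + 1)‖ = (p : ℝ) ^ (r + 2) := by
    push_cast at hr1
    rw [hmain2, norm_mul, norm_mul, h41, hr1, norm_pow, norm_inv, norm_neg, Padic.norm_p, inv_inv, one_mul, one_mul]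
    congr 1; ring
  have hy : ‖∑ x ∈ (range ((-(-((14 * (N : ℤ) - 2) / 4))).toNat)).erase (3 * N - 1),
      4 * (1 + (r : ℚ_[p])) * (1 - 4 * ((x : ℚ_[p]) + 1))⁻¹ ^ (1 + r + 1)‖ ≤ 1 := by
    apply IsUltrametricDist.norm_sum_le_of_forall_le_of_nonneg zero_le_one
    intro v hv
    rw [mem_erase, mem_range] at hv
    have h3 := norm_inv_int_le_one (p := p) (1 - 4 * ((v : ℤ) + 1)) (by
      rintro ⟨q, hq⟩
      have hq0 : q < 0 := by
        by_contra hq0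
        have : (0 : ℤ) ≤ p * q := mul_nonneg (by positivity) (by omega)
        omega
      have hq1 : -2 < q := by
        by_contra hq1
        have : (p : ℤ) * q ≤ p * (-2) := mul_le_mul_of_nonneg_left (by omega) (by positivity)
        omega
      have : q = -1 := by omega
      subst this
      omega)
    push_cast at h3 hr1
    rw [norm_mul, norm_mul, norm_pow, h41, hr1, one_mul, one_mul]
    exact pow_le_one₀ (norm_nonneg _) h3
  rw [IsUltrametricDist.norm_add_eq_max_of_norm_ne_norm, hx, max_eq_left]
  · exact hy.trans (one_le_pow₀ hp1.le)
  · rw [hx]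
    exact (lt_of_le_of_lt hy (one_lt_pow₀ hp1 (by omega))).ne'

lemma T_Psi0 (m a b η N p : ℕ) (hN : 1 ≤ N) (hpN : p = 12 * N - 1) :
    Psi (IT N) (nT m a b N) (dT m a b η N) (14 * N - 2) p = 1 - m := by
  unfold Psi
  have e0 : ((14 * N - 2 : ℕ) : ℤ) = 14 * N - 2 := by omega
  have hsub : ({14 * (N : ℤ) - 2, 2 * (N : ℤ) - 1, -(10 * (N : ℤ))} : Finset ℤ) ⊆ IT N := by
    unfold IT
    intro x hx
    rw [e0, mem_Icc]
    simp only [mem_insert, mem_singleton] at hx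
    omega
  rw [← sum_subset hsub]
  · have i1 : (p : ℤ) ∣ 14 * N - 2 - (2 * N - 1) := ⟨1, by omega⟩
    have i2 : (p : ℤ) ∣ 14 * N - 2 - (-(10 * N)) := ⟨2, by omega⟩
    rw [sum_insert, sum_insert, sum_singleton, if_pos i1, if_pos i2, if_pos (by simp)]
    · have a1 : |(14 * (N : ℤ) - 2)| = 14 * N - 2 := abs_of_nonneg (by omega)
      have a2 : |(2 * (N : ℤ) - 1)| = 2 * N - 1 := abs_of_nonneg (by omega)
      have a3 : |(-(10 * (N : ℤ)))| = 10 * N := by rw [abs_neg]; exact abs_of_nonneg (by omega)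
      have d1 : dT m a b η N (14 * (N : ℤ) - 2) = 1 := by unfold dT; rw [if_pos (by omega)]
      have d2 : dT m a b η N (2 * (N : ℤ) - 1) = 0 := by
        unfold dT; rw [if_neg (by omega), if_neg (by omega), df_T, if_neg (by omega)]
      have d3 : dT m a b η N (-(10 * (N : ℤ))) = m + a + (m + b) := by
        unfold dT
        rw [if_neg (by omega), if_neg (by omega), df_T, if_pos (by omega), if_neg (by omega), if_pos (by omega), if_pos (by omega), zero_add]
      have n1 : nT m a b N (14 * (N : ℤ) - 2) = 0 := by rw [nf_T, if_pos (by omega)]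
      have n2 : nT m a b N (2 * (N : ℤ) - 1) = m + (m + a) + (m + b) := by
        rw [nf_T, if_neg (by omega), if_pos (by omega), if_pos (by omega), if_pos (by omega)]
      have n3 : nT m a b N (-(10 * (N : ℤ))) = 0 := by rw [nf_T, if_pos (by omega)]
      rw [d1, d2, d3, n1, n2, n3]
      push_cast
      ring
    · simp; omega
    · simp; omega
  · intro x hx hx2
    rw [if_neg]
    rintro ⟨q, hq⟩
    apply hx2
    unfold IT at hx
    rw [e0, mem_Icc] at hx
    have hq0 : -1 < q := by
      by_contra hq0
      have : (p : ℤ) * q ≤ p * (-1) := mul_le_mul_of_nonneg_left (by omega) (by positivity)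
      omega
    have hq1 : q < 3 := by
      by_contra hq0
      have : (p : ℤ) * 3 ≤ p * q := mul_le_mul_of_nonneg_left (by omega) (by positivity)
      omega
    simp only [mem_insert, mem_singleton]
    have : q = 0 ∨ q = 1 ∨ q = 2 := by omega
    rcases this with rfl | rfl | rfl <;> omega

lemma T_nonvanish (m a b η r N p : ℕ) [hp : Fact p.Prime] (hm : 1 ≤ m) (hba : b ≤ a) (hN : N % 2 = 1) (hpN : p = 12 * N - 1)
    (hr : r + 1 < p) (hmr : m ≤ r + 1) (hmb : m + b ≤ r + 2) (Jq : ℕ → ℚ) (hJ : ∀ k, ‖((Jq k : ℚ) : ℚ_[p])‖ ≤ 1) :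
    Sq (IT N) (nT m a b N) (dT m a b η N) r Jq ≠ 0 := by
  have e0 : ((14 * N - 2 : ℕ) : ℤ) = 14 * N - 2 := by omega
  have hp1 : (1 : ℝ) < p := by exact_mod_cast hp.out.one_lt
  have hp0 : (p : ℝ) ≠ 0 := by positivity
  have hpp : (p : ℤ) = 12 * N - 1 := by omega
  have hN1 : (1 : ℤ) ≤ N := by omega
  have hsq : 2 * (14 * (N : ℤ) - 2) < (p : ℤ) ^ (1 + 1) := by
    rw [hpp, show (12 * (N : ℤ) - 1) ^ (1 + 1) = 144 * (N * N) - 24 * N + 1 by ring]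
    nlinarith
  have hI : ∀ e ∈ IT N, ∀ x ∈ IT N, |e - x| < (p : ℤ) ^ (1 + 1) := by
    intro e he x hx
    unfold IT at he hx
    apply abs_sub_lt' he hx
    rw [e0]
    linarith
  have hmem : (14 * (N : ℤ) - 2) ∈ IT N := by unfold IT; rw [e0, mem_Icc]; omega
  have hd1 : dT m a b η N (14 * N - 2) = 1 := by
    unfold dT
    rw [if_pos (by rw [e0]; exact abs_of_nonneg (by omega))]
  have hn1 : ∀ e : ℤ, 2 ∣ e → nT m a b N e = 0 := by
    intro e he
    by_contra h
    exact nT_odd m a b N e h he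
  have hac : ‖(acoef (IT N) (nT m a b N) (dT m a b η N) (14 * N - 2) 1 : ℚ_[p])‖ = (p : ℝ) ^ (-(m : ℤ)) := by
    unfold acoef
    rw [hd1, Bser_norm0 _ _ _ _ hmem (hn1 _ (by omega)) 1 (hI _ hmem), hd1, sum_range_one, zero_add, pow_one, T_Psi0 m a b η N p (by omega) hpN]
    congr 1; push_cast; ring
  have hmono : ∀ u v : ℤ, u ≤ v → (p : ℝ) ^ u ≤ (p : ℝ) ^ v := fun u v h => zpow_le_zpow_right₀ hp1.le h
  apply Sq_ne_zero (p := p) _ _ _ r Jq hJ (14 * N - 2) hmem hd1 ((p : ℝ) ^ ((r : ℤ) + 2 - m)) ((p : ℝ) ^ ((r : ℤ) + 1 - m)) (by positivity)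
    (zpow_lt_zpow_right₀ hp1 (by omega))
  · rw [hac, T_H0 N r p hN hpN hr, ← zpow_natCast, ← zpow_add₀ hp0]
    congr 1; push_cast; ring
  · rw [hac]; exact hmono _ _ (by omega)
  · intro e he hne i hi
    rw [mem_Icc] at hi
    have he2 : 2 ∣ e := dT_even m a b η N hm e (by omega)
    have hB1 : (1 : ℝ) ≤ (p : ℝ) ^ ((r : ℤ) + 1 - m) := by
      rw [← zpow_zero (p : ℝ)]; exact hmono _ _ (by omega)
    have heL : |e| ≤ 14 * N - 2 := by
      unfold IT at he
      rw [mem_Icc, e0] at he; exact abs_le.2 he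
    by_cases hal : |e| + ((14 * N - 2 : ℕ) : ℤ) < 2 * p
    · obtain ⟨q1, q2⟩ := T_alone m a b η N (by omega) p (by omega) e he he2 hm hal
      have h1 := acoef_norm_one (p := p) (IT N) (nT m a b N) (dT m a b η N) e q2 i
      exact ⟨h1.trans hB1, (mul_le_one₀ h1 (norm_nonneg _) (q1 _)).trans hB1⟩
    · have hPsi := T_Psi_le m a b η N hm (by omega) p e (by omega) (by omega) he2
      have h3 := chi_le ((14 * N - 2 + e) / p)
      have h3' := chi_le ((14 * N - 2 - e) / p)
      have hm0 : (0 : ℤ) ≤ m := by positivity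
      have ha0 : (0 : ℤ) ≤ a := by positivity
      have hb0 : (0 : ℤ) ≤ b := by positivity
      obtain ⟨t1, t2, t3⟩ := T_big N p e (by omega) (by omega) heL (by omega)
      have hA := acoef_norm (p := p) (IT N) (nT m a b N) (dT m a b η N) e he (hn1 e he2) 1 (hI e he) i hi.2
      rw [sum_range_one, zero_add, pow_one] at hA
      rw [t1] at hPsi
      by_cases hsp : |e| ≠ 14 * N - 2 ∧ |e| ≠ 10 * N
      · rw [t3 (Or.inr ⟨hpp, hsp⟩)] at hPsi
        have hPs : Psi (IT N) (nT m a b N) (dT m a b η N) e p ≤ b - m - a := by nlinarith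
        have hH := Hq_norm (p := p) (i + r) 1 e he2 (by linarith)
        constructor
        · exact hA.trans (hmono _ _ (by push_cast; omega))
        · refine (mul_le_mul hA hH (norm_nonneg _) (by positivity)).trans ?_
          rw [pow_one, ← zpow_natCast, ← zpow_add₀ hp0]
          exact hmono _ _ (by push_cast; omega)
      · have hPs : Psi (IT N) (nT m a b N) (dT m a b η N) e p ≤ b := by nlinarith
        have hHi : ‖((Hq (i + r) e : ℚ) : ℚ_[p])‖ ≤ 1 := by
          apply Hq_int _ e he2
          rintro z hz1 hz2 ⟨q, hq⟩
          have hq0 : -2 < q := by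
            by_contra hq0
            have : (p : ℤ) * q ≤ p * (-2) := mul_le_mul_of_nonneg_left (by omega) (by positivity)
            rcases abs_cases e with h5 | h5 <;> omega
          have hq1 : q < 2 := by
            by_contra hq0
            have : (p : ℤ) * 2 ≤ p * q := mul_le_mul_of_nonneg_left (by omega) (by positivity)
            rcases abs_cases e with h5 | h5 <;> omega
          have : q = 0 ∨ q = 1 ∨ q = -1 := by omega
          rcases this with rfl | rfl | rfl <;> rcases abs_cases e with h5 | h5 <;> omega
        have hA2 := hA.trans (hmono _ ((r : ℤ) + 1 - m) (by push_cast; omega))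
        exact ⟨hA2, (mul_le_of_le_one_right (norm_nonneg _) hHi).trans hA2⟩

lemma T_sum0 (m a b N : ℕ) (hN : 1 ≤ N) :
    ∑ x ∈ IT N, (df (wT m a b) (ellT N) x : ℤ) - ∑ x ∈ IT N, (nT m a b N x : ℤ) = 3 * m + a + b := by
  have key : ∀ ℓ : ℕ, ℓ ≤ 14 * N - 2 → 2 ∣ ℓ → ∑ x ∈ IT N, (if |x| ≤ (ℓ : ℤ) then chi x else 0) = 1 := by
    intro ℓ h1 h2
    have h := alt_sum ℓ (14 * N - 2) h1 1 0 (by norm_num) (by norm_num) (by norm_num)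
    simp only [one_dvd, if_true, add_zero, sub_zero, Int.ediv_one] at h
    have hc : chi (ℓ : ℤ) = 1 := by unfold chi; rw [if_pos (by omega)]
    rw [hc] at h
    unfold IT
    omega
  have k1 := key (6 * N) (by omega) (by omega)
  have k2 := key (10 * N) (by omega) (by omega)
  have k3 := key (14 * N - 2) (by omega) (by omega)
  rw [← sum_sub_distrib]
  have : ∀ x ∈ IT N, (df (wT m a b) (ellT N) x : ℤ) - (nT m a b N x : ℤ) =
      m * (if |x| ≤ ((6 * N : ℕ) : ℤ) then chi x else 0) + (m + a) * (if |x| ≤ ((10 * N : ℕ) : ℤ) then chi x else 0)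
      + (m + b) * (if |x| ≤ ((14 * N - 2 : ℕ) : ℤ) then chi x else 0) := by
    intro x _
    rw [df_T, nf_T]
    unfold chi
    push_cast
    split_ifs <;> push_cast <;> ring
  rw [sum_congr rfl this, sum_add_distrib, sum_add_distrib, ← mul_sum, ← mul_sum, ← mul_sum, k1, k2, k3]
  ring

lemma T_sum1 (m a b η N : ℕ) (hm : 1 ≤ m) (hη : η ≤ 1) (hN : 1 ≤ N) :
    ∑ x ∈ IT N, (dT m a b η N x : ℤ) + 2 * (m + b - 1) + η = ∑ x ∈ IT N, (df (wT m a b) (ellT N) x : ℤ) := by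
  have e0 : ((14 * N - 2 : ℕ) : ℤ) = 14 * N - 2 := by omega
  have : ∀ x ∈ IT N, (df (wT m a b) (ellT N) x : ℤ) = (dT m a b η N x : ℤ) + (if x = 14 * (N : ℤ) - 2 then ((m : ℤ) + b - 1) else 0)
     + (if x = -(14 * (N : ℤ) - 2) then ((m : ℤ) + b - 1) else 0) + (if x = 0 then (η : ℤ) else 0) := by
    intro x _
    have c0 : ∀ y : ℤ, |y| = 14 * N - 2 → df (wT m a b) (ellT N) y = m + b := by
      intro y hy
      rw [df_T, if_pos (by rcases abs_cases y with h | h <;> omega), if_neg (by omega), if_neg (by omega), if_pos (by omega)]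
      omega
    have c1 : df (wT m a b) (ellT N) 0 = 3 * m + a + b := by
      rw [df_T, if_pos (by omega), abs_zero, if_pos (by omega), if_pos (by omega), if_pos (by omega)]; ring
    unfold dT
    rw [e0]
    by_cases h1 : |x| = 14 * N - 2
    · rw [if_pos h1, c0 x h1, if_neg (show ¬ x = 0 by rcases abs_cases x with h | h <;> omega)]
      rcases abs_cases x with h | h
      · rw [if_pos (by omega), if_neg (by omega)]; push_cast; ring
      · rw [if_neg (by omega), if_pos (by omega)]; push_cast; ring
    · rw [if_neg h1, if_neg (show ¬ x = 14 * (N : ℤ) - 2 by rcases abs_cases x with h | h <;> omega),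
        if_neg (show ¬ x = -(14 * (N : ℤ) - 2) by rcases abs_cases x with h | h <;> omega)]
      by_cases h2 : x = 0
      · rw [if_pos h2, if_pos h2, h2, c1]; omega
      · rw [if_neg h2, if_neg h2]; omega
  rw [sum_congr rfl this, sum_add_distrib, sum_add_distrib, sum_add_distrib, sum_ite_eq', sum_ite_eq', sum_ite_eq']
  rw [if_pos (by unfold IT; rw [mem_Icc]; omega), if_pos (by unfold IT; rw [mem_Icc]; omega), if_pos (by unfold IT; rw [mem_Icc]; omega)]
  ring

lemma T_deg (m a b η N : ℕ) (hm : 1 ≤ m) (hη : η ≤ 1) (hba : b ≤ a) (hN : 1 ≤ N) :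
    ∑ x ∈ IT N, nT m a b N x + 2 ≤ ∑ x ∈ IT N, dT m a b η N x ∧
    (∑ x ∈ IT N, nT m a b N x + ∑ x ∈ IT N, dT m a b η N x) % 2 = (3 * m + a + b + η) % 2 := by
  have h0 := T_sum0 m a b N hN
  have h1 := T_sum1 m a b η N hm hη hN
  have h2 : ((∑ x ∈ IT N, nT m a b N x : ℕ) : ℤ) = ∑ x ∈ IT N, (nT m a b N x : ℤ) := by push_cast; rfl
  have h3 : ((∑ x ∈ IT N, dT m a b η N x : ℕ) : ℤ) = ∑ x ∈ IT N, (dT m a b η N x : ℤ) := by push_cast; rfl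
  omega

lemma dT_neg (m a b η N : ℕ) (x : ℤ) : dT m a b η N (-x) = dT m a b η N x := by
  unfold dT
  simp only [df_T, abs_neg, dvd_neg, neg_eq_zero]

lemma nT_neg (m a b N : ℕ) (x : ℤ) : nT m a b N (-x) = nT m a b N x := by
  simp only [nf_T, abs_neg, dvd_neg]

lemma IT_neg (N : ℕ) (x : ℤ) : x ∈ IT N ↔ -x ∈ IT N := by
  unfold IT; rw [mem_Icc, mem_Icc]; omega

/-- wrong parity coefficient sums vanish -/
lemma parity_vanish (I : Finset ℤ) (n d : ℤ → ℕ) (hI : ∀ x, x ∈ I ↔ -x ∈ I)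
    (hn : ∀ x, n (-x) = n x) (hd : ∀ x, d (-x) = d x) (i k : ℕ) (hpar : (∑ x ∈ I, n x + ∑ x ∈ I, d x + i) % 2 = 1) :
    ∑ e ∈ I, (if i ≤ d e then acoef I n d e i * eps e ^ k else 0) = 0 := by
  have h : ∑ e ∈ I, (if i ≤ d e then acoef I n d e i * eps e ^ k else 0) =
      ∑ e ∈ I, -(if i ≤ d e then acoef I n d e i * eps e ^ k else 0) := by
    apply sum_bij (fun e _ => -e)
    · intro e he; exact (hI e).1 he
    · intro x _ y _ h; simpa using h
    · intro y hy; exact ⟨-y, (hI y).1 hy, by simp⟩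
    · intro e he
      rw [hd]
      split_ifs with h1
      · rw [acoef_neg I n d hI hn hd e he i h1, Odd.neg_one_pow (Nat.odd_iff.2 hpar)]
        have : eps (-e) = eps e := by unfold eps; simp
        rw [this]; ring
      · simp
  rw [sum_neg_distrib] at h
  linarith

lemma T_rational (m a b η N r : ℕ) (hm : 1 ≤ m) (hη : η ≤ 1) (hba : b ≤ a) (hN : 1 ≤ N) (Jq : ℕ → ℚ)
    (hJ : ∀ i, 1 ≤ i → Jv (i + r) = (Jq (i + r) : ℚ_[2]) ∨ (Jq (i + r) = 0 ∧ (3 * m + a + b < i ∨ (3 * m + a + b + η + i) % 2 = 1 ∨ (i = 1 ∧ r % 2 = 1)))) :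
    HasV (fun t => PowerSeries.coeff r (Rser (IT N) (nT m a b N) (dT m a b η N) (1 + 4 * (t : ℚ_[2]))))
      ((Sq (IT N) (nT m a b N) (dT m a b η N) r Jq : ℚ) : ℚ_[2]) := by
  obtain ⟨hdeg, hpar⟩ := T_deg m a b η N hm hη hba hN
  have h := S_formula (IT N) (nT m a b N) (dT m a b η N) (by omega) (dT_even m a b η N hm) r
  rwa [S_rational (IT N) (nT m a b N) (dT m a b η N) r Jq] at h
  intro i hi
  rcases hJ i hi with h1 | ⟨h1, h2⟩
  · exact Or.inl h1
  · refine Or.inr ⟨h1, ?_⟩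
    rcases h2 with h2 | h2 | ⟨rfl, h2⟩
    · apply sum_eq_zero
      intro e _
      rw [if_neg]
      have := dT_le_D m a b η N hm e
      omega
    · exact parity_vanish _ _ _ (IT_neg N) (nT_neg m a b N) (dT_neg m a b η N) i _ (by omega)
    · refine Eq.trans (sum_congr rfl ?_) (residue_sum (IT N) (nT m a b N) (dT m a b η N) hdeg)
      intro e _
      have : eps e ^ (1 + r) = 1 := by
        unfold eps
        split_ifs
        · simp
        · exact Even.neg_one_pow (Nat.even_iff.2 (by omega))
      rw [this, mul_one]

lemma T_two (m a b η r x : ℕ) (hm : 1 ≤ m) (hx : 1 ≤ x) {S : ℚ_[2]}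
    (hS : HasV (fun t => PowerSeries.coeff r (Rser (IT (5 * x)) (nT m a b (5 * x)) (dT m a b η (5 * x)) (1 + 4 * (t : ℚ_[2])))) S) :
    ‖S‖ ≤ 2 ^ (4 * (m + b)) * ((280 * x : ℕ) : ℝ) ^ (r + 1 + (3 * m + a + b)) * ((2⁻¹ : ℝ) ^ (20 * (15 * m + 5 * a + 7 * b))) ^ x := by
  obtain ⟨L, hL⟩ : ∃ L, L = 14 * (5 * x) - 2 := ⟨_, rfl⟩
  obtain ⟨M, hM⟩ : ∃ M, M = Nat.clog 2 (2 * L + 1) := ⟨_, rfl⟩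
  have hM1 : 2 * L + 1 ≤ 2 ^ M := by rw [hM]; exact Nat.le_pow_clog (by norm_num) _
  have hM2 : 2 ^ (M - 1) < 2 * L + 1 := by
    rw [hM]
    exact Nat.pow_pred_clog_lt_self (by norm_num) (by omega)
  have hM3 : 2 ≤ M := by
    by_contra h
    have : 2 ^ M ≤ 2 ^ 1 := Nat.pow_le_pow_right (by norm_num) (by omega)
    omega
  obtain ⟨m', rfl⟩ := Nat.exists_eq_add_of_le' hM3
  have hY : 2 ^ (m' + 2) ≤ 280 * x := by
    rw [show m' + 2 = (m' + 2 - 1) + 1 by omega, pow_succ]; omega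
  have hG := G_bound (wT m a b) (ellT (5 * x)) (14 * (5 * x) - 2) (ellT_le (5 * x) (by omega)) (m' + 2) (by omega) (by rw [← hL]; exact hM1)
    (nT m a b (5 * x)) (fun _ => le_rfl)
  have h := S_bound (IT (5 * x)) (nT m a b (5 * x)) (dT m a b η (5 * x)) (dT_even m a b η _ hm) m' r _
    (fun t y => gg (m' + 2) (1 + 4 * t - y)) (fun t y => gg_le _ _) (fun t y => gg_dvd _ _) hG hS
  obtain ⟨G, hGd⟩ : ∃ G, G = ∑ k, wT m a b k * (2 * ellT (5 * x) k - (m' + 2)) := ⟨_, rfl⟩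
  rw [← hGd] at h
  have hGl : 20 * (15 * m + 5 * a + 7 * b) * x ≤ G + (3 * m + a + b) * (m' + 2) + 4 * (m + b) := by
    rw [hGd, Fin.sum_univ_three]
    simp only [wT, ellT, Matrix.cons_val_zero, Matrix.cons_val_one, Matrix.cons_val]
    obtain ⟨u1, hu1⟩ : ∃ u, u = 2 * (6 * (5 * x)) - (m' + 2) := ⟨_, rfl⟩
    obtain ⟨u2, hu2⟩ : ∃ u, u = 2 * (10 * (5 * x)) - (m' + 2) := ⟨_, rfl⟩
    obtain ⟨u3, hu3⟩ : ∃ u, u = 2 * (14 * (5 * x) - 2) - (m' + 2) := ⟨_, rfl⟩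
    rw [← hu1, ← hu2, ← hu3]
    have g1 : 60 * x ≤ u1 + (m' + 2) := by omega
    have g2 : 100 * x ≤ u2 + (m' + 2) := by omega
    have g3 : 140 * x ≤ u3 + (m' + 2) + 4 := by omega
    nlinarith [Nat.mul_le_mul_left m g1, Nat.mul_le_mul_left (m + a) g2, Nat.mul_le_mul_left (m + b) g3]
  refine h.trans ?_
  have hYr : (2 : ℝ) ^ (m' + 2) ≤ ((280 * x : ℕ) : ℝ) := by exact_mod_cast hY
  have s1 : (2 : ℝ) ^ (m' + 1 + (m' + 2) * r) ≤ ((280 * x : ℕ) : ℝ) ^ (r + 1) := by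
    calc (2 : ℝ) ^ (m' + 1 + (m' + 2) * r) ≤ 2 ^ ((m' + 2) * (r + 1)) := pow_le_pow_right₀ (by norm_num) (by nlinarith)
      _ = (2 ^ (m' + 2)) ^ (r + 1) := pow_mul _ _ _
      _ ≤ _ := pow_le_pow_left₀ (by positivity) hYr _
  have s2 : (2⁻¹ : ℝ) ^ G ≤ 2 ^ (4 * (m + b)) * ((280 * x : ℕ) : ℝ) ^ (3 * m + a + b) * ((2⁻¹ : ℝ) ^ (20 * (15 * m + 5 * a + 7 * b))) ^ x := by
    calc (2⁻¹ : ℝ) ^ G = 2 ^ (4 * (m + b)) * (2 ^ (m' + 2)) ^ (3 * m + a + b) * (2⁻¹) ^ (G + (3 * m + a + b) * (m' + 2) + 4 * (m + b)) := by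
          rw [← pow_mul, pow_add, pow_add, mul_comm (m' + 2), inv_pow, inv_pow, inv_pow]
          field_simp
      _ ≤ 2 ^ (4 * (m + b)) * ((280 * x : ℕ) : ℝ) ^ (3 * m + a + b) * (2⁻¹) ^ (20 * (15 * m + 5 * a + 7 * b) * x) := by
          apply mul_le_mul
          · exact mul_le_mul_of_nonneg_left (pow_le_pow_left₀ (by positivity) hYr _) (by positivity)
          · exact pow_le_pow_of_le_one (by norm_num) (by norm_num) hGl
          · positivity
          · positivity
      _ = _ := by rw [pow_mul _ _ x]
  calc _ ≤ ((280 * x : ℕ) : ℝ) ^ (r + 1) * (2 ^ (4 * (m + b)) * ((280 * x : ℕ) : ℝ) ^ (3 * m + a + b) * ((2⁻¹ : ℝ) ^ (20 * (15 * m + 5 * a + 7 * b))) ^ x) :=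
        mul_le_mul s1 s2 (by positivity) (by positivity)
    _ = _ := by rw [pow_add _ (r + 1)]; ring

lemma T_delta (m a b r x : ℕ) (hx : 1 ≤ x) (C B : ℝ) (hC : 0 < C) (hB : 0 < B) (hp : ∀ n, (primorial n : ℝ) ≤ C * B ^ n) :
    (DeltaT m a b r x : ℝ) ≤ ((280 * x : ℕ) : ℝ) ^ (2 * (r + 1 + (3 * m + a + b)) + (3 * m + a + b + r + 1) * Nat.sqrt (280 * x)) *
      C ^ (r + 1 + b + (m + a) + 2 * m) *
      (B ^ (70 * (r + 1 + b - (m + a)) + 60 * (r + 1 + b - (r + 1 + b - (m + a))) + 50 * (m + a) + 24 * m)) ^ x := by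
  unfold DeltaT
  obtain ⟨c7, h7⟩ : ∃ c, c = r + 1 + b - (m + a) := ⟨_, rfl⟩
  obtain ⟨c6, h6⟩ : ∃ c, c = r + 1 + b - c7 := ⟨_, rfl⟩
  obtain ⟨F, hF⟩ : ∃ F, F = 3 * m + a + b + r + 1 := ⟨_, rfl⟩
  obtain ⟨R, hR⟩ : ∃ R, R = r + 1 + (3 * m + a + b) := ⟨_, rfl⟩
  rw [← h7, ← h6, ← hF, ← hR]
  have q1 : smallD (2 * (14 * (5 * x) - 2)) F ≤ (280 * x) ^ (F * Nat.sqrt (280 * x)) := by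
    refine (smallD_le _ F (by omega)).trans ?_
    calc _ ≤ (280 * x) ^ (F * Nat.sqrt (2 * (14 * (5 * x) - 2))) := Nat.pow_le_pow_left (by omega) _
      _ ≤ _ := Nat.pow_le_pow_right (by omega) (Nat.mul_le_mul_left _ (Nat.sqrt_le_sqrt (by omega)))
  have q2 : ((4 * (5 * x) - 1) * (8 * (5 * x) - 1)) ^ R ≤ (280 * x) ^ (2 * R) := by
    rw [pow_mul]
    apply Nat.pow_le_pow_left
    rw [pow_two]
    exact Nat.mul_le_mul (by omega) (by omega)
  have q3 : ∀ k c : ℕ, (primorial (k * x) : ℝ) ^ c ≤ C ^ c * (B ^ (k * c)) ^ x := by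
    intro k c
    calc (primorial (k * x) : ℝ) ^ c ≤ (C * B ^ (k * x)) ^ c := pow_le_pow_left₀ (by positivity) (hp _) _
      _ = _ := by rw [mul_pow, ← pow_mul, ← pow_mul]; congr 2; ring
  have q1r : (smallD (2 * (14 * (5 * x) - 2)) F : ℝ) ≤ ((280 * x : ℕ) : ℝ) ^ (F * Nat.sqrt (280 * x)) := by exact_mod_cast q1
  have q2r : ((((4 * (5 * x) - 1) * (8 * (5 * x) - 1)) ^ R : ℕ) : ℝ) ≤ ((280 * x : ℕ) : ℝ) ^ (2 * R) := by exact_mod_cast q2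
  have e1 : r + 1 + b + (m + a) + 2 * m = c7 + c6 + (m + a) + 2 * m := by omega
  rw [e1, Nat.cast_mul, Nat.cast_mul, Nat.cast_mul, Nat.cast_mul, Nat.cast_mul, Nat.cast_pow (primorial _), Nat.cast_pow (primorial _), Nat.cast_pow (primorial _), Nat.cast_pow (primorial _)]
  calc _ ≤ (((280 * x : ℕ) : ℝ) ^ (F * Nat.sqrt (280 * x)) * ((280 * x : ℕ) : ℝ) ^ (2 * R)) *
      ((C ^ c7 * (B ^ (70 * c7)) ^ x) * (C ^ c6 * (B ^ (60 * c6)) ^ x) * (C ^ (m + a) * (B ^ (50 * (m + a))) ^ x) * (C ^ (2 * m) * (B ^ (12 * (2 * m))) ^ x)) := by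
        apply mul_le_mul (mul_le_mul q1r q2r (by positivity) (by positivity)) _ (by positivity) (by positivity)
        apply mul_le_mul _ (q3 _ _) (by positivity) (by positivity)
        apply mul_le_mul _ (q3 _ _) (by positivity) (by positivity)
        exact mul_le_mul (q3 _ _) (q3 _ _) (by positivity) (by positivity)
    _ = _ := by
      rw [show 12 * (2 * m) = 24 * m by ring]
      simp only [pow_add, mul_pow]
      ring

lemma T_arch (m a b η r x : ℕ) (hm : 1 ≤ m) (hη : η ≤ 1) (hx : 1 ≤ x) (Jq : ℕ → ℚ) (Jm : ℚ) (hJm : 0 ≤ Jm) (hJ : ∀ k, |Jq k| ≤ Jm) :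
    ((|Sq (IT (5 * x)) (nT m a b (5 * x)) (dT m a b η (5 * x)) r Jq| : ℚ) : ℝ) ≤
      ((3 * m + a + b) * (2 * (3 * m + a + b)) ^ (3 * m + a + b) * 2 ^ (3 * m + a + b + r) * (Jm + 4 * (3 * m + a + b + r))) *
      ((280 * x : ℕ) : ℝ) ^ (2 * (m + b) + 1 + (3 * m + a + b) + 2) := by
  obtain ⟨D, hD⟩ : ∃ D, D = 3 * m + a + b := ⟨_, rfl⟩
  obtain ⟨L, hL⟩ : ∃ L, L = 14 * (5 * x) - 2 := ⟨_, rfl⟩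
  obtain ⟨κ, hκ⟩ : ∃ κ, κ = 2 * (m + b) + 1 := ⟨_, rfl⟩
  have hIT : IT (5 * x) = Icc (-(L : ℤ)) L := by unfold IT; rw [hL]
  have hYn : 2 * L + 1 ≤ 280 * x := by omega
  have hY1 : (1 : ℚ) ≤ ((280 * x : ℕ) : ℚ) := by exact_mod_cast (show 1 ≤ 280 * x by omega)
  have hDle : ∀ e, dT m a b η (5 * x) e ≤ D := by rw [hD]; exact dT_le_D m a b η _ hm
  have hnle : ∀ e, nT m a b (5 * x) e ≤ D := by
    intro e; rw [hD, nf_T]; split_ifs <;> omega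
  have hsum : (∑ y ∈ Icc (-(L : ℤ)) L, nT m a b (5 * x) y + ∑ y ∈ Icc (-(L : ℤ)) L, dT m a b η (5 * x) y) ≤ 2 * D * (280 * x) := by
    have c : (Icc (-(L : ℤ)) L).card = 2 * L + 1 := by rw [Int.card_Icc]; omega
    have t1 := sum_le_card_nsmul (Icc (-(L : ℤ)) L) (nT m a b (5 * x)) D (fun e _ => hnle e)
    have t2 := sum_le_card_nsmul (Icc (-(L : ℤ)) L) (dT m a b η (5 * x)) D (fun e _ => hDle e)
    rw [c, smul_eq_mul] at t1 t2
    have := Nat.mul_le_mul_right D hYn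
    nlinarith
  have hDpos : 1 ≤ D := by omega
  set Y : ℚ := ((280 * x : ℕ) : ℚ) with hYd
  have ha : ∀ e ∈ Icc (-(L : ℤ)) L, ∀ i, 1 ≤ i → i ≤ dT m a b η (5 * x) e →
      |acoef (Icc (-(L : ℤ)) L) (nT m a b (5 * x)) (dT m a b η (5 * x)) e i| ≤ Y ^ κ * (2 * D * Y) ^ D := by
    intro e he i hi1 hi2
    have he2 : 2 ∣ e := dT_even m a b η (5 * x) hm e (by omega)
    have hne : nT m a b (5 * x) e = 0 := by
      by_contra h; exact nT_odd m a b _ e h he2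
    have h := acoef_abs (wT m a b) (ellT (5 * x)) L (by clear * - hL hx; omega) (by rw [hL]; exact ellT_le (5 * x) (by omega)) (ellT_even _)
      (nT m a b (5 * x)) (dT m a b η (5 * x)) (fun _ => 0) (fun y => (if y = (L : ℤ) then m + b else 0) + (if y = -(L : ℤ) then m + b else 0) + (if y = 0 then 1 else 0)) κ
      (fun _ => le_rfl) (by
        intro y
        have hLc : (L : ℤ) = 14 * (5 * x) - 2 := by omega
        unfold dT
        rw [← hL]
        by_cases h1 : |y| = (L : ℤ)
        · rw [if_pos h1, df_T, ← hL]
          rcases abs_cases y with h | h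
          · rw [if_pos (show y = (L : ℤ) by omega)]
            push_cast
            rw [if_neg (show ¬ |y| ≤ 6 * (5 * (x : ℤ)) by omega), if_neg (show ¬ |y| ≤ 10 * (5 * (x : ℤ)) by omega)]
            split_ifs <;> omega
          · rw [if_pos (show y = -(L : ℤ) by omega)]
            push_cast
            rw [if_neg (show ¬ |y| ≤ 6 * (5 * (x : ℤ)) by omega), if_neg (show ¬ |y| ≤ 10 * (5 * (x : ℤ)) by omega)]
            split_ifs <;> omega
        · rw [if_neg h1]
          split_ifs <;> omega) (by
        rw [sum_const_zero, zero_add, sum_add_distrib, sum_add_distrib, sum_ite_eq', sum_ite_eq', sum_ite_eq', hκ]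
        split_ifs <;> omega) e he he2 hne i
    refine h.trans ?_
    apply mul_le_mul
    · apply pow_le_pow_left₀ (by positivity)
      rw [hYd]; exact_mod_cast (show 2 * L ≤ 280 * x by omega)
    · calc _ ≤ (2 * D * Y) ^ (dT m a b η (5 * x) e - i) := by
            apply pow_le_pow_left₀ (by positivity)
            rw [hYd]; exact_mod_cast hsum
        _ ≤ _ := by
            apply pow_le_pow_right₀
            · have : (1 : ℚ) ≤ D := by exact_mod_cast hDpos
              nlinarith
            · have := hDle e; omega
    · positivity
    · positivity
  have h := Sq_abs L (nT m a b (5 * x)) (dT m a b η (5 * x)) r D Jq (Y ^ κ * (2 * D * Y) ^ D) Jm hJm hJ (by positivity) hDle ha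
  rw [hIT]
  have hq : |Sq (Icc (-(L : ℤ)) L) (nT m a b (5 * x)) (dT m a b η (5 * x)) r Jq| ≤
      (D * (2 * D) ^ D * 2 ^ (D + r) * (Jm + 4 * (D + r))) * Y ^ (κ + D + 2) := by
    refine h.trans ?_
    have l1 : (2 * (L : ℚ) + 1) ≤ Y := by rw [hYd]; exact_mod_cast hYn
    have l2 : Jm + 4 * (D + r) * (L + 1) ≤ (Jm + 4 * (D + r)) * Y := by
      have l3 : (L : ℚ) + 1 ≤ Y := by have : (0 : ℚ) ≤ L := by positivity
                                      linarith
      have l4 : Jm ≤ Jm * Y := le_mul_of_one_le_right hJm hY1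
      have l5 : 4 * ((D : ℚ) + r) * (L + 1) ≤ 4 * (D + r) * Y := mul_le_mul_of_nonneg_left l3 (by positivity)
      linarith
    calc _ ≤ Y * (D * (Y ^ κ * (2 * D * Y) ^ D * 2 ^ (D + r) * ((Jm + 4 * (D + r)) * Y))) := by
          apply mul_le_mul l1 _ (by positivity) (by positivity)
          apply mul_le_mul_of_nonneg_left _ (by positivity)
          exact mul_le_mul_of_nonneg_left l2 (by positivity)
      _ = _ := by rw [pow_add, pow_add, mul_pow (2 * (D : ℚ))]; ring
  have hq2 : ((|Sq (Icc (-(L : ℤ)) L) (nT m a b (5 * x)) (dT m a b η (5 * x)) r Jq| : ℚ) : ℝ) ≤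
      (((D * (2 * D) ^ D * 2 ^ (D + r) * (Jm + 4 * (D + r))) * Y ^ (κ + D + 2) : ℚ) : ℝ) := by exact_mod_cast hq
  refine hq2.trans (le_of_eq ?_)
  rw [hYd, hκ, hD]
  push_cast
  ring

lemma theta_lt (ex G : ℕ) (hex : 1 ≤ ex) (h : 5 * ex ≤ 64 * G) :
    (((29536 : ℕ) : ℝ) / (10000 : ℕ)) ^ ex * (2⁻¹ : ℝ) ^ (20 * G) < 1 := by
  have hB : (((29536 : ℕ) : ℝ) / (10000 : ℕ)) ^ 32 < 2 ^ 50 := by norm_num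
  obtain ⟨B, hBd⟩ : ∃ B : ℝ, B = (((29536 : ℕ) : ℝ) / (10000 : ℕ)) := ⟨_, rfl⟩
  rw [← hBd] at hB ⊢
  have hB0 : 0 < B := by rw [hBd]; positivity
  have h1 : (B ^ ex) ^ 32 < (2 ^ (20 * G)) ^ 32 := by
    calc (B ^ ex) ^ 32 = (B ^ 32) ^ ex := by rw [← pow_mul, ← pow_mul, mul_comm]
      _ < (2 ^ 50) ^ ex := pow_lt_pow_left₀ hB (by positivity) (by omega)
      _ = 2 ^ (50 * ex) := by rw [← pow_mul]
      _ ≤ 2 ^ (20 * G * 32) := pow_le_pow_right₀ (by norm_num) (by omega)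
      _ = _ := pow_mul _ _ _
  have h2 := lt_of_pow_lt_pow_left₀ 32 (by positivity) h1
  rw [inv_pow, ← div_eq_mul_inv, div_lt_one (by positivity)]
  exact h2

/-- common denominators and bounds for finitely supported rational sequences -/
lemma common_den (Jq : ℕ → ℚ) (T : ℕ) (hT : ∀ k, T < k → Jq k = 0) :
    ∃ (Q : ℕ) (Jm : ℚ), 1 ≤ Q ∧ 0 ≤ Jm ∧ (∀ k, |Jq k| ≤ Jm) ∧ (∀ k, ∃ z : ℤ, (Q : ℚ) * Jq k = z) := by
  refine ⟨∏ k ∈ range (T + 1), (Jq k).den, ∑ k ∈ range (T + 1), |Jq k|, ?_, ?_, ?_, ?_⟩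
  · exact Finset.prod_pos (fun k _ => (Jq k).den_pos)
  · exact Finset.sum_nonneg (fun k _ => abs_nonneg _)
  · intro k
    by_cases hk : T < k
    · rw [hT k hk, abs_zero]; exact Finset.sum_nonneg (fun k _ => abs_nonneg _)
    · exact Finset.single_le_sum (f := fun k => |Jq k|) (fun k _ => abs_nonneg _) (mem_range.2 (by omega))
  · intro k
    by_cases hk : T < k
    · exact ⟨0, by rw [hT k hk]; simp⟩
    · rw [← Finset.mul_prod_erase (range (T + 1)) _ (mem_range.2 (show k < T + 1 by omega))]
      refine ⟨(∏ x ∈ (range (T + 1)).erase k, (Jq x).den : ℕ) * (Jq k).num, ?_⟩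
      push_cast
      rw [mul_right_comm, mul_comm ((Jq k).den : ℚ) (Jq k), Rat.mul_den_eq_num, mul_comm]

lemma norm_le_of_den {p : ℕ} [hp : Fact p.Prime] (Q : ℕ) (q : ℚ) (z : ℤ) (h : (Q : ℚ) * q = z) :
    ‖((Q * q : ℚ) : ℚ_[p])‖ ≤ 1 ∧ (1 ≤ Q → Q < p → ‖(q : ℚ_[p])‖ ≤ 1) := by
  have h1 : ‖((Q * q : ℚ) : ℚ_[p])‖ ≤ 1 := by
    rw [h, Rat.cast_intCast]; exact Padic.norm_int_le_one _
  refine ⟨h1, fun hQ1 hQ => ?_⟩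
  have h2 : ‖((Q : ℕ) : ℚ_[p])‖ = 1 := by
    have : ¬ (p : ℤ) ∣ (Q : ℤ) := by
      intro h
      have := Int.le_of_dvd (by positivity) h
      omega
    rw [← Padic.norm_intCast_lt_one_iff] at this
    push Not at this
    exact_mod_cast le_antisymm (Padic.norm_int_le_one _) this
  rw [Rat.cast_mul, norm_mul, Rat.cast_natCast, h2, one_mul] at h1
  exact h1

theorem T_main (m a b η r : ℕ) (hm : 1 ≤ m) (hη : η ≤ 1) (hba : b ≤ a) (hmr : m ≤ r + 1) (hmb : m + b ≤ r + 2)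
    (hineq : 5 * (70 * (r + 1 + b - (m + a)) + 60 * (r + 1 + b - (r + 1 + b - (m + a))) + 50 * (m + a) + 24 * m) ≤ 64 * (15 * m + 5 * a + 7 * b)) :
    ∃ i, 1 ≤ i ∧ i ≤ 3 * m + a + b ∧ (3 * m + a + b + η + i) % 2 = 0 ∧ ¬ (i = 1 ∧ r % 2 = 1) ∧ ∀ q : ℚ, Jv (i + r) ≠ (q : ℚ_[2]) := by
  classical
  by_contra hcon
  push Not at hcon
  obtain ⟨D, hD⟩ : ∃ D, D = 3 * m + a + b := ⟨_, rfl⟩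
  let Jq : ℕ → ℚ := fun k => if h : k ≤ D + r ∧ ∃ q : ℚ, Jv k = (q : ℚ_[2]) then h.2.choose else 0
  have hJq0 : ∀ k, D + r < k → Jq k = 0 := by
    intro k hk
    simp only [Jq]
    rw [dif_neg (by omega)]
  have hJq1 : ∀ k, k ≤ D + r → (∃ q : ℚ, Jv k = (q : ℚ_[2])) → Jv k = (Jq k : ℚ_[2]) := by
    intro k hk hq
    simp only [Jq]
    rw [dif_pos ⟨hk, hq⟩]
    exact hq.choose_spec
  have hJq2 : ∀ k, ¬ (∃ q : ℚ, Jv k = (q : ℚ_[2])) → Jq k = 0 := by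
    intro k hq
    simp only [Jq]
    rw [dif_neg (fun h => hq h.2)]
  have hrat : ∀ i, 1 ≤ i → Jv (i + r) = (Jq (i + r) : ℚ_[2]) ∨ (Jq (i + r) = 0 ∧ (3 * m + a + b < i ∨ (3 * m + a + b + η + i) % 2 = 1 ∨ (i = 1 ∧ r % 2 = 1))) := by
    intro i hi
    by_cases h1 : i ≤ D
    · by_cases h2 : ∃ q : ℚ, Jv (i + r) = (q : ℚ_[2])
      · exact Or.inl (hJq1 _ (by omega) h2)
      · refine Or.inr ⟨hJq2 _ h2, ?_⟩
        by_contra h3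
        push Not at h3
        exact h2 (hcon i hi (by omega) (by omega) h3.2.2)
    · exact Or.inr ⟨hJq0 _ (by omega), Or.inl (by omega)⟩
  obtain ⟨Q, Jm, hQ1, hJm0, hJm, hQ⟩ := common_den Jq (D + r) hJq0
  choose z hz using hQ
  obtain ⟨C, hC, hprim⟩ := primorial_bound
  obtain ⟨ex, hex⟩ : ∃ ex, ex = 70 * (r + 1 + b - (m + a)) + 60 * (r + 1 + b - (r + 1 + b - (m + a))) + 50 * (m + a) + 24 * m := ⟨_, rfl⟩
  obtain ⟨G, hG⟩ : ∃ G, G = 15 * m + 5 * a + 7 * b := ⟨_, rfl⟩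
  rw [← hex, ← hG] at hineq
  have hθ := theta_lt ex G (by omega) hineq
  obtain ⟨B, hBd⟩ : ∃ B : ℝ, B = (((29536 : ℕ) : ℝ) / (10000 : ℕ)) := ⟨_, rfl⟩
  rw [← hBd] at hθ
  rw [← hBd] at hprim
  have hB0 : 0 < B := by rw [hBd]; positivity
  obtain ⟨A, hA⟩ : ∃ A : ℝ, A = ((3 * m + a + b) * (2 * (3 * m + a + b)) ^ (3 * m + a + b) * 2 ^ (3 * m + a + b + r) * (Jm + 4 * (3 * m + a + b + r))) := ⟨_, rfl⟩
  have hJmr : (0 : ℝ) ≤ Jm := by exact_mod_cast hJm0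
  have hmr0 : (1 : ℝ) ≤ m := by exact_mod_cast hm
  have hApos : 0 < A := by rw [hA]; positivity
  obtain ⟨E, hE⟩ : ∃ E, E = r + 1 + b + (m + a) + 2 * m := ⟨_, rfl⟩
  have has := asymp (2 ^ (4 * (m + b)) * C ^ E * Q * A) (B ^ ex * (2⁻¹ : ℝ) ^ (20 * G)) 280
    (r + 1 + (3 * m + a + b) + 2 * (r + 1 + (3 * m + a + b)) + (2 * (m + b) + 1 + (3 * m + a + b) + 2)) (3 * m + a + b + r + 1)
    (by have : (0 : ℝ) < Q := by exact_mod_cast hQ1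
        positivity) (by norm_num) (by positivity) hθ
  obtain ⟨x₀, hx₀⟩ := eventually_atTop.1 has
  obtain ⟨p, hpgt, hpp, hpmod⟩ := Nat.forall_exists_prime_gt_and_modEq (60 * x₀ + Q + r + 60) (q := 120) (a := 59) (by norm_num) (by norm_num)
  have hpm : p % 120 = 59 := hpmod
  obtain ⟨x, hx⟩ : ∃ x, p = 60 * x - 1 := ⟨(p + 1) / 60, by omega⟩
  have hx1 : 1 ≤ x := by omega
  have hlt := hx₀ x (by omega)
  have : Fact p.Prime := ⟨hpp⟩
  set Sv := Sq (IT (5 * x)) (nT m a b (5 * x)) (dT m a b η (5 * x)) r Jq with hSv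
  have hS0 : Sv ≠ 0 := T_nonvanish m a b η r (5 * x) p hm hba (by omega) (by omega) (by omega) hmr hmb Jq
    (fun k => (norm_le_of_den (p := p) Q (Jq k) (z k) (hz k)).2 hQ1 (by omega))
  have hHV := T_rational m a b η (5 * x) r hm hη hba (by omega) Jq hrat
  rw [← hSv] at hHV
  have h2 := T_two m a b η r x hm hx1 hHV
  have hΔ := T_delta m a b r x hx1 C B hC hB0 hprim
  have har := T_arch m a b η r x hm hη hx1 Jq Jm hJm0 hJm
  rw [← hA, ← hSv] at har
  rw [← hex, ← hE] at hΔ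
  rw [← hG] at h2
  have hΔ0 : (DeltaT m a b r x : ℚ) ≠ 0 := by
    have : DeltaT m a b r x ≠ 0 := by
      unfold DeltaT
      have k1 := (smallD_pos (2 * (14 * (5 * x) - 2)) (3 * m + a + b + r + 1)).ne'
      have k2 := primorial_pos (70 * x)
      have k3 := primorial_pos (60 * x)
      have k4 := primorial_pos (50 * x)
      have k5 := primorial_pos (12 * x)
      have k6 : (4 * (5 * x) - 1) * (8 * (5 * x) - 1) ≠ 0 := Nat.mul_ne_zero (by omega) (by omega)
      have k7 := pow_ne_zero (r + 1 + (3 * m + a + b)) k6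
      exact Nat.mul_ne_zero (Nat.mul_ne_zero k1 k7) (by positivity)
    exact_mod_cast this
  have hQ0 : (Q : ℚ) ≠ 0 := by exact_mod_cast (show Q ≠ 0 by omega)
  have hpf := prod_formula (DeltaT m a b r x * (Q * Sv)) (mul_ne_zero hΔ0 (mul_ne_zero hQ0 hS0))
    (fun p' hp' hp2 => T_integral m a b η r x hm hx1 Jq Q p' hp2 (fun k => (norm_le_of_den (p := p') Q (Jq k) (z k) (hz k)).1))
  have hn2 : ‖((DeltaT m a b r x * (Q * Sv) : ℚ) : ℚ_[2])‖ ≤ ‖((Sv : ℚ) : ℚ_[2])‖ := by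
    rw [Rat.cast_mul, Rat.cast_mul, norm_mul, norm_mul, Rat.cast_natCast, Rat.cast_natCast]
    have k1 : ‖((DeltaT m a b r x : ℕ) : ℚ_[2])‖ ≤ 1 := by exact_mod_cast Padic.norm_int_le_one (p := 2) (DeltaT m a b r x : ℤ)
    have k2 : ‖((Q : ℕ) : ℚ_[2])‖ ≤ 1 := by exact_mod_cast Padic.norm_int_le_one (p := 2) (Q : ℤ)
    exact (mul_le_of_le_one_left (by positivity) k1).trans (mul_le_of_le_one_left (by positivity) k2)
  have habs : ((|(DeltaT m a b r x * (Q * Sv) : ℚ)| : ℚ) : ℝ) = (DeltaT m a b r x : ℝ) * (Q * ((|Sv| : ℚ) : ℝ)) := by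
    rw [abs_mul, abs_mul, abs_of_nonneg (show (0 : ℚ) ≤ (DeltaT m a b r x : ℚ) by positivity), abs_of_nonneg (show (0 : ℚ) ≤ (Q : ℚ) by positivity)]
    push_cast; rfl
  have hfin := hpf.trans (mul_le_mul_of_nonneg_left (hn2.trans h2) (by positivity))
  have habs' : (|((DeltaT m a b r x * (Q * Sv) : ℚ) : ℝ)| : ℝ) = (DeltaT m a b r x : ℝ) * (Q * ((|Sv| : ℚ) : ℝ)) := by
    rw [← habs, Rat.cast_abs]
  rw [habs'] at hfin
  have hfin2 := hfin.trans (mul_le_mul_of_nonneg_right (mul_le_mul hΔ (mul_le_mul_of_nonneg_left har (by positivity)) (by positivity) (by positivity)) (by positivity))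
  refine absurd (hfin2.trans (le_of_eq ?_)) (not_le.2 hlt)
  clear hfin2 hfin habs habs' hn2 hpf har hΔ h2 hlt
  generalize r + 1 + (3 * m + a + b) = K1
  generalize 2 * (m + b) + 1 + (3 * m + a + b) + 2 = K2
  generalize B ^ ex = Bx
  generalize (2⁻¹ : ℝ) ^ (20 * G) = Gx
  generalize (280 * x).sqrt = sx
  generalize C ^ E = CE
  generalize (2 : ℝ) ^ (4 * (m + b)) = P
  rw [mul_pow]
  simp only [pow_add]
  ring

lemma T_case (s D η r : ℕ) (hη : η ≤ 1) (hD : 3 ≤ D) (h1 : r = s ∧ D ≤ 2 * s + 4 ∧ 2 * s + 3 ≤ D ∨ r = s + 1 ∧ D = 2 * s + 3 ∧ 2 ≤ s) :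
    ∃ i, 1 ≤ i ∧ i ≤ D ∧ (D + η + i) % 2 = 0 ∧ ¬ (i = 1 ∧ r % 2 = 1) ∧ ∀ q : ℚ, Jv (i + r) ≠ q := by
  have key : ∀ m a b : ℕ, 3 * m + a + b = D → b ≤ a → a ≤ 1 → 1 ≤ m → 
      ∃ i, 1 ≤ i ∧ i ≤ D ∧ (D + η + i) % 2 = 0 ∧ ¬ (i = 1 ∧ r % 2 = 1) ∧ ∀ q : ℚ, Jv (i + r) ≠ q := by
    intro m a b hmab hba ha hm
    have hin : 5 * (70 * (r + 1 + b - (m + a)) + 60 * (r + 1 + b - (r + 1 + b - (m + a))) + 50 * (m + a) + 24 * m) ≤ 64 * (15 * m + 5 * a + 7 * b) := by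
      rcases Nat.lt_or_ge (r + 1 + b) (m + a) with h3 | h3
      · obtain rfl : s = 0 := by omega
        omega
      have h4 : r + 1 + b - (r + 1 + b - (m + a)) = m + a := by omega
      rw [h4]
      obtain rfl | rfl : a = 0 ∨ a = 1 := by omega
      · obtain rfl : b = 0 := by omega
        omega
      · obtain rfl | rfl : b = 0 ∨ b = 1 := by omega
        · omega
        · omega
    have := T_main m a b η r hm hη hba (by omega) (by omega) hin
    rw [hmab] at this
    exact this
  rcases (by omega : D % 3 = 0 ∨ D % 3 = 1 ∨ D % 3 = 2) with h | h | h
  · exact key (D / 3) 0 0 (by omega) (by omega) (by omega) (by omega)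
  · exact key (D / 3) 1 0 (by omega) (by omega) (by omega) (by omega)
  · exact key (D / 3) 1 1 (by omega) (by omega) (by omega) (by omega)

lemma zeta_irr (k : ℕ) (hk : 1 ≤ k) (h : ∀ q : ℚ, Jv k ≠ q) :
    ∃ z : ℚ_[2], zeta2Quarter (k + 1) z ∧ ∀ q : ℚ, z ≠ (q : ℚ_[2]) := by
  refine ⟨_, zeta2Quarter_J k hk, fun q hq => h (q * k) ?_⟩
  have hk0 : (k : ℚ_[2]) ≠ 0 := by exact_mod_cast (by omega : k ≠ 0)
  rw [div_eq_iff hk0] at hq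
  rw [hq]; push_cast; rfl

lemma T_all (s δ : ℕ) (hδ : δ ≤ 1) (h : 1 ≤ s ∨ δ = 1) :
    ∃ j : ℕ, s + 3 ≤ j ∧ j ≤ 3 * s + 5 ∧ j % 2 = δ ∧ ∃ z : ℚ_[2], zeta2Quarter j z ∧ ∀ q : ℚ, z ≠ (q : ℚ_[2]) := by
  by_cases h1 : (s + 1) % 2 = δ
  · obtain ⟨i, hi1, hi2, hi3, hi4, hi5⟩ := T_case s (2 * s + 4) 0 s (by omega) (by omega) (by omega)
    exact ⟨i + s + 1, by omega, by omega, by omega, zeta_irr (i + s) (by omega) hi5⟩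
  · by_cases h2 : s % 2 = 1
    · obtain ⟨i, hi1, hi2, hi3, hi4, hi5⟩ := T_case s (2 * s + 3) 0 s (by omega) (by omega) (by omega)
      exact ⟨i + s + 1, by omega, by omega, by omega, zeta_irr (i + s) (by omega) hi5⟩
    · obtain ⟨i, hi1, hi2, hi3, hi4, hi5⟩ := T_case s (2 * s + 3) 1 (s + 1) (by omega) (by omega) (by omega)
      exact ⟨i + (s + 1) + 1, by omega, by omega, by omega, zeta_irr (i + (s + 1)) (by omega) hi5⟩

noncomputable def cnt (L ℓ : ℕ) (R c : ℤ) : ℤ :=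
  ∑ x ∈ Icc (-(L : ℤ)) (L : ℤ), if R ∣ c - x then (if |x| ≤ (ℓ : ℤ) then 1 else 0) else 0

lemma cnt_eq (L ℓ : ℕ) (hℓ : ℓ ≤ L) (P e : ℤ) (hP : 0 < P) :
    cnt L ℓ P e = (ℓ - e) / P + (ℓ + e) / P + 1 := by
  unfold cnt
  set A := ((ℓ : ℤ) + e) / P with hA
  set B := ((ℓ : ℤ) - e) / P with hB
  have hA1 : P * A ≤ ℓ + e := Int.mul_ediv_self_le hP.ne'
  have hA2 : (ℓ : ℤ) + e < P * A + P := by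
    have := Int.lt_ediv_add_one_mul_self ((ℓ : ℤ) + e) hP
    rw [← hA] at this; linarith
  have hB1 : P * B ≤ ℓ - e := Int.mul_ediv_self_le hP.ne'
  have hB2 : (ℓ : ℤ) - e < P * B + P := by
    have := Int.lt_ediv_add_one_mul_self ((ℓ : ℤ) - e) hP
    rw [← hB] at this; linarith
  have hAB : -A ≤ B + 1 := by
    by_contra h
    have : A + B + 2 ≤ 0 := by omega
    nlinarith
  have hc : B + A + 1 = ∑ j ∈ Icc (-A) B, (1 : ℤ) := by
    rw [sum_const, Int.card_Icc]; simp; omega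
  rw [hc]
  rw [← Finset.sum_filter, ← Finset.sum_filter]
  symm
  apply Finset.sum_bij (fun j _ => e + j * P)
  · intro j hj
    rw [mem_Icc] at hj
    have h3 : -(ℓ : ℤ) ≤ e + j * P := by nlinarith
    have h4 : e + j * P ≤ ℓ := by nlinarith
    simp only [mem_filter, mem_Icc, abs_le]
    refine ⟨⟨⟨by omega, by omega⟩, ⟨-j, by ring⟩⟩, by omega, by omega⟩
  · intro a _ b _ hab
    have : a * P = b * P := by linarith
    exact mul_right_cancel₀ hP.ne' this
  · intro x hx
    simp only [mem_filter, mem_Icc, abs_le] at hx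
    obtain ⟨⟨_, j, hj⟩, h3, h4⟩ := hx
    refine ⟨-j, ?_, by linarith⟩
    rw [mem_Icc]
    constructor
    · by_contra hlt
      have : A + 1 ≤ j := by omega
      nlinarith
    · by_contra hlt
      have : j + B + 1 ≤ 0 := by omega
      nlinarith
  · intro j _; rfl

def n3 (M : ℕ) (x : ℤ) : ℕ :=
  if x % 4 = 1 then (if |x| ≤ ((6 * M : ℕ) : ℤ) then 2 else 0) + (if |x| ≤ ((4 * M : ℕ) : ℤ) then 2 else 0) else 0

def d3 (M : ℕ) (x : ℤ) : ℕ :=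
  if 2 ∣ x then (if |x| ≤ ((6 * M : ℕ) : ℤ) then 1 else 0) + (if |x| ≤ ((4 * M : ℕ) : ℤ) then 1 else 0) else 0

noncomputable def I3 (M : ℕ) : Finset ℤ := Icc (-((6 * M : ℕ) : ℤ)) ((6 * M : ℕ) : ℤ)

lemma d3_even (M : ℕ) (x : ℤ) (h : d3 M x ≠ 0) : 2 ∣ x := by
  unfold d3 at h; by_contra h2; rw [if_neg h2] at h; exact h rfl

lemma n3_odd (M : ℕ) (x : ℤ) (h : n3 M x ≠ 0) : ¬ 2 ∣ x := by
  unfold n3 at h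
  intro h2
  rw [if_neg (by omega)] at h; exact h rfl

lemma d3_le (M : ℕ) (x : ℤ) : d3 M x ≤ 2 := by unfold d3; split_ifs <;> omega

/-- contribution of one radius to the count, `A = (ℓ - e)/P`, `B = (ℓ + e)/P`, first zero on the `A` side -/
def h3 (A B : ℤ) : ℤ := A / 2 + B / 2 + 1 - 2 * ((A - 1) / 4 + (B + 1) / 4 + 1)

lemma cnt2 (L ℓ : ℕ) (hℓ : ℓ ≤ L) (P e : ℤ) (hP : 0 < P) :
    cnt L ℓ (2 * P) e = ((ℓ - e) / P) / 2 + ((ℓ + e) / P) / 2 + 1 := by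
  rw [cnt_eq L ℓ hℓ _ e (by omega), Int.ediv_ediv_of_nonneg hP.le, Int.ediv_ediv_of_nonneg hP.le, mul_comm P 2]

lemma cnt4p (L ℓ : ℕ) (hℓ : ℓ ≤ L) (P e : ℤ) (hP : 0 < P) :
    cnt L ℓ (4 * P) (e + P) = ((ℓ - e) / P - 1) / 4 + ((ℓ + e) / P + 1) / 4 + 1 := by
  have h1 : ((ℓ : ℤ) - e) / P - 1 = (ℓ - (e + P)) / P := by
    rw [show (ℓ : ℤ) - (e + P) = (ℓ - e) + P * (-1) by ring, Int.add_mul_ediv_left _ _ hP.ne']; ring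
  have h2 : ((ℓ : ℤ) + e) / P + 1 = (ℓ + (e + P)) / P := by
    rw [show (ℓ : ℤ) + (e + P) = (ℓ + e) + P * 1 by ring, Int.add_mul_ediv_left _ _ hP.ne']
  rw [cnt_eq L ℓ hℓ _ _ (by omega), h1, h2, Int.ediv_ediv_of_nonneg hP.le, Int.ediv_ediv_of_nonneg hP.le, mul_comm P 4]

lemma cnt4m (L ℓ : ℕ) (hℓ : ℓ ≤ L) (P e : ℤ) (hP : 0 < P) :
    cnt L ℓ (4 * P) (e - P) = ((ℓ - e) / P + 1) / 4 + ((ℓ + e) / P - 1) / 4 + 1 := by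
  have h1 : ((ℓ : ℤ) - e) / P + 1 = (ℓ - (e - P)) / P := by
    rw [show (ℓ : ℤ) - (e - P) = (ℓ - e) + P * 1 by ring, Int.add_mul_ediv_left _ _ hP.ne']
  have h2 : ((ℓ : ℤ) + e) / P - 1 = (ℓ + (e - P)) / P := by
    rw [show (ℓ : ℤ) + (e - P) = (ℓ + e) + P * (-1) by ring, Int.add_mul_ediv_left _ _ hP.ne']; ring
  rw [cnt_eq L ℓ hℓ _ _ (by omega), h1, h2, Int.ediv_ediv_of_nonneg hP.le, Int.ediv_ediv_of_nonneg hP.le, mul_comm P 4]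

lemma Psi3_cnt (M : ℕ) (P e z : ℤ) (hP2 : ¬ 2 ∣ P) (he : 2 ∣ e) (hz : z = e + P ∨ z = e - P) (hz4 : z % 4 = 1) :
    Psi (I3 M) (n3 M) (d3 M) e P = cnt (6 * M) (6 * M) (2 * P) e + cnt (6 * M) (4 * M) (2 * P) e
      - 2 * (cnt (6 * M) (6 * M) (4 * P) z + cnt (6 * M) (4 * M) (4 * P) z) := by
  have hc2 : ∀ x : ℤ, 2 * P ∣ e - x ↔ P ∣ e - x ∧ 2 ∣ x := by
    intro x
    have hco : IsCoprime (2 : ℤ) P := (Int.prime_two.coprime_iff_not_dvd).2 hP2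
    constructor
    · intro h
      have h1 : (2 : ℤ) ∣ e - x := (dvd_mul_right 2 P).trans h
      exact ⟨(dvd_mul_left P 2).trans h, by omega⟩
    · rintro ⟨h1, h2⟩
      exact hco.mul_dvd (by omega) h1
  have hc4 : ∀ x : ℤ, 4 * P ∣ z - x ↔ P ∣ e - x ∧ x % 4 = 1 := by
    intro x
    have hco : IsCoprime (4 : ℤ) P := by
      have : IsCoprime (2 : ℤ) P := (Int.prime_two.coprime_iff_not_dvd).2 hP2
      rw [show (4 : ℤ) = 2 * 2 by norm_num]
      exact this.mul_left this
    have hPP : P ∣ z - x ↔ P ∣ e - x := by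
      rcases hz with h | h
      · rw [h, show e + P - x = (e - x) + P by ring, dvd_add_self_right]
      · rw [h, show e - P - x = (e - x) - P by ring, dvd_sub_self_right]
    rw [← hPP]
    constructor
    · intro h
      have h1 : (4 : ℤ) ∣ z - x := (dvd_mul_right 4 P).trans h
      exact ⟨(dvd_mul_left P 4).trans h, by omega⟩
    · rintro ⟨h1, h2⟩
      exact hco.mul_dvd (by omega) h1
  unfold Psi cnt I3
  rw [← sum_add_distrib, ← sum_add_distrib, mul_sum, ← sum_sub_distrib]
  apply sum_congr rfl
  intro x _
  simp only [hc2, hc4, n3, d3]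
  by_cases h1 : P ∣ e - x <;> by_cases h2 : 2 ∣ x <;> by_cases h4 : x % 4 = 1 <;> simp [h1, h2, h4]
  all_goals split_ifs <;> omega

lemma Psi3_eq (M : ℕ) (P e : ℤ) (hP : 0 < P) (hP2 : ¬ 2 ∣ P) (he : 2 ∣ e) :
    ((e + P) % 4 = 1 ∧ Psi (I3 M) (n3 M) (d3 M) e P = h3 ((6 * M - e) / P) ((6 * M + e) / P) + h3 ((4 * M - e) / P) ((4 * M + e) / P)) ∨ 
    ((e - P) % 4 = 1 ∧ Psi (I3 M) (n3 M) (d3 M) e P = h3 ((6 * M + e) / P) ((6 * M - e) / P) + h3 ((4 * M + e) / P) ((4 * M - e) / P)) := by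
  rcases (by omega : (e + P) % 4 = 1 ∨ (e - P) % 4 = 1) with h | h
  · left
    refine ⟨h, ?_⟩
    rw [Psi3_cnt M P e _ hP2 he (Or.inl rfl) h, cnt2 _ _ (by omega) _ _ hP, cnt2 _ _ (by omega) _ _ hP, cnt4p _ _ (by omega) _ _ hP, cnt4p _ _ (by omega) _ _ hP]
    unfold h3
    push_cast
    ring
  · right
    refine ⟨h, ?_⟩
    rw [Psi3_cnt M P e _ hP2 he (Or.inr rfl) h, cnt2 _ _ (by omega) _ _ hP, cnt2 _ _ (by omega) _ _ hP, cnt4m _ _ (by omega) _ _ hP, cnt4m _ _ (by omega) _ _ hP]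
    unfold h3
    push_cast
    ring

lemma h3_le (A B : ℤ) : h3 A B ≤ 2 := by unfold h3; omega

lemma Psi3_le (M : ℕ) (P e : ℤ) (hP : 0 < P) (hP2 : ¬ 2 ∣ P) (he : 2 ∣ e) :
    Psi (I3 M) (n3 M) (d3 M) e P ≤ 4 := by
  rcases Psi3_eq M P e hP hP2 he with ⟨_, h⟩ | ⟨_, h⟩ <;> rw [h]
  · have := h3_le ((6 * M - e) / P) ((6 * M + e) / P)
    have := h3_le ((4 * M - e) / P) ((4 * M + e) / P)
    omega
  · have := h3_le ((6 * M + e) / P) ((6 * M - e) / P)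
    have := h3_le ((4 * M + e) / P) ((4 * M - e) / P)
    omega

lemma ediv_cases (y P : ℤ) (hP : 0 < P) : P * (y / P) ≤ y ∧ y < P * (y / P) + P := by
  refine ⟨Int.mul_ediv_self_le hP.ne', ?_⟩
  have := Int.lt_ediv_add_one_mul_self y hP
  linarith

lemma ediv_eq' (y P k : ℤ) (hP : 0 < P) (h1 : k * P ≤ y) (h2 : y < (k + 1) * P) : y / P = k := by
  apply le_antisymm
  · exact Int.lt_add_one_iff.1 (Int.ediv_lt_of_lt_mul hP h2)
  · exact Int.le_ediv_of_mul_le hP h1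

/-- two consecutive radii with the numerators differing by between `P` and `2P` -/
lemma ediv_diff (y y' P : ℤ) (hP : 0 < P) (h1 : y + P ≤ y') (h2 : y' < y + 2 * P) :
    y' / P = y / P + 1 ∨ y' / P = y / P + 2 := by
  obtain ⟨a1, a2⟩ := ediv_cases y P hP
  rcases lt_or_ge y' (P * (y / P) + 2 * P) with h | h
  · left; exact ediv_eq' _ _ _ hP (by linarith) (by linarith)
  · right; exact ediv_eq' _ _ _ hP (by linarith) (by linarith)

lemma Psi3_mid1 (M : ℕ) (P e : ℤ) (hP : 0 < P) (hP2 : ¬ 2 ∣ P) (he : 2 ∣ e) (h1 : (M : ℤ) < P) (h2 : P ≤ 2 * M) :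
    Psi (I3 M) (n3 M) (d3 M) e P ≤ 2 := by
  have k1 := ediv_diff (4 * M - e) (6 * M - e) P hP (by omega) (by omega)
  have k2 := ediv_diff (4 * M + e) (6 * M + e) P hP (by omega) (by omega)
  rcases Psi3_eq M P e hP hP2 he with ⟨_, h⟩ | ⟨_, h⟩ <;> rw [h] <;> unfold h3
  all_goals
    generalize (6 * (M : ℤ) - e) / P = A2 at *
    generalize (6 * (M : ℤ) + e) / P = B2 at *
    generalize (4 * (M : ℤ) - e) / P = A1 at *
    generalize (4 * (M : ℤ) + e) / P = B1 at *
    omega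

lemma ediv_list (y P : ℤ) (hP : 0 < P) (h1 : -P ≤ y) (h2 : y < 6 * P) :
    (y / P = -1 ∧ y < 0) ∨ (y / P = 0 ∧ 0 ≤ y ∧ y < P) ∨ (y / P = 1 ∧ P ≤ y ∧ y < 2 * P) ∨
    (y / P = 2 ∧ 2 * P ≤ y ∧ y < 3 * P) ∨ (y / P = 3 ∧ 3 * P ≤ y ∧ y < 4 * P) ∨ (y / P = 4 ∧ 4 * P ≤ y ∧ y < 5 * P) ∨
    (y / P = 5 ∧ 5 * P ≤ y ∧ y < 6 * P) := by
  rcases lt_or_ge y 0 with h | h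
  · exact Or.inl ⟨ediv_eq' _ _ _ hP (by linarith) (by linarith), h⟩
  rcases lt_or_ge y P with h3 | h3
  · exact Or.inr (Or.inl ⟨ediv_eq' _ _ _ hP (by linarith) (by linarith), by omega⟩)
  rcases lt_or_ge y (2 * P) with h4 | h4
  · exact Or.inr (Or.inr (Or.inl ⟨ediv_eq' _ _ _ hP (by linarith) (by linarith), by omega⟩))
  rcases lt_or_ge y (3 * P) with h5 | h5
  · exact Or.inr (Or.inr (Or.inr (Or.inl ⟨ediv_eq' _ _ _ hP (by linarith) (by linarith), by omega⟩)))
  rcases lt_or_ge y (4 * P) with h6 | h6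
  · exact Or.inr (Or.inr (Or.inr (Or.inr (Or.inl ⟨ediv_eq' _ _ _ hP (by linarith) (by linarith), by omega⟩))))
  rcases lt_or_ge y (5 * P) with h7 | h7
  · exact Or.inr (Or.inr (Or.inr (Or.inr (Or.inr (Or.inl ⟨ediv_eq' _ _ _ hP (by linarith) (by linarith), by omega⟩)))))
  · exact Or.inr (Or.inr (Or.inr (Or.inr (Or.inr (Or.inr ⟨ediv_eq' _ _ _ hP (by linarith) (by linarith), by omega⟩)))))

/-- needed poles: bounds for the count; here `f = |e|` -/
lemma h3_needed (M P f : ℤ) (hP : 0 < P) (h1 : 2 * M < P) (hf : P < f) (hf2 : f ≤ 6 * M) :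
    h3 ((6 * M + f) / P) ((6 * M - f) / P) + h3 ((4 * M + f) / P) ((4 * M - f) / P) ≤
      if P ≤ 4 * M then 1 else if P ≤ 5 * M then 0 else -1 := by
  have a2 : (6 * M - f) / P = 0 ∨ (6 * M - f) / P = 1 := by
    rcases ediv_list (6 * M - f) P hP (by omega) (by omega) with h | h | h | h | h | h | h <;> omega
  have a1 : (4 * M - f) / P = -1 ∧ 4 * M < f ∨ (4 * M - f) / P = 0 ∧ f ≤ 4 * M := by
    rcases ediv_list (4 * M - f) P hP (by omega) (by omega) with h | h | h | h | h | h | h <;> omega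
  have b2 := ediv_list (6 * M + f) P hP (by omega) (by omega)
  have b1 := ediv_list (4 * M + f) P hP (by omega) (by omega)
  unfold h3
  generalize (6 * M - f) / P = A2 at *
  generalize (6 * M + f) / P = B2 at *
  generalize (4 * M - f) / P = A1 at *
  generalize (4 * M + f) / P = B1 at *
  have A2h : A2 / 2 - 2 * ((A2 + 1) / 4) = 0 := by omega
  have A1h : A1 / 2 - 2 * ((A1 + 1) / 4) = -1 ∧ 4 * M < f ∨ A1 / 2 - 2 * ((A1 + 1) / 4) = 0 ∧ f ≤ 4 * M := by omega
  clear a2 a1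
  generalize A2 / 2 = u2 at *
  generalize (A2 + 1) / 4 = v2 at *
  generalize A1 / 2 = u1 at *
  generalize (A1 + 1) / 4 = v1 at *
  rcases b2 with h | h | h | h | h | h | h <;> obtain ⟨rfl, h⟩ := h <;>
  rcases b1 with h' | h' | h' | h' | h' | h' | h' <;> obtain ⟨rfl, h'⟩ := h' <;> norm_num <;> split_ifs <;> omega

lemma h3_unneeded (M P f : ℤ) (hP : 0 < P) (h1 : 4 * M < P) (hf : -(6 * M) ≤ f) (hf2 : f ≤ 6 * M) :
    h3 ((6 * M + f) / P) ((6 * M - f) / P) + h3 ((4 * M + f) / P) ((4 * M - f) / P) ≤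
      if P ≤ 5 * M then 3 else 2 := by
  have a2 := ediv_list (6 * M - f) P hP (by omega) (by omega)
  have a1 := ediv_list (4 * M - f) P hP (by omega) (by omega)
  have b1 : ((4 * M + f) / P = -1 ∧ 4 * M + f < 0) ∨ 0 ≤ 4 * M + f := by
    rcases ediv_list (4 * M + f) P hP (by omega) (by omega) with h | h | h | h | h | h | h <;> omega
  unfold h3
  generalize (6 * M - f) / P = A2 at *
  generalize (6 * M + f) / P = B2 at *
  generalize (4 * M - f) / P = A1 at *
  generalize (4 * M + f) / P = B1 at *
  have B2h : B2 / 2 + 1 - 2 * ((B2 - 1) / 4 + 1) ≤ 1 := by omega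
  have B1h : B1 / 2 + 1 - 2 * ((B1 - 1) / 4 + 1) ≤ 1 := by omega
  have B1h' : B1 / 2 + 1 - 2 * ((B1 - 1) / 4 + 1) ≤ 0 ∨ 0 ≤ 4 * M + f := by omega
  clear b1
  generalize B2 / 2 = u2 at *
  generalize (B2 - 1) / 4 = v2 at *
  generalize B1 / 2 = u1 at *
  generalize (B1 - 1) / 4 = v1 at *
  rcases a2 with h | h | h | h | h | h | h <;> obtain ⟨rfl, h⟩ := h <;>
  rcases a1 with h' | h' | h' | h' | h' | h' | h' <;> obtain ⟨rfl, h'⟩ := h' <;> norm_num <;> split_ifs <;> omega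

def cost3 (M p : ℕ) : ℕ :=
  if p ≤ M then 6 else if p ≤ 2 * M then 4 else if p ≤ 4 * M then 3 else if p ≤ 5 * M then 2 else if p ≤ 6 * M then 1 else 0

lemma Psi3_needed (M : ℕ) (P e z : ℤ) (hP : 0 < P) (hP2 : ¬ 2 ∣ P) (he : 2 ∣ e) (h1 : 2 * (M : ℤ) < P)
    (he1 : -(6 * (M : ℤ)) ≤ e) (he2 : e ≤ 6 * M) (hz : z % 4 = 1) (hz2 : 0 < z ∧ z < e ∨ e < z ∧ z < 0) (hd : P ∣ e - z) :
    P < 6 * M ∧ Psi (I3 M) (n3 M) (d3 M) e P ≤ if P ≤ 4 * M then 1 else if P ≤ 5 * M then 0 else -1 := by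
  obtain ⟨k, hk⟩ := hd
  have hk2 : ¬ 2 ∣ k := by
    rintro ⟨j, rfl⟩
    have : e - z = 2 * (P * j) := by rw [hk]; ring
    omega
  have hk3 : k < 3 := by
    by_contra h
    have : P * 3 ≤ P * k := mul_le_mul_of_nonneg_left (by omega) hP.le
    omega
  have hk4 : -3 < k := by
    by_contra h
    have : P * k ≤ P * (-3) := mul_le_mul_of_nonneg_left (by omega) hP.le
    omega
  rcases (by omega : k = 1 ∨ k = -1) with rfl | rfl
  · have hf : P < e := by omega
    refine ⟨by omega, ?_⟩
    rcases Psi3_eq M P e hP hP2 he with ⟨h, _⟩ | ⟨_, h⟩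
    · omega
    · rw [h]; exact h3_needed M P e hP h1 hf he2
  · have hf : P < -e := by omega
    refine ⟨by omega, ?_⟩
    rcases Psi3_eq M P e hP hP2 he with ⟨_, h⟩ | ⟨h, _⟩
    · have := h3_needed M P (-e) hP h1 hf (by omega)
      rw [h]
      simpa only [sub_neg_eq_add, ← sub_eq_add_neg] using this
    · omega

lemma Psi3_unneeded (M : ℕ) (P e : ℤ) (hP : 0 < P) (hP2 : ¬ 2 ∣ P) (he : 2 ∣ e) (h1 : 4 * (M : ℤ) < P)
    (he1 : -(6 * (M : ℤ)) ≤ e) (he2 : e ≤ 6 * M)  :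
    Psi (I3 M) (n3 M) (d3 M) e P ≤ if P ≤ 5 * M then 3 else 2 := by
  rcases Psi3_eq M P e hP hP2 he with ⟨_, h⟩ | ⟨_, h⟩
  · have := h3_unneeded M P (-e) hP h1 (by omega) (by omega)
    rw [h]
    simpa only [sub_neg_eq_add, ← sub_eq_add_neg] using this
  · rw [h]; exact h3_unneeded M P e hP h1 he1 he2

lemma T3_mid (M p : ℕ) [hp : Fact p.Prime] (hp2 : p ≠ 2) (e : ℤ) (he : e ∈ I3 M) (he2 : 2 ∣ e) :
    CC p (I3 M) (n3 M) (d3 M) 1 (cost3 M p) e := by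
  have hP : (0 : ℤ) < p := by exact_mod_cast hp.out.pos
  have hP2 : ¬ (2 : ℤ) ∣ (p : ℤ) := by
    have := hp.out.eq_two_or_odd
    omega
  have hI := he
  unfold I3 at hI
  rw [mem_Icc] at hI
  push_cast at hI
  have h4 := Psi3_le M p e hP hP2 he2
  unfold CC
  rcases Nat.lt_or_ge M p with hM1 | hM1
  swap
  · left
    have : cost3 M p = 6 := by unfold cost3; rw [if_pos hM1]
    rw [this]; push_cast; omega
  rcases Nat.lt_or_ge (2 * M) p with hM2 | hM2
  swap
  · left
    have : cost3 M p = 4 := by unfold cost3; rw [if_neg (by omega), if_pos hM2]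
    have h2 := Psi3_mid1 M p e hP hP2 he2 (by omega) (by omega)
    rw [this]; push_cast; omega
  have hc : cost3 M p = if p ≤ 4 * M then 3 else if p ≤ 5 * M then 2 else if p ≤ 6 * M then 1 else 0 := by
    unfold cost3; rw [if_neg (by omega), if_neg (by omega)]
  by_cases hn : ∃ z : ℤ, z % 4 = 1 ∧ (0 < z ∧ z < e ∨ e < z ∧ z < 0) ∧ (p : ℤ) ∣ e - z
  · obtain ⟨z, hz1, hz2, hz3⟩ := hn
    left
    obtain ⟨k1, k2⟩ := Psi3_needed M p e z hP hP2 he2 (by omega) hI.1 hI.2 hz1 hz2 hz3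
    rw [hc]
    split_ifs at k2 ⊢ <;> push_cast <;> omega
  · right
    push Not at hn
    refine ⟨fun k => Hq_int k e he2 (fun z h1 h2 => hn z h1 h2), ?_⟩
    rcases Nat.lt_or_ge (6 * M) p with hM6 | hM6
    · right
      intro x hx hxe hdx hdvd
      have h2x := d3_even M x hdx
      unfold I3 at hx
      rw [mem_Icc] at hx
      push_cast at hx
      obtain ⟨k, hk⟩ := hdvd
      have hk2 : 2 ∣ k := by
        have h5 : (2 : ℤ) ∣ p * k := by omega
        exact (Int.prime_two.dvd_mul.1 h5).resolve_left hP2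
      obtain ⟨j, rfl⟩ := hk2
      have hj : j ≠ 0 := by rintro rfl; omega
      rcases (by omega : 1 ≤ j ∨ j ≤ -1) with h | h
      · have : (p : ℤ) * 2 ≤ p * (2 * j) := mul_le_mul_of_nonneg_left (by omega) hP.le
        omega
      · have : (p : ℤ) * (2 * j) ≤ p * (-2) := mul_le_mul_of_nonneg_left (by omega) hP.le
        omega
    · left
      rw [hc]
      rcases Nat.lt_or_ge (4 * M) p with hM4 | hM4
      · have k := Psi3_unneeded M p e hP hP2 he2 (by omega) hI.1 hI.2
        split_ifs at k ⊢ <;> push_cast <;> omega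
      · rw [if_pos hM4]; push_cast; omega

def Delta3 (M : ℕ) : ℕ := smallD (2 * (6 * M)) 6 *
  (primorial (6 * M) ^ 1 * primorial (5 * M) ^ 1 * primorial (4 * M) ^ 1 * primorial (2 * M) ^ 1 * primorial (1 * M) ^ 2)

lemma Delta3_dvd (M p : ℕ) (hp : p.Prime) : p ^ cost3 M p ∣ Delta3 M := by
  unfold Delta3 cost3
  have k6 : p ≤ 6 * M → p ^ 1 ∣ primorial (6 * M) ^ 1 := prime_pow_dvd_primorial p _ _ hp
  have k5 : p ≤ 5 * M → p ^ 1 ∣ primorial (5 * M) ^ 1 := prime_pow_dvd_primorial p _ _ hp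
  have k4 : p ≤ 4 * M → p ^ 1 ∣ primorial (4 * M) ^ 1 := prime_pow_dvd_primorial p _ _ hp
  have k2 : p ≤ 2 * M → p ^ 1 ∣ primorial (2 * M) ^ 1 := prime_pow_dvd_primorial p _ _ hp
  have k1 : p ≤ M → p ^ 2 ∣ primorial (1 * M) ^ 2 := fun h => prime_pow_dvd_primorial p _ _ hp (by omega)
  apply Dvd.dvd.mul_left
  split_ifs with h1 h2 h3 h4 h5
  · have := mul_dvd_mul (mul_dvd_mul (mul_dvd_mul (mul_dvd_mul (k6 (by omega)) (k5 (by omega))) (k4 (by omega))) (k2 (by omega))) (k1 h1)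
    simpa only [← pow_add] using this
  · have := mul_dvd_mul (mul_dvd_mul (mul_dvd_mul (k6 (by omega)) (k5 (by omega))) (k4 (by omega))) (k2 (by omega))
    exact Dvd.dvd.mul_right (by simpa only [← pow_add] using this) _
  · have := mul_dvd_mul (mul_dvd_mul (k6 (by omega)) (k5 (by omega))) (k4 (by omega))
    exact Dvd.dvd.mul_right (Dvd.dvd.mul_right (by simpa only [← pow_add] using this) _) _
  · have := mul_dvd_mul (k6 (by omega)) (k5 (by omega))
    exact Dvd.dvd.mul_right (Dvd.dvd.mul_right (Dvd.dvd.mul_right (by simpa only [← pow_add] using this) _) _) _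
  · exact Dvd.dvd.mul_right (Dvd.dvd.mul_right (Dvd.dvd.mul_right (Dvd.dvd.mul_right (k6 h5) _) _) _) _
  · simp

lemma T3_integral (M : ℕ) (Jq : ℕ → ℚ) (Q : ℕ)
    (p : ℕ) [hp : Fact p.Prime] (hp2 : p ≠ 2) (hQ : ∀ k, ‖((Q * Jq k : ℚ) : ℚ_[p])‖ ≤ 1) :
    ‖((Delta3 M * (Q * Sq (I3 M) (n3 M) (d3 M) 1 Jq) : ℚ) : ℚ_[p])‖ ≤ 1 := by
  apply Sq_integral (6 * M) (n3 M) (d3 M) (d3_even M) (n3_odd M) 1 Jq Q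
    (Delta3 M) 4 (cost3 M) _ _ _ _ p hp2 hQ
  · intro P e hP hP2 he
    exact Psi3_le M P e hP hP2 he
  · intro p a' hp h1 h2
    have := smallD_dvd (2 * (6 * M)) 6 p a' hp h1 h2
    unfold Delta3
    exact Dvd.dvd.mul_right this _
  · intro p _ hp2 _ _ e he he2 _
    exact T3_mid M p hp2 e he he2
  · intro p hp _ _ _
    exact Delta3_dvd M p hp

lemma T3_delta (M : ℕ) (hM : 1 ≤ M) (C B : ℝ) (hC : 0 < C) (hB : 0 < B) (hp : ∀ n, (primorial n : ℝ) ≤ C * B ^ n) :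
    (Delta3 M : ℝ) ≤ ((12 * M : ℕ) : ℝ) ^ (6 * Nat.sqrt (12 * M)) * C ^ 6 * (B ^ 19) ^ M := by
  unfold Delta3
  have q1 : smallD (2 * (6 * M)) 6 ≤ (12 * M) ^ (6 * Nat.sqrt (12 * M)) := by
    have := smallD_le (2 * (6 * M)) 6 (by omega)
    rwa [show 2 * (6 * M) = 12 * M by ring] at this ⊢
  have q1' : ((smallD (2 * (6 * M)) 6 : ℕ) : ℝ) ≤ ((12 * M : ℕ) : ℝ) ^ (6 * Nat.sqrt (12 * M)) := by exact_mod_cast q1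
  have q3 : ∀ k c : ℕ, (primorial (k * M) : ℝ) ^ c ≤ C ^ c * (B ^ (k * c)) ^ M := by
    intro k c
    calc (primorial (k * M) : ℝ) ^ c ≤ (C * B ^ (k * M)) ^ c := pow_le_pow_left₀ (by positivity) (hp _) _
      _ = _ := by rw [mul_pow, ← pow_mul, ← pow_mul]; congr 2; ring
  rw [Nat.cast_mul, mul_assoc (((12 * M : ℕ) : ℝ) ^ (6 * Nat.sqrt (12 * M)))]
  refine mul_le_mul q1' ?_ (by positivity) (by positivity)
  simp only [Nat.cast_mul, Nat.cast_pow]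
  calc _ ≤ (C ^ 1 * (B ^ (6 * 1)) ^ M) * (C ^ 1 * (B ^ (5 * 1)) ^ M) * (C ^ 1 * (B ^ (4 * 1)) ^ M) * (C ^ 1 * (B ^ (2 * 1)) ^ M) * (C ^ 2 * (B ^ (1 * 2)) ^ M) := by
        refine mul_le_mul (mul_le_mul (mul_le_mul (mul_le_mul (q3 6 1) (q3 5 1) ?_ ?_) (q3 4 1) ?_ ?_) (q3 2 1) ?_ ?_) (q3 1 2) ?_ ?_ <;> positivity
    _ = _ := by
        simp only [← pow_mul]
        ring

lemma cnt_count (L ℓ : ℕ) (R c : ℤ) :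
    cnt L ℓ R c = ((∑ x ∈ Icc (-(L : ℤ)) (L : ℤ), if R ∣ c - x then (if |x| ≤ (ℓ : ℤ) then 1 else 0) else 0 : ℕ) : ℤ) := by
  unfold cnt; push_cast; rfl

lemma T3_deg (M : ℕ) : ∑ x ∈ I3 M, n3 M x + 2 = ∑ x ∈ I3 M, d3 M x ∧ ∑ x ∈ I3 M, d3 M x = 10 * M + 2 := by
  have h1 : ((∑ x ∈ I3 M, d3 M x : ℕ) : ℤ) = cnt (6 * M) (6 * M) 2 0 + cnt (6 * M) (4 * M) 2 0 := by
    unfold cnt I3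
    rw [← sum_add_distrib]
    push_cast
    apply sum_congr rfl
    intro x _
    unfold d3
    have : (2 : ℤ) ∣ 0 - x ↔ 2 ∣ x := by omega
    simp only [this]
    split_ifs <;> simp_all
  have h2 : ((∑ x ∈ I3 M, n3 M x : ℕ) : ℤ) = 2 * (cnt (6 * M) (6 * M) 4 1 + cnt (6 * M) (4 * M) 4 1) := by
    unfold cnt I3
    rw [← sum_add_distrib, mul_sum]
    push_cast
    apply sum_congr rfl
    intro x _
    unfold n3
    have : (4 : ℤ) ∣ 1 - x ↔ x % 4 = 1 := by omega
    simp only [this]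
    split_ifs <;> simp_all
  have c1 := cnt_eq (6 * M) (6 * M) le_rfl 2 0 (by norm_num)
  have c2 := cnt_eq (6 * M) (4 * M) (by omega) 2 0 (by norm_num)
  have c3 := cnt_eq (6 * M) (6 * M) le_rfl 4 1 (by norm_num)
  have c4 := cnt_eq (6 * M) (4 * M) (by omega) 4 1 (by norm_num)
  rw [c1, c2] at h1
  rw [c3, c4] at h2
  generalize ∑ x ∈ I3 M, d3 M x = D at *
  generalize ∑ x ∈ I3 M, n3 M x = N at *
  clear c1 c2 c3 c4
  omega

lemma T3_rational (M : ℕ) (Jq : ℕ → ℚ) (hJ3 : Jv 3 = (Jq 3 : ℚ_[2])) (hJ0 : ∀ k, k ≠ 3 → Jq k = 0) :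
    HasV (fun t => PowerSeries.coeff 1 (Rser (I3 M) (n3 M) (d3 M) (1 + 4 * (t : ℚ_[2]))))
      ((Sq (I3 M) (n3 M) (d3 M) 1 Jq : ℚ) : ℚ_[2]) := by
  obtain ⟨hdeg, _⟩ := T3_deg M
  have h := S_formula (I3 M) (n3 M) (d3 M) (by omega) (d3_even M) 1
  rwa [S_rational (I3 M) (n3 M) (d3 M) 1 Jq] at h
  intro i hi
  by_cases h2 : i = 2
  · subst h2; exact Or.inl hJ3
  · right
    refine ⟨hJ0 _ (by omega), ?_⟩
    by_cases h1 : i = 1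
    · subst h1
      refine Eq.trans (sum_congr rfl ?_) (residue_sum (I3 M) (n3 M) (d3 M) (by omega))
      intro e _
      have : eps e ^ (1 + 1) = 1 := by
        unfold eps
        split_ifs <;> norm_num
      rw [this, mul_one]
    · apply sum_eq_zero
      intro e _
      rw [if_neg]
      have := d3_le M e
      omega

lemma gg_three (M : ℕ) (hM : 1 ≤ M) (y : ℤ) (h : y % 4 = 2) : gg M y = 1 := by
  obtain ⟨K, rfl⟩ := Nat.exists_eq_add_of_le' hM
  unfold gg
  rw [sum_range_succ', sum_eq_zero]
  · rw [if_pos (by omega)]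
  · intro j _
    rw [if_neg]
    intro hd
    have : (4 : ℤ) ∣ y := Dvd.dvd.trans ⟨2 ^ j, by ring⟩ hd
    omega

lemma gg_even (M : ℕ) (y : ℤ) (h : ¬ 2 ∣ y) : gg M y = 0 := by
  unfold gg
  apply sum_eq_zero
  intro j _
  rw [if_neg]
  intro hd
  exact h ((dvd_pow_self 2 (by omega)).trans hd)

lemma count3 (m L : ℕ) (hℓ : 2 * m ≤ L) (M : ℕ) (hM0 : 1 ≤ M) (hM : 2 * L + 1 ≤ 2 ^ M) (t : ℤ) :
    3 * m - M ≤ ∑ x ∈ Icc (-(L : ℤ)) (L : ℤ), if x % 4 = 1 then (if |x| ≤ ((2 * m : ℕ) : ℤ) then gg M (1 + 4 * t - x) else 0) else 0 := by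
  have h := count_gg (2 * m) L hℓ M hM (1 + 4 * t)
  have h1 : ∑ x ∈ Icc (-(L : ℤ)) (L : ℤ), (if |x| ≤ ((2 * m : ℕ) : ℤ) then gg M (1 + 4 * t - x) else 0) = 
     ∑ x ∈ Icc (-(L : ℤ)) (L : ℤ), (if x % 4 = 1 then (if |x| ≤ ((2 * m : ℕ) : ℤ) then gg M (1 + 4 * t - x) else 0) else 0) +
     ∑ x ∈ Icc (-(L : ℤ)) (L : ℤ), (if (4 : ℤ) ∣ 3 - x then (if |x| ≤ ((2 * m : ℕ) : ℤ) then 1 else 0) else 0) := by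
    rw [← sum_add_distrib]
    apply sum_congr rfl
    intro x _
    by_cases h1 : x % 4 = 1
    · rw [if_pos h1, if_neg (by omega : ¬ (4 : ℤ) ∣ 3 - x), add_zero]
    · rw [if_neg h1, zero_add]
      by_cases h3 : (4 : ℤ) ∣ 3 - x
      · rw [if_pos h3, gg_three M hM0 _ (by omega)]
      · rw [if_neg h3, gg_even M _ (by omega)]; simp
  have h2 := cnt_eq L (2 * m) hℓ 4 3 (by norm_num)
  rw [cnt_count] at h2
  rw [h1] at h
  clear h1
  revert h h2
  generalize (∑ x ∈ Icc (-(L : ℤ)) (L : ℤ), (if (4 : ℤ) ∣ 3 - x then (if |x| ≤ ((2 * m : ℕ) : ℤ) then 1 else 0) else 0) : ℕ) = X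
  generalize (∑ x ∈ Icc (-(L : ℤ)) (L : ℤ), (if x % 4 = 1 then (if |x| ≤ ((2 * m : ℕ) : ℤ) then gg M (1 + 4 * t - x) else 0) else 0) : ℕ) = Y
  intro h h2
  omega

lemma T3_two (M : ℕ) (hM : 1 ≤ M) {S : ℚ_[2]}
    (hS : HasV (fun t => PowerSeries.coeff 1 (Rser (I3 M) (n3 M) (d3 M) (1 + 4 * (t : ℚ_[2])))) S) :
    ‖S‖ ≤ ((24 * M : ℕ) : ℝ) ^ 6 * ((2⁻¹ : ℝ) ^ 30) ^ M := by
  obtain ⟨L, hL⟩ : ∃ L, L = 6 * M := ⟨_, rfl⟩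
  obtain ⟨K, hK⟩ : ∃ K, K = Nat.clog 2 (2 * L + 1) := ⟨_, rfl⟩
  have hM1 : 2 * L + 1 ≤ 2 ^ K := by rw [hK]; exact Nat.le_pow_clog (by norm_num) _
  have hM2 : 2 ^ (K - 1) < 2 * L + 1 := by
    rw [hK]
    exact Nat.pow_pred_clog_lt_self (by norm_num) (by omega)
  have hM3 : 2 ≤ K := by
    by_contra h
    have : 2 ^ K ≤ 2 ^ 1 := Nat.pow_le_pow_right (by norm_num) (by omega)
    omega
  obtain ⟨m', rfl⟩ := Nat.exists_eq_add_of_le' hM3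
  have hY : 2 ^ (m' + 2) ≤ 24 * M := by
    rw [show m' + 2 = (m' + 2 - 1) + 1 by omega, pow_succ]; omega
  obtain ⟨G, hGd⟩ : ∃ G, G = 2 * (3 * (3 * M) - (m' + 2)) + 2 * (3 * (2 * M) - (m' + 2)) := ⟨_, rfl⟩
  have hG : ∀ t : ℤ, G ≤ ∑ x ∈ I3 M, n3 M x * gg (m' + 2) (1 + 4 * t - x) := by
    intro t
    have g1 := count3 (3 * M) L (by omega) (m' + 2) (by omega) hM1 t
    have g2 := count3 (2 * M) L (by omega) (m' + 2) (by omega) hM1 t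
    rw [hGd]
    refine (add_le_add (Nat.mul_le_mul_left 2 g1) (Nat.mul_le_mul_left 2 g2)).trans (le_of_eq ?_)
    rw [mul_sum, mul_sum, ← sum_add_distrib]
    unfold I3
    rw [hL]
    apply sum_congr rfl
    intro x _
    unfold n3
    rw [show 2 * (3 * M) = 6 * M by ring, show 2 * (2 * M) = 4 * M by ring]
    split_ifs <;> ring
  have h := S_bound (I3 M) (n3 M) (d3 M) (d3_even M) m' 1 G
    (fun t y => gg (m' + 2) (1 + 4 * t - y)) (fun t y => gg_le _ _) (fun t y => gg_dvd _ _) hG hS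
  refine h.trans ?_
  have e1 : (2 : ℝ) ^ (m' + 1 + (m' + 2) * 1) * (2⁻¹ : ℝ) ^ G ≤ 2 ^ (2 * (m' + 2)) * ((2 : ℝ) ^ (4 * (m' + 2)) * (2⁻¹ : ℝ) ^ (30 * M)) := by
    refine mul_le_mul (pow_le_pow_right₀ (by norm_num) (by omega)) ?_ (by positivity) (by positivity)
    have : (2⁻¹ : ℝ) ^ G = 2 ^ (4 * (m' + 2)) * (2⁻¹ : ℝ) ^ (G + 4 * (m' + 2)) := by
      rw [pow_add, mul_comm ((2⁻¹ : ℝ) ^ G), ← mul_assoc, ← mul_pow]; norm_num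
    rw [this]
    refine mul_le_mul_of_nonneg_left (pow_le_pow_of_le_one (by norm_num) (by norm_num) (by omega)) (by positivity)
  refine e1.trans ?_
  rw [← mul_assoc, ← pow_add, show 2 * (m' + 2) + 4 * (m' + 2) = (m' + 2) * 6 by ring, pow_mul, pow_mul]
  refine mul_le_mul_of_nonneg_right (pow_le_pow_left₀ (by positivity) ?_ 6) (by positivity)
  exact_mod_cast hY

lemma pair3 (L ℓ : ℕ) (hL : 1 ≤ L) (hℓ : ℓ ≤ L) (hev : 2 ∣ ℓ) (e : ℤ) (heL : |e| ≤ L) (he : 2 ∣ e) :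
    ∏ x ∈ Icc (-(L : ℤ)) (L : ℤ), |((e - x : ℤ) : ℚ)| ^ (if x % 4 = 1 then (if |x| ≤ (ℓ : ℤ) then 2 else 0) else 0) ≤
      (4 * L : ℚ) ^ 2 * ∏ x ∈ (Icc (-(L : ℤ)) (L : ℤ)).erase e, |((e - x : ℤ) : ℚ)| ^ (if 2 ∣ x then (if |x| ≤ (ℓ : ℤ) then 1 else 0) else 0) := by
  obtain ⟨I, hI⟩ : ∃ I, I = Icc (-(L : ℤ)) (L : ℤ) := ⟨_, rfl⟩
  rw [← hI]
  let v : ℤ → ℚ := fun x => |((e - x : ℤ) : ℚ)|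
  have habs : ∀ x : ℤ, x ≠ e → (1 : ℚ) ≤ v x := by
    intro x hx
    have : 1 ≤ |e - x| := Int.one_le_abs (by omega)
    simp only [v]
    exact_mod_cast this
  have hv0 : ∀ x, 0 ≤ v x := fun x => abs_nonneg _
  obtain ⟨Z, hZ⟩ : ∃ Z, Z = I.filter (fun x => x % 4 = 1 ∧ |x| ≤ (ℓ : ℤ)) := ⟨_, rfl⟩
  obtain ⟨E, hE⟩ : ∃ E, E = (I.erase e).filter (fun x => 2 ∣ x ∧ |x| ≤ (ℓ : ℤ)) := ⟨_, rfl⟩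
  have e1 : ∏ x ∈ I, |((e - x : ℤ) : ℚ)| ^ (if x % 4 = 1 then (if |x| ≤ (ℓ : ℤ) then 2 else 0) else 0) = ∏ x ∈ Z, (v x) ^ 2 := by
    rw [hZ, Finset.prod_filter]
    apply prod_congr rfl
    intro x _
    by_cases h1 : x % 4 = 1 <;> by_cases h2 : |x| ≤ (ℓ : ℤ) <;> simp [h1, h2, v]
  have e2 : ∏ x ∈ I.erase e, |((e - x : ℤ) : ℚ)| ^ (if 2 ∣ x then (if |x| ≤ (ℓ : ℤ) then 1 else 0) else 0) = ∏ x ∈ E, v x := by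
    rw [hE, Finset.prod_filter]
    apply prod_congr rfl
    intro x _
    by_cases h1 : 2 ∣ x <;> by_cases h2 : |x| ≤ (ℓ : ℤ) <;> simp [h1, h2, v]
  rw [e1, e2]
  let f1 : ℤ → ℤ := fun x => if e < x then x + 1 else x - 1
  let f2 : ℤ → ℤ := fun x => if e < x then x + 3 else x - 3
  have hZm : ∀ x ∈ Z, x % 4 = 1 ∧ -(ℓ : ℤ) ≤ x ∧ x ≤ ℓ := by
    intro x hx
    rw [hZ, mem_filter, abs_le] at hx
    exact hx.2
  have i1 : Set.InjOn f1 Z := by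
    intro x hx y hy hxy
    have h1 := hZm x hx
    have h2 := hZm y hy
    simp only [f1] at hxy
    split_ifs at hxy <;> omega
  have i2 : Set.InjOn f2 Z := by
    intro x hx y hy hxy
    have h1 := hZm x hx
    have h2 := hZm y hy
    simp only [f2] at hxy
    split_ifs at hxy <;> omega
  have hdis : Disjoint (Z.image f1) (Z.image f2) := by
    rw [Finset.disjoint_left]
    intro a h1 h2
    obtain ⟨x, hx, rfl⟩ := mem_image.1 h1
    obtain ⟨y, hy, hxy⟩ := mem_image.1 h2
    have h1 := hZm x hx
    have h2 := hZm y hy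
    simp only [f1, f2] at hxy
    split_ifs at hxy <;> omega
  obtain ⟨F, hF⟩ : ∃ F : Finset ℤ, F = ({(ℓ : ℤ) + 2, -((ℓ : ℤ) + 2)} : Finset ℤ).erase e := ⟨_, rfl⟩
  have hEm : ∀ x, x ∈ E ↔ x ≠ e ∧ 2 ∣ x ∧ -(ℓ : ℤ) ≤ x ∧ x ≤ ℓ := by
    intro x
    rw [hE, mem_filter, mem_erase, hI, mem_Icc, abs_le]
    constructor
    · rintro ⟨⟨a, _⟩, b, c⟩; exact ⟨a, b, c⟩
    · rintro ⟨a, b, c⟩; exact ⟨⟨a, by omega⟩, b, c⟩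
  have hFm : ∀ x, x ∈ F ↔ x ≠ e ∧ (x = (ℓ : ℤ) + 2 ∨ x = -((ℓ : ℤ) + 2)) := by
    intro x
    rw [hF, mem_erase]; simp
  have hEF : Disjoint E F := by
    rw [Finset.disjoint_left]
    intro a h1 h2
    rw [hEm] at h1
    rw [hFm] at h2
    omega
  have hev' : (2 : ℤ) ∣ ℓ := by exact_mod_cast hev
  have hsub : (Z.image f1) ∪ (Z.image f2) ⊆ E ∪ F := by
    intro a ha
    rw [mem_union] at ha ⊢
    rw [hEm, hFm]
    rcases ha with h | h
    · obtain ⟨x, hx, rfl⟩ := mem_image.1 h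
      have h1 := hZm x hx
      simp only [f1]
      split_ifs <;> omega
    · obtain ⟨x, hx, rfl⟩ := mem_image.1 h
      have h1 := hZm x hx
      simp only [f2]
      split_ifs <;> omega
  have hFp : ∏ x ∈ F, v x ≤ (4 * L : ℚ) ^ 2 := by
    have hL' : (1 : ℚ) ≤ L := by exact_mod_cast hL
    have h1 : ∏ x ∈ F, v x ≤ ∏ x ∈ F, (4 * L : ℚ) := by
      apply prod_le_prod (fun x _ => hv0 x)
      intro x hx
      rw [hFm] at hx
      rw [abs_le] at heL
      have : |e - x| ≤ 4 * L := by
        rw [abs_le]; omega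
      simp only [v]
      exact_mod_cast this
    refine h1.trans ?_
    rw [prod_const]
    apply pow_le_pow_right₀ (by linarith)
    rw [hF]
    exact (card_erase_le).trans card_le_two
  have hle : ∀ x ∈ Z, v x ≤ v (f1 x) ∧ v x ≤ v (f2 x) := by
    intro x hx
    have h1 := hZm x hx
    have h2 : |e - x| ≤ |e - f1 x| ∧ |e - x| ≤ |e - f2 x| := by
      simp only [f1, f2]
      split_ifs with h
      · rw [abs_of_neg (by omega : e - x < 0), abs_of_neg (by omega), abs_of_neg (by omega)]; omega
      · rw [abs_of_nonneg (by omega : 0 ≤ e - x), abs_of_nonneg (by omega), abs_of_nonneg (by omega)]; omega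
    simp only [v]
    exact ⟨by exact_mod_cast h2.1, by exact_mod_cast h2.2⟩
  calc ∏ x ∈ Z, (v x) ^ 2 ≤ ∏ x ∈ Z, v (f1 x) * v (f2 x) := by
        apply prod_le_prod (fun x _ => by positivity)
        intro x hx
        rw [pow_two]
        exact mul_le_mul (hle x hx).1 (hle x hx).2 (hv0 _) (hv0 _)
    _ = (∏ x ∈ Z.image f1, v x) * ∏ x ∈ Z.image f2, v x := by
        rw [prod_mul_distrib, prod_image i1, prod_image i2]
    _ = ∏ x ∈ Z.image f1 ∪ Z.image f2, v x := (prod_union hdis).symm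
    _ ≤ ∏ x ∈ E ∪ F, v x := by
        apply Finset.prod_le_prod_of_subset_of_one_le hsub
        · intro x _; exact hv0 x
        · intro x hx _
          apply habs
          rw [mem_union, hEm, hFm] at hx
          omega
    _ = (∏ x ∈ E, v x) * ∏ x ∈ F, v x := prod_union hEF
    _ ≤ (∏ x ∈ E, v x) * (4 * L : ℚ) ^ 2 := mul_le_mul_of_nonneg_left hFp (prod_nonneg fun x _ => hv0 x)
    _ = _ := mul_comm _ _

lemma T3_acoef (M : ℕ) (hM : 1 ≤ M) (e : ℤ) (heI : e ∈ I3 M) (i : ℕ) (hi : 1 ≤ i) (hde : i ≤ d3 M e) :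
    |acoef (I3 M) (n3 M) (d3 M) e i| ≤ ((24 * M : ℕ) : ℚ) ^ 5 := by
  have he : 2 ∣ e := d3_even M e (by omega)
  have hne : n3 M e = 0 := by
    by_contra h
    exact n3_odd M e h he
  have heL : |e| ≤ ((6 * M : ℕ) : ℤ) := by
    unfold I3 at heI
    rw [mem_Icc] at heI
    rw [abs_le]; exact heI
  have p1 := pair3 (6 * M) (6 * M) (by omega) le_rfl (by omega) e heL he
  have p2 := pair3 (6 * M) (4 * M) (by omega) (by omega) (by omega) e heL he
  have h := Bser_BdR (I3 M) (n3 M) (d3 M) e hne (d3 M e - i)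
  unfold acoef
  refine h.trans ?_
  obtain ⟨g1, g2⟩ := T3_deg M
  have hT : ((∑ x ∈ I3 M, n3 M x + ∑ x ∈ I3 M, d3 M x : ℕ) : ℚ) ^ (d3 M e - i) ≤ ((24 * M : ℕ) : ℚ) ^ 1 := by
    have hh : (∑ x ∈ I3 M, n3 M x + ∑ x ∈ I3 M, d3 M x) ≤ 24 * M := by omega
    calc _ ≤ ((24 * M : ℕ) : ℚ) ^ (d3 M e - i) := by
            apply pow_le_pow_left₀ (Nat.cast_nonneg _); exact_mod_cast hh
      _ ≤ _ := by
            apply pow_le_pow_right₀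
            · exact_mod_cast (by omega : 1 ≤ 24 * M)
            · have := d3_le M e; omega
  rw [show (5 : ℕ) = 4 + 1 by norm_num, pow_add _ 4 1]
  refine mul_le_mul ?_ hT (by positivity) (by positivity)
  have hpos : 0 < ∏ x ∈ (I3 M).erase e, |((e - x : ℤ) : ℚ)| ^ d3 M x := by
    apply Finset.prod_pos
    intro x hx
    have h1 := Finset.ne_of_mem_erase hx
    have : 0 < |e - x| := abs_pos.2 (by omega)
    have h2 : (0 : ℚ) < |((e - x : ℤ) : ℚ)| := by exact_mod_cast this
    positivity
  simp_rw [inv_pow, Finset.prod_inv_distrib]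
  rw [← div_eq_mul_inv, div_le_iff₀ hpos]
  have q1 : ∏ x ∈ I3 M, |((e - x : ℤ) : ℚ)| ^ n3 M x =
     (∏ x ∈ I3 M, |((e - x : ℤ) : ℚ)| ^ (if x % 4 = 1 then (if |x| ≤ ((6 * M : ℕ) : ℤ) then 2 else 0) else 0)) *
     ∏ x ∈ I3 M, |((e - x : ℤ) : ℚ)| ^ (if x % 4 = 1 then (if |x| ≤ ((4 * M : ℕ) : ℤ) then 2 else 0) else 0) := by
    rw [← prod_mul_distrib]
    apply prod_congr rfl
    intro x _
    rw [← pow_add]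
    unfold n3
    congr 1
    split_ifs <;> rfl
  have q2 : ∏ x ∈ (I3 M).erase e, |((e - x : ℤ) : ℚ)| ^ d3 M x =
     (∏ x ∈ (I3 M).erase e, |((e - x : ℤ) : ℚ)| ^ (if 2 ∣ x then (if |x| ≤ ((6 * M : ℕ) : ℤ) then 1 else 0) else 0)) *
     ∏ x ∈ (I3 M).erase e, |((e - x : ℤ) : ℚ)| ^ (if 2 ∣ x then (if |x| ≤ ((4 * M : ℕ) : ℤ) then 1 else 0) else 0) := by
    rw [← prod_mul_distrib]
    apply prod_congr rfl
    intro x _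
    rw [← pow_add]
    unfold d3
    congr 1
    split_ifs <;> rfl
  rw [q1, q2]
  refine (mul_le_mul p1 p2 (prod_nonneg fun x _ => by positivity) (by positivity)).trans (le_of_eq ?_)
  unfold I3
  push_cast
  ring

lemma T3_abs (M : ℕ) (hM : 1 ≤ M) (Jq : ℕ → ℚ) (Jm : ℚ) (hJm : 0 ≤ Jm) (hJ : ∀ k, |Jq k| ≤ Jm) :
    |Sq (I3 M) (n3 M) (d3 M) 1 Jq| ≤ (16 * (Jm + 12)) * ((24 * M : ℕ) : ℚ) ^ 7 := by
  have h := Sq_abs (6 * M) (n3 M) (d3 M) 1 2 Jq (((24 * M : ℕ) : ℚ) ^ 5) Jm hJm hJ (by positivity) (d3_le M)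
    (fun e he i h1 h2 => T3_acoef M hM e he i h1 h2)
  have hM' : (1 : ℚ) ≤ M := by exact_mod_cast hM
  refine h.trans ?_
  obtain ⟨Y, hY⟩ : ∃ Y : ℚ, Y = ((24 * M : ℕ) : ℚ) := ⟨_, rfl⟩
  rw [← hY]
  have hY' : Y = 24 * M := by rw [hY]; push_cast; ring
  have h1 : (2 * ((6 * M : ℕ) : ℚ) + 1) ≤ Y := by rw [hY']; push_cast; linarith
  have h2 : Jm + 4 * (((2 : ℕ) : ℚ) + ((1 : ℕ) : ℚ)) * (((6 * M : ℕ) : ℚ) + 1) ≤ (Jm + 12) * Y := by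
    have : (((6 * M : ℕ) : ℚ) + 1) ≤ Y := by rw [hY']; push_cast; linarith
    have h3 : (1 : ℚ) ≤ Y := by rw [hY']; linarith
    have h4 := mul_le_mul_of_nonneg_left h3 hJm
    push_cast at this ⊢
    linarith
  have hY0 : 0 ≤ Y := by rw [hY']; positivity
  calc _ ≤ Y * (((2 : ℕ) : ℚ) * (Y ^ 5 * 2 ^ (2 + 1) * ((Jm + 12) * Y))) := by
        refine mul_le_mul h1 ?_ (by positivity) hY0
        refine mul_le_mul_of_nonneg_left ?_ (by positivity)
        exact mul_le_mul_of_nonneg_left h2 (by positivity)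
    _ = _ := by push_cast; ring

/-- families of power series with a second order Taylor formula with integral remainder -/
def TS3 (Ψ : ℤ → PowerSeries ℚ_[2]) : Prop :=
  ∃ Φ : ℤ → PowerSeries ℤ_[2],
    (∀ t, PowerSeries.rescale (4 : ℚ_[2]) (Ψ t) = PowerSeries.map (PadicInt.Coe.ringHom (p := 2)) (Φ t)) ∧
    ∀ t h : ℤ, (h : ℤ_[2]) ^ 3 ∣ PowerSeries.coeff 0 (Φ (t + h)) - PowerSeries.coeff 0 (Φ t)
      - h * PowerSeries.coeff 1 (Φ t) - h ^ 2 * PowerSeries.coeff 2 (Φ t)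

lemma coeff_mul_012 {R : Type*} [CommRing R] (f g : PowerSeries R) :
    PowerSeries.coeff 0 (f * g) = PowerSeries.coeff 0 f * PowerSeries.coeff 0 g ∧
    PowerSeries.coeff 1 (f * g) = PowerSeries.coeff 0 f * PowerSeries.coeff 1 g + PowerSeries.coeff 1 f * PowerSeries.coeff 0 g ∧
    PowerSeries.coeff 2 (f * g) = PowerSeries.coeff 0 f * PowerSeries.coeff 2 g + PowerSeries.coeff 1 f * PowerSeries.coeff 1 g
      + PowerSeries.coeff 2 f * PowerSeries.coeff 0 g := by
  simp only [PowerSeries.coeff_mul, Finset.Nat.antidiagonal_succ, Finset.Nat.antidiagonal_zero]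
  simp
  ring

lemma TS3.mul {Ψ Ψ' : ℤ → PowerSeries ℚ_[2]} (h1 : TS3 Ψ) (h2 : TS3 Ψ') : TS3 (fun t => Ψ t * Ψ' t) := by
  obtain ⟨F, hF, hF'⟩ := h1
  obtain ⟨G, hG, hG'⟩ := h2
  refine ⟨fun t => F t * G t, fun t => by rw [map_mul, map_mul, hF, hG], fun t h => ?_⟩
  obtain ⟨a, ha⟩ := hF' t h
  obtain ⟨b, hb⟩ := hG' t h
  obtain ⟨e0, e1, e2⟩ := coeff_mul_012 (F t) (G t)
  obtain ⟨e3, -, -⟩ := coeff_mul_012 (F (t + h)) (G (t + h))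
  rw [e0, e1, e2, e3]
  generalize PowerSeries.coeff 0 (F (t + h)) = A at *
  generalize PowerSeries.coeff 0 (G (t + h)) = B at *
  generalize PowerSeries.coeff 0 (F t) = a0 at *
  generalize PowerSeries.coeff 1 (F t) = a1 at *
  generalize PowerSeries.coeff 2 (F t) = a2 at *
  generalize PowerSeries.coeff 0 (G t) = b0 at *
  generalize PowerSeries.coeff 1 (G t) = b1 at *
  generalize PowerSeries.coeff 2 (G t) = b2 at *
  refine ⟨a * B + (a0 + h * a1 + h ^ 2 * a2) * b + a1 * b2 + a2 * b1 + h * a2 * b2, ?_⟩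
  linear_combination B * ha + (a0 + h * a1 + h ^ 2 * a2) * hb

lemma TS3.one : TS3 (fun _ => 1) := by
  refine ⟨fun _ => 1, fun t => by simp, fun t h => ?_⟩
  simp [PowerSeries.coeff_one]

lemma TS3.pow {Ψ : ℤ → PowerSeries ℚ_[2]} (h1 : TS3 Ψ) (n : ℕ) : TS3 (fun t => Ψ t ^ n) := by
  induction n with
  | zero => simpa using TS3.one
  | succ n ih => simpa [pow_succ] using ih.mul h1

lemma TS3.prod (s : Finset ℤ) {φ : ℤ → ℤ → PowerSeries ℚ_[2]}
    (h1 : ∀ i ∈ s, TS3 (φ i)) : TS3 (fun t => ∏ i ∈ s, φ i t) := by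
  induction s using Finset.induction_on with
  | empty => simpa using TS3.one
  | insert a s ha ih =>
    have := (h1 a (by simp)).mul (ih (fun i hi => h1 i (by simp [hi])))
    simpa [Finset.prod_insert ha] using this

lemma coeff_CX {R : Type*} [CommRing R] (c d : R) :
    PowerSeries.coeff 0 (PowerSeries.C c + PowerSeries.C d * PowerSeries.X) = c ∧
    PowerSeries.coeff 1 (PowerSeries.C c + PowerSeries.C d * PowerSeries.X) = d ∧
    ∀ k, PowerSeries.coeff (k + 2) (PowerSeries.C c + PowerSeries.C d * PowerSeries.X) = 0 := by
  refine ⟨?_, ?_, fun k => ?_⟩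
  · simp
  · simp [PowerSeries.coeff_C]
  · rw [map_add, PowerSeries.coeff_C_mul, PowerSeries.coeff_C, PowerSeries.coeff_X]
    simp

lemma TS3.lin_aux (x t : ℤ) :
    PowerSeries.rescale (4 : ℚ_[2]) (PowerSeries.C (1 + 4 * (t : ℚ_[2]) - x) + PowerSeries.X)
      = PowerSeries.map (PadicInt.Coe.ringHom (p := 2))
        (PowerSeries.C ((1 + 4 * t - x : ℤ) : ℤ_[2]) + PowerSeries.C 4 * PowerSeries.X) := by
  obtain ⟨c0, c1, c2⟩ := coeff_CX (((1 + 4 * t - x : ℤ) : ℤ_[2])) 4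
  have h1 : PowerSeries.C (1 + 4 * (t : ℚ_[2]) - x) + PowerSeries.X =
    PowerSeries.C (1 + 4 * (t : ℚ_[2]) - x) + PowerSeries.C 1 * PowerSeries.X := by simp
  rw [h1]
  obtain ⟨b0, b1, b2⟩ := coeff_CX (1 + 4 * (t : ℚ_[2]) - x) 1
  ext k
  rw [PowerSeries.coeff_rescale, PowerSeries.coeff_map]
  rcases k with _ | _ | k
  · rw [c0, b0]
    simp [map_ofNat]
  · rw [c1, b1]; simp [map_ofNat]
  · rw [show k + 1 + 1 = k + 2 by ring, c2, b2]; simp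

lemma TS3.lin (x : ℤ) : TS3 (fun t => PowerSeries.C (1 + 4 * (t : ℚ_[2]) - x) + PowerSeries.X) := by
  refine ⟨fun t => PowerSeries.C ((1 + 4 * t - x : ℤ) : ℤ_[2]) + PowerSeries.C 4 * PowerSeries.X,
    fun t => TS3.lin_aux x t, fun t h => ?_⟩
  simp only []
  obtain ⟨c0, c1, c2⟩ := coeff_CX (((1 + 4 * t - x : ℤ) : ℤ_[2])) 4
  obtain ⟨b0, b1, b2⟩ := coeff_CX (((1 + 4 * (t + h) - x : ℤ) : ℤ_[2])) 4
  rw [b0, c0, c1, c2 0]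
  refine ⟨0, by push_cast; ring⟩

lemma TS3.lin_inv (x : ℤ) (hx : 2 ∣ x) : TS3 (fun t => (PowerSeries.C (1 + 4 * (t : ℚ_[2]) - x) + PowerSeries.X)⁻¹) := by
  let P : ℤ → PowerSeries ℤ_[2] := fun t => PowerSeries.C ((1 + 4 * t - x : ℤ) : ℤ_[2]) + PowerSeries.C 4 * PowerSeries.X
  have hu : ∀ t, ∃ w, P t * w = 1 := by
    intro t
    refine IsUnit.exists_right_inv ?_
    rw [PowerSeries.isUnit_iff_constantCoeff]
    have : PowerSeries.constantCoeff (P t) = ((1 + 4 * t - x : ℤ) : ℤ_[2]) := by simp [P]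
    rw [this, PadicInt.isUnit_iff]
    have h3 := PadicInt.norm_int_lt_one_iff_dvd (p := 2) (1 + 4 * t - x)
    have h1 := PadicInt.norm_le_one (p := 2) ((1 + 4 * t - x : ℤ) : ℤ_[2])
    by_contra hne
    have h5 := h3.1 (lt_of_le_of_ne h1 hne)
    push_cast at h5
    omega
  choose W hW using hu
  refine ⟨W, fun t => ?_, fun t h => ?_⟩
  · have h1 : (PowerSeries.C (1 + 4 * (t : ℚ_[2]) - x) + PowerSeries.X) *
        (PowerSeries.C (1 + 4 * (t : ℚ_[2]) - x) + PowerSeries.X)⁻¹ = 1 := by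
      apply PowerSeries.mul_inv_cancel
      simp only [map_add, PowerSeries.constantCoeff_C, PowerSeries.constantCoeff_X, add_zero]
      exact_mod_cast (by omega : 1 + 4 * t - x ≠ 0)
    have h2 := congrArg (PowerSeries.rescale (4 : ℚ_[2])) h1
    have h3 := congrArg (PowerSeries.map (PadicInt.Coe.ringHom (p := 2))) (hW t)
    rw [map_mul, map_one, TS3.lin_aux] at h2
    rw [map_mul, map_one] at h3
    simp only [P] at h3
    have hne := left_ne_zero_of_mul_eq_one h3
    exact mul_left_cancel₀ hne (h2.trans h3.symm)
  · obtain ⟨e0, e1, e2⟩ := coeff_mul_012 (P t) (W t)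
    obtain ⟨e3, -, -⟩ := coeff_mul_012 (P (t + h)) (W (t + h))
    rw [hW] at e0 e1 e2 e3
    obtain ⟨p0, p1, p2⟩ := coeff_CX (((1 + 4 * t - x : ℤ) : ℤ_[2])) 4
    obtain ⟨b0, b1, b2⟩ := coeff_CX (((1 + 4 * (t + h) - x : ℤ) : ℤ_[2])) 4
    have p2 := p2 0
    have p3 : ((1 + 4 * (t + h) - x : ℤ) : ℤ_[2]) = ((1 + 4 * t - x : ℤ) : ℤ_[2]) + 4 * h := by
      push_cast; ring
    rw [p3] at b0
    simp only [P] at e0 e1 e2 e3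
    rw [p3] at e3
    clear b1 b2
    have p3 := b0
    clear b0
    rw [p0, p1] at e1
    rw [p0, p1, p2] at e2
    rw [p0] at e0
    rw [p3] at e3
    generalize ((1 + 4 * t - x : ℤ) : ℤ_[2]) = a at *
    simp only [PowerSeries.coeff_one, if_true, if_neg one_ne_zero, if_neg two_ne_zero] at e0 e1 e2 e3
    generalize PowerSeries.coeff 0 (W (t + h)) = B at *
    generalize PowerSeries.coeff 0 (W t) = b0 at *
    generalize PowerSeries.coeff 1 (W t) = b1 at *
    generalize PowerSeries.coeff 2 (W t) = b2 at *
    refine ⟨-4 * b2 * B, ?_⟩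
    linear_combination B * e0 - (b0 + h * b1 + h ^ 2 * b2) * e3 + h * B * e1 + h ^ 2 * B * e2

lemma TS3_R (I : Finset ℤ) (n d : ℤ → ℕ) (hd : ∀ x, d x ≠ 0 → 2 ∣ x) :
    TS3 (fun t => Rser I n d (1 + 4 * (t : ℚ_[2]))) := by
  unfold Rser
  apply TS3.mul
  · exact TS3.prod I (φ := fun x t => (PowerSeries.C (1 + 4 * (t : ℚ_[2]) - x) + PowerSeries.X) ^ n x)
      (fun x _ => (TS3.lin x).pow _)
  · apply TS3.prod I (φ := fun x t => ((PowerSeries.C (1 + 4 * (t : ℚ_[2]) - x) + PowerSeries.X)⁻¹) ^ d x)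
    intro x _
    by_cases hx : d x ≠ 0
    · exact (TS3.lin_inv x (hd x hx)).pow _
    · push Not at hx
      simp only [hx, pow_zero]
      exact TS3.one

lemma diff_limit {Ψ : ℤ → PowerSeries ℚ_[2]} (h : TS3 Ψ) {S S2 : ℚ_[2]}
    (h1 : HasV (fun t => PowerSeries.coeff 1 (Ψ t)) S) (h2 : HasV (fun t => PowerSeries.coeff 2 (Ψ t)) S2) :
    Tendsto (fun m : ℕ => ((2 : ℚ_[2]) ^ m)⁻¹ * ((2 : ℚ_[2]) ^ m)⁻¹ * ∑ k ∈ range (2 ^ m),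
      (PowerSeries.coeff 0 (Ψ ((k : ℤ) + 2 ^ m)) - PowerSeries.coeff 0 (Ψ (k : ℤ)))) atTop (nhds (4 * S)) := by
  obtain ⟨Φ, hΦ, hT⟩ := h
  have hc : ∀ (r : ℕ) (t : ℤ), 4 ^ r * PowerSeries.coeff r (Ψ t) = ((PowerSeries.coeff r (Φ t) : ℤ_[2]) : ℚ_[2]) := by
    intro r t
    have := congrArg (PowerSeries.coeff r) (hΦ t)
    rw [PowerSeries.coeff_rescale, PowerSeries.coeff_map] at this
    exact this
  choose c hcc using fun (m k : ℕ) => hT (k : ℤ) (2 ^ m)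
  have hexp : ∀ m k : ℕ, PowerSeries.coeff 0 (Ψ ((k : ℤ) + 2 ^ m)) - PowerSeries.coeff 0 (Ψ (k : ℤ))
     = 2 ^ m * (4 * PowerSeries.coeff 1 (Ψ k)) + (2 ^ m) ^ 2 * (16 * PowerSeries.coeff 2 (Ψ k)) + (2 ^ m) ^ 3 * (c m k : ℚ_[2]) := by
    intro m k
    have g0 := hc 0 k
    have g0' := hc 0 (k + 2 ^ m)
    have g1 := hc 1 k
    have g2 := hc 2 k
    have g := congrArg (fun z : ℤ_[2] => (z : ℚ_[2])) (hcc m k)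
    push_cast [coe_two'] at g
    rw [← g0, ← g0', ← g1, ← g2] at g
    linear_combination g
  have hz1 : Tendsto (fun m : ℕ => ((2 : ℚ_[2]) ^ m)) atTop (nhds 0) := by
    apply squeeze_zero_norm (a := fun m => (2⁻¹ : ℝ) ^ m)
    · intro m; rw [norm_two_pow']
    · exact tendsto_pow_atTop_nhds_zero_of_lt_one (by norm_num) (by norm_num)
  have hz : Tendsto (fun m : ℕ => ((2 : ℚ_[2]) ^ m) * ((∑ k ∈ range (2 ^ m), c m k : ℤ_[2]) : ℚ_[2])) atTop (nhds 0) := by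
    apply squeeze_zero_norm (a := fun m => (2⁻¹ : ℝ) ^ m)
    · intro m
      rw [norm_mul, norm_two_pow']
      exact mul_le_of_le_one_right (by positivity) (PadicInt.norm_le_one _)
    · exact tendsto_pow_atTop_nhds_zero_of_lt_one (by norm_num) (by norm_num)
  have key := ((Tendsto.const_mul (4 : ℚ_[2]) h1).add ((hz1.mul h2).const_mul (16 : ℚ_[2]))).add hz
  rw [zero_mul, mul_zero, add_zero, add_zero] at key
  refine key.congr ?_
  intro m
  simp_rw [hexp m]
  rw [sum_add_distrib, sum_add_distrib, ← mul_sum, ← mul_sum, ← mul_sum, ← mul_sum, ← mul_sum]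
  have hs : ((∑ k ∈ range (2 ^ m), c m k : ℤ_[2]) : ℚ_[2]) = ∑ k ∈ range (2 ^ m), (c m k : ℚ_[2]) :=
    map_sum (PadicInt.Coe.ringHom (p := 2)) _ _
  rw [hs]
  have hne : (2 : ℚ_[2]) ^ m ≠ 0 := pow_ne_zero _ two_ne_zero
  field_simp

lemma choose_odd (m i : ℕ) (hi : i < 2 ^ m) : (2 ^ m - 1).choose i % 2 = 1 := by
  induction i with
  | zero => simp
  | succ i ih =>
    have h1 := ih (by omega)
    have h2 : 2 ∣ (2 ^ m).choose (i + 1) := Nat.prime_two.dvd_choose_pow (by omega) (by omega)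
    have h3 : (2 ^ m).choose (i + 1) = (2 ^ m - 1).choose i + (2 ^ m - 1).choose (i + 1) := by
      conv_lhs => rw [show 2 ^ m = (2 ^ m - 1) + 1 by omega]
      rw [Nat.choose_succ_succ]
    omega

lemma norm_odd (n : ℕ) (h : n % 2 = 1) : ‖(n : ℚ_[2])‖ = 1 := by
  have h3 := Padic.norm_intCast_lt_one_iff (p := 2) (k := (n : ℤ))
  have h1 := Padic.norm_int_le_one (p := 2) (n : ℤ)
  push_cast at h3 h1
  by_contra hne
  have := h3.1 (lt_of_le_of_ne h1 hne)
  omega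

lemma norm_nat_le_one (n : ℕ) : ‖(n : ℚ_[2])‖ ≤ 1 := by
  have h1 := Padic.norm_int_le_one (p := 2) (n : ℤ)
  exact_mod_cast h1

lemma inv_norm (n a : ℕ) (h : ¬ 2 ^ (a + 1) ∣ n) : ‖(n : ℚ_[2])⁻¹‖ ≤ 2 ^ a := by
  have hn : n ≠ 0 := by rintro rfl; exact h (dvd_zero _)
  obtain ⟨b, c, hc, rfl⟩ := Nat.exists_eq_pow_mul_and_not_dvd hn 2 (by norm_num)
  have hb : b ≤ a := by
    by_contra hb
    exact h ((pow_dvd_pow 2 (by omega)).mul_right c)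
  push_cast
  rw [norm_inv, norm_mul, norm_two_pow', norm_odd c (by omega), mul_one, inv_pow, inv_inv]
  exact pow_le_pow_right₀ (by norm_num) hb

/-- the weights in the Newton expansion -/
noncomputable def Wk (m k : ℕ) : ℚ_[2] :=
  ((2 : ℚ_[2]) ^ m)⁻¹ * ((2 : ℚ_[2]) ^ m)⁻¹ * (((2 * 2 ^ m).choose (k + 1) : ℚ_[2]) - 2 * ((2 ^ m).choose (k + 1) : ℚ_[2]))

lemma Wk_eq (m k : ℕ) : Wk m k = 2 * ((k + 1 : ℕ) : ℚ_[2])⁻¹ *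
    ∑ i ∈ range k, ((i + 1 : ℕ) : ℚ_[2])⁻¹ * (((2 ^ m - 1).choose i * (2 ^ m - 1).choose (k - 1 - i) : ℕ) : ℚ_[2]) := by
  obtain ⟨N, hN⟩ : ∃ N, N + 1 = 2 ^ m := ⟨2 ^ m - 1, by have := Nat.one_le_two_pow (n := m); omega⟩
  have hNq : (2 : ℚ_[2]) ^ m = (N + 1 : ℕ) := by rw [hN]; push_cast; rfl
  have hne : ((N + 1 : ℕ) : ℚ_[2]) ≠ 0 := by exact_mod_cast (by omega : N + 1 ≠ 0)
  have h1 : (2 * (N + 1)).choose (k + 1) = 2 * (N + 1).choose (k + 1) + ∑ i ∈ range k, (N + 1).choose (i + 1) * (N + 1).choose (k - i) := by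
    rw [two_mul (N + 1), Nat.add_choose_eq, Finset.Nat.sum_antidiagonal_eq_sum_range_succ_mk, Finset.sum_range_succ, Finset.sum_range_succ']
    simp only [Nat.choose_zero_right, Nat.sub_zero, Nat.sub_self, mul_one, one_mul]
    have : ∀ i ∈ range k, (N + 1).choose (i + 1) * (N + 1).choose (k + 1 - (i + 1)) = (N + 1).choose (i + 1) * (N + 1).choose (k - i) := by
      intro i _; rw [Nat.add_sub_add_right]
    rw [sum_congr rfl this]
    ring
  unfold Wk
  rw [hNq, ← hN, h1]
  push_cast
  rw [add_sub_cancel_left]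
  have hpos : ∀ j : ℕ, ((j : ℚ_[2]) + 1) ≠ 0 := fun j => by exact_mod_cast (by omega : j + 1 ≠ 0)
  have hch : ∀ j : ℕ, (((N + 1).choose (j + 1) : ℕ) : ℚ_[2]) = (N + 1) * ((j : ℚ_[2]) + 1)⁻¹ * (N.choose j : ℚ_[2]) := by
    intro j
    have := Nat.add_one_mul_choose_eq N j
    have h2 : ((N : ℚ_[2]) + 1) * (N.choose j) = ((N + 1).choose (j + 1) : ℕ) * ((j : ℚ_[2]) + 1) := by exact_mod_cast this
    have := hpos j
    field_simp
    linear_combination -h2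
  have h2 : ∑ i ∈ range k, (((N + 1).choose (i + 1) : ℕ) : ℚ_[2]) * (((N + 1).choose (k - i) : ℕ) : ℚ_[2])
     = (N + 1) ^ 2 * ((k : ℚ_[2]) + 1)⁻¹ * ∑ i ∈ range k, (((i : ℚ_[2]) + 1)⁻¹ * ((N.choose i : ℚ_[2]) * (N.choose (k - 1 - i) : ℚ_[2])) +
        (((k - 1 - i : ℕ) : ℚ_[2]) + 1)⁻¹ * ((N.choose (k - 1 - i) : ℚ_[2]) * (N.choose (k - 1 - (k - 1 - i)) : ℚ_[2]))) := by
    rw [mul_sum]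
    apply sum_congr rfl
    intro i hi
    rw [mem_range] at hi
    obtain ⟨l, rfl⟩ : ∃ l, k = i + l + 1 := ⟨k - 1 - i, by omega⟩
    rw [show i + l + 1 - i = l + 1 by omega, show i + l + 1 - 1 - i = l by omega, show i + l + 1 - 1 - l = i by omega, hch, hch]
    have p1 := hpos i
    have p2 := hpos l
    have p3 := hpos (i + l + 1)
    push_cast at p3 ⊢
    field_simp
    ring
  rw [h2, sum_add_distrib, Finset.sum_range_reflect (fun i => ((i : ℚ_[2]) + 1)⁻¹ * ((N.choose i : ℚ_[2]) * (N.choose (k - 1 - i) : ℚ_[2]))) k]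
  push_cast at hne
  field_simp
  ring

lemma Wk_le (m k a b : ℕ) (ha : k < 2 ^ (a + 1)) (hb : ¬ 2 ^ (b + 1) ∣ k + 1) :
    ‖Wk m k‖ ≤ 2⁻¹ * 2 ^ b * 2 ^ a := by
  rw [Wk_eq, norm_mul, norm_mul]
  have h2 : ‖(2 : ℚ_[2])‖ = 2⁻¹ := by simpa using norm_two_pow' 1
  rw [h2]
  refine mul_le_mul (mul_le_mul_of_nonneg_left (inv_norm _ _ hb) (by norm_num)) ?_ (norm_nonneg _) (by positivity)
  apply IsUltrametricDist.norm_sum_le_of_forall_le_of_nonneg (by positivity)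
  intro i hi
  rw [mem_range] at hi
  rw [norm_mul]
  refine (mul_le_of_le_one_right (norm_nonneg _) (norm_nat_le_one _)).trans (inv_norm _ _ ?_)
  intro hd
  have := Nat.le_of_dvd (by omega) hd
  omega

lemma Wk_exact (m K : ℕ) (hK : 2 ≤ K) (hm : K ≤ m) : ‖Wk m (2 ^ K - 1)‖ = 2⁻¹ * 2 ^ K * 2 ^ (K - 1) := by
  obtain ⟨K, rfl⟩ := Nat.exists_eq_add_of_le' hK
  have hp : 2 ^ (K + 2) = 4 * 2 ^ K := by ring
  have hp1 : 2 ^ (K + 1) = 2 * 2 ^ K := by ring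
  have hp0 : 1 ≤ 2 ^ K := Nat.one_le_two_pow
  have hpm : 2 ^ (K + 2) ≤ 2 ^ m := Nat.pow_le_pow_right (by norm_num) hm
  have h2 : ‖(2 : ℚ_[2])‖ = 2⁻¹ := by simpa using norm_two_pow' 1
  rw [Wk_eq, norm_mul, norm_mul, h2]
  have e1 : 2 ^ (K + 2) - 1 + 1 = 2 ^ (K + 2) := by omega
  rw [e1]
  have e2 : ‖((2 ^ (K + 2) : ℕ) : ℚ_[2])⁻¹‖ = 2 ^ (K + 2) := by
    push_cast
    rw [norm_inv, norm_two_pow', inv_pow, inv_inv]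
  rw [e2]
  congr 1
  have hmem : 2 ^ (K + 1) - 1 ∈ range (2 ^ (K + 2) - 1) := by rw [mem_range]; omega
  rw [← Finset.add_sum_erase _ _ hmem]
  have t1 : ‖((2 ^ (K + 1) - 1 + 1 : ℕ) : ℚ_[2])⁻¹ * (((2 ^ m - 1).choose (2 ^ (K + 1) - 1) * (2 ^ m - 1).choose (2 ^ (K + 2) - 1 - 1 - (2 ^ (K + 1) - 1)) : ℕ) : ℚ_[2])‖ = 2 ^ (K + 1) := by
    rw [norm_mul, norm_odd]
    · rw [show 2 ^ (K + 1) - 1 + 1 = 2 ^ (K + 1) by omega]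
      push_cast
      rw [norm_inv, norm_two_pow', inv_pow, inv_inv, mul_one]
    · rw [Nat.mul_mod, choose_odd _ _ (by omega), choose_odd _ _ (by omega)]
  have t2 : ‖∑ i ∈ (range (2 ^ (K + 2) - 1)).erase (2 ^ (K + 1) - 1), ((i + 1 : ℕ) : ℚ_[2])⁻¹ * (((2 ^ m - 1).choose i * (2 ^ m - 1).choose (2 ^ (K + 2) - 1 - 1 - i) : ℕ) : ℚ_[2])‖ ≤ 2 ^ K := by
    apply IsUltrametricDist.norm_sum_le_of_forall_le_of_nonneg (by positivity)
    intro i hi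
    rw [mem_erase, mem_range] at hi
    rw [norm_mul]
    refine (mul_le_of_le_one_right (norm_nonneg _) (norm_nat_le_one _)).trans (inv_norm _ _ ?_)
    rintro ⟨c, hc⟩
    rw [hp1] at hc
    have : c = 1 := by
      rcases c with _ | _ | c
      · omega
      · rfl
      · exfalso
        have : 2 * 2 ^ K * (c + 1 + 1) = 4 * 2 ^ K + 2 * 2 ^ K * c := by ring
        omega
    subst this
    omega
  have hlt : (2 : ℝ) ^ K < 2 ^ (K + 1) := pow_lt_pow_right₀ (by norm_num) (by omega)
  rw [IsUltrametricDist.norm_add_eq_max_of_norm_ne_norm (by rw [t1]; exact (t2.trans_lt hlt).ne'), t1,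
    max_eq_left (t2.trans hlt.le)]
  rfl

open Polynomial in
lemma D_poly (P : Polynomial ℚ_[2]) (k : ℕ) (h : P.natDegree < k) :
    (fwdDiff (1 : ℕ))^[k] (fun t : ℕ => P.eval (t : ℚ_[2])) 0 = 0 := by
  have h1 := congrFun (Polynomial.fwdDiff_iter_eq_zero_of_degree_lt h) 0
  rw [fwdDiff_iter_eq_sum_shift] at h1 ⊢
  simpa using h1

lemma D_lead (P : Polynomial ℚ_[2]) :
    (fwdDiff (1 : ℕ))^[P.natDegree] (fun t : ℕ => P.eval (t : ℚ_[2])) 0 = P.leadingCoeff * P.natDegree.factorial := by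
  have h1 := congrFun (Polynomial.fwdDiff_iter_degree_eq_factorial P) 0
  rw [fwdDiff_iter_eq_sum_shift] at h1 ⊢
  simpa using h1

lemma D_norm (φ : ℕ → ℚ_[2]) (k : ℕ) (ε : ℝ) (hε : 0 ≤ ε) (h : ∀ t, ‖φ t‖ ≤ ε) :
    ‖(fwdDiff (1 : ℕ))^[k] φ 0‖ ≤ ε := by
  rw [fwdDiff_iter_eq_sum_shift]
  apply IsUltrametricDist.norm_sum_le_of_forall_le_of_nonneg hε
  intro i _
  rw [zsmul_eq_mul, norm_mul]
  exact (mul_le_of_le_one_left (norm_nonneg _) (Padic.norm_int_le_one _)).trans (h _)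

lemma D_le (φ : ℕ → ℚ_[2]) (P : Polynomial ℚ_[2]) (k : ℕ) (ε : ℝ) (hε : 0 ≤ ε) (hP : P.natDegree < k)
    (h : ∀ t : ℕ, ‖φ t - P.eval (t : ℚ_[2])‖ ≤ ε) : ‖(fwdDiff (1 : ℕ))^[k] φ 0‖ ≤ ε := by
  have e : φ = (fun t : ℕ => P.eval (t : ℚ_[2])) + (fun t : ℕ => φ t - P.eval (t : ℚ_[2])) := by
    funext t; simp
  rw [e, fwdDiff_iter_add]
  simp only [Pi.add_apply]
  rw [D_poly P k hP, zero_add]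
  exact D_norm _ k ε hε h

lemma sum_choose_range (x k : ℕ) : ∑ t ∈ range x, t.choose k = x.choose (k + 1) := by
  induction x with
  | zero => simp
  | succ x ih => rw [sum_range_succ, ih, Nat.choose_succ_succ, add_comm]

lemma newton_sum (g : ℕ → ℚ_[2]) (x n : ℕ) (h : x ≤ n) :
    ∑ t ∈ range x, g t = ∑ k ∈ range n, (fwdDiff (1 : ℕ))^[k] g 0 * (x.choose (k + 1) : ℚ_[2]) := by
  have h1 : ∀ t ∈ range x, g t = ∑ k ∈ range n, (fwdDiff (1 : ℕ))^[k] g 0 * (t.choose k : ℚ_[2]) := by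
    intro t ht
    rw [mem_range] at ht
    have := shift_eq_sum_fwdDiff_iter (1 : ℕ) g t 0
    simp only [zero_add, smul_eq_mul, mul_one, nsmul_eq_mul] at this
    rw [this]
    rw [← Finset.sum_subset (s₁ := range (t + 1)) (s₂ := range n)]
    · apply sum_congr rfl; intro i _; simp [mul_comm]
    · intro i hi; rw [mem_range] at *; omega
    · intro i _ hi
      rw [mem_range] at hi
      rw [Nat.choose_eq_zero_of_lt (by omega)]; simp
  rw [sum_congr rfl h1, sum_comm]
  apply sum_congr rfl
  intro k _
  rw [← mul_sum, ← sum_choose_range]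
  push_cast
  rfl

lemma newton_W (g : ℕ → ℚ_[2]) (m : ℕ) :
    ((2 : ℚ_[2]) ^ m)⁻¹ * ((2 : ℚ_[2]) ^ m)⁻¹ * ∑ k ∈ range (2 ^ m), (g (k + 2 ^ m) - g k)
      = ∑ k ∈ range (2 * 2 ^ m), (fwdDiff (1 : ℕ))^[k] g 0 * Wk m k := by
  have h1 := newton_sum g (2 * 2 ^ m) (2 * 2 ^ m) le_rfl
  have h2 := newton_sum g (2 ^ m) (2 * 2 ^ m) (by omega)
  have h3 : ∑ k ∈ range (2 ^ m), (g (k + 2 ^ m) - g k) = ∑ t ∈ range (2 * 2 ^ m), g t - 2 * ∑ t ∈ range (2 ^ m), g t := by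
    rw [two_mul (2 ^ m), sum_range_add, sum_sub_distrib, two_mul]
    simp only [add_comm (2 ^ m)]
    ring
  rw [h3, h1, h2, mul_sum, ← sum_sub_distrib, mul_sum]
  apply sum_congr rfl
  intro k _
  unfold Wk
  ring

lemma trunc_inv (U : Polynomial ℤ_[2]) (hU : IsUnit (U.coeff 0)) (j : ℕ) :
    ∃ V R : Polynomial ℤ_[2], V.natDegree ≤ j ∧ U * V = 1 - Polynomial.X ^ (j + 1) * R := by
  obtain ⟨c, hc⟩ := hU.exists_right_inv
  have step : ∀ (R : Polynomial ℤ_[2]), ∃ R', R - Polynomial.C (R.coeff 0 * c) * U = Polynomial.X * R' := by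
    intro R
    refine Polynomial.X_dvd_iff.2 ?_
    rw [Polynomial.coeff_sub, Polynomial.coeff_C_mul]
    linear_combination -R.coeff 0 * hc
  induction j with
  | zero =>
    obtain ⟨R', hR'⟩ := step 1
    refine ⟨Polynomial.C c, R', by simp, ?_⟩
    simp at hR' ⊢
    rw [← hR']; ring
  | succ j ih =>
    obtain ⟨V, R, h1, h2⟩ := ih
    obtain ⟨R', hR'⟩ := step R
    refine ⟨V + Polynomial.C (R.coeff 0 * c) * Polynomial.X ^ (j + 1), R', ?_, ?_⟩
    · refine (Polynomial.natDegree_add_le _ _).trans (max_le (by omega) ?_)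
      exact Polynomial.natDegree_C_mul_X_pow_le _ _
    · rw [mul_add, h2, pow_succ (Polynomial.X) (j + 1), mul_assoc _ Polynomial.X R', ← hR']
      ring

lemma eval4_odd (U : Polynomial ℤ) (hU : U.coeff 0 % 2 = 1) (t : ℕ) : U.eval (4 * (t : ℤ)) % 2 = 1 := by
  have h := Polynomial.sub_dvd_eval_sub (4 * (t : ℤ)) 0 U
  rw [← Polynomial.coeff_zero_eq_eval_zero] at h
  obtain ⟨c, hc⟩ := h
  generalize Polynomial.eval (4 * (t : ℤ)) U = A at *
  have : (4 * (t : ℤ) - 0) * c = 2 * (2 * t * c) := by ring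
  omega

lemma norm_int_odd (n : ℤ) (h : n % 2 = 1) : ‖(n : ℚ_[2])‖ = 1 := by
  have h3 := Padic.norm_intCast_lt_one_iff (p := 2) (k := n)
  have h1 := Padic.norm_int_le_one (p := 2) n
  by_contra hne
  have := h3.1 (lt_of_le_of_ne h1 hne)
  push_cast at this
  omega

lemma norm_int_even (n : ℤ) (h : n % 2 = 0) : ‖(n : ℚ_[2])‖ ≤ 2⁻¹ := by
  obtain ⟨c, rfl⟩ : (2 : ℤ) ∣ n := by omega
  push_cast
  have h2 : ‖(2 : ℚ_[2])‖ = 2⁻¹ := by simpa using norm_two_pow' 1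
  rw [norm_mul, h2]
  exact mul_le_of_le_one_right (by norm_num) (Padic.norm_int_le_one _)

lemma w_approx (U : Polynomial ℤ) (hU : U.coeff 0 % 2 = 1) (j : ℕ) :
    ∃ V : Polynomial ℤ_[2], V.natDegree ≤ j ∧
      ∀ t : ℕ, ‖((U.eval (4 * (t : ℤ)) : ℤ) : ℚ_[2])⁻¹ - ((V.eval (4 * (t : ℤ_[2])) : ℤ_[2]) : ℚ_[2])‖ ≤ (4⁻¹ : ℝ) ^ (j + 1) := by
  have hu : IsUnit ((U.map (Int.castRingHom ℤ_[2])).coeff 0) := by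
    rw [Polynomial.coeff_map, PadicInt.isUnit_iff]
    have := norm_int_odd _ hU
    simpa [PadicInt.norm_def] using this
  obtain ⟨V, R, hV, hR⟩ := trunc_inv _ hu j
  refine ⟨V, hV, fun t => ?_⟩
  obtain ⟨u, hut⟩ : ∃ u, u = U.eval (4 * (t : ℤ)) := ⟨_, rfl⟩
  have hodd := eval4_odd U hU t
  rw [← hut] at hodd ⊢
  have hn := norm_int_odd u hodd
  have hne : (u : ℚ_[2]) ≠ 0 := by
    intro h; rw [h, norm_zero] at hn; norm_num at hn
  have hev := congrArg (Polynomial.eval (4 * (t : ℤ_[2]))) hR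
  have hue : Polynomial.eval (4 * (t : ℤ_[2])) (U.map (Int.castRingHom ℤ_[2])) = (u : ℤ_[2]) := by
    rw [hut]
    have := Polynomial.eval_intCast_map (Int.castRingHom ℤ_[2]) U (4 * (t : ℤ))
    push_cast at this
    simpa using this
  rw [Polynomial.eval_mul, hue] at hev
  simp only [Polynomial.eval_sub, Polynomial.eval_one, Polynomial.eval_mul, Polynomial.eval_pow, Polynomial.eval_X] at hev
  have c4 : ((4 : ℤ_[2]) : ℚ_[2]) = 4 := map_ofNat (PadicInt.Coe.ringHom (p := 2)) 4
  have hev2 : (((u : ℤ_[2]) * V.eval (4 * (t : ℤ_[2])) : ℤ_[2]) : ℚ_[2]) = ((1 - (4 * (t : ℤ_[2])) ^ (j + 1) * R.eval (4 * (t : ℤ_[2])) : ℤ_[2]) : ℚ_[2]) := by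
    rw [hev]
  push_cast at hev2
  rw [c4] at hev2
  have e : (u : ℚ_[2])⁻¹ - ((V.eval (4 * (t : ℤ_[2])) : ℤ_[2]) : ℚ_[2]) =
     (u : ℚ_[2])⁻¹ * ((4 * (t : ℚ_[2])) ^ (j + 1) * ((R.eval (4 * (t : ℤ_[2])) : ℤ_[2]) : ℚ_[2])) := by
    field_simp
    linear_combination -hev2
  rw [e, norm_mul, norm_inv, hn, inv_one, one_mul, norm_mul, norm_pow, norm_mul]
  have h4 : ‖(4 : ℚ_[2])‖ = 4⁻¹ := by
    have := norm_two_pow' 2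
    norm_num at this ⊢
    exact this
  rw [h4]
  refine (mul_le_of_le_one_right (by positivity) (PadicInt.norm_le_one _)).trans ?_
  apply pow_le_pow_left₀ (by positivity)
  exact mul_le_of_le_one_right (by norm_num) (norm_nat_le_one _)

/-- evaluation of the truncated inverse as a polynomial over the field -/
lemma V_poly (V : Polynomial ℤ_[2]) (t : ℕ) : ((V.eval (4 * (t : ℤ_[2])) : ℤ_[2]) : ℚ_[2]) =
    ((V.map PadicInt.Coe.ringHom).comp (Polynomial.C 4 * Polynomial.X)).eval (t : ℚ_[2]) := by
  rw [Polynomial.eval_comp]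
  simp only [Polynomial.eval_mul, Polynomial.eval_C, Polynomial.eval_X]
  have := Polynomial.eval_map_apply (f := (PadicInt.Coe.ringHom (p := 2))) (p := V) (4 * (t : ℤ_[2]))
  simp only [map_mul, map_natCast, map_ofNat] at this
  rw [this]
  rfl

lemma V_deg (V : Polynomial ℤ_[2]) (j : ℕ) (h : V.natDegree ≤ j) :
    ((V.map (PadicInt.Coe.ringHom (p := 2))).comp (Polynomial.C 4 * Polynomial.X)).natDegree ≤ j := by
  refine Polynomial.natDegree_comp_le.trans ?_
  calc _ ≤ j * 1 := Nat.mul_le_mul (Polynomial.natDegree_map_le.trans h) (by simpa using Polynomial.natDegree_C_mul_X_pow_le (4 : ℚ_[2]) 1)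
    _ = j := mul_one j

section akan
variable (c : ℕ → ℕ) (U : Polynomial ℤ)

/-- the reduced function -/
noncomputable def gfun (c : ℕ → ℕ) (U : Polynomial ℤ) (t : ℕ) : ℚ_[2] :=
  (c t : ℚ_[2]) ^ 2 * ((U.eval (4 * (t : ℤ)) : ℤ) : ℚ_[2])⁻¹

lemma gfun_norm (hU : U.coeff 0 % 2 = 1) (t : ℕ) : ‖gfun c U t‖ ≤ 1 := by
  unfold gfun
  rw [norm_mul, norm_inv, norm_int_odd _ (eval4_odd U hU t), norm_pow]
  simpa using pow_le_one₀ (n := 2) (norm_nonneg _) (norm_nat_le_one (c t))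

lemma gfun_two (hU : U.coeff 0 % 2 = 1) (t : ℕ) : ‖gfun c U t - (c t : ℚ_[2])‖ ≤ 2⁻¹ := by
  unfold gfun
  have hodd := eval4_odd U hU t
  generalize U.eval (4 * (t : ℤ)) = u at *
  have hn := norm_int_odd _ hodd
  have hne : (u : ℚ_[2]) ≠ 0 := by
    intro h; rw [h, norm_zero] at hn; norm_num at hn
  have e : (c t : ℚ_[2]) ^ 2 * (u : ℚ_[2])⁻¹ - (c t : ℚ_[2]) = (u : ℚ_[2])⁻¹ * (((c t : ℤ) * ((c t : ℤ) - u) : ℤ) : ℚ_[2]) := by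
    push_cast
    field_simp
  rw [e, norm_mul, norm_inv, hn, inv_one, one_mul]
  apply norm_int_even
  rcases Int.emod_two_eq_zero_or_one (c t : ℤ) with h | h
  · rw [Int.mul_emod, h]; simp
  · rw [Int.mul_emod, show ((c t : ℤ) - u) % 2 = 0 by omega]; simp

end akan

lemma a_mid (K : ℕ) (P : Polynomial ℚ_[2]) (c : ℕ → ℕ) (U : Polynomial ℤ) (hU : U.coeff 0 % 2 = 1)
    (hP : ∀ t : ℕ, P.eval (t : ℚ_[2]) = (c t : ℚ_[2])) (hd : P.natDegree = 2 ^ K - 1) (k : ℕ) (hk : 2 ^ K ≤ k) : ‖(fwdDiff (1 : ℕ))^[k] (gfun c U) 0‖ ≤ 2⁻¹ := by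
  have := Nat.one_le_two_pow (n := K)
  apply D_le _ P k _ (by norm_num) (by omega)
  intro t
  rw [hP]
  exact gfun_two c U hU t

lemma a_top (K : ℕ) (P : Polynomial ℚ_[2]) (c : ℕ → ℕ) (U : Polynomial ℤ) (hU : U.coeff 0 % 2 = 1)
    (hP : ∀ t : ℕ, P.eval (t : ℚ_[2]) = (c t : ℚ_[2])) (hd : P.natDegree = 2 ^ K - 1) (h1 : ‖P.leadingCoeff * (2 ^ K - 1).factorial‖ = 1) : ‖(fwdDiff (1 : ℕ))^[2 ^ K - 1] (gfun c U) 0‖ = 1 := by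
  have e : gfun c U = (fun t : ℕ => P.eval (t : ℚ_[2])) + (fun t : ℕ => gfun c U t - P.eval (t : ℚ_[2])) := by
    funext t; simp
  rw [e, fwdDiff_iter_add]
  simp only [Pi.add_apply]
  have h2 := D_lead P
  rw [hd] at h2
  rw [h2]
  have h3 := D_norm (fun t : ℕ => gfun c U t - P.eval (t : ℚ_[2])) (2 ^ K - 1) 2⁻¹ (by norm_num) (by
    intro t; rw [hP]; exact gfun_two c U hU t)
  rw [IsUltrametricDist.norm_add_eq_max_of_norm_ne_norm (by rw [h1]; intro h; rw [← h] at h3; norm_num at h3), h1,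
    max_eq_left (h3.trans (by norm_num))]

lemma a_high (K : ℕ) (P : Polynomial ℚ_[2]) (c : ℕ → ℕ) (U : Polynomial ℤ) (hU : U.coeff 0 % 2 = 1)
    (hP : ∀ t : ℕ, P.eval (t : ℚ_[2]) = (c t : ℚ_[2])) (hd : P.natDegree = 2 ^ K - 1) (j : ℕ) : ‖(fwdDiff (1 : ℕ))^[2 * 2 ^ K - 1 + j] (gfun c U) 0‖ ≤ (4⁻¹ : ℝ) ^ (j + 1) := by
  have h1 := Nat.one_le_two_pow (n := K)
  obtain ⟨V, hV, hVt⟩ := w_approx U hU j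
  apply D_le _ (P ^ 2 * (V.map PadicInt.Coe.ringHom).comp (Polynomial.C 4 * Polynomial.X)) _ _ (by positivity)
  · have h2 := V_deg V j hV
    have h3 := Polynomial.natDegree_mul_le (p := P ^ 2) (q := (V.map (PadicInt.Coe.ringHom (p := 2))).comp (Polynomial.C 4 * Polynomial.X))
    have h4 := Polynomial.natDegree_pow_le (p := P) (n := 2)
    rw [hd] at h4
    omega
  · intro t
    rw [Polynomial.eval_mul, ← V_poly, Polynomial.eval_pow, hP]
    unfold gfun
    rw [← mul_sub, norm_mul]
    refine (mul_le_of_le_one_left (norm_nonneg _) ?_).trans (hVt t)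
    rw [norm_pow]
    exact pow_le_one₀ (norm_nonneg _) (norm_nat_le_one (c t))

lemma a_edge (K : ℕ) (P : Polynomial ℚ_[2]) (c : ℕ → ℕ) (U : Polynomial ℤ) (hU : U.coeff 0 % 2 = 1)
    (hP : ∀ t : ℕ, P.eval (t : ℚ_[2]) = (c t : ℚ_[2])) (hd : P.natDegree = 2 ^ K - 1) (hK : 1 ≤ K) : ‖(fwdDiff (1 : ℕ))^[2 * 2 ^ K - 1] (gfun c U) 0‖ ≤ 8⁻¹ := by
  have h1 : 2 ≤ 2 ^ K := by simpa using Nat.pow_le_pow_right (n := 2) (by norm_num) hK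
  obtain ⟨V, hV, hVt⟩ := w_approx U hU 1
  obtain ⟨a, b, hab⟩ := Polynomial.exists_eq_X_add_C_of_natDegree_le_one hV
  have hVe : ∀ t : ℕ, ((V.eval (4 * (t : ℤ_[2])) : ℤ_[2]) : ℚ_[2]) = b + a * (4 * t) := by
    have c4 : ((4 : ℤ_[2]) : ℚ_[2]) = 4 := map_ofNat (PadicInt.Coe.ringHom (p := 2)) 4
    intro t; rw [hab]; simp [c4]; ring
  have h4 : ‖(4 : ℚ_[2])‖ = 4⁻¹ := by
    have := norm_two_pow' 2
    norm_num at this ⊢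
    exact this
  apply D_le _ (Polynomial.C (b : ℚ_[2]) * P ^ 2 + Polynomial.C (a * 4 : ℚ_[2]) * (Polynomial.X * P)) _ _ (by positivity)
  · refine (Polynomial.natDegree_add_le _ _).trans_lt (max_lt ?_ ?_)
    · refine (Polynomial.natDegree_C_mul_le _ _).trans_lt ?_
      have h4 := Polynomial.natDegree_pow_le (p := P) (n := 2)
      omega
    · refine (Polynomial.natDegree_C_mul_le _ _).trans_lt ?_
      have h4 := Polynomial.natDegree_mul_le (p := Polynomial.X) (q := P)
      rw [Polynomial.natDegree_X] at h4
      omega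
  · intro t
    simp only [Polynomial.eval_add, Polynomial.eval_mul, Polynomial.eval_C, Polynomial.eval_X, Polynomial.eval_pow, hP]
    have hw := hVt t
    rw [hVe] at hw
    have e : gfun c U t - (b * (c t : ℚ_[2]) ^ 2 + a * 4 * (t * (c t : ℚ_[2])))
       = (c t : ℚ_[2]) ^ 2 * (((U.eval (4 * (t : ℤ)) : ℤ) : ℚ_[2])⁻¹ - (b + a * (4 * t))) +
         4 * (a * (t * (((c t : ℤ) * ((c t : ℤ) - 1) : ℤ) : ℚ_[2]))) := by
      unfold gfun; push_cast; ring
    rw [e]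
    refine (IsUltrametricDist.norm_add_le_max _ _).trans (max_le ?_ ?_)
    · rw [norm_mul]
      refine (mul_le_of_le_one_left (norm_nonneg _) ?_).trans (hw.trans (by norm_num))
      rw [norm_pow]
      exact pow_le_one₀ (norm_nonneg _) (norm_nat_le_one (c t))
    · rw [norm_mul, norm_mul, norm_mul, h4]
      have q1 : ‖((((c t : ℤ) * ((c t : ℤ) - 1) : ℤ)) : ℚ_[2])‖ ≤ 2⁻¹ := by
        apply norm_int_even
        rcases Int.emod_two_eq_zero_or_one (c t : ℤ) with h | h
        · rw [Int.mul_emod, h]; simp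
        · rw [Int.mul_emod, show ((c t : ℤ) - 1) % 2 = 0 by omega]; simp
      have q2 := norm_nat_le_one t
      have q3 : ‖(a : ℚ_[2])‖ ≤ 1 := PadicInt.norm_le_one a
      have q4 : ‖(t : ℚ_[2])‖ * ‖((((c t : ℤ) * ((c t : ℤ) - 1) : ℤ)) : ℚ_[2])‖ ≤ 2⁻¹ :=
        (mul_le_of_le_one_left (norm_nonneg _) q2).trans q1
      have q5 := (mul_le_of_le_one_left (by positivity) q3).trans q4
      calc _ ≤ 4⁻¹ * (2⁻¹ : ℝ) := mul_le_mul_of_nonneg_left q5 (by norm_num)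
        _ = 8⁻¹ := by norm_num

lemma aW_le (L : ℕ) (P : Polynomial ℚ_[2]) (c : ℕ → ℕ) (U : Polynomial ℤ) (hU : U.coeff 0 % 2 = 1)
    (hP : ∀ t : ℕ, P.eval (t : ℚ_[2]) = (c t : ℚ_[2])) (hd : P.natDegree = 2 ^ (L + 1) - 1) (m k : ℕ) (hk : k ≠ 2 ^ (L + 1) - 1) :
    ‖(fwdDiff (1 : ℕ))^[k] (gfun c U) 0 * Wk m k‖ ≤ 2⁻¹ * 2 ^ L * 2 ^ L := by
  have p0 := Nat.one_le_two_pow (n := L)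
  have p1 : 2 ^ (L + 1) = 2 * 2 ^ L := by ring
  have p2 : 2 ^ (L + 1 + 1) = 4 * 2 ^ L := by ring
  have p3 : 2 ^ (L + 2 + 1) = 8 * 2 ^ L := by ring
  rw [norm_mul]
  rcases Nat.lt_or_ge k (2 ^ (L + 1)) with h1 | h1
  · have hb : ¬ 2 ^ (L + 1) ∣ k + 1 := fun h => by have := Nat.le_of_dvd (by omega) h; omega
    have hW := Wk_le m k L L h1 hb
    exact (mul_le_of_le_one_left (norm_nonneg _) (D_norm _ k 1 (by norm_num) (gfun_norm c U hU))).trans hW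
  rcases Nat.lt_or_ge k (2 * 2 ^ (L + 1) - 1) with h2 | h2
  · have hb : ¬ 2 ^ (L + 1) ∣ k + 1 := by
      rintro ⟨q, hq⟩
      have h3 : 1 < q := by
        by_contra h
        have : 2 ^ (L + 1) * q ≤ 2 ^ (L + 1) * 1 := Nat.mul_le_mul_left _ (by omega)
        omega
      have : 2 ^ (L + 1) * 2 ≤ 2 ^ (L + 1) * q := Nat.mul_le_mul_left _ (by omega)
      omega
    have hW := Wk_le m k (L + 1) L (by omega) hb
    have ha := a_mid (L + 1) P c U hU hP hd k h1
    calc _ ≤ 2⁻¹ * (2⁻¹ * 2 ^ L * 2 ^ (L + 1)) := mul_le_mul ha hW (norm_nonneg _) (by norm_num)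
      _ = _ := by rw [pow_succ]; ring
  obtain ⟨j, rfl⟩ : ∃ j, k = 2 * 2 ^ (L + 1) - 1 + j := ⟨k - (2 * 2 ^ (L + 1) - 1), by omega⟩
  rcases j with _ | j
  · have hb : ¬ 2 ^ (L + 2 + 1) ∣ 2 * 2 ^ (L + 1) - 1 + 0 + 1 := fun h => by have := Nat.le_of_dvd (by omega) h; omega
    have hW := Wk_le m (2 * 2 ^ (L + 1) - 1 + 0) (L + 1) (L + 2) (by omega) hb
    have ha := a_edge (L + 1) P c U hU hP hd (by omega)
    calc _ ≤ 8⁻¹ * (2⁻¹ * 2 ^ (L + 2) * 2 ^ (L + 1)) := mul_le_mul ha hW (norm_nonneg _) (by norm_num)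
      _ = _ := by rw [pow_succ, pow_succ]; ring
  · have hlt : 4 * 2 ^ L + (j + 1) < 2 ^ (L + j + 2 + 1) := by
      have e : 2 ^ (L + j + 2 + 1) = 8 * (2 ^ L * 2 ^ j) := by ring
      have h3 := Nat.lt_two_pow_self (n := j)
      rw [e]
      have h4 : 2 ^ L ≤ 2 ^ L * 2 ^ j := Nat.le_mul_of_pos_right _ (by positivity)
      have h5 : 2 ^ j ≤ 2 ^ L * 2 ^ j := Nat.le_mul_of_pos_left _ (by positivity)
      generalize 2 ^ L * 2 ^ j = A at *
      omega
    have hb : ¬ 2 ^ (L + j + 2 + 1) ∣ 2 * 2 ^ (L + 1) - 1 + (j + 1) + 1 := fun h => by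
      have := Nat.le_of_dvd (by omega) h; omega
    have hW := Wk_le m (2 * 2 ^ (L + 1) - 1 + (j + 1)) (L + j + 2) (L + j + 2) (by omega) hb
    have ha := a_high (L + 1) P c U hU hP hd (j + 1)
    calc _ ≤ (4⁻¹ : ℝ) ^ (j + 1 + 1) * (2⁻¹ * 2 ^ (L + j + 2) * 2 ^ (L + j + 2)) := mul_le_mul ha hW (norm_nonneg _) (by positivity)
      _ = _ := by
        have : (4⁻¹ : ℝ) ^ (j + 1 + 1) * (2 ^ (j + 2) * 2 ^ (j + 2)) = 1 := by
          rw [← mul_pow, ← mul_pow]; norm_num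
        rw [show L + j + 2 = L + (j + 2) by ring, pow_add (2 : ℝ) L]
        linear_combination (2⁻¹ * 2 ^ L * 2 ^ L : ℝ) * this

lemma aW_sum (L : ℕ) (P : Polynomial ℚ_[2]) (c : ℕ → ℕ) (U : Polynomial ℤ) (hU : U.coeff 0 % 2 = 1)
    (hP : ∀ t : ℕ, P.eval (t : ℚ_[2]) = (c t : ℚ_[2])) (hd : P.natDegree = 2 ^ (L + 1) - 1) (m : ℕ) (hL : 1 ≤ L) (hm : L + 1 ≤ m) (h1 : ‖P.leadingCoeff * (2 ^ (L + 1) - 1).factorial‖ = 1) :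
    ‖((2 : ℚ_[2]) ^ m)⁻¹ * ((2 : ℚ_[2]) ^ m)⁻¹ * ∑ k ∈ range (2 ^ m), (gfun c U (k + 2 ^ m) - gfun c U k)‖ = 2 ^ L * 2 ^ L := by
  rw [newton_W]
  have p0 := Nat.one_le_two_pow (n := L)
  have p1 : 2 ^ (L + 1) = 2 * 2 ^ L := by ring
  have pm : 2 ^ (L + 1) ≤ 2 ^ m := Nat.pow_le_pow_right (by norm_num) hm
  have hmem : 2 ^ (L + 1) - 1 ∈ range (2 * 2 ^ m) := by rw [mem_range]; omega
  rw [← Finset.add_sum_erase _ _ hmem]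
  have t1 : ‖(fwdDiff (1 : ℕ))^[2 ^ (L + 1) - 1] (gfun c U) 0 * Wk m (2 ^ (L + 1) - 1)‖ = 2 ^ L * 2 ^ L := by
    rw [norm_mul, a_top (L + 1) P c U hU hP hd h1, Wk_exact m (L + 1) (by omega) hm, pow_succ, Nat.add_sub_cancel]
    ring
  have t2 : ‖∑ k ∈ (range (2 * 2 ^ m)).erase (2 ^ (L + 1) - 1), (fwdDiff (1 : ℕ))^[k] (gfun c U) 0 * Wk m k‖ ≤ 2⁻¹ * 2 ^ L * 2 ^ L := by
    apply IsUltrametricDist.norm_sum_le_of_forall_le_of_nonneg (by positivity)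
    intro k hk
    exact aW_le L P c U hU hP hd m k (mem_erase.1 hk).1
  have hlt : (2⁻¹ * 2 ^ L * 2 ^ L : ℝ) < 2 ^ L * 2 ^ L := by
    have : (0 : ℝ) < 2 ^ L * 2 ^ L := by positivity
    linarith
  rw [IsUltrametricDist.norm_add_eq_max_of_norm_ne_norm (by rw [t1]; exact (t2.trans_lt hlt).ne'), t1,
    max_eq_left (t2.trans hlt.le)]

/-- `(t + h).choose m` as a polynomial in `t`. -/
noncomputable def chP (h m : ℕ) : Polynomial ℚ_[2] :=
  Polynomial.C ((m.factorial : ℚ_[2])⁻¹) * (descPochhammer ℚ_[2] m).comp (Polynomial.X + Polynomial.C (h : ℚ_[2]))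

lemma chP_eval (h m t : ℕ) : (chP h m).eval (t : ℚ_[2]) = (((t + h).choose m : ℕ) : ℚ_[2]) := by
  unfold chP
  have hm : (m.factorial : ℚ_[2]) ≠ 0 := by exact_mod_cast m.factorial_ne_zero
  rw [Polynomial.eval_mul, Polynomial.eval_C, Polynomial.eval_comp]
  simp only [Polynomial.eval_add, Polynomial.eval_X, Polynomial.eval_C]
  rw [← Nat.cast_add, descPochhammer_eval_eq_descFactorial, Nat.descFactorial_eq_factorial_mul_choose]
  push_cast
  field_simp

lemma chP_deg (h m : ℕ) : (chP h m).natDegree = m := by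
  unfold chP
  have hm : (m.factorial : ℚ_[2])⁻¹ ≠ 0 := inv_ne_zero (by exact_mod_cast m.factorial_ne_zero)
  rw [Polynomial.natDegree_C_mul hm, Polynomial.natDegree_comp, descPochhammer_natDegree, Polynomial.natDegree_X_add_C, mul_one]

lemma chP_lead (h m : ℕ) : (chP h m).leadingCoeff = (m.factorial : ℚ_[2])⁻¹ := by
  unfold chP
  have := (monic_descPochhammer ℚ_[2] m).comp_X_add_C (h : ℚ_[2])
  rw [Polynomial.leadingCoeff_mul, this.leadingCoeff]
  simp

lemma num_prod (M m t : ℕ) (hm : 2 * m ≤ 6 * M) :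
    ∏ x ∈ I3 M, (1 + 4 * (t : ℚ_[2]) - (x : ℚ_[2])) ^ (if x % 4 = 1 then (if |x| ≤ ((2 * m : ℕ) : ℤ) then 1 else 0) else 0)
      = 4 ^ m * (m.factorial : ℚ_[2]) * (((t + m / 2).choose m : ℕ) : ℚ_[2]) := by
  have h1 : (4 : ℚ_[2]) ^ m * (m.factorial : ℚ_[2]) * (((t + m / 2).choose m : ℕ) : ℚ_[2]) =
      ∏ i ∈ range m, (4 * (((t + m / 2 : ℕ) : ℚ_[2]) - i)) := by
    rw [prod_mul_distrib, prod_const, card_range, ← descPochhammer_eval_eq_prod_range, descPochhammer_eval_eq_descFactorial,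
      Nat.descFactorial_eq_factorial_mul_choose]
    push_cast
    ring
  rw [h1]
  have h2 : ∀ x ∈ I3 M, (1 + 4 * (t : ℚ_[2]) - (x : ℚ_[2])) ^ (if x % 4 = 1 then (if |x| ≤ ((2 * m : ℕ) : ℤ) then 1 else 0) else 0)
     = if x % 4 = 1 ∧ |x| ≤ ((2 * m : ℕ) : ℤ) then (1 + 4 * (t : ℚ_[2]) - (x : ℚ_[2])) else 1 := by
    intro x _
    by_cases a : x % 4 = 1 <;> by_cases b : |x| ≤ ((2 * m : ℕ) : ℤ) <;> simp [a, b]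
  rw [prod_congr rfl h2, ← prod_filter]
  symm
  apply Finset.prod_bij (fun (i : ℕ) _ => 1 + 4 * ((i : ℤ) - (m / 2 : ℕ)))
  · intro i hi
    rw [mem_range] at hi
    unfold I3
    rw [mem_filter, mem_Icc, abs_le]
    push_cast
    omega
  · intro a _ b _ hab
    omega
  · intro x hx
    unfold I3 at hx
    rw [mem_filter, mem_Icc, abs_le] at hx
    push_cast at hx
    refine ⟨(((x - 1) / 4) + (m / 2 : ℕ)).toNat, ?_, ?_⟩
    · rw [mem_range]; omega
    · omega
  · intro i _
    generalize m / 2 = q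
    push_cast
    ring

/-- the denominator polynomial -/
noncomputable def U3 (M : ℕ) : Polynomial ℤ := ∏ x ∈ I3 M, (Polynomial.X + Polynomial.C (1 - x)) ^ d3 M x

lemma U3_odd (M : ℕ) : (U3 M).coeff 0 % 2 = 1 := by
  unfold U3
  rw [Polynomial.coeff_zero_eq_eval_zero, Polynomial.eval_prod]
  apply Finset.prod_induction _ (fun z : ℤ => z % 2 = 1)
  · intro a b ha hb; rw [Int.mul_emod, ha, hb]; rfl
  · rfl
  · intro x _
    simp only [Polynomial.eval_pow, Polynomial.eval_add, Polynomial.eval_X, Polynomial.eval_C, zero_add]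
    by_cases h : d3 M x = 0
    · rw [h, pow_zero]; rfl
    · have h2 := d3_even M x h
      have h3 : Odd (1 - x) := by rw [Int.odd_iff]; omega
      exact Int.odd_iff.1 h3.pow

lemma coeff0_R (M t : ℕ) : PowerSeries.coeff 0 (Rser (I3 M) (n3 M) (d3 M) (1 + 4 * (t : ℚ_[2]))) =
    ((4 : ℚ_[2]) ^ (2 * M) * ((2 * M).factorial : ℚ_[2])) ^ 2 * (4 ^ (3 * M) * ((3 * M).factorial : ℚ_[2])) ^ 2 *
      gfun (fun t => (t + 2 * M / 2).choose (2 * M) * (t + 3 * M / 2).choose (3 * M)) (U3 M) t := by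
  unfold Rser gfun U3
  rw [PowerSeries.coeff_zero_eq_constantCoeff_apply, map_mul, map_prod, map_prod]
  simp only [map_pow, map_add, PowerSeries.constantCoeff_inv, PowerSeries.constantCoeff_C, PowerSeries.constantCoeff_X, add_zero]
  have h1 : ∏ x ∈ I3 M, (1 + 4 * (t : ℚ_[2]) - (x : ℚ_[2])) ^ n3 M x =
      (∏ x ∈ I3 M, (1 + 4 * (t : ℚ_[2]) - (x : ℚ_[2])) ^ (if x % 4 = 1 then (if |x| ≤ ((2 * (2 * M) : ℕ) : ℤ) then 1 else 0) else 0)) ^ 2 *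
      (∏ x ∈ I3 M, (1 + 4 * (t : ℚ_[2]) - (x : ℚ_[2])) ^ (if x % 4 = 1 then (if |x| ≤ ((2 * (3 * M) : ℕ) : ℤ) then 1 else 0) else 0)) ^ 2 := by
    rw [← prod_pow, ← prod_pow, ← prod_mul_distrib]
    apply prod_congr rfl
    intro x _
    rw [← pow_mul, ← pow_mul, ← pow_add]
    congr 1
    unfold n3
    rw [show 2 * (2 * M) = 4 * M by ring, show 2 * (3 * M) = 6 * M by ring]
    split_ifs <;> rfl
  rw [h1, num_prod M (2 * M) t (by omega), num_prod M (3 * M) t (by omega), Polynomial.eval_prod]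
  have h2 : ((∏ x ∈ I3 M, Polynomial.eval (4 * (t : ℤ)) ((Polynomial.X + Polynomial.C (1 - x)) ^ d3 M x) : ℤ) : ℚ_[2])⁻¹ =
     ∏ x ∈ I3 M, ((1 + 4 * (t : ℚ_[2]) - (x : ℚ_[2]))⁻¹) ^ d3 M x := by
    rw [Int.cast_prod, ← prod_inv_distrib]
    apply prod_congr rfl
    intro x _
    simp only [Polynomial.eval_pow, Polynomial.eval_add, Polynomial.eval_X, Polynomial.eval_C]
    push_cast
    rw [inv_pow]
    congr 2
    ring
  rw [h2]
  push_cast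
  ring

lemma T3_nonvanish (M L : ℕ) (hL : 1 ≤ L) (hM : 5 * M = 2 ^ (L + 1) - 1) {S : ℚ_[2]}
    (hS : HasV (fun t => PowerSeries.coeff 1 (Rser (I3 M) (n3 M) (d3 M) (1 + 4 * (t : ℚ_[2])))) S) : S ≠ 0 := by
  intro hS0
  subst hS0
  obtain ⟨hdeg, _⟩ := T3_deg M
  have h2 := S_formula (I3 M) (n3 M) (d3 M) (by omega) (d3_even M) 2
  have hlim := diff_limit (TS3_R (I3 M) (n3 M) (d3 M) (d3_even M)) hS h2
  rw [mul_zero] at hlim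
  obtain ⟨A, hA⟩ : ∃ A : ℚ_[2], A = ((4 : ℚ_[2]) ^ (2 * M) * ((2 * M).factorial : ℚ_[2])) ^ 2 * (4 ^ (3 * M) * ((3 * M).factorial : ℚ_[2])) ^ 2 := ⟨_, rfl⟩
  have hA0 : A ≠ 0 := by
    have k1 : ((2 * M).factorial : ℚ_[2]) ≠ 0 := by exact_mod_cast (2 * M).factorial_ne_zero
    have k2 : ((3 * M).factorial : ℚ_[2]) ≠ 0 := by exact_mod_cast (3 * M).factorial_ne_zero
    have k3 : (4 : ℚ_[2]) ≠ 0 := by norm_num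
    rw [hA]
    exact mul_ne_zero (pow_ne_zero _ (mul_ne_zero (pow_ne_zero _ k3) k1)) (pow_ne_zero _ (mul_ne_zero (pow_ne_zero _ k3) k2))
  obtain ⟨c, hc⟩ : ∃ c : ℕ → ℕ, c = (fun t => (t + 2 * M / 2).choose (2 * M) * (t + 3 * M / 2).choose (3 * M)) := ⟨_, rfl⟩
  have hR : ∀ t : ℕ, PowerSeries.coeff 0 (Rser (I3 M) (n3 M) (d3 M) (1 + 4 * (t : ℚ_[2]))) = A * gfun c (U3 M) t := by
    intro t; rw [hA, hc]; exact coeff0_R M t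
  have hev : ∀ m : ℕ, ((2 : ℚ_[2]) ^ m)⁻¹ * ((2 : ℚ_[2]) ^ m)⁻¹ * ∑ k ∈ range (2 ^ m),
      (PowerSeries.coeff 0 (Rser (I3 M) (n3 M) (d3 M) (1 + 4 * ((((k : ℤ) + 2 ^ m : ℤ)) : ℚ_[2]))) -
        PowerSeries.coeff 0 (Rser (I3 M) (n3 M) (d3 M) (1 + 4 * (((k : ℤ)) : ℚ_[2])))) =
      A * (((2 : ℚ_[2]) ^ m)⁻¹ * ((2 : ℚ_[2]) ^ m)⁻¹ * ∑ k ∈ range (2 ^ m), (gfun c (U3 M) (k + 2 ^ m) - gfun c (U3 M) k)) := by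
    intro m
    have : ∀ k ∈ range (2 ^ m), (PowerSeries.coeff 0 (Rser (I3 M) (n3 M) (d3 M) (1 + 4 * ((((k : ℤ) + 2 ^ m : ℤ)) : ℚ_[2]))) -
        PowerSeries.coeff 0 (Rser (I3 M) (n3 M) (d3 M) (1 + 4 * (((k : ℤ)) : ℚ_[2])))) = A * (gfun c (U3 M) (k + 2 ^ m) - gfun c (U3 M) k) := by
      intro k _
      have e1 := hR k
      have e2 := hR (k + 2 ^ m)
      push_cast at e1 e2 ⊢
      rw [e1, e2]
      ring
    rw [sum_congr rfl this, ← mul_sum]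
    ring
  obtain ⟨P, hPd⟩ : ∃ P : Polynomial ℚ_[2], P = chP (2 * M / 2) (2 * M) * chP (3 * M / 2) (3 * M) := ⟨_, rfl⟩
  have hP : ∀ t : ℕ, P.eval (t : ℚ_[2]) = (c t : ℚ_[2]) := by
    intro t
    rw [hPd, hc, Polynomial.eval_mul, chP_eval, chP_eval]
    push_cast
    rfl
  have hl : ∀ h m, chP h m ≠ 0 := by
    intro h m h0
    have := chP_lead h m
    rw [h0, Polynomial.leadingCoeff_zero] at this
    exact (inv_ne_zero (by exact_mod_cast m.factorial_ne_zero)) this.symm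
  have hd : P.natDegree = 2 ^ (L + 1) - 1 := by
    rw [hPd, Polynomial.natDegree_mul (hl _ _) (hl _ _), chP_deg, chP_deg]
    omega
  have h1 : ‖P.leadingCoeff * (2 ^ (L + 1) - 1).factorial‖ = 1 := by
    have hodd := norm_odd _ (choose_odd (L + 1) (2 * M) (by have := Nat.one_le_two_pow (n := L + 1); omega))
    rw [← hodd]
    congr 1
    rw [hPd, Polynomial.leadingCoeff_mul, chP_lead, chP_lead, ← hM]
    have k1 : ((2 * M).factorial : ℚ_[2]) ≠ 0 := by exact_mod_cast (2 * M).factorial_ne_zero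
    have k2 : ((3 * M).factorial : ℚ_[2]) ≠ 0 := by exact_mod_cast (3 * M).factorial_ne_zero
    have k3 := Nat.choose_mul_factorial_mul_factorial (n := 5 * M) (k := 2 * M) (by omega)
    rw [show 5 * M - 2 * M = 3 * M by omega] at k3
    rw [← k3]
    push_cast
    field_simp
  have hnorm := hlim.norm
  rw [norm_zero] at hnorm
  have hpos : 0 < ‖A‖ * (2 ^ L * 2 ^ L) := mul_pos (norm_pos_iff.2 hA0) (by positivity)
  obtain ⟨m, hm1, hm2⟩ := ((hnorm.eventually (gt_mem_nhds hpos)).and (eventually_ge_atTop (L + 1))).exists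
  have hkey := aW_sum L P c (U3 M) (U3_odd M) hP hd m hL hm2 h1
  rw [hev m, norm_mul, hkey] at hm1
  exact lt_irrefl _ hm1

theorem T3_main : ∀ q : ℚ, Jv 3 ≠ (q : ℚ_[2]) := by
  intro q hq
  obtain ⟨Jq, hJq⟩ : ∃ Jq : ℕ → ℚ, Jq = fun k => if k = 3 then q else 0 := ⟨_, rfl⟩
  have hJ3 : Jv 3 = (Jq 3 : ℚ_[2]) := by rw [hJq]; simpa using hq
  have hJ0 : ∀ k, k ≠ 3 → Jq k = 0 := by intro k hk; rw [hJq]; simp [hk]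
  obtain ⟨Q, Jm, hQ1, hJm0, hJm, hQ⟩ := common_den Jq 3 (fun k hk => hJ0 k (by omega))
  choose z hz using hQ
  obtain ⟨C, hC, hprim⟩ := primorial_bound
  have hθ : (((29536 : ℕ) : ℝ) / (10000 : ℕ)) ^ 19 * (2⁻¹ : ℝ) ^ 30 < 1 := by norm_num
  obtain ⟨B, hBd⟩ : ∃ B : ℝ, B = (((29536 : ℕ) : ℝ) / (10000 : ℕ)) := ⟨_, rfl⟩
  rw [← hBd] at hθ
  rw [← hBd] at hprim
  have hB0 : 0 < B := by rw [hBd]; positivity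
  obtain ⟨A, hA⟩ : ∃ A : ℝ, A = 16 * ((Jm : ℝ) + 12) := ⟨_, rfl⟩
  have hJmr : (0 : ℝ) ≤ Jm := by exact_mod_cast hJm0
  have hApos : 0 < A := by rw [hA]; positivity
  have has := asymp (C ^ 6 * Q * A) (B ^ 19 * (2⁻¹ : ℝ) ^ 30) 24 13 6
    (by have : (0 : ℝ) < Q := by exact_mod_cast hQ1
        positivity) (by norm_num) (by positivity) hθ
  obtain ⟨x₀, hx₀⟩ := eventually_atTop.1 has
  obtain ⟨M, hM5⟩ : ∃ M, 16 ^ (x₀ + 1) = 1 + 5 * M := by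
    have h := Nat.sub_dvd_pow_sub_pow 16 1 (x₀ + 1)
    rw [one_pow] at h
    have h2 : 1 ≤ 16 ^ (x₀ + 1) := Nat.one_le_pow _ _ (by norm_num)
    obtain ⟨w, hw⟩ := h
    refine ⟨3 * w, ?_⟩
    omega
  have hMge : x₀ + 1 ≤ M := by
    have h3 : 8 * (x₀ + 1) ≤ 16 ^ (x₀ + 1) := by
      have h4 := Nat.lt_pow_self (n := x₀) (a := 16) (by norm_num)
      rw [pow_succ]; omega
    omega
  have hM1 : 1 ≤ M := by omega
  have hlt := hx₀ M (by omega)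
  have hL : 5 * M = 2 ^ ((4 * x₀ + 3) + 1) - 1 := by
    have : 2 ^ ((4 * x₀ + 3) + 1) = 16 ^ (x₀ + 1) := by
      rw [show (16 : ℕ) = 2 ^ 4 by norm_num, ← pow_mul]
      congr 1
    omega
  have hHV := T3_rational M Jq hJ3 hJ0
  have hS0' := T3_nonvanish M (4 * x₀ + 3) (by omega) hL hHV
  obtain ⟨Sv, hSv⟩ : ∃ Sv, Sv = Sq (I3 M) (n3 M) (d3 M) 1 Jq := ⟨_, rfl⟩
  have har := T3_abs M hM1 Jq Jm hJm0 hJm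
  have h2 := T3_two M hM1 hHV
  rw [← hSv] at hS0' har h2
  have hS0 : Sv ≠ 0 := by
    intro h; rw [h] at hS0'; simp at hS0'
  have hΔ := T3_delta M hM1 C B hC hB0 hprim
  have hΔ2 : (Delta3 M : ℝ) ≤ ((24 * M : ℕ) : ℝ) ^ (6 * Nat.sqrt (24 * M)) * C ^ 6 * (B ^ 19) ^ M := by
    refine hΔ.trans ?_
    refine mul_le_mul_of_nonneg_right (mul_le_mul_of_nonneg_right ?_ (by positivity)) (by positivity)
    have e1 : ((12 * M : ℕ) : ℝ) ≤ ((24 * M : ℕ) : ℝ) := by exact_mod_cast (by omega : 12 * M ≤ 24 * M)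
    have e2 : (1 : ℝ) ≤ ((24 * M : ℕ) : ℝ) := by exact_mod_cast (by omega : 1 ≤ 24 * M)
    refine (pow_le_pow_left₀ (by positivity) e1 _).trans (pow_le_pow_right₀ e2 ?_)
    exact Nat.mul_le_mul_left _ (Nat.sqrt_le_sqrt (by omega))
  have har2 : ((|Sv| : ℚ) : ℝ) ≤ A * ((24 * M : ℕ) : ℝ) ^ 7 := by
    rw [hA]
    exact_mod_cast har
  have hΔ0 : (Delta3 M : ℚ) ≠ 0 := by
    have : Delta3 M ≠ 0 := by
      unfold Delta3
      have k1 := (smallD_pos (2 * (6 * M)) 6).ne'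
      have kp := fun n => (primorial_pos n).ne'
      simp [k1, kp]
    exact_mod_cast this
  have hQ0 : (Q : ℚ) ≠ 0 := by exact_mod_cast (show Q ≠ 0 by omega)
  have hpf := prod_formula (Delta3 M * (Q * Sv)) (mul_ne_zero hΔ0 (mul_ne_zero hQ0 hS0))
    (fun p' hp' hp2 => by
      rw [hSv]
      exact T3_integral M Jq Q p' hp2 (fun k => (norm_le_of_den (p := p') Q (Jq k) (z k) (hz k)).1))
  have hn2 : ‖((Delta3 M * (Q * Sv) : ℚ) : ℚ_[2])‖ ≤ ‖((Sv : ℚ) : ℚ_[2])‖ := by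
    rw [Rat.cast_mul, Rat.cast_mul, norm_mul, norm_mul, Rat.cast_natCast, Rat.cast_natCast]
    exact (mul_le_of_le_one_left (by positivity) (norm_nat_le_one _)).trans (mul_le_of_le_one_left (by positivity) (norm_nat_le_one _))
  have hfin := hpf.trans (mul_le_mul_of_nonneg_left (hn2.trans h2) (by positivity))
  have habs' : (|((Delta3 M * (Q * Sv) : ℚ) : ℝ)| : ℝ) = (Delta3 M : ℝ) * (Q * ((|Sv| : ℚ) : ℝ)) := by
    push_cast
    rw [abs_mul, abs_mul, abs_of_nonneg (show (0 : ℝ) ≤ (Delta3 M : ℝ) by positivity), abs_of_nonneg (show (0 : ℝ) ≤ (Q : ℝ) by positivity)]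
  rw [habs'] at hfin
  have hfin2 := hfin.trans (mul_le_mul_of_nonneg_right (mul_le_mul hΔ2 (mul_le_mul_of_nonneg_left har2 (by positivity)) (by positivity) (by positivity)) (by positivity))
  refine absurd (hfin2.trans (le_of_eq ?_)) (not_le.2 hlt)
  clear hfin2 hfin habs' hn2 hpf har hΔ h2 hlt hθ has hx₀
  generalize B ^ 19 = Bx
  generalize (2⁻¹ : ℝ) ^ 30 = Gx
  generalize (24 * M).sqrt = sx
  generalize ((24 * M : ℕ) : ℝ) = Y
  generalize C ^ 6 = CE
  rw [mul_pow]
  simp only [pow_add]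
  ring

theorem T_final (s δ : ℕ) (hδ : δ ≤ 1) :
    ∃ j : ℕ, s + 3 ≤ j ∧ j ≤ 3 * s + 5 ∧ j % 2 = δ ∧
      ∃ z : ℚ_[2], zeta2Quarter j z ∧ ∀ q : ℚ, z ≠ (q : ℚ_[2]) := by
  by_cases h : 1 ≤ s ∨ δ = 1
  · exact T_all s δ hδ h
  · have h1 : s = 0 := by omega
    have h2 : δ = 0 := by omega
    subst h1 h2
    exact ⟨4, by norm_num, by norm_num, by norm_num, zeta_irr 3 (by norm_num) T3_main⟩

theorem irrational_zeta2Quarter_in_range (s δ : ℕ) (hδ : δ ≤ 1) :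
    ∃ j : ℕ, s + 3 ≤ j ∧ j ≤ 3 * s + 5 ∧ j % 2 = δ ∧
      ∃ z : ℚ_[2], zeta2Quarter j z ∧ ∀ q : ℚ, z ≠ (q : ℚ_[2]) := by
  exact T_final s δ hδ
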